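/- (Representation formula for higher order derivatives.) In the Carnot setting, with [a_{ij}] satisfying the ellipticity condition with constant Λ, for every integer k ≥ 1 and every x̄ ∈ ℝ^N there exist functions Γ_{x̄}^{I;J} ∈ C^∞(ℝ^N∖{0}), indexed by pairs of multi-indices I, J of length k with entries in {1,…,m}, each homogeneous of degree 2−Q (Γ_{x̄}^{I;J}(D_λw) = λ^{2−Q}Γ_{x̄}^{I;J}(w) for w ≠ 0), satisfying for every integer p ≥ 0 the uniform bound sup_{|H|≤p} sup_{‖w‖=1} |Y_H Γ_{x̄}^{I;J}(w)| ≤ c(p,k,Λ, Carnot structure) (independent of x̄), and such that for every u ∈ C^{k+2,α}_{0,Y}(ℝ^N), every multi-index I with |I| = k, and every x ∈ ℝ^N: Y_Iu(x) = ∑_{|J|=k} ∫_{ℝ^N} Γ_{x̄}^{I;J}(y^{-1}*x) · Y_J L_{x̄}u(y) dy, where L_{x̄} := ∑_{i,j=1}^m a_{ij}(x̄) Y_iY_j is the frozen operator. -/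

import Mathlib

open MeasureTheory

noncomputable section

variable {E : Type*} [NormedAddCommGroup E] [NormedSpace ℝ E]

/-- Derivative of `u` along the vector field `Y` at `x`. -/
def vfDeriv (Y : E → E) (u : E → ℝ) (x : E) : ℝ := lineDeriv ℝ u x (Y x)

/-- Iterated derivative along a list of vector fields. -/
def vfIter {m : ℕ} (Y : Fin m → E → E) : List (Fin m) → (E → ℝ) → E → ℝ
  | [], u => u
  | i :: l, u => vfDeriv (Y i) (vfIter Y l u)

/-- Lie bracket of two vector fields. -/
def vfLie (Y Z : E → E) (x : E) : E := fderiv ℝ Z x (Y x) - fderiv ℝ Y x (Z x)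

/-- Iterated Lie bracket along a nonempty list of indices. -/
def vfIterLie {m : ℕ} (Y : Fin m → E → E) : List (Fin m) → E → E
  | [] => fun _ => 0
  | [i] => Y i
  | i :: j :: l => vfLie (Y i) (vfIterLie Y (j :: l))

/-- Hörmander's condition: the iterated Lie brackets span the space at every point. -/
def HormanderCond {m : ℕ} (Y : Fin m → E → E) : Prop :=
  ∀ x : E,
    Submodule.span ℝ {v : E | ∃ l : List (Fin m), l ≠ [] ∧ v = vfIterLie Y l x} = ⊤

/-- Carnot–Carathéodory control distance induced by the vector fields `Y`. -/
def controlDist {m : ℕ} (Y : Fin m → E → E) (x y : E) : ℝ :=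
  sInf {δ : ℝ | 0 < δ ∧ ∃ γ : ℝ → E, ∃ c : Fin m → ℝ → ℝ, ∃ K : NNReal,
    LipschitzOnWith K γ (Set.Icc 0 1) ∧ γ 0 = x ∧ γ 1 = y ∧
    (∀ᵐ t ∂(volume.restrict (Set.Ioo (0:ℝ) 1)),
      HasDerivAt γ (∑ i, c i t • Y i (γ t)) t) ∧
    (∀ i, ∀ t ∈ Set.Icc (0:ℝ) 1, |c i t| < δ)}

def supBoundOn (Ω : Set E) (u : E → ℝ) (C : ℝ) : Prop := ∀ x ∈ Ω, |u x| ≤ C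

/-- Sup norm of `u` on `Ω`. -/
def supNormOn (Ω : Set E) (u : E → ℝ) : ℝ := sInf {C : ℝ | 0 ≤ C ∧ supBoundOn Ω u C}

def holderBoundOn (d : E → E → ℝ) (α : ℝ) (Ω : Set E) (u : E → ℝ) (C : ℝ) : Prop :=
  ∀ x ∈ Ω, ∀ y ∈ Ω, |u x - u y| ≤ C * d x y ^ α

/-- Hölder seminorm of `u` on `Ω` w.r.t. the distance `d`. -/
def holderSemi (d : E → E → ℝ) (α : ℝ) (Ω : Set E) (u : E → ℝ) : ℝ :=
  sInf {C : ℝ | 0 ≤ C ∧ holderBoundOn d α Ω u C}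

/-- Hölder norm of `u` on `Ω`. -/
def holderNorm (d : E → E → ℝ) (α : ℝ) (Ω : Set E) (u : E → ℝ) : ℝ :=
  supNormOn Ω u + holderSemi d α Ω u

/-- `u ∈ C^α(Ω)`: `u` is bounded and Hölder continuous on `Ω`. -/
def MemCalpha (d : E → E → ℝ) (α : ℝ) (Ω : Set E) (u : E → ℝ) : Prop :=
  (∃ C, 0 ≤ C ∧ supBoundOn Ω u C) ∧ ∃ C, 0 ≤ C ∧ holderBoundOn d α Ω u C

/-- `u ∈ C^{k,α}(Ω)`: all derivatives along the fields `Y` up to order `k`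
exist pointwise on `Ω` and belong to `C^α(Ω)`. -/
def MemCkAlpha {m : ℕ} (Y : Fin m → E → E) (d : E → E → ℝ) (α : ℝ) (k : ℕ)
    (Ω : Set E) (u : E → ℝ) : Prop :=
  (∀ l : List (Fin m), l.length ≤ k → MemCalpha d α Ω (vfIter Y l u)) ∧
  ∀ l : List (Fin m), l.length < k → ∀ i : Fin m, ∀ x ∈ Ω,
    LineDifferentiableAt ℝ (vfIter Y l u) x (Y i x)

/-- The `C^{k,α}(Ω)` norm: sum of the `C^α` norms of all derivatives up to order `k`. -/
def ckNorm {m : ℕ} (Y : Fin m → E → E) (d : E → E → ℝ) (α : ℝ) (k : ℕ)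
    (Ω : Set E) (u : E → ℝ) : ℝ :=
  ∑ j ∈ Finset.range (k + 1), ∑ f : Fin j → Fin m,
    holderNorm d α Ω (vfIter Y (List.ofFn f) u)

/-- Symmetric, uniformly positive-definite coefficient matrix with ellipticity constant `Λ`. -/
def EllipticSym {m : ℕ} (a : Fin m → Fin m → E → ℝ) (Λ : ℝ) : Prop :=
  ∀ x : E, (∀ i j, a i j x = a j i x) ∧
    ∀ ξ : Fin m → ℝ,
      Λ * (∑ i, ξ i ^ 2) ≤ (∑ i, ∑ j, a i j x * ξ i * ξ j) ∧
      (∑ i, ∑ j, a i j x * ξ i * ξ j) ≤ Λ⁻¹ * (∑ i, ξ i ^ 2)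

/-- The operator `L u = ∑_{i,j} a_{ij}(x) Y_i Y_j u`. -/
def opL {m : ℕ} (Y : Fin m → E → E) (a : Fin m → Fin m → E → ℝ) (u : E → ℝ) (x : E) : ℝ :=
  ∑ i, ∑ j, a i j x * vfIter Y [i, j] u x

/-- The frozen operator `L_{x̄} u = ∑_{i,j} a_{ij}(x̄) Y_i Y_j u`. -/
def opLFrozen {m : ℕ} (Y : Fin m → E → E) (a : Fin m → Fin m → E → ℝ) (xb : E)
    (u : E → ℝ) (x : E) : ℝ :=
  ∑ i, ∑ j, a i j xb * vfIter Y [i, j] u x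

/-- Anisotropic dilations `D_λ(x)_i = λ^{σ_i} x_i`. -/
def dil {N : ℕ} (σ : Fin N → ℕ) (l : ℝ) (x : Fin N → ℝ) : Fin N → ℝ :=
  fun i => l ^ (σ i) * x i

/-- A vector field `Y` is homogeneous of degree `s` with respect to the dilations `dil σ`. -/
def IsHomogeneousVF {N : ℕ} (σ : Fin N → ℕ) (Y : (Fin N → ℝ) → (Fin N → ℝ)) (s : ℝ) : Prop :=
  ∀ u : (Fin N → ℝ) → ℝ, ContDiff ℝ (⊤ : ℕ∞) u → ∀ l : ℝ, 0 < l → ∀ x,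
    vfDeriv Y (fun w => u (dil σ l w)) x = l ^ s * vfDeriv Y u (dil σ l x)

/-- Smooth homogeneous norm `‖x‖ = (∑ |x_i|^{2σ_N!/σ_i})^{1/(2σ_N!)}`. -/
def homNorm {N : ℕ} (σ : Fin N → ℕ) (x : Fin N → ℝ) : ℝ :=
  (∑ i, |x i| ^ ((2 * Nat.factorial (Finset.univ.sup σ)) / σ i)) ^
    ((1 : ℝ) / (2 * (Nat.factorial (Finset.univ.sup σ) : ℝ)))

/-- Left-invariance of a vector field with respect to the group operation `mul`. -/
def LeftInvariantVF (mul : E → E → E) (Y : E → E) : Prop :=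
  ∀ z : E, ∀ u : E → ℝ, ContDiff ℝ (⊤ : ℕ∞) u → ∀ x,
    vfDeriv Y (fun w => u (mul z w)) x = vfDeriv Y u (mul z x)

/-- A Carnot group structure on `ℝ^N` with `m` generators. -/
structure CarnotSetting (N m : ℕ) where
  mul : (Fin N → ℝ) → (Fin N → ℝ) → (Fin N → ℝ)
  inv : (Fin N → ℝ) → (Fin N → ℝ)
  σ : Fin N → ℕ
  Y : Fin m → (Fin N → ℝ) → (Fin N → ℝ)
  smooth_mul : ContDiff ℝ (⊤ : ℕ∞) (fun p : (Fin N → ℝ) × (Fin N → ℝ) => mul p.1 p.2)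
  smooth_inv : ContDiff ℝ (⊤ : ℕ∞) inv
  mul_assoc' : ∀ x y z, mul (mul x y) z = mul x (mul y z)
  zero_mul' : ∀ x, mul 0 x = x
  mul_zero' : ∀ x, mul x 0 = x
  inv_mul' : ∀ x, mul (inv x) x = 0
  mul_inv' : ∀ x, mul x (inv x) = 0
  σ_mono : Monotone σ
  σ_ge_one : ∀ i, 1 ≤ σ i
  σ_first : ∀ h : 0 < N, σ ⟨0, h⟩ = 1
  dil_auto : ∀ l : ℝ, 0 < l → ∀ x y, mul (dil σ l x) (dil σ l y) = dil σ l (mul x y)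
  Q_gt_two : 2 < ∑ i, σ i
  Y_smooth : ∀ i, ContDiff ℝ (⊤ : ℕ∞) (Y i)
  Y_leftinv : ∀ i, LeftInvariantVF mul (Y i)
  Y_homog : ∀ i, IsHomogeneousVF σ (Y i) 1
  hormander : HormanderCond Y

namespace CarnotSetting

variable {N m : ℕ}

/-- Homogeneous dimension `Q = ∑ σ_i`. -/
def Q (G : CarnotSetting N m) : ℕ := ∑ i, G.σ i

/-- Carnot–Carathéodory distance induced by the generators. -/
def dY (G : CarnotSetting N m) : (Fin N → ℝ) → (Fin N → ℝ) → ℝ := controlDist G.Y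

/-- Quasidistance `d(x,y) = ‖y⁻¹ * x‖` from the smooth homogeneous norm. -/
def qd (G : CarnotSetting N m) (x y : Fin N → ℝ) : ℝ := homNorm G.σ (G.mul (G.inv y) x)

/-- Ball for the quasidistance `qd`. -/
def ball (G : CarnotSetting N m) (x₀ : Fin N → ℝ) (r : ℝ) : Set (Fin N → ℝ) :=
  {x | G.qd x x₀ < r}

end CarnotSetting



section
open MeasureTheory Set Filter Topology
open scoped ContDiff
noncomputable section
namespace CarnotSetting
variable {N m : ℕ}

lemma two_le_infty : (2 : WithTop ℕ∞) ≤ ∞ := by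
  exact (WithTop.coe_le_coe.2 (le_top : (2:ℕ∞) ≤ ⊤))

lemma cmul_left (G : CarnotSetting N m) (z : Fin N → ℝ) : ContDiff ℝ ∞ (fun x => G.mul z x) :=
  G.smooth_mul.comp (contDiff_const.prodMk contDiff_id)

lemma cmul_right (G : CarnotSetting N m) (z : Fin N → ℝ) : ContDiff ℝ ∞ (fun x => G.mul x z) :=
  G.smooth_mul.comp (contDiff_id.prodMk contDiff_const)

lemma cmul {X : Type*} [NormedAddCommGroup X] [NormedSpace ℝ X] (G : CarnotSetting N m)
    {f g : X → (Fin N → ℝ)} (hf : ContDiff ℝ ∞ f) (hg : ContDiff ℝ ∞ g) :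
    ContDiff ℝ ∞ (fun x => G.mul (f x) (g x)) :=
  G.smooth_mul.comp (hf.prodMk hg)

lemma continuous_mul' (G : CarnotSetting N m) :
    Continuous (fun p : (Fin N → ℝ) × (Fin N → ℝ) => G.mul p.1 p.2) := G.smooth_mul.continuous

lemma contmul {X : Type*} [TopologicalSpace X] (G : CarnotSetting N m)
    {f g : X → (Fin N → ℝ)} (hf : Continuous f) (hg : Continuous g) :
    Continuous (fun x => G.mul (f x) (g x)) :=
  G.continuous_mul'.comp (hf.prodMk hg)

lemma inv_mul_cancel_left' (G : CarnotSetting N m) (x y) : G.mul (G.inv x) (G.mul x y) = y := by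
  rw [← G.mul_assoc', G.inv_mul', G.zero_mul']
lemma mul_inv_cancel_left' (G : CarnotSetting N m) (x y) : G.mul x (G.mul (G.inv x) y) = y := by
  rw [← G.mul_assoc', G.mul_inv', G.zero_mul']
lemma inv_mul_cancel_right' (G : CarnotSetting N m) (x y) : G.mul (G.mul x (G.inv y)) y = x := by
  rw [G.mul_assoc', G.inv_mul', G.mul_zero']
lemma mul_inv_cancel_right' (G : CarnotSetting N m) (x y) : G.mul (G.mul x y) (G.inv y) = x := by
  rw [G.mul_assoc', G.mul_inv', G.mul_zero']
lemma eq_inv_of_mul (G : CarnotSetting N m) {x y} (h : G.mul x y = 0) : y = G.inv x := by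
  rw [← G.inv_mul_cancel_left' x y, h, G.mul_zero']
lemma inv_inv' (G : CarnotSetting N m) (x) : G.inv (G.inv x) = x :=
  (G.eq_inv_of_mul (G.inv_mul' x)).symm
lemma inv_zero' (G : CarnotSetting N m) : G.inv 0 = 0 :=
  (G.eq_inv_of_mul (G.mul_zero' 0)).symm
lemma inv_mul_rev' (G : CarnotSetting N m) (x y) :
    G.inv (G.mul x y) = G.mul (G.inv y) (G.inv x) := by
  refine (G.eq_inv_of_mul ?_).symm
  rw [G.mul_assoc', ← G.mul_assoc' y, G.mul_inv', G.zero_mul', G.mul_inv']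
lemma dil_zero' (σ : Fin N → ℕ) (l : ℝ) : dil σ l 0 = 0 := by ext i; simp [dil]
lemma dil_dil (σ : Fin N → ℕ) (l k : ℝ) (x) : dil σ l (dil σ k x) = dil σ (l * k) x := by
  ext i; simp [dil, mul_pow, mul_assoc]
lemma dil_one' (σ : Fin N → ℕ) (x) : dil σ 1 x = x := by ext i; simp [dil]
lemma dil_inv_dil (σ : Fin N → ℕ) {l : ℝ} (hl : 0 < l) (x) : dil σ l⁻¹ (dil σ l x) = x := by
  rw [dil_dil, inv_mul_cancel₀ hl.ne', dil_one']
lemma dil_dil_inv (σ : Fin N → ℕ) {l : ℝ} (hl : 0 < l) (x) : dil σ l (dil σ l⁻¹ x) = x := by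
  rw [dil_dil, mul_inv_cancel₀ hl.ne', dil_one']
lemma inv_dil (G : CarnotSetting N m) {l : ℝ} (hl : 0 < l) (x) :
    G.inv (dil G.σ l x) = dil G.σ l (G.inv x) := by
  refine (G.eq_inv_of_mul ?_).symm
  rw [G.dil_auto l hl, G.mul_inv', dil_zero']
lemma dil_eq_zero (σ : Fin N → ℕ) {l : ℝ} (hl : 0 < l) {x} : dil σ l x = 0 ↔ x = 0 := by
  refine ⟨fun h => ?_, fun h => by rw [h, dil_zero']⟩
  rw [← dil_inv_dil σ hl x, h, dil_zero']
lemma inv_eq_zero' (G : CarnotSetting N m) {x} : G.inv x = 0 ↔ x = 0 := by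
  refine ⟨fun h => ?_, fun h => by rw [h, G.inv_zero']⟩
  rw [← G.inv_inv' x, h, G.inv_zero']
lemma inv_mul_eq_zero' (G : CarnotSetting N m) {x y} : G.mul (G.inv y) x = 0 ↔ x = y := by
  refine ⟨fun h => ?_, fun h => by rw [h, G.inv_mul']⟩
  rw [← G.mul_inv_cancel_left' y x, h, G.mul_zero']

/-- the dilation as a continuous linear map -/
def dilL (σ : Fin N → ℕ) (l : ℝ) : (Fin N → ℝ) →L[ℝ] (Fin N → ℝ) :=
  ContinuousLinearMap.pi (fun i => (l ^ (σ i)) • ContinuousLinearMap.proj i)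
@[simp] lemma dilL_apply (σ : Fin N → ℕ) (l : ℝ) (x) : dilL σ l x = dil σ l x := by
  ext i; simp [dilL, dil]
lemma dil_contDiff (σ : Fin N → ℕ) (l : ℝ) : ContDiff ℝ ∞ (dil σ l) := by
  have : dil σ l = dilL σ l := by ext x; simp
  rw [this]; exact (dilL σ l).contDiff
lemma dil_hasFDerivAt (σ : Fin N → ℕ) (l : ℝ) (x) : HasFDerivAt (dil σ l) (dilL σ l) x := by
  have : dil σ l = dilL σ l := by ext x; simp
  rw [this]; exact (dilL σ l).hasFDerivAt
lemma dil_continuous (σ : Fin N → ℕ) (l : ℝ) : Continuous (dil σ l) := (dil_contDiff σ l).continuous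
lemma dil_tendsto (G : CarnotSetting N m) (x : Fin N → ℝ) :
    Tendsto (fun l => dil G.σ l x) (𝓝[>] 0) (𝓝 0) := by
  have : Continuous (fun l => dil G.σ l x) := by unfold dil; fun_prop
  have h := this.tendsto 0
  have h0 : dil G.σ 0 x = 0 := by
    ext i; simp [dil, (Nat.one_le_iff_ne_zero.1 (G.σ_ge_one i))]
  rw [h0] at h
  exact h.mono_left nhdsWithin_le_nhds
lemma dil_continuous2 (σ : Fin N → ℕ) : Continuous (fun p : ℝ × (Fin N → ℝ) => dil σ p.1 p.2) := by
  unfold dil; fun_prop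

/-! vfDeriv of smooth functions -/
lemma vfDeriv_eq {F : Type*} [NormedAddCommGroup F] [NormedSpace ℝ F] (X : F → F) {u : F → ℝ} {x : F}
    (h : DifferentiableAt ℝ u x) : vfDeriv X u x = fderiv ℝ u x (X x) :=
  h.lineDeriv_eq_fderiv

lemma vfDeriv_eq' (X : (Fin N → ℝ) → (Fin N → ℝ)) {u : (Fin N → ℝ) → ℝ}
    (h : ContDiff ℝ ∞ u) : vfDeriv X u = fun x => fderiv ℝ u x (X x) := by
  ext x; exact vfDeriv_eq X ((h.differentiable (by simp)) x)

lemma vfDeriv_contDiff {X : (Fin N → ℝ) → (Fin N → ℝ)} {u : (Fin N → ℝ) → ℝ}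
    (hX : ContDiff ℝ ∞ X) (h : ContDiff ℝ ∞ u) : ContDiff ℝ ∞ (vfDeriv X u) := by
  rw [vfDeriv_eq' X h]
  exact (h.fderiv_right (by simp)).clm_apply hX

lemma fderiv_contDiff {F : Type*} [NormedAddCommGroup F] [NormedSpace ℝ F]
    {F' : Type*} [NormedAddCommGroup F'] [NormedSpace ℝ F'] {u : F → F'}
    (h : ContDiff ℝ ∞ u) : ContDiff ℝ ∞ (fderiv ℝ u) := h.fderiv_right (by simp)

lemma vfDeriv_contDiffOn {X : (Fin N → ℝ) → (Fin N → ℝ)} {u : (Fin N → ℝ) → ℝ} {O : Set (Fin N → ℝ)}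
    (hO : IsOpen O) (hX : ContDiff ℝ ∞ X) (h : ContDiffOn ℝ ∞ u O) :
    ContDiffOn ℝ ∞ (vfDeriv X u) O := by
  have h1 : ContDiffOn ℝ ∞ (fun x => fderiv ℝ u x (X x)) O :=
    (h.fderiv_of_isOpen hO (by simp)).clm_apply hX.contDiffOn
  refine h1.congr fun x hx => vfDeriv_eq X ?_
  exact (h.contDiffAt (hO.mem_nhds hx)).differentiableAt (by simp)

lemma vfIter_contDiffOn (G : CarnotSetting N m) {u : (Fin N → ℝ) → ℝ} {O : Set (Fin N → ℝ)}
    (hO : IsOpen O) (h : ContDiffOn ℝ ∞ u O) (l : List (Fin m)) :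
    ContDiffOn ℝ ∞ (vfIter G.Y l u) O := by
  induction l with
  | nil => exact h
  | cons i l ih => exact vfDeriv_contDiffOn hO (G.Y_smooth i) ih

lemma vfIter_contDiff (G : CarnotSetting N m) {u : (Fin N → ℝ) → ℝ}
    (h : ContDiff ℝ ∞ u) (l : List (Fin m)) :
    ContDiff ℝ ∞ (vfIter G.Y l u) := by
  induction l with
  | nil => exact h
  | cons i l ih => exact vfDeriv_contDiff (G.Y_smooth i) ih

lemma vfDeriv_congr_nhds {X : (Fin N → ℝ) → (Fin N → ℝ)} {u v : (Fin N → ℝ) → ℝ} {x}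
    (h : u =ᶠ[𝓝 x] v) : vfDeriv X u x = vfDeriv X v x := by
  exact h.lineDeriv_eq

lemma vfIter_congr_on {Y : Fin m → (Fin N → ℝ) → (Fin N → ℝ)} {u v : (Fin N → ℝ) → ℝ} {O : Set (Fin N → ℝ)}
    (hO : IsOpen O) (h : ∀ x ∈ O, u x = v x) (l : List (Fin m)) :
    ∀ x ∈ O, vfIter Y l u x = vfIter Y l v x := by
  induction l with
  | nil => exact h
  | cons i l ih =>
    intro x hx
    exact vfDeriv_congr_nhds (Filter.eventually_of_mem (hO.mem_nhds hx) ih)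

lemma vfIter_append {Y : Fin m → (Fin N → ℝ) → (Fin N → ℝ)} (l l' : List (Fin m)) (u : (Fin N → ℝ) → ℝ) :
    vfIter Y (l ++ l') u = vfIter Y l (vfIter Y l' u) := by
  induction l with
  | nil => rfl
  | cons i l ih => simp [vfIter, ih]

/-! invariance -/
lemma coord_test {X : (Fin N → ℝ) → (Fin N → ℝ)} (φ : (Fin N → ℝ) → (Fin N → ℝ)) (hφ : ContDiff ℝ ∞ φ)
    (j : Fin N) (x) : vfDeriv X (fun w => φ w j) x = fderiv ℝ φ x (X x) j := by
  have hd : DifferentiableAt ℝ φ x := hφ.differentiable (by simp) x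
  have h1 : HasFDerivAt (fun w => φ w j) ((ContinuousLinearMap.proj j).comp (fderiv ℝ φ x)) x :=
    (ContinuousLinearMap.proj (R := ℝ) (φ := fun _ : Fin N => ℝ) j).hasFDerivAt.comp x hd.hasFDerivAt
  rw [vfDeriv_eq X h1.differentiableAt, h1.fderiv]; rfl

lemma coord_test_id {X : (Fin N → ℝ) → (Fin N → ℝ)} 
    (j : Fin N) (x) : vfDeriv X (fun w => w j) x = X x j := by
  have := coord_test (X := X) (fun w => w) contDiff_id j x
  simpa using this

/-- left invariance of a vector field in differential form -/
def LInv (G : CarnotSetting N m) (X : (Fin N → ℝ) → (Fin N → ℝ)) : Prop :=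
  ∀ z x, X (G.mul z x) = fderiv ℝ (fun w => G.mul z w) x (X x)

lemma coord_contDiff (j : Fin N) : ContDiff ℝ ∞ (fun w : Fin N → ℝ => w j) := by fun_prop

lemma Y_linv (G : CarnotSetting N m) (i) : G.LInv (G.Y i) := by
  intro z x
  ext j
  have h := G.Y_leftinv i z (fun w => w j) (coord_contDiff j) x
  rw [coord_test _ (G.cmul_left z), coord_test_id] at h
  exact h.symm

/-- homogeneity of vector field of degree k in differential form -/
def HomV (σ : Fin N → ℕ) (k : ℕ) (X : (Fin N → ℝ) → (Fin N → ℝ)) : Prop :=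
  ∀ l : ℝ, 0 < l → ∀ x, l ^ k • X (dil σ l x) = dil σ l (X x)

lemma Y_homV (G : CarnotSetting N m) (i) : HomV G.σ 1 (G.Y i) := by
  intro l hl x
  ext j
  have h := G.Y_homog i (fun w => w j) (coord_contDiff j) l hl x
  rw [coord_test _ (dil_contDiff G.σ l), coord_test_id, (dil_hasFDerivAt G.σ l x).fderiv] at h
  simpa using h.symm

lemma vfLie_eq_lieBracket (X Z : (Fin N → ℝ) → (Fin N → ℝ)) :
    vfLie X Z = VectorField.lieBracket ℝ X Z := rfl

lemma vfLie_contDiff {X Z : (Fin N → ℝ) → (Fin N → ℝ)} (hX : ContDiff ℝ ∞ X) (hZ : ContDiff ℝ ∞ Z) :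
    ContDiff ℝ ∞ (vfLie X Z) :=
  ((fderiv_contDiff hZ).clm_apply hX).sub ((fderiv_contDiff hX).clm_apply hZ)

/-- mixed lemma: if `X (φ x) = Dφ x (X x)` and same for `Z` then same for the bracket. -/
lemma vfLie_related {X Z X' Z' : (Fin N → ℝ) → (Fin N → ℝ)} (hX : ContDiff ℝ ∞ X) (hZ : ContDiff ℝ ∞ Z)
    (hX' : ContDiff ℝ ∞ X') (hZ' : ContDiff ℝ ∞ Z')
    {φ : (Fin N → ℝ) → (Fin N → ℝ)} (hφ : ContDiff ℝ ∞ φ)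
    (h1 : ∀ x, X' (φ x) = fderiv ℝ φ x (X x)) (h2 : ∀ x, Z' (φ x) = fderiv ℝ φ x (Z x)) (x) :
    vfLie X' Z' (φ x) = fderiv ℝ φ x (vfLie X Z x) := by
  have dφ := (hφ.differentiable (by simp))
  have ddφ : ∀ x, HasFDerivAt (fderiv ℝ φ) (fderiv ℝ (fderiv ℝ φ) x) x := fun x =>
    ((fderiv_contDiff hφ).differentiable (by simp) x).hasFDerivAt
  have key : ∀ {W W' : (Fin N → ℝ) → (Fin N → ℝ)}, ContDiff ℝ ∞ W → ContDiff ℝ ∞ W' →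
      (∀ x, W' (φ x) = fderiv ℝ φ x (W x)) → ∀ e, fderiv ℝ W' (φ x) (fderiv ℝ φ x e) =
        fderiv ℝ (fderiv ℝ φ) x e (W x) + fderiv ℝ φ x (fderiv ℝ W x e) := by
    intro W W' hW hW' h e
    have a1 : HasFDerivAt (fun x => W' (φ x)) ((fderiv ℝ W' (φ x)).comp (fderiv ℝ φ x)) x :=
      (hW'.differentiable (by simp) _).hasFDerivAt.comp x (dφ x).hasFDerivAt
    have a2 := (ddφ x).clm_apply ((hW.differentiable (by simp) x).hasFDerivAt)
    have := a1.unique (a2.congr_of_eventuallyEq (Filter.Eventually.of_forall h))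
    have := congrArg (fun L => L e) this
    simp at this
    rw [this]; abel
  have sym : fderiv ℝ (fderiv ℝ φ) x (X x) (Z x) = fderiv ℝ (fderiv ℝ φ) x (Z x) (X x) :=
    (hφ.contDiffAt.isSymmSndFDerivAt (by simp [two_le_infty])) _ _
  unfold vfLie
  rw [h1, h2, key hZ hZ' h2, key hX hX' h1, sym, map_sub]
  abel

lemma vfIterLie_contDiff (G : CarnotSetting N m) (l : List (Fin m)) :
    ContDiff ℝ ∞ (vfIterLie G.Y l) := by
  induction l with
  | nil => exact contDiff_const
  | cons i l ih =>
    cases l with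
    | nil => exact G.Y_smooth i
    | cons j l => exact vfLie_contDiff (G.Y_smooth i) ih

lemma vfIterLie_linv (G : CarnotSetting N m) (l : List (Fin m)) : G.LInv (vfIterLie G.Y l) := by
  induction l with
  | nil => intro z x; simp [vfIterLie]
  | cons i l ih =>
    cases l with
    | nil => exact G.Y_linv i
    | cons j l =>
      intro z x
      exact vfLie_related (G.Y_smooth i) (G.vfIterLie_contDiff _) (G.Y_smooth i)
        (G.vfIterLie_contDiff _) (G.cmul_left z) (G.Y_linv i z) (ih z) x

lemma vfLie_smul {X Z : (Fin N → ℝ) → (Fin N → ℝ)} (hX : ContDiff ℝ ∞ X) (hZ : ContDiff ℝ ∞ Z)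
    (a b : ℝ) (x) : vfLie (fun y => a • X y) (fun y => b • Z y) x = (a * b) • vfLie X Z x := by
  unfold vfLie
  have := hX.differentiable (by simp) x
  have := hZ.differentiable (by simp) x
  rw [fderiv_fun_const_smul ‹DifferentiableAt ℝ X x›, fderiv_fun_const_smul ‹DifferentiableAt ℝ Z x›]
  simp [smul_sub, smul_smul, mul_comm]

lemma vfIterLie_homV (G : CarnotSetting N m) (l : List (Fin m)) :
    HomV G.σ l.length (vfIterLie G.Y l) := by
  induction l with
  | nil => intro l hl x; simp [vfIterLie, dil_zero']
  | cons i l ih =>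
    cases l with
    | nil => exact G.Y_homV i
    | cons j l =>
      intro t ht x
      have h1 := vfLie_related (G.Y_smooth i) (G.vfIterLie_contDiff (j :: l))
        (((G.Y_smooth i)).const_smul (t ^ 1))
        ((G.vfIterLie_contDiff (j :: l)).const_smul (t ^ (j :: l).length)) (dil_contDiff G.σ t)
        (fun x => by
          rw [(dil_hasFDerivAt G.σ t x).fderiv, dilL_apply]; exact G.Y_homV i t ht x)
        (fun x => by
          rw [(dil_hasFDerivAt G.σ t x).fderiv, dilL_apply]; exact ih t ht x) x
      rw [(dil_hasFDerivAt G.σ t x).fderiv, dilL_apply] at h1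
      have h2 := vfLie_smul (G.Y_smooth i) (G.vfIterLie_contDiff (j :: l)) (t^1) (t ^ (j::l).length)
        (dil G.σ t x)
      show t ^ (i :: j :: l).length • vfLie (G.Y i) (vfIterLie G.Y (j::l)) (dil G.σ t x) = 
        dil G.σ t (vfLie (G.Y i) (vfIterLie G.Y (j::l)) x)
      rw [← h1]
      refine Eq.trans ?_ h2.symm
      rw [List.length_cons (a := i)]; congr 1; ring

lemma vfDeriv_comp_mul (G : CarnotSetting N m) {X} (hX : G.LInv X) {u : (Fin N → ℝ) → ℝ} (z x)
    (hu : DifferentiableAt ℝ u (G.mul z x)) :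
    vfDeriv X (fun w => u (G.mul z w)) x = vfDeriv X u (G.mul z x) := by
  have h0 := ((G.cmul_left z).differentiable (by simp) x).hasFDerivAt
  have h1 : HasFDerivAt (fun w => u (G.mul z w)) _ x := hu.hasFDerivAt.comp x h0
  rw [vfDeriv_eq X h1.differentiableAt, h1.fderiv, vfDeriv_eq X hu, hX z x]; rfl

lemma vfIter_comp_mul (G : CarnotSetting N m) {u : (Fin N → ℝ) → ℝ} (hu : ContDiff ℝ ∞ u) (z)
    (l : List (Fin m)) :
    vfIter G.Y l (fun w => u (G.mul z w)) = fun x => vfIter G.Y l u (G.mul z x) := by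
  induction l with
  | nil => rfl
  | cons i l ih =>
    ext x
    simp only [vfIter]
    rw [ih]
    exact G.vfDeriv_comp_mul (G.Y_linv i) z x ((G.vfIter_contDiff hu l).differentiable (by simp) _)

lemma vfDeriv_comp_dil (G : CarnotSetting N m) {X} {k : ℕ} (hX : HomV G.σ k X) {u : (Fin N → ℝ) → ℝ} 
    {t : ℝ} (ht : 0 < t) (x) (hu : DifferentiableAt ℝ u (dil G.σ t x)) :
    vfDeriv X (fun w => u (dil G.σ t w)) x = t ^ k * vfDeriv X u (dil G.σ t x) := by
  have h1 : HasFDerivAt (fun w => u (dil G.σ t w)) _ x :=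
    hu.hasFDerivAt.comp x (dil_hasFDerivAt G.σ t x)
  rw [vfDeriv_eq X h1.differentiableAt, h1.fderiv, vfDeriv_eq X hu]
  have := hX t ht x
  simp only [ContinuousLinearMap.comp_apply, dilL_apply, ← this, map_smul, smul_eq_mul]

/-- commutator formula -/
lemma vfDeriv_comm {X Z : (Fin N → ℝ) → (Fin N → ℝ)} (hX : ContDiff ℝ ∞ X) (hZ : ContDiff ℝ ∞ Z)
    {u : (Fin N → ℝ) → ℝ} {O : Set (Fin N → ℝ)} (hO : IsOpen O) (hu : ContDiffOn ℝ ∞ u O) {x} (hx : x ∈ O) :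
    vfDeriv (vfLie X Z) u x = vfDeriv X (vfDeriv Z u) x - vfDeriv Z (vfDeriv X u) x := by
  have hux : ContDiffAt ℝ ∞ u x := hu.contDiffAt (hO.mem_nhds hx)
  have key : ∀ {W W' : (Fin N → ℝ) → (Fin N → ℝ)}, ContDiff ℝ ∞ W → ContDiff ℝ ∞ W' →
      vfDeriv W (vfDeriv W' u) x = fderiv ℝ (fderiv ℝ u) x (W x) (W' x) +
        fderiv ℝ u x (fderiv ℝ W' x (W x)) := by
    intro W W' hW hW'
    have e : vfDeriv W' u =ᶠ[𝓝 x] fun y => fderiv ℝ u y (W' y) := by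
      filter_upwards [hO.mem_nhds hx] with y hy
      exact vfDeriv_eq _ ((hu.contDiffAt (hO.mem_nhds hy)).differentiableAt (by simp))
    have h2 : HasFDerivAt (fderiv ℝ u) (fderiv ℝ (fderiv ℝ u) x) x :=
      ((hux.fderiv_right (m := ∞) (by simp)).differentiableAt (by simp)).hasFDerivAt
    have a2 := h2.clm_apply ((hW'.differentiable (by simp) x).hasFDerivAt)
    rw [vfDeriv_congr_nhds e, vfDeriv_eq _ a2.differentiableAt, a2.fderiv]
    simp; abel
  have sym := (hux.isSymmSndFDerivAt (by simp [two_le_infty])) (X x) (Z x)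
  rw [key hX hZ, key hZ hX, sym, vfDeriv_eq _ (hux.differentiableAt (by simp)), vfLie, map_sub]
  abel

end CarnotSetting
end

end

section
open MeasureTheory Set Filter Topology
open scoped ContDiff
noncomputable section
namespace CarnotSetting
variable {N m : ℕ}

lemma measurePreserving_of_det {φ ψ : (Fin N → ℝ) → (Fin N → ℝ)} (hφ : ContDiff ℝ ∞ φ)
    (h1 : ∀ x, ψ (φ x) = x) (h2 : ∀ x, φ (ψ x) = x) (hd : ∀ x, |(fderiv ℝ φ x).det| = 1) :
    MeasurePreserving φ volume volume := by
  refine ⟨hφ.continuous.measurable, ?_⟩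
  ext s hs
  rw [Measure.map_apply hφ.continuous.measurable hs]
  have hs' := hφ.continuous.measurable hs
  have := lintegral_abs_det_fderiv_eq_addHaar_image volume hs' (f := φ) (f' := fderiv ℝ φ)
    (fun x _ => ((hφ.differentiable (by simp) x).hasFDerivAt).hasFDerivWithinAt)
    (fun x _ y _ h => by rw [← h1 x, h, h1 y])
  rw [image_preimage_eq _ (fun x => ⟨ψ x, h2 x⟩)] at this
  rw [← this]
  simp [hd]

lemma dilL_det (σ : Fin N → ℕ) (l : ℝ) : (dilL σ l).det = l ^ (∑ i, σ i) := by
  have : (dilL σ l : (Fin N → ℝ) →ₗ[ℝ] (Fin N → ℝ)) = Matrix.toLin' (Matrix.diagonal fun i => l ^ (σ i)) := by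
    ext x i
    by_cases hij : i = x
    · subst hij; simp [dilL]
    · simp [dilL, hij]
  rw [ContinuousLinearMap.det, this, LinearMap.det_toLin', Matrix.det_diagonal, Finset.prod_pow_eq_pow_sum]

lemma det_conj (σ : Fin N → ℕ) {l : ℝ} (hl : 0 < l) {A B : (Fin N → ℝ) →L[ℝ] (Fin N → ℝ)}
    (h : A.comp (dilL σ l) = (dilL σ l).comp B) : A.det = B.det := by
  have h0 : (dilL σ l).det ≠ 0 := by rw [dilL_det]; positivity
  have : A.det * (dilL σ l).det = (dilL σ l).det * B.det := by
    have := congrArg ContinuousLinearMap.det h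
    simpa [ContinuousLinearMap.det, LinearMap.det_comp] using this
  rw [mul_comm] at this
  exact mul_left_cancel₀ h0 this

lemma det_lim {σ : Fin N → ℕ} {A : ℝ → (Fin N → ℝ) →L[ℝ] (Fin N → ℝ)} {A0 B}
    (h : ∀ l > 0, (A l).comp (dilL σ l) = (dilL σ l).comp B) (hA : Tendsto A (𝓝[>] 0) (𝓝 A0)) :
    B.det = A0.det := by
  have h1 : Tendsto (fun l => (A l).det) (𝓝[>] 0) (𝓝 A0.det) :=
    (ContinuousLinearMap.continuous_det.tendsto A0).comp hA
  refine tendsto_nhds_unique (tendsto_const_nhds.congr' ?_) h1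
  filter_upwards [self_mem_nhdsWithin] with l hl
  exact (det_conj σ hl (h l hl)).symm

lemma fderiv_dil_conj {σ : Fin N → ℕ} {l : ℝ} {φ φ' : (Fin N → ℝ) → (Fin N → ℝ)}
    (hφ : ContDiff ℝ ∞ φ) (hφ' : ContDiff ℝ ∞ φ') (h : ∀ x, φ' (dil σ l x) = dil σ l (φ x)) (x) :
    (fderiv ℝ φ' (dil σ l x)).comp (dilL σ l) = (dilL σ l).comp (fderiv ℝ φ x) := by
  have a1 : HasFDerivAt (fun x => φ' (dil σ l x)) _ x :=
    (hφ'.differentiable (by simp) _).hasFDerivAt.comp x (dil_hasFDerivAt σ l x)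
  have a2 : HasFDerivAt (fun x => dil σ l (φ x)) _ x :=
    (dil_hasFDerivAt σ l _).comp x (hφ.differentiable (by simp) _).hasFDerivAt
  exact a1.unique (a2.congr_of_eventuallyEq (Filter.Eventually.of_forall h))

lemma fderiv_mul_left_eq (G : CarnotSetting N m) (z x : Fin N → ℝ) :
    fderiv ℝ (fun w => G.mul z w) x = (fderiv ℝ (fun p : (Fin N → ℝ) × (Fin N → ℝ) => G.mul p.1 p.2)
      (z, x)).comp (ContinuousLinearMap.inr ℝ _ _) := by
  have h := (G.smooth_mul.differentiable (by simp) (z, x)).hasFDerivAt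
  exact (h.comp x (hasFDerivAt_prodMk_right z x)).fderiv

lemma fderiv_mul_right_eq (G : CarnotSetting N m) (z x : Fin N → ℝ) :
    fderiv ℝ (fun w => G.mul w z) x = (fderiv ℝ (fun p : (Fin N → ℝ) × (Fin N → ℝ) => G.mul p.1 p.2)
      (x, z)).comp (ContinuousLinearMap.inl ℝ _ _) := by
  have h := (G.smooth_mul.differentiable (by simp) (x, z)).hasFDerivAt
  exact (HasFDerivAt.comp (f := fun w => (w, z)) x h (hasFDerivAt_prodMk_left x z)).fderiv

lemma fderiv_smooth_mul_continuous (G : CarnotSetting N m) :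
    Continuous (fderiv ℝ (fun p : (Fin N → ℝ) × (Fin N → ℝ) => G.mul p.1 p.2)) :=
  (fderiv_contDiff G.smooth_mul).continuous

lemma fderiv_mul_zero_left (G : CarnotSetting N m) (x) :
    fderiv ℝ (fun w => G.mul 0 w) x = ContinuousLinearMap.id ℝ _ := by
  have : (fun w => G.mul 0 w) = id := by ext1 w; exact G.zero_mul' w
  rw [this, fderiv_id]

lemma fderiv_mul_zero_right (G : CarnotSetting N m) (x) :
    fderiv ℝ (fun w => G.mul w 0) x = ContinuousLinearMap.id ℝ _ := by
  have : (fun w => G.mul w 0) = id := by ext1 w; exact G.mul_zero' w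
  rw [this, fderiv_id]

lemma dil_pair_tendsto (G : CarnotSetting N m) (z x : Fin N → ℝ) :
    Tendsto (fun l => (dil G.σ l z, dil G.σ l x)) (𝓝[>] 0) (𝓝 (0, 0)) :=
  (G.dil_tendsto z).prodMk_nhds (G.dil_tendsto x)

lemma det_mul_left (G : CarnotSetting N m) (z x) : (fderiv ℝ (fun w => G.mul z w) x).det = 1 := by
  have h : ∀ l > 0, (fderiv ℝ (fun w => G.mul (dil G.σ l z) w) (dil G.σ l x)).comp (dilL G.σ l) =
      (dilL G.σ l).comp (fderiv ℝ (fun w => G.mul z w) x) := fun l hl =>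
    fderiv_dil_conj (G.cmul_left z) (G.cmul_left _) (fun x => G.dil_auto l hl z x) x
  have h2 : Tendsto (fun l => fderiv ℝ (fun w => G.mul (dil G.σ l z) w) (dil G.σ l x)) (𝓝[>] 0)
      (𝓝 (fderiv ℝ (fun w => G.mul 0 w) 0)) := by
    simp_rw [fderiv_mul_left_eq]
    have hc : Continuous fun p => (fderiv ℝ (fun p : (Fin N → ℝ) × (Fin N → ℝ) => G.mul p.1 p.2) p).comp
      (ContinuousLinearMap.inr ℝ _ _) := G.fderiv_smooth_mul_continuous.clm_comp continuous_const
    exact (hc.tendsto (0,0)).comp (G.dil_pair_tendsto z x)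
  rw [det_lim h h2, fderiv_mul_zero_left]; simp [ContinuousLinearMap.det]

lemma det_mul_right (G : CarnotSetting N m) (z x) : (fderiv ℝ (fun w => G.mul w z) x).det = 1 := by
  have h : ∀ l > 0, (fderiv ℝ (fun w => G.mul w (dil G.σ l z)) (dil G.σ l x)).comp (dilL G.σ l) =
      (dilL G.σ l).comp (fderiv ℝ (fun w => G.mul w z) x) := fun l hl =>
    fderiv_dil_conj (G.cmul_right z) (G.cmul_right _) (fun x => G.dil_auto l hl x z) x
  have h2 : Tendsto (fun l => fderiv ℝ (fun w => G.mul w (dil G.σ l z)) (dil G.σ l x)) (𝓝[>] 0)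
      (𝓝 (fderiv ℝ (fun w => G.mul w 0) 0)) := by
    simp_rw [fderiv_mul_right_eq]
    have hc : Continuous fun p => (fderiv ℝ (fun p : (Fin N → ℝ) × (Fin N → ℝ) => G.mul p.1 p.2) p).comp
      (ContinuousLinearMap.inl ℝ _ _) := G.fderiv_smooth_mul_continuous.clm_comp continuous_const
    exact (hc.tendsto (0,0)).comp (G.dil_pair_tendsto x z)
  rw [det_lim h h2, fderiv_mul_zero_right]; simp [ContinuousLinearMap.det]

lemma det_inv' (G : CarnotSetting N m) (x) : |(fderiv ℝ G.inv x).det| = 1 := by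
  have h : ∀ l > 0, (fderiv ℝ G.inv (dil G.σ l x)).comp (dilL G.σ l) =
      (dilL G.σ l).comp (fderiv ℝ G.inv x) := fun l hl =>
    fderiv_dil_conj G.smooth_inv G.smooth_inv (fun x => G.inv_dil hl x) x
  have h2 : Tendsto (fun l => fderiv ℝ G.inv (dil G.σ l x)) (𝓝[>] 0) (𝓝 (fderiv ℝ G.inv 0)) :=
    ((fderiv_contDiff G.smooth_inv).continuous.tendsto 0).comp (G.dil_tendsto x)
  rw [det_lim h h2]
  have d0 := (G.smooth_inv.differentiable (by simp) 0).hasFDerivAt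
  have d1 := (G.smooth_inv.differentiable (by simp) (G.inv 0)).hasFDerivAt
  have d2 := d1.comp 0 d0
  have e : G.inv ∘ G.inv = id := by ext1 y; exact G.inv_inv' y
  rw [e, G.inv_zero'] at d2
  have := d2.unique (hasFDerivAt_id 0)
  have := congrArg ContinuousLinearMap.det this
  simp only [ContinuousLinearMap.det, ContinuousLinearMap.toLinearMap_comp, LinearMap.det_comp,
    ContinuousLinearMap.coe_id, LinearMap.det_id] at this
  have h3 := congrArg abs this
  rw [abs_mul, abs_one] at h3
  have h4 := abs_nonneg (LinearMap.det (fderiv ℝ G.inv 0).toLinearMap)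
  show |LinearMap.det (fderiv ℝ G.inv 0).toLinearMap| = 1
  nlinarith

lemma mp_left (G : CarnotSetting N m) (z) : MeasurePreserving (fun x => G.mul z x) volume volume :=
  measurePreserving_of_det (ψ := fun x => G.mul (G.inv z) x) (G.cmul_left z) (G.inv_mul_cancel_left' z)
    (G.mul_inv_cancel_left' z) (fun x => by rw [det_mul_left, abs_one])
lemma mp_right (G : CarnotSetting N m) (z) : MeasurePreserving (fun x => G.mul x z) volume volume :=
  measurePreserving_of_det (ψ := fun x => G.mul x (G.inv z)) (G.cmul_right z)
    (fun x => G.mul_inv_cancel_right' x z)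
    (fun x => G.inv_mul_cancel_right' x z) (fun x => by rw [det_mul_right, abs_one])
lemma mp_inv (G : CarnotSetting N m) : MeasurePreserving G.inv volume volume :=
  measurePreserving_of_det (ψ := G.inv) G.smooth_inv G.inv_inv' G.inv_inv' G.det_inv'

/-- left translation as homeomorphism -/
def homeoL (G : CarnotSetting N m) (z : Fin N → ℝ) : (Fin N → ℝ) ≃ₜ (Fin N → ℝ) where
  toFun x := G.mul z x
  invFun x := G.mul (G.inv z) x
  left_inv := G.inv_mul_cancel_left' z
  right_inv := G.mul_inv_cancel_left' z
  continuous_toFun := (G.cmul_left z).continuous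
  continuous_invFun := (G.cmul_left _).continuous
def homeoR (G : CarnotSetting N m) (z : Fin N → ℝ) : (Fin N → ℝ) ≃ₜ (Fin N → ℝ) where
  toFun x := G.mul x z
  invFun x := G.mul x (G.inv z)
  left_inv := fun x => G.mul_inv_cancel_right' x z
  right_inv := fun x => G.inv_mul_cancel_right' x z
  continuous_toFun := (G.cmul_right z).continuous
  continuous_invFun := (G.cmul_right _).continuous
def homeoI (G : CarnotSetting N m) : (Fin N → ℝ) ≃ₜ (Fin N → ℝ) where
  toFun x := G.inv x
  invFun x := G.inv x
  left_inv := G.inv_inv'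
  right_inv := G.inv_inv'
  continuous_toFun := G.smooth_inv.continuous
  continuous_invFun := G.smooth_inv.continuous
def homeoD (σ : Fin N → ℕ) {l : ℝ} (hl : 0 < l) : (Fin N → ℝ) ≃ₜ (Fin N → ℝ) where
  toFun x := dil σ l x
  invFun x := dil σ l⁻¹ x
  left_inv := dil_inv_dil σ hl
  right_inv := dil_dil_inv σ hl
  continuous_toFun := dil_continuous σ l
  continuous_invFun := dil_continuous σ _

lemma integral_left (G : CarnotSetting N m) (z) (f : (Fin N → ℝ) → ℝ) :
    ∫ x, f (G.mul z x) = ∫ x, f x :=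
  (G.mp_left z).integral_comp (G.homeoL z).measurableEmbedding f
lemma integral_right (G : CarnotSetting N m) (z) (f : (Fin N → ℝ) → ℝ) :
    ∫ x, f (G.mul x z) = ∫ x, f x :=
  (G.mp_right z).integral_comp (G.homeoR z).measurableEmbedding f
lemma integral_inv' (G : CarnotSetting N m) (f : (Fin N → ℝ) → ℝ) :
    ∫ x, f (G.inv x) = ∫ x, f x :=
  (G.mp_inv).integral_comp (G.homeoI).measurableEmbedding f
lemma integrable_left (G : CarnotSetting N m) (z) {f : (Fin N → ℝ) → ℝ} :
    Integrable (fun x => f (G.mul z x)) ↔ Integrable f :=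
  (G.mp_left z).integrable_comp_emb (G.homeoL z).measurableEmbedding
lemma integrable_inv' (G : CarnotSetting N m) {f : (Fin N → ℝ) → ℝ} :
    Integrable (fun x => f (G.inv x)) ↔ Integrable f :=
  (G.mp_inv).integrable_comp_emb (G.homeoI).measurableEmbedding

lemma map_dil (σ : Fin N → ℕ) {l : ℝ} (hl : 0 < l) :
    Measure.map (dil σ l) volume = ENNReal.ofReal ((l ^ (∑ i, σ i))⁻¹) • (volume : Measure (Fin N → ℝ)) := by
  have h0 : (dilL σ l).det ≠ 0 := by rw [dilL_det]; positivity
  have := Real.map_linearMap_volume_pi_eq_smul_volume_pi (f := (dilL σ l : (Fin N → ℝ) →ₗ[ℝ] (Fin N → ℝ))) h0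
  have e : (⇑(dilL σ l : (Fin N → ℝ) →ₗ[ℝ] (Fin N → ℝ))) = dil σ l := by ext1 x; simp
  rw [e] at this
  rw [this]
  have e2 : LinearMap.det (dilL σ l : (Fin N → ℝ) →ₗ[ℝ] (Fin N → ℝ)) = l ^ (∑ i, σ i) := dilL_det σ l
  rw [e2, abs_of_pos (by positivity)]

lemma integral_dil (σ : Fin N → ℕ) {l : ℝ} (hl : 0 < l) (f : (Fin N → ℝ) → ℝ) :
    ∫ x, f (dil σ l x) = (l ^ (∑ i, σ i))⁻¹ * ∫ x, f x := by
  have := (homeoD σ hl).measurableEmbedding.integral_map (μ := volume) f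
  change ∫ y, f y ∂(Measure.map (dil σ l) volume) = ∫ x, f (dil σ l x) at this
  rw [← this]
  rw [map_dil σ hl, integral_smul_measure, ENNReal.toReal_ofReal (by positivity)]; simp
lemma lintegral_dil (σ : Fin N → ℕ) {l : ℝ} (hl : 0 < l) (f : (Fin N → ℝ) → ENNReal) :
    ∫⁻ x, f (dil σ l x) = ENNReal.ofReal ((l ^ (∑ i, σ i))⁻¹) * ∫⁻ x, f x := by
  have := (homeoD σ hl).measurableEmbedding.lintegral_map (μ := volume) f
  change ∫⁻ y, f y ∂(Measure.map (dil σ l) volume) = ∫⁻ x, f (dil σ l x) at this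
  rw [← this]
  rw [map_dil σ hl, lintegral_smul_measure]; simp
lemma integrable_dil (σ : Fin N → ℕ) {l : ℝ} (hl : 0 < l) {f : (Fin N → ℝ) → ℝ} :
    Integrable (fun x => f (dil σ l x)) ↔ Integrable f := by
  have := (homeoD σ hl).measurableEmbedding.integrable_map_iff (μ := volume) (g := f)
  change Integrable f (Measure.map (dil σ l) volume) ↔ Integrable (fun x => f (dil σ l x)) at this
  rw [← this, map_dil σ hl, integrable_smul_measure]
  · simp; positivity
  · simp

/-! divergence -/
/-- each diagonal partial derivative vanishes -/
def DivFree (X : (Fin N → ℝ) → (Fin N → ℝ)) : Prop :=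
  ∀ j x, fderiv ℝ (fun w => X w j) x (Pi.single j 1) = 0

lemma divFree_of_homV (G : CarnotSetting N m) {X : (Fin N → ℝ) → (Fin N → ℝ)} (hX : ContDiff ℝ ∞ X) {k : ℕ}
    (hk : 1 ≤ k) (h : HomV G.σ k X) : DivFree X := by
  intro j x
  have hXj : ContDiff ℝ ∞ (fun w => X w j) := contDiff_pi.1 hX j
  have key : ∀ l : ℝ, 0 < l → l ^ k * fderiv ℝ (fun w => X w j) (dil G.σ l x) (Pi.single j 1) =
      fderiv ℝ (fun w => X w j) x (Pi.single j 1) := by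
    intro l hl
    have a1 : HasFDerivAt (fun w => l ^ k * X (dil G.σ l w) j) _ x :=
      ((hXj.differentiable (by simp) _).hasFDerivAt.comp x (dil_hasFDerivAt G.σ l x)).const_mul (l ^ k)
    have a2 : HasFDerivAt (fun w => l ^ (G.σ j) * X w j) _ x :=
      ((hXj.differentiable (by simp) x).hasFDerivAt).const_mul (l ^ (G.σ j))
    have e : (fun w => l ^ k * X (dil G.σ l w) j) = fun w => l ^ (G.σ j) * X w j := by
      ext w
      have := congrFun (h l hl w) j
      simpa [dil] using this
    rw [e] at a1
    have := congrArg (fun L => L (Pi.single j 1)) (a1.unique a2)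
    simp only [smul_apply, ContinuousLinearMap.comp_apply, dilL_apply, smul_eq_mul] at this
    have e3 : dil G.σ l (Pi.single j 1) = (l ^ (G.σ j)) • (Pi.single j (1:ℝ)) := by
      ext i
      by_cases hij : i = j
      · subst hij; simp [dil]
      · simp [dil, hij]
    rw [e3, map_smul, smul_eq_mul, mul_left_comm] at this
    exact mul_left_cancel₀ (by positivity) this
  have hc : Continuous fun y => fderiv ℝ (fun w => X w j) y (Pi.single j 1) :=
    (fderiv_contDiff hXj).continuous.clm_apply continuous_const
  have t1 : Tendsto (fun l : ℝ => l ^ k * fderiv ℝ (fun w => X w j) (dil G.σ l x) (Pi.single j 1))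
      (𝓝[>] 0) (𝓝 (0 ^ k * fderiv ℝ (fun w => X w j) 0 (Pi.single j 1))) := by
    refine Tendsto.mul ?_ ((hc.tendsto 0).comp (G.dil_tendsto x))
    exact ((continuous_pow k).tendsto 0).mono_left nhdsWithin_le_nhds
  have t2 : Tendsto (fun l : ℝ => l ^ k * fderiv ℝ (fun w => X w j) (dil G.σ l x) (Pi.single j 1))
      (𝓝[>] 0) (𝓝 (fderiv ℝ (fun w => X w j) x (Pi.single j 1))) := by
    refine tendsto_const_nhds.congr' ?_
    filter_upwards [self_mem_nhdsWithin] with l hl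
    exact (key l hl).symm
  rw [tendsto_nhds_unique t2 t1, zero_pow (by omega), zero_mul]

lemma Y_divFree (G : CarnotSetting N m) (i) : DivFree (G.Y i) :=
  G.divFree_of_homV (G.Y_smooth i) le_rfl (G.Y_homV i)

lemma fderiv_apply_eq_sum (L : (Fin N → ℝ) →L[ℝ] ℝ) (v : Fin N → ℝ) :
    L v = ∑ j, v j * L (Pi.single j 1) := by
  conv_lhs => rw [← Finset.univ_sum_single v]
  rw [map_sum]
  refine Finset.sum_congr rfl fun j _ => ?_
  have : (Pi.single j (v j) : Fin N → ℝ) = v j • Pi.single j 1 := by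
    rw [← Pi.single_smul]; simp
  rw [this, map_smul, smul_eq_mul]

/-- smooth and compactly supported -/
def Test (ψ : (Fin N → ℝ) → ℝ) : Prop := ContDiff ℝ ∞ ψ ∧ HasCompactSupport ψ

lemma vfDeriv_support {X : (Fin N → ℝ) → (Fin N → ℝ)} {ψ : (Fin N → ℝ) → ℝ} :
    tsupport (vfDeriv X ψ) ⊆ tsupport ψ := by
  refine closure_minimal ?_ (isClosed_tsupport ψ)
  intro x hx
  by_contra h
  apply hx
  have : ψ =ᶠ[𝓝 x] fun _ => 0 := notMem_tsupport_iff_eventuallyEq.1 h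
  rw [vfDeriv_congr_nhds this]
  simp [vfDeriv, lineDeriv]

lemma Test.vf {X : (Fin N → ℝ) → (Fin N → ℝ)} (hX : ContDiff ℝ ∞ X) {ψ} (h : Test ψ) :
    Test (vfDeriv X ψ) :=
  ⟨vfDeriv_contDiff hX h.1, h.2.of_isClosed_subset (isClosed_tsupport _) vfDeriv_support⟩
lemma Test.Y (G : CarnotSetting N m) {ψ} (h : Test ψ) (i) : Test (vfDeriv (G.Y i) ψ) := h.vf (G.Y_smooth i)
lemma Test.iter (G : CarnotSetting N m) {ψ} (h : Test ψ) (l) : Test (vfIter G.Y l ψ) := by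
  induction l with
  | nil => exact h
  | cons i l ih => exact ih.Y G i
lemma Test.integrable {ψ : (Fin N → ℝ) → ℝ} (h : Test ψ) : Integrable ψ :=
  h.1.continuous.integrable_of_hasCompactSupport h.2
lemma Test.mul_smooth {ψ φ : (Fin N → ℝ) → ℝ} (h : Test ψ) (hφ : ContDiff ℝ ∞ φ) :
    Test (fun x => ψ x * φ x) := ⟨h.1.mul hφ, h.2.mul_right⟩
lemma Test.smooth_mul {ψ φ : (Fin N → ℝ) → ℝ} (h : Test ψ) (hφ : ContDiff ℝ ∞ φ) :
    Test (fun x => φ x * ψ x) := ⟨hφ.mul h.1, h.2.mul_left⟩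
lemma Test.add {ψ φ : (Fin N → ℝ) → ℝ} (h : Test ψ) (hφ : Test φ) : Test (fun x => ψ x + φ x) :=
  ⟨h.1.add hφ.1, h.2.add hφ.2⟩
lemma Test.sub {ψ φ : (Fin N → ℝ) → ℝ} (h : Test ψ) (hφ : Test φ) : Test (fun x => ψ x - φ x) :=
  ⟨h.1.sub hφ.1, by
    have : HasCompactSupport (fun x => ψ x + (-φ x)) := h.2.add hφ.2.neg
    simpa [sub_eq_add_neg] using this⟩
lemma Test.const_mul {ψ : (Fin N → ℝ) → ℝ} (h : Test ψ) (c : ℝ) : Test (fun x => c * ψ x) :=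
  h.smooth_mul contDiff_const
lemma Test.zero : Test (fun _ : Fin N → ℝ => (0:ℝ)) := ⟨contDiff_const, HasCompactSupport.zero⟩
lemma Test.sum {ι : Type*} (s : Finset ι) {ψ : ι → (Fin N → ℝ) → ℝ} (h : ∀ i ∈ s, Test (ψ i)) :
    Test (fun x => ∑ i ∈ s, ψ i x) := by
  classical
  induction s using Finset.induction_on with
  | empty => simpa using Test.zero
  | insert a s ha ih =>
    simp only [Finset.sum_insert ha]
    exact (h a (by simp)).add (ih fun i hi => h i (by simp [hi]))
lemma Test.comp_homeo {ψ : (Fin N → ℝ) → ℝ} (h : Test ψ) (e : (Fin N → ℝ) ≃ₜ (Fin N → ℝ))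
    (he : ContDiff ℝ ∞ e) : Test (fun x => ψ (e x)) :=
  ⟨h.1.comp he, h.2.comp_homeomorph e⟩
lemma Test.left (G : CarnotSetting N m) {ψ : (Fin N → ℝ) → ℝ} (h : Test ψ) (z) :
    Test (fun x => ψ (G.mul z x)) := h.comp_homeo (G.homeoL z) (G.cmul_left z)
lemma Test.right (G : CarnotSetting N m) {ψ : (Fin N → ℝ) → ℝ} (h : Test ψ) (z) :
    Test (fun x => ψ (G.mul x z)) := h.comp_homeo (G.homeoR z) (G.cmul_right z)
lemma Test.inv' (G : CarnotSetting N m) {ψ : (Fin N → ℝ) → ℝ} (h : Test ψ) :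
    Test (fun x => ψ (G.inv x)) := h.comp_homeo (G.homeoI) G.smooth_inv
lemma Test.dil {ψ : (Fin N → ℝ) → ℝ} (h : Test ψ) (σ : Fin N → ℕ) {l : ℝ} (hl : 0 < l) :
    Test (fun x => ψ (dil σ l x)) := h.comp_homeo (homeoD σ hl) (dil_contDiff σ l)

lemma vfDeriv_mul {X : (Fin N → ℝ) → (Fin N → ℝ)} {f g : (Fin N → ℝ) → ℝ} {x}
    (hf : DifferentiableAt ℝ f x) (hg : DifferentiableAt ℝ g x) :
    vfDeriv X (fun y => f y * g y) x = vfDeriv X f x * g x + f x * vfDeriv X g x := by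
  rw [vfDeriv_eq X hf, vfDeriv_eq X hg, vfDeriv_eq X (hf.fun_mul hg), (hf.hasFDerivAt.fun_mul hg.hasFDerivAt).fderiv]
  simp; ring
lemma vfDeriv_add {X : (Fin N → ℝ) → (Fin N → ℝ)} {f g : (Fin N → ℝ) → ℝ} {x}
    (hf : DifferentiableAt ℝ f x) (hg : DifferentiableAt ℝ g x) :
    vfDeriv X (fun y => f y + g y) x = vfDeriv X f x + vfDeriv X g x := by
  rw [vfDeriv_eq X hf, vfDeriv_eq X hg, vfDeriv_eq X (hf.fun_add hg), (hf.hasFDerivAt.fun_add hg.hasFDerivAt).fderiv]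
  simp
lemma vfDeriv_sub {X : (Fin N → ℝ) → (Fin N → ℝ)} {f g : (Fin N → ℝ) → ℝ} {x}
    (hf : DifferentiableAt ℝ f x) (hg : DifferentiableAt ℝ g x) :
    vfDeriv X (fun y => f y - g y) x = vfDeriv X f x - vfDeriv X g x := by
  rw [vfDeriv_eq X hf, vfDeriv_eq X hg, vfDeriv_eq X (hf.fun_sub hg), (hf.hasFDerivAt.fun_sub hg.hasFDerivAt).fderiv]
  simp
lemma vfDeriv_const_mul {X : (Fin N → ℝ) → (Fin N → ℝ)} {f : (Fin N → ℝ) → ℝ} {x} (c : ℝ)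
    (hf : DifferentiableAt ℝ f x) : vfDeriv X (fun y => c * f y) x = c * vfDeriv X f x := by
  rw [vfDeriv_eq X hf, vfDeriv_eq X (hf.const_mul c), (hf.hasFDerivAt.const_mul c).fderiv]
  simp
lemma vfDeriv_sum {X : (Fin N → ℝ) → (Fin N → ℝ)} {ι : Type*} (s : Finset ι) {f : ι → (Fin N → ℝ) → ℝ} {x}
    (hf : ∀ i ∈ s, DifferentiableAt ℝ (f i) x) :
    vfDeriv X (fun y => ∑ i ∈ s, f i y) x = ∑ i ∈ s, vfDeriv X (f i) x := by
  have h1 : HasFDerivAt (fun y => ∑ i ∈ s, f i y) (∑ i ∈ s, fderiv ℝ (f i) x) x :=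
    HasFDerivAt.fun_sum fun i hi => (hf i hi).hasFDerivAt
  rw [vfDeriv_eq X h1.differentiableAt, h1.fderiv, sum_apply]
  exact Finset.sum_congr rfl fun i hi => (vfDeriv_eq X (hf i hi)).symm
lemma vfDeriv_const {X : (Fin N → ℝ) → (Fin N → ℝ)} (c : ℝ) (x) : vfDeriv X (fun _ => c) x = 0 := by
  simp [vfDeriv, lineDeriv]

lemma Test.integral_vf {X : (Fin N → ℝ) → (Fin N → ℝ)} (hX : ContDiff ℝ ∞ X) (hd : DivFree X)
    {h : (Fin N → ℝ) → ℝ} (hh : Test h) : ∫ x, vfDeriv X h x = 0 := by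
  have e : ∀ x, vfDeriv X h x = ∑ j, X x j * fderiv ℝ h x (Pi.single j 1) := by
    intro x; rw [vfDeriv_eq' X hh.1]; exact fderiv_apply_eq_sum _ _
  simp_rw [e]
  have hXj : ∀ j, ContDiff ℝ ∞ (fun w => X w j) := fun j => contDiff_pi.1 hX j
  have t1 : ∀ j, Test (fun x => fderiv ℝ h x (Pi.single j 1)) := fun j => by
    have := hh.vf (X := fun _ => Pi.single j 1) contDiff_const
    rwa [vfDeriv_eq' _ hh.1] at this
  have hi : ∀ j, Integrable (fun x => X x j * fderiv ℝ h x (Pi.single j 1)) :=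
    fun j => ((t1 j).smooth_mul (hXj j)).integrable
  rw [integral_finsetSum _ fun j _ => hi j]
  refine Finset.sum_eq_zero fun j _ => ?_
  rw [integral_mul_fderiv_eq_neg_fderiv_mul_of_integrable]
  · simp [hd j]
  · simp [hd j]
  · exact hi j
  · exact (hh.smooth_mul (hXj j)).integrable
  · exact fun x _ => (hXj j).differentiable (by simp) x
  · exact fun x _ => hh.1.differentiable (by simp) x

lemma ibp {X : (Fin N → ℝ) → (Fin N → ℝ)} (hX : ContDiff ℝ ∞ X) (hd : DivFree X)
    {f g : (Fin N → ℝ) → ℝ} (hf : Test f) (hg : ContDiff ℝ ∞ g) :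
    ∫ x, vfDeriv X f x * g x = - ∫ x, f x * vfDeriv X g x := by
  have h := (hf.mul_smooth hg).integral_vf hX hd
  have e : ∀ x, vfDeriv X (fun x => f x * g x) x = vfDeriv X f x * g x + f x * vfDeriv X g x := fun x =>
    vfDeriv_mul (hf.1.differentiable (by simp) x) (hg.differentiable (by simp) x)
  simp_rw [e] at h
  rw [integral_add ((hf.vf hX).mul_smooth hg).integrable
    (hf.mul_smooth (vfDeriv_contDiff hX hg)).integrable] at h
  linarith

lemma ibp' {X : (Fin N → ℝ) → (Fin N → ℝ)} (hX : ContDiff ℝ ∞ X) (hd : DivFree X)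
    {f g : (Fin N → ℝ) → ℝ} (hf : ContDiff ℝ ∞ f) (hg : Test g) :
    ∫ x, vfDeriv X f x * g x = - ∫ x, f x * vfDeriv X g x := by
  have := ibp hX hd hg hf
  simp_rw [mul_comm (vfDeriv X f _), mul_comm (f _)]
  linarith

/-! left/right invariant fields from vectors -/
def LV (G : CarnotSetting N m) (e x : Fin N → ℝ) : Fin N → ℝ := fderiv ℝ (fun w => G.mul x w) 0 e
def RV (G : CarnotSetting N m) (e x : Fin N → ℝ) : Fin N → ℝ := fderiv ℝ (fun w => G.mul w x) 0 e

lemma LV_contDiff (G : CarnotSetting N m) (e) : ContDiff ℝ ∞ (G.LV e) := by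
  unfold LV
  simp_rw [fderiv_mul_left_eq]
  exact (((fderiv_contDiff G.smooth_mul).comp (contDiff_id.prodMk contDiff_const)).clm_comp
    contDiff_const).clm_apply contDiff_const
lemma RV_contDiff (G : CarnotSetting N m) (e) : ContDiff ℝ ∞ (G.RV e) := by
  unfold RV
  simp_rw [fderiv_mul_right_eq]
  exact (((fderiv_contDiff G.smooth_mul).comp (contDiff_const.prodMk contDiff_id)).clm_comp
    contDiff_const).clm_apply contDiff_const
lemma LV_zero (G : CarnotSetting N m) (e) : G.LV e 0 = e := by
  rw [LV, fderiv_mul_zero_left]; rfl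
lemma RV_zero (G : CarnotSetting N m) (e) : G.RV e 0 = e := by
  rw [RV, fderiv_mul_zero_right]; rfl

lemma LV_linv (G : CarnotSetting N m) (e) : G.LInv (G.LV e) := by
  intro z x
  unfold LV
  have h1 : (fun w => G.mul (G.mul z x) w) = fun w => G.mul z (G.mul x w) := by
    ext1 w; exact G.mul_assoc' z x w
  have a0 := ((G.cmul_left x).differentiable (by simp) 0).hasFDerivAt
  have a1 := ((G.cmul_left z).differentiable (by simp) (G.mul x 0)).hasFDerivAt
  have a2 : HasFDerivAt (fun w => G.mul z (G.mul x w)) _ 0 := a1.comp 0 a0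
  rw [h1, a2.fderiv, G.mul_zero']; rfl

lemma linv_eq_LV (G : CarnotSetting N m) {X} (h : G.LInv X) : X = G.LV (X 0) := by
  ext1 x
  have := h x 0
  rwa [G.mul_zero'] at this

/-- left-invariant and right-invariant fields commute -/
lemma vfLie_LR (G : CarnotSetting N m) {X} (hXs : ContDiff ℝ ∞ X) (hX : G.LInv X) (e x) :
    vfLie X (G.RV e) x = 0 := by
  -- differentiate `X (a*x) = D(L_a)(x) (X x)` in `a` at `0`, direction `e`
  let M : (Fin N → ℝ) × (Fin N → ℝ) → (Fin N → ℝ) := fun p => G.mul p.1 p.2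
  have hM : ContDiff ℝ ∞ M := G.smooth_mul
  have hdM : ∀ p, HasFDerivAt (fderiv ℝ M) (fderiv ℝ (fderiv ℝ M) p) p := fun p =>
    ((fderiv_contDiff hM).differentiable (by simp) p).hasFDerivAt
  have a1 : HasFDerivAt (fun a => X (G.mul a x)) _ 0 := 
    (hXs.differentiable (by simp) _).hasFDerivAt.comp 0 ((G.cmul_right x).differentiable (by simp) 0).hasFDerivAt
  have a2 : HasFDerivAt (fun a => fderiv ℝ M (a, x) (0, X x)) _ 0 :=
    ((hdM (0, x)).comp 0 (hasFDerivAt_prodMk_left (0 : Fin N → ℝ) x)).clm_apply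
      (hasFDerivAt_const ((0 : Fin N → ℝ), X x) 0)
  have e1 : (fun a => X (G.mul a x)) = fun a => fderiv ℝ M (a, x) (0, X x) := by
    ext1 a; rw [hX a x, fderiv_mul_left_eq]; simp [M]
  rw [e1] at a1
  have b1 := congrArg (fun L => L e) (a1.unique a2)
  have c1 : HasFDerivAt (fun y => fderiv ℝ M (0, y) (e, 0)) _ x :=
    ((hdM (0, x)).comp x (hasFDerivAt_prodMk_right (0 : Fin N → ℝ) x)).clm_apply
      (hasFDerivAt_const (e, (0 : Fin N → ℝ)) x)
  have e2 : G.RV e = fun y => fderiv ℝ M (0, y) (e, 0) := by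
    ext1 a; rw [RV, fderiv_mul_right_eq]; simp [M]
  have sym := (hM.contDiffAt (x := ((0 : Fin N → ℝ), x))).isSymmSndFDerivAt (by simp [two_le_infty]) (e, 0) (0, X x)
  unfold vfLie
  rw [e2, c1.fderiv]
  simp only [ContinuousLinearMap.comp_apply, ContinuousLinearMap.flip_apply,
    zero_add, ContinuousLinearMap.inr_apply,
    ContinuousLinearMap.inl_apply, G.zero_mul', ContinuousLinearMap.comp_zero] at b1 ⊢
  rw [← sym, ← b1]
  have e3 : fderiv ℝ (fun w => G.mul w x) 0 e = fderiv ℝ M (0, x) (e, 0) := by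
    rw [fderiv_mul_right_eq]; simp [M]
  rw [e3]; simp

lemma vf_RV_comm (G : CarnotSetting N m) {X} (hXs : ContDiff ℝ ∞ X) (hX : G.LInv X) (e)
    {u : (Fin N → ℝ) → ℝ} (hu : ContDiff ℝ ∞ u) :
    vfDeriv X (vfDeriv (G.RV e) u) = vfDeriv (G.RV e) (vfDeriv X u) := by
  ext x
  have h := vfDeriv_comm hXs (G.RV_contDiff e) isOpen_univ hu.contDiffOn (mem_univ x)
  have h0 : vfDeriv (vfLie X (G.RV e)) u x = 0 := by
    rw [vfDeriv, G.vfLie_LR hXs hX]; simp [lineDeriv]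
  linarith

end CarnotSetting
end

end

section
open MeasureTheory Set Filter Topology
open scoped ContDiff
noncomputable section
namespace CarnotSetting
variable {N m : ℕ}

/-- integral curve through the origin on an open interval -/
def IsCurve (X : (Fin N → ℝ) → (Fin N → ℝ)) (a b : ℝ) (γ : ℝ → (Fin N → ℝ)) : Prop :=
  γ 0 = 0 ∧ (0:ℝ) ∈ Ioo a b ∧ ∀ t ∈ Ioo a b, HasDerivAt γ (X (γ t)) t

lemma exists_curve {X : (Fin N → ℝ) → (Fin N → ℝ)} (hX : ContDiff ℝ ∞ X) :
    ∃ ε > 0, ∃ γ, IsCurve X (-ε) ε γ := by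
  obtain ⟨γ, h0, ε, hε, h⟩ :=
    ((hX.of_le (by simp)).contDiffAt (x := 0) : ContDiffAt ℝ 1 X 0).exists_forall_mem_closedBall_exists_eq_forall_mem_Ioo_hasDerivAt₀ 0
  refine ⟨ε, hε, γ, h0, by simp [hε], fun t ht => h t (by simpa using ht)⟩

/-- flow derivative of left translates of a curve -/
lemma IsCurve.translate (G : CarnotSetting N m) {X} (hX : G.LInv X) {a b γ}
    (h : IsCurve X a b γ) (x) {t} (ht : t ∈ Ioo a b) :
    HasDerivAt (fun s => G.mul x (γ s)) (X (G.mul x (γ t))) t := by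
  rw [hX x (γ t)]
  exact (((G.cmul_left x).differentiable (by simp) _).hasFDerivAt).comp_hasDerivAt t (h.2.2 t ht)

lemma IsCurve.recenter (G : CarnotSetting N m) {X} (hX : G.LInv X) {a b γ}
    (h : IsCurve X a b γ) {t} (ht : t ∈ Ioo a b) :
    IsCurve X (a - t) (b - t) (fun s => G.mul (G.inv (γ t)) (γ (t + s))) := by
  refine ⟨by simp [G.inv_mul'], by simpa using ht, fun s hs => ?_⟩
  have h1 := h.translate G hX (G.inv (γ t)) (t := t + s) ⟨by linarith [hs.1], by linarith [hs.2]⟩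
  have h2 : HasDerivAt (fun s => t + s) 1 s := (hasDerivAt_id s).const_add t
  have := h1.scomp s h2
  simpa [Function.comp_def] using this

lemma IsCurve.dil (G : CarnotSetting N m) {X} (hX : HomV G.σ 1 X) {a b γ}
    (h : IsCurve X a b γ) {l : ℝ} (hl : 0 < l) :
    IsCurve X (l * a) (l * b) (fun s => dil G.σ l (γ (s / l))) := by
  refine ⟨by simp [h.1, dil_zero'], ?_, fun s hs => ?_⟩
  · have := h.2.1
    exact ⟨by nlinarith [this.1], by nlinarith [this.2]⟩
  · have hs' : s / l ∈ Ioo a b := by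
      constructor
      · rw [lt_div_iff₀ hl]; linarith [hs.1]
      · rw [div_lt_iff₀ hl]; linarith [hs.2]
    have h1 := h.2.2 _ hs'
    have h2 : HasDerivAt (fun s : ℝ => s / l) (1 / l) s := (hasDerivAt_id s).div_const l
    have h3 := h1.scomp s h2
    have h4 := (dil_hasFDerivAt G.σ l _).comp_hasDerivAt s h3
    have e : X (_root_.dil G.σ l (γ (s / l))) = dilL G.σ l ((1 / l) • X (γ (s / l))) := by
      rw [map_smul, dilL_apply, ← hX l hl (γ (s / l)), smul_smul, pow_one, one_div_mul_cancel hl.ne', one_smul]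
    show HasDerivAt _ (X (_root_.dil G.σ l (γ (s / l)))) s
    rw [e]; exact h4

/-- reachability by concatenation of integral curves with total time `C` -/
inductive Reach (G : CarnotSetting N m) : (Fin N → ℝ) → ℝ → Prop
  | one : Reach G 0 0
  | step {z C a b γ t} (i : Fin m) (hz : Reach G z C) (hγ : IsCurve (G.Y i) a b γ) (ht : t ∈ Ioo a b) :
      Reach G (G.mul z (γ t)) (C + |t|)

variable {G : CarnotSetting N m}
lemma Reach.single {a b γ t} (i : Fin m) (hγ : IsCurve (G.Y i) a b γ) (ht : t ∈ Ioo a b) :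
    Reach G (γ t) |t| := by
  have := Reach.step i Reach.one hγ ht
  rwa [G.zero_mul', zero_add] at this
lemma Reach.mul {z C z' C'} (h : Reach G z C) (h' : Reach G z' C') : Reach G (G.mul z z') (C + C') := by
  induction h' with
  | one => rwa [G.mul_zero', add_zero]
  | step i hz hγ ht ih =>
    rw [← G.mul_assoc', ← add_assoc]
    exact Reach.step i ih hγ ht
lemma Reach.nonneg {z C} (h : Reach G z C) : 0 ≤ C := by
  induction h with
  | one => exact le_rfl
  | step i hz hγ ht ih => positivity
lemma Reach.inv {z C} (h : Reach G z C) : Reach G (G.inv z) C := by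
  induction h with
  | one => rw [G.inv_zero']; exact Reach.one
  | @step z C a b γ t i hz hγ ht ih =>
    rw [G.inv_mul_rev', add_comm]
    refine Reach.mul ?_ ih
    have h1 := hγ.recenter G (G.Y_linv i) ht
    have h2 := Reach.single i h1 (t := -t) ⟨by linarith [hγ.2.1.1], by linarith [hγ.2.1.2]⟩
    simpa [hγ.1, G.mul_zero'] using h2
lemma Reach.dil {z C} (h : Reach G z C) {l : ℝ} (hl : 0 < l) : Reach G (dil G.σ l z) (l * C) := by
  induction h with
  | one => rw [dil_zero', mul_zero]; exact Reach.one
  | @step z C a b γ t i hz hγ ht ih =>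
    have h1 := hγ.dil G (G.Y_homV i) hl
    have h2 := Reach.step i ih h1 (t := l * t)
      ⟨by have := ht.1; nlinarith, by have := ht.2; nlinarith⟩
    rw [mul_add, ← G.dil_auto l hl]
    rw [mul_div_cancel_left₀ t hl.ne', abs_mul, abs_of_pos hl] at h2
    exact h2

/-! adjoint action -/
def Ad (G : CarnotSetting N m) (g : Fin N → ℝ) : (Fin N → ℝ) →L[ℝ] (Fin N → ℝ) :=
  fderiv ℝ (fun w => G.mul (G.mul g w) (G.inv g)) 0

lemma conj_contDiff (G : CarnotSetting N m) (g) :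
    ContDiff ℝ ∞ (fun w => G.mul (G.mul g w) (G.inv g)) :=
  G.cmul (G.cmul_left g) contDiff_const
lemma conj_hasFDerivAt (G : CarnotSetting N m) (g) :
    HasFDerivAt (fun w => G.mul (G.mul g w) (G.inv g)) (G.Ad g) 0 :=
  ((G.conj_contDiff g).differentiable (by simp) 0).hasFDerivAt
lemma Ad_zero (G : CarnotSetting N m) : G.Ad 0 = ContinuousLinearMap.id ℝ _ := by
  unfold Ad
  have : (fun w => G.mul (G.mul 0 w) (G.inv 0)) = id := by
    ext1 w; rw [G.zero_mul', G.inv_zero', G.mul_zero']; rfl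
  rw [this, fderiv_id]
lemma Ad_mul (G : CarnotSetting N m) (g h w) : G.Ad (G.mul g h) w = G.Ad g (G.Ad h w) := by
  have h1 := G.conj_hasFDerivAt h
  have h2 := G.conj_hasFDerivAt g
  have e0 : G.mul (G.mul h 0) (G.inv h) = 0 := by rw [G.mul_zero', G.mul_inv']
  rw [← e0] at h2
  have h3 := h2.comp 0 h1
  have e : (fun w => G.mul (G.mul g w) (G.inv g)) ∘ (fun w => G.mul (G.mul h w) (G.inv h)) =
      fun w => G.mul (G.mul (G.mul g h) w) (G.inv (G.mul g h)) := by
    ext1 w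
    simp only [Function.comp, G.inv_mul_rev', G.mul_assoc']
  rw [e] at h3
  rw [Ad, h3.fderiv]; rfl
lemma LV_eq_RV_Ad (G : CarnotSetting N m) (g w) : G.LV w g = G.RV (G.Ad g w) g := by
  have h1 := G.conj_hasFDerivAt g
  have h2 := ((G.cmul_right g).differentiable (by simp) (G.mul (G.mul g 0) (G.inv g))).hasFDerivAt
  have h3 := h2.comp 0 h1
  have e0 : G.mul (G.mul g 0) (G.inv g) = 0 := by rw [G.mul_zero', G.mul_inv']
  have e : (fun w => G.mul w g) ∘ (fun w => G.mul (G.mul g w) (G.inv g)) = fun w => G.mul g w := by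
    ext1 w; exact G.inv_mul_cancel_right' _ _
  rw [e, e0] at h3
  rw [LV, h3.fderiv]; rfl

lemma Ad_smooth (G : CarnotSetting N m) : ContDiff ℝ ∞ (fun g => G.Ad g) := by
  have h : ContDiff ℝ ∞ (fun p : (Fin N → ℝ) × (Fin N → ℝ) => G.mul (G.mul p.1 p.2) (G.inv p.1)) :=
    G.cmul (G.cmul contDiff_fst contDiff_snd) (G.smooth_inv.comp contDiff_fst)
  have : (fun g => G.Ad g) = fun g => (fderiv ℝ (fun p : (Fin N → ℝ) × (Fin N → ℝ) =>
      G.mul (G.mul p.1 p.2) (G.inv p.1)) (g, 0)).comp (ContinuousLinearMap.inr ℝ _ _) := by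
    ext1 g
    exact ((h.differentiable (by simp) (g, 0)).hasFDerivAt.comp 0 (hasFDerivAt_prodMk_right g 0)).fderiv
  rw [this]
  exact ((fderiv_contDiff h).comp (contDiff_id.prodMk contDiff_const)).clm_comp contDiff_const

/-- the right-invariant frame as a linear-map valued smooth function -/
def RVL (G : CarnotSetting N m) (x : Fin N → ℝ) : (Fin N → ℝ) →L[ℝ] (Fin N → ℝ) :=
  fderiv ℝ (fun w => G.mul w x) 0
lemma RVL_apply (G : CarnotSetting N m) (x e) : G.RVL x e = G.RV e x := rfl
lemma RVL_smooth (G : CarnotSetting N m) : ContDiff ℝ ∞ (fun g => G.RVL g) := by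
  unfold RVL
  simp_rw [fderiv_mul_right_eq]
  exact ((fderiv_contDiff G.smooth_mul).comp (contDiff_const.prodMk contDiff_id)).clm_comp contDiff_const

lemma Ad_curve_deriv (G : CarnotSetting N m) {X} (hXs : ContDiff ℝ ∞ X) (hX : G.LInv X) {a b γ}
    (hγ : IsCurve X a b γ) (w) :
    HasDerivAt (fun t => G.Ad (γ t) w) (vfLie X (G.LV w) 0) 0 := by
  have hγ0 : HasDerivAt γ (X 0) 0 := by simpa [hγ.1] using hγ.2.2 0 hγ.2.1
  have hA0 : HasFDerivAt (fun g => G.Ad g) (fderiv ℝ (fun g => G.Ad g) (γ 0)) (γ 0) :=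
    (G.Ad_smooth.differentiable (by simp) _).hasFDerivAt
  have hA := (hA0.comp_hasDerivAt 0 hγ0).clm_apply (hasDerivAt_const (0:ℝ) w)
  simp only [Function.comp_def, map_zero, add_zero] at hA
  set D := (fderiv ℝ (fun g => G.Ad g) (γ 0)) (X 0) w with hD
  have hR0 : HasFDerivAt (fun g => G.RVL g) (fderiv ℝ (fun g => G.RVL g) (γ 0)) (γ 0) :=
    (G.RVL_smooth.differentiable (by simp) _).hasFDerivAt
  have hR := (hR0.comp_hasDerivAt 0 hγ0).clm_apply hA
  have hRw := (hR0.comp_hasDerivAt 0 hγ0).clm_apply (hasDerivAt_const (0:ℝ) w)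
  have hRw' : HasDerivAt (fun t => G.RV w (γ t)) (fderiv ℝ (G.RV w) 0 (X 0)) 0 := by
    have := ((G.RV_contDiff w).differentiable (by simp) (γ 0)).hasFDerivAt.comp_hasDerivAt 0 hγ0
    rwa [hγ.1] at this
  have u1 := hRw'.unique hRw
  have hL : HasDerivAt (fun t => G.LV w (γ t)) (fderiv ℝ (G.LV w) 0 (X 0)) 0 := by
    have := ((G.LV_contDiff w).differentiable (by simp) (γ 0)).hasFDerivAt.comp_hasDerivAt 0 hγ0
    rwa [hγ.1] at this
  have e : (fun t => G.LV w (γ t)) = fun t => G.RVL (γ t) (G.Ad (γ t) w) := by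
    ext1 t; exact G.LV_eq_RV_Ad _ _
  rw [e] at hL
  have u2 := hL.unique hR
  have z1 : G.RVL (γ 0) D = D := by rw [hγ.1, RVL_apply, RV_zero]
  have z2 : G.Ad (γ 0) w = w := by rw [hγ.1, Ad_zero]; rfl
  rw [Function.comp_apply, z1, z2] at u2
  rw [Function.comp_apply] at u1
  simp only [map_zero, add_zero] at u1
  have h0 := G.vfLie_LR hXs hX w 0
  rw [vfLie, RV_zero, sub_eq_zero] at h0
  have : vfLie X (G.LV w) 0 = D := by
    rw [vfLie, LV_zero, ← h0, u2, u1]; abel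
  rw [this]; exact hA

/-- span of all conjugates -/
def Wsp (G : CarnotSetting N m) : Submodule ℝ (Fin N → ℝ) :=
  Submodule.span ℝ {v | ∃ g C i, Reach G g C ∧ v = G.Ad g (G.Y i 0)}

lemma Wsp_Ad (G : CarnotSetting N m) {g C} (hg : Reach G g C) {w} (hw : w ∈ G.Wsp) : G.Ad g w ∈ G.Wsp := by
  unfold Wsp at hw ⊢
  induction hw using Submodule.span_induction with
  | mem x hx =>
    obtain ⟨h, C', i, hr, rfl⟩ := hx
    rw [← Ad_mul]
    exact Submodule.subset_span ⟨_, _, i, hg.mul hr, rfl⟩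
  | zero => simp
  | add x y _ _ hx hy => rw [map_add]; exact Submodule.add_mem _ hx hy
  | smul a x _ hx => rw [map_smul]; exact Submodule.smul_mem _ _ hx

lemma Wsp_lie (G : CarnotSetting N m) (i) {w} (hw : w ∈ G.Wsp) : vfLie (G.Y i) (G.LV w) 0 ∈ G.Wsp := by
  obtain ⟨ε, hε, γ, hγ⟩ := exists_curve (G.Y_smooth i)
  have h := G.Ad_curve_deriv (G.Y_smooth i) (G.Y_linv i) hγ w
  have hcl : IsClosed (G.Wsp : Set (Fin N → ℝ)) := Submodule.closed_of_finiteDimensional _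
  refine hcl.mem_of_tendsto h.tendsto_slope ?_
  have : Ioo (-ε) ε ∈ 𝓝[≠] (0:ℝ) := mem_nhdsWithin_of_mem_nhds (Ioo_mem_nhds (by linarith) hε)
  filter_upwards [this] with t ht
  rw [slope_def_module]
  refine Submodule.smul_mem _ _ (Submodule.sub_mem _ (G.Wsp_Ad (Reach.single i hγ ht) hw) ?_)
  rw [hγ.1, Ad_zero]; exact hw

lemma Wsp_top (G : CarnotSetting N m) : G.Wsp = ⊤ := by
  have hl : ∀ l : List (Fin m), l ≠ [] → vfIterLie G.Y l 0 ∈ G.Wsp := by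
    intro l
    induction l with
    | nil => simp
    | cons i l ih =>
      intro _
      cases l with
      | nil => 
        refine Submodule.subset_span ⟨0, 0, i, Reach.one, ?_⟩
        rw [Ad_zero]; rfl
      | cons j l =>
        have := G.Wsp_lie i (ih (by simp))
        rwa [← G.linv_eq_LV (G.vfIterLie_linv (j :: l))] at this
  rw [eq_top_iff, ← G.hormander 0, Submodule.span_le]
  rintro v ⟨l, hl0, rfl⟩
  exact hl l hl0

lemma fderiv_mul_zero (G : CarnotSetting N m) :
    HasStrictFDerivAt (fun p : (Fin N → ℝ) × (Fin N → ℝ) => G.mul p.1 p.2)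
      (ContinuousLinearMap.fst ℝ _ _ + ContinuousLinearMap.snd ℝ _ _) (0, 0) := by
  have h := G.smooth_mul.contDiffAt.hasStrictFDerivAt (x := (0,0)) (by simp)
  have e : fderiv ℝ (fun p : (Fin N → ℝ) × (Fin N → ℝ) => G.mul p.1 p.2) (0, 0) =
      ContinuousLinearMap.fst ℝ _ _ + ContinuousLinearMap.snd ℝ _ _ := by
    refine ContinuousLinearMap.ext fun p => ?_
    have h1 := G.fderiv_mul_right_eq 0 0
    have h2 := G.fderiv_mul_left_eq 0 0
    rw [fderiv_mul_zero_right] at h1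
    rw [fderiv_mul_zero_left] at h2
    have h1' := congrArg (fun T => T p.1) h1
    have h2' := congrArg (fun T => T p.2) h2
    simp only [ContinuousLinearMap.comp_apply, ContinuousLinearMap.inl_apply, ContinuousLinearMap.inr_apply,
      ContinuousLinearMap.id_apply] at h1' h2'
    have h3 : p = (p.1, 0) + (0, p.2) := by simp
    rw [h3, map_add, ← h1', ← h2']; simp
  rw [e] at h; exact h

/-- a parametrised family of reachable points whose differential at 0 covers `W`. -/
def Param (G : CarnotSetting N m) (W : Submodule ℝ (Fin N → ℝ)) : Prop :=
  ∃ (F : Type) (_ : NormedAddCommGroup F) (_ : NormedSpace ℝ F) (_ : CompleteSpace F)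
    (Φ : F → (Fin N → ℝ)) (Φ' : F →L[ℝ] (Fin N → ℝ)) (C : ℝ), HasStrictFDerivAt Φ Φ' 0 ∧ Φ 0 = 0 ∧
    W ≤ Φ'.range ∧ ∀ᶠ t in 𝓝 0, ∃ C' ≤ C, Reach G (Φ t) C'

lemma Param.sup {W W'} (h : Param G W) (h' : Param G W') : Param G (W ⊔ W') := by
  obtain ⟨F, i1, i2, i3, Φ, Φ', C, h1, h2, h3, h4⟩ := h
  obtain ⟨F', j1, j2, j3, Ψ, Ψ', D, k1, k2, k3, k4⟩ := h'
  refine ⟨F × F', inferInstance, inferInstance, inferInstance, fun p => G.mul (Φ p.1) (Ψ p.2), _, C + D,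
    HasStrictFDerivAt.comp (g := fun p : (Fin N → ℝ) × (Fin N → ℝ) => G.mul p.1 p.2)
      (f := fun p : F × F' => (Φ p.1, Ψ p.2)) (0 : F × F') 
      (by rw [show (Φ (0 : F × F').1, Ψ (0 : F × F').2) = (0,0) by simp [h2, k2]]; exact G.fderiv_mul_zero)
      ((h1.comp (0 : F × F') hasStrictFDerivAt_fst).prodMk (k1.comp (0 : F × F') hasStrictFDerivAt_snd)), ?_, ?_, ?_⟩
  · simp [h2, k2, G.mul_zero']
  · rw [sup_le_iff]
    constructor
    · intro w hw
      obtain ⟨t, ht⟩ := h3 hw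
      exact ⟨(t, 0), by simpa using ht⟩
    · intro w hw
      obtain ⟨t, ht⟩ := k3 hw
      exact ⟨(0, t), by simpa using ht⟩
  · have : 𝓝 (0 : F × F') = 𝓝 0 ×ˢ 𝓝 0 := nhds_prod_eq
    rw [this]
    filter_upwards [h4.prod_mk k4] with p hp
    obtain ⟨⟨c, hc, hc'⟩, ⟨d, hd, hd'⟩⟩ := hp
    exact ⟨c + d, by linarith, hc'.mul hd'⟩

lemma Param.single {g C} (i) (hg : Reach G g C) : Param G (Submodule.span ℝ {G.Ad g (G.Y i 0)}) := by
  obtain ⟨ε, hε, γ, hγ⟩ := exists_curve (G.Y_smooth i)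
  have hc : HasStrictDerivAt γ (G.Y i (γ 0)) 0 := by
    refine hasStrictDerivAt_of_hasDerivAt_of_continuousAt (f' := fun t => G.Y i (γ t)) ?_ ?_
    · filter_upwards [Ioo_mem_nhds hγ.2.1.1 hγ.2.1.2] with t ht using hγ.2.2 t ht
    · exact ((G.Y_smooth i).continuous.continuousAt).comp (hγ.2.2 0 hγ.2.1).continuousAt
  have hk : HasStrictFDerivAt (fun w => G.mul (G.mul g w) (G.inv g)) (G.Ad g) (γ 0) := by
    rw [hγ.1]; exact (G.conj_contDiff g).contDiffAt.hasStrictFDerivAt (by simp)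
  have hk2 := hk.comp 0 hc.hasStrictFDerivAt
  refine ⟨ℝ, inferInstance, inferInstance, inferInstance, fun t => G.mul (G.mul g (γ t)) (G.inv g), _, 
    2 * C + ε, hk2, ?_, ?_, ?_⟩
  · simp [hγ.1, G.mul_zero', G.mul_inv']
  · rw [Submodule.span_singleton_le_iff_mem]
    exact ⟨1, by simp [hγ.1]⟩
  · filter_upwards [Ioo_mem_nhds hγ.2.1.1 hγ.2.1.2] with t ht
    refine ⟨C + |t| + C, ?_, (hg.mul (Reach.single i hγ ht)).mul hg.inv⟩
    have : |t| < ε := abs_lt.2 ⟨ht.1, ht.2⟩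
    linarith

lemma Param.bot : Param G ⊥ :=
  ⟨ℝ, inferInstance, inferInstance, inferInstance, fun _ => 0, 0, 0, hasStrictFDerivAt_const _ _, rfl, bot_le,
    Filter.Eventually.of_forall fun _ => ⟨0, le_rfl, Reach.one⟩⟩

lemma Param.top (G : CarnotSetting N m) : Param G ⊤ := by
  classical
  have h1 : (Submodule.span ℝ {v | ∃ g C i, Reach G g C ∧ v = G.Ad g (G.Y i 0)}).FG := by
    have : G.Wsp.FG := by rw [Wsp_top]; exact Module.Finite.fg_top
    exact this
  obtain ⟨s, hs, he⟩ := (Submodule.fg_span_iff_fg_span_finset_subset _).1 h1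
  have h2 : ⊤ = Submodule.span ℝ (s : Set (Fin N → ℝ)) := by rw [← he]; exact (G.Wsp_top).symm
  rw [h2]
  clear h1 he h2
  induction s using Finset.induction_on with
  | empty => simpa using Param.bot
  | insert v s hv ih =>
    rw [Finset.coe_insert, Submodule.span_insert]
    obtain ⟨g, C, i, hr, rfl⟩ := hs (Finset.mem_insert_self _ _)
    exact (Param.single i hr).sup (ih (fun x hx => hs (Finset.mem_insert_of_mem hx)))

lemma reach_nhds (G : CarnotSetting N m) : ∃ C, 0 < C ∧ ∀ᶠ z in 𝓝 (0 : Fin N → ℝ), ∃ C' ≤ C, Reach G z C' := by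
  obtain ⟨F, i1, i2, i3, Φ, Φ', C, h1, h2, h3, h4⟩ := Param.top G
  refine ⟨max C 1, by positivity, ?_⟩
  have := h1.map_nhds_eq_of_surj (top_le_iff.1 h3)
  rw [h2] at this
  rw [← this, eventually_map]
  filter_upwards [h4] with t ht
  obtain ⟨c, hc, h⟩ := ht
  exact ⟨c, hc.trans (le_max_left _ _), h⟩

/-- maximal weight -/
def smax (G : CarnotSetting N m) : ℕ := Finset.univ.sup G.σ
lemma N_pos (G : CarnotSetting N m) : 0 < N := by
  rcases Nat.eq_zero_or_pos N with rfl | h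
  · have := G.Q_gt_two; simp at this
  · exact h
lemma σ_le_smax (G : CarnotSetting N m) (i) : G.σ i ≤ G.smax := Finset.le_sup (Finset.mem_univ i)
lemma smax_pos (G : CarnotSetting N m) : 1 ≤ G.smax :=
  (G.σ_ge_one ⟨0, G.N_pos⟩).trans (G.σ_le_smax _)

lemma norm_dil_inv_le (G : CarnotSetting N m) {l : ℝ} (hl : 0 < l) (hl1 : l ≤ 1) (z) :
    ‖dil G.σ l⁻¹ z‖ ≤ (l ^ G.smax)⁻¹ * ‖z‖ := by
  rw [pi_norm_le_iff_of_nonneg (by positivity)]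
  intro i
  rw [dil, norm_mul, norm_pow, norm_inv, Real.norm_of_nonneg hl.le, inv_pow]
  exact mul_le_mul (inv_anti₀ (by positivity) (pow_le_pow_of_le_one hl.le hl1 (G.σ_le_smax i)))
    (norm_le_pi_norm z i) (norm_nonneg _) (by positivity)

lemma reach_small (G : CarnotSetting N m) : ∃ C > 0, ∃ r > 0, ∀ z, ‖z‖ ≤ r →
    ∃ C' ≤ C * ‖z‖ ^ ((1:ℝ) / G.smax), Reach G z C' := by
  obtain ⟨C, hC, h⟩ := G.reach_nhds
  obtain ⟨r, hr, h⟩ := Metric.eventually_nhds_iff.1 h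
  have hs0 : (0:ℝ) < G.smax := by exact_mod_cast G.smax_pos
  set r' := r / 2 with hr'
  have hr'0 : 0 < r' := by positivity
  refine ⟨C * (r' ^ ((1:ℝ) / G.smax))⁻¹, by positivity, r', hr'0, fun z hz => ?_⟩
  rcases eq_or_ne z 0 with rfl | hz0
  · exact ⟨0, by positivity, Reach.one⟩
  set l := (‖z‖ / r') ^ ((1:ℝ) / G.smax) with hl
  have hzp : 0 < ‖z‖ := norm_pos_iff.2 hz0
  have hl0 : 0 < l := by positivity
  have hl1 : l ≤ 1 := Real.rpow_le_one (by positivity) (by rwa [div_le_one hr'0]) (by positivity)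
  have hls : l ^ G.smax = ‖z‖ / r' := by
    rw [hl, ← Real.rpow_natCast, ← Real.rpow_mul (by positivity), one_div_mul_cancel hs0.ne', Real.rpow_one]
  have h1 := G.norm_dil_inv_le hl0 hl1 z
  rw [hls] at h1
  have h2 : (‖z‖ / r')⁻¹ * ‖z‖ = r' := by field_simp
  obtain ⟨c, hc, hr⟩ := h (y := dil G.σ l⁻¹ z) (by rw [dist_zero_right]; linarith)
  have h3 := hr.dil hl0
  rw [dil_dil_inv G.σ hl0] at h3
  refine ⟨l * c, ?_, h3⟩
  calc l * c ≤ l * C := by gcongr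
    _ = _ := by rw [hl, Real.div_rpow (by positivity) (by positivity)]; ring

end CarnotSetting
end

end

section
open MeasureTheory Set Filter Topology
open scoped ContDiff ENNReal
noncomputable section
namespace CarnotSetting
variable {N m : ℕ}

/-- real valued L2 norm -/
def n2 {X : Type*} [MeasurableSpace X] (μ : Measure X) (f : X → ℝ) : ℝ := (eLpNorm f 2 μ).toReal

section n2
variable {X : Type*} [MeasurableSpace X] {μ ν : Measure X} {f g : X → ℝ}
lemma n2_nonneg : 0 ≤ n2 μ f := ENNReal.toReal_nonneg
lemma eLpNorm_sq (f : X → ℝ) : eLpNorm f 2 μ ^ 2 = ∫⁻ x, ‖f x‖ₑ ^ 2 ∂μ := by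
  rw [eLpNorm_eq_lintegral_rpow_enorm_toReal (by norm_num) (by norm_num)]
  simp only [ENNReal.toReal_ofNat, ENNReal.rpow_ofNat]
  rw [← ENNReal.rpow_natCast, ← ENNReal.rpow_mul]; norm_num
lemma n2_lint (h : MemLp f 2 μ) : ENNReal.ofReal (n2 μ f ^ 2) = ∫⁻ x, ‖f x‖ₑ ^ 2 ∂μ := by
  rw [← eLpNorm_sq, n2, ENNReal.ofReal_pow ENNReal.toReal_nonneg, ENNReal.ofReal_toReal h.2.ne]
lemma n2_sq (h : MemLp f 2 μ) : n2 μ f ^ 2 = ∫ x, f x ^ 2 ∂μ := by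
  rw [integral_eq_lintegral_of_nonneg_ae (Eventually.of_forall fun x => sq_nonneg _) (h.1.pow 2)]
  rw [← ENNReal.toReal_ofReal (sq_nonneg (n2 μ f)), n2_lint h]
  congr 1
  refine lintegral_congr fun x => ?_
  rw [← enorm_pow, Real.enorm_of_nonneg (sq_nonneg _)]
lemma n2_le_of_lint {c : ℝ} (hc : 0 ≤ c) (h : ∫⁻ x, ‖f x‖ₑ ^ 2 ∂μ ≤ ENNReal.ofReal (c ^ 2)) : n2 μ f ≤ c := by
  rw [← eLpNorm_sq, ENNReal.ofReal_pow hc] at h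
  exact ENNReal.toReal_le_of_le_ofReal hc ((ENNReal.pow_le_pow_left_iff (by norm_num)).1 h)
lemma n2_add_le (hf : MemLp f 2 μ) (hg : MemLp g 2 μ) : n2 μ (fun x => f x + g x) ≤ n2 μ f + n2 μ g := by
  unfold n2
  rw [← ENNReal.toReal_add hf.2.ne hg.2.ne]
  exact ENNReal.toReal_mono (ENNReal.add_ne_top.2 ⟨hf.2.ne, hg.2.ne⟩) (eLpNorm_add_le hf.1 hg.1 (by norm_num))
lemma n2_sub_le (hf : MemLp f 2 μ) (hg : MemLp g 2 μ) : n2 μ (fun x => f x - g x) ≤ n2 μ f + n2 μ g := by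
  unfold n2
  rw [← ENNReal.toReal_add hf.2.ne hg.2.ne]
  exact ENNReal.toReal_mono (ENNReal.add_ne_top.2 ⟨hf.2.ne, hg.2.ne⟩) (eLpNorm_sub_le hf.1 hg.1 (by norm_num))
lemma n2_const_mul (c : ℝ) : n2 μ (fun x => c * f x) = |c| * n2 μ f := by
  unfold n2
  have := eLpNorm_const_smul c f 2 μ
  rw [show (fun x => c * f x) = c • f from rfl, this, ENNReal.toReal_mul]; simp
lemma n2_le_of_ae {c : ℝ} (hg : MemLp g 2 μ) (hc : 0 ≤ c) (h : ∀ᵐ x ∂μ, |f x| ≤ c * |g x|) : n2 μ f ≤ c * n2 μ g := by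
  unfold n2
  have := eLpNorm_le_mul_eLpNorm_of_ae_le_mul (p := 2) (f := f) (g := g) (c := c) (μ := μ) h
  rw [← ENNReal.toReal_ofReal hc, ← ENNReal.toReal_mul]
  exact ENNReal.toReal_mono (ENNReal.mul_ne_top ENNReal.ofReal_ne_top hg.2.ne) this
lemma n2_mono_measure (hg : MemLp f 2 ν) (h : μ ≤ ν) : n2 μ f ≤ n2 ν f :=
  ENNReal.toReal_mono hg.2.ne (eLpNorm_mono_measure f h)
lemma n2_sum_le {ι : Type*} (s : Finset ι) (F : ι → X → ℝ) (h : ∀ i ∈ s, MemLp (F i) 2 μ) :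
    n2 μ (fun x => ∑ i ∈ s, F i x) ≤ ∑ i ∈ s, n2 μ (F i) := by
  classical
  induction s using Finset.induction_on with
  | empty => simp [n2]
  | insert a s ha ih =>
    simp only [Finset.sum_insert ha]
    refine (n2_add_le (h a (Finset.mem_insert_self _ _)) (memLp_finsetSum _ fun i hi => h i (Finset.mem_insert_of_mem hi))).trans ?_
    have := ih fun i hi => h i (Finset.mem_insert_of_mem hi)
    linarith
lemma lint_sq_le (g : X → ℝ≥0∞) (hg : AEMeasurable g μ) : (∫⁻ x, g x ∂μ) ^ 2 ≤ μ univ * ∫⁻ x, g x ^ 2 ∂μ := by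
  have h := ENNReal.lintegral_mul_le_Lp_mul_Lq μ (p := 2) (q := 2) (by constructor <;> norm_num) hg
    (g := fun _ => 1) aemeasurable_const
  simp only [Pi.mul_apply, mul_one, ENNReal.one_rpow, lintegral_const, one_mul, ENNReal.rpow_ofNat] at h
  calc _ ≤ _ := pow_le_pow_left' h 2
    _ = _ := by
      rw [mul_pow, ← ENNReal.rpow_natCast, ← ENNReal.rpow_mul, ← ENNReal.rpow_natCast, ← ENNReal.rpow_mul]
      norm_num [mul_comm]
end n2

lemma memLp_ball {f : (Fin N → ℝ) → ℝ} (hf : Continuous f) (x r) : MemLp f 2 (volume.restrict (Metric.ball x r)) := by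
  have h1 : MemLp f 2 (volume.restrict (Metric.closedBall x r)) := by
    obtain ⟨C, hC⟩ := (isCompact_closedBall x r).exists_bound_of_continuousOn hf.continuousOn
    haveI : IsFiniteMeasure ((volume : Measure (Fin N → ℝ)).restrict (Metric.closedBall x r)) :=
      ⟨by rw [Measure.restrict_apply_univ]; exact measure_closedBall_lt_top⟩
    refine MemLp.of_bound hf.aestronglyMeasurable C ?_
    exact ae_restrict_of_forall_mem measurableSet_closedBall hC
  exact h1.mono_measure (Measure.restrict_mono Metric.ball_subset_closedBall le_rfl)
lemma Test.memLp {f : (Fin N → ℝ) → ℝ} (hf : Test f) : MemLp f 2 volume :=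
  hf.1.continuous.memLp_of_hasCompactSupport hf.2

lemma n2_right (G : CarnotSetting N m) {f : (Fin N → ℝ) → ℝ} (hf : Continuous f) (z) :
    n2 volume (fun x => f (G.mul x z)) = n2 volume f := by
  unfold n2
  congr 1
  exact eLpNorm_comp_measurePreserving (g := f) hf.aestronglyMeasurable (G.mp_right z)
lemma n2_left (G : CarnotSetting N m) {f : (Fin N → ℝ) → ℝ} (hf : Continuous f) (z) :
    n2 volume (fun x => f (G.mul z x)) = n2 volume f := by
  unfold n2
  congr 1
  exact eLpNorm_comp_measurePreserving (g := f) hf.aestronglyMeasurable (G.mp_left z)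

lemma ctrl_step (G : CarnotSetting N m) {f : (Fin N → ℝ) → ℝ} (hf : Test f) (i : Fin m) {a b γ t}
    (hγ : IsCurve (G.Y i) a b γ) (ht : t ∈ Ioo a b) :
    n2 volume (fun x => f (G.mul x (γ t)) - f x) ≤ |t| * n2 volume (vfDeriv (G.Y i) f) := by
  have hY := hf.Y G i
  have hsub : uIcc 0 t ⊆ Ioo a b := by
    intro s hs
    exact (ordConnected_Ioo.uIcc_subset hγ.2.1 ht) hs
  -- continuous extension of γ
  have hγc : ContinuousOn γ (uIcc 0 t) := fun s hs => (hγ.2.2 s (hsub hs)).continuousAt.continuousWithinAt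
  set γ' : ℝ → (Fin N → ℝ) := IccExtend (min_le_max (a := 0) (b := t)) ((uIcc 0 t).restrict γ) with hγ'
  have hγ'c : Continuous γ' := (continuousOn_iff_continuous_restrict.1 hγc).Icc_extend'
  have hγe : ∀ s ∈ uIcc 0 t, γ' s = γ s := fun s hs => IccExtend_of_mem _ _ hs
  have hpt : ∀ x, ‖f (G.mul x (γ t)) - f x‖ₑ ^ 2 ≤
      ENNReal.ofReal |t| * ∫⁻ s in uIoc 0 t, ‖vfDeriv (G.Y i) f (G.mul x (γ' s))‖ₑ ^ 2 := by
    intro x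
    have hcont : Continuous fun s => vfDeriv (G.Y i) f (G.mul x (γ' s)) :=
      hY.1.continuous.comp ((G.cmul_left x).continuous.comp hγ'c)
    have hInt : ∫ s in (0:ℝ)..t, vfDeriv (G.Y i) f (G.mul x (γ' s)) = f (G.mul x (γ t)) - f x := by
      have := intervalIntegral.integral_eq_sub_of_hasDerivAt (f := fun s => f (G.mul x (γ s)))
        (f' := fun s => vfDeriv (G.Y i) f (G.mul x (γ' s))) (a := 0) (b := t) ?_ (hcont.intervalIntegrable _ _)
      · rw [this, hγ.1, G.mul_zero']
      · intro s hs
        have h1 := hγ.translate G (G.Y_linv i) x (hsub hs)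
        have h2 := (hf.1.differentiable (by simp) (G.mul x (γ s))).hasFDerivAt.comp_hasDerivAt s h1
        rw [hγe s hs, vfDeriv_eq _ (hf.1.differentiable (by simp) _)]
        exact h2
    rw [← hInt]
    have h1 : ‖∫ s in (0:ℝ)..t, vfDeriv (G.Y i) f (G.mul x (γ' s))‖ₑ ≤
        ∫⁻ s in uIoc 0 t, ‖vfDeriv (G.Y i) f (G.mul x (γ' s))‖ₑ := by
      rw [← ofReal_norm, intervalIntegral.norm_intervalIntegral_eq, ofReal_norm]
      exact enorm_integral_le_lintegral_enorm _
    refine (pow_le_pow_left' h1 2).trans ((lint_sq_le _ hcont.enorm.aemeasurable).trans ?_)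
    rw [Measure.restrict_apply_univ]
    gcongr
    rw [uIoc, Real.volume_Ioc, max_sub_min_eq_abs, sub_zero]
  have hIm : ∀ s, ∫⁻ x, ‖vfDeriv (G.Y i) f (G.mul x (γ' s))‖ₑ ^ 2 = ENNReal.ofReal (n2 volume (vfDeriv (G.Y i) f) ^ 2) := by
    intro s
    rw [n2_lint hY.memLp]
    exact (G.mp_right (γ' s)).lintegral_comp (f := fun y => ‖vfDeriv (G.Y i) f y‖ₑ ^ 2) (hY.1.continuous.enorm.measurable.pow_const 2)
  refine n2_le_of_lint (mul_nonneg (abs_nonneg _) n2_nonneg) ?_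
  calc _ ≤ ∫⁻ x, ENNReal.ofReal |t| * ∫⁻ s in uIoc 0 t, ‖vfDeriv (G.Y i) f (G.mul x (γ' s))‖ₑ ^ 2 := lintegral_mono hpt
    _ = ENNReal.ofReal |t| * ∫⁻ x, ∫⁻ s in uIoc 0 t, ‖vfDeriv (G.Y i) f (G.mul x (γ' s))‖ₑ ^ 2 :=
        lintegral_const_mul' _ _ ENNReal.ofReal_ne_top
    _ = ENNReal.ofReal |t| * ∫⁻ s in uIoc 0 t, ∫⁻ x, ‖vfDeriv (G.Y i) f (G.mul x (γ' s))‖ₑ ^ 2 := by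
        congr 1
        refine lintegral_lintegral_swap ?_
        have : Continuous fun p : (Fin N → ℝ) × ℝ => vfDeriv (G.Y i) f (G.mul p.1 (γ' p.2)) :=
          hY.1.continuous.comp (G.contmul continuous_fst (hγ'c.comp continuous_snd))
        exact (this.enorm.measurable.pow_const 2).aemeasurable
    _ = _ := by
        simp_rw [hIm]
        rw [lintegral_const, Measure.restrict_apply_univ, uIoc, Real.volume_Ioc, max_sub_min_eq_abs, sub_zero,
          ← ENNReal.ofReal_mul (by positivity), ← ENNReal.ofReal_mul (by positivity)]
        congr 1
        ring

variable {G : CarnotSetting N m}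
lemma Reach.ctrl {z C} (h : Reach G z C) {f : (Fin N → ℝ) → ℝ} (hf : Test f) :
    n2 volume (fun x => f (G.mul x z) - f x) ≤ C * ∑ i, n2 volume (vfDeriv (G.Y i) f) := by
  induction h with
  | one => simp [G.mul_zero', n2]
  | @step z C a b γ t i hz hγ ht ih =>
    have h1 := G.ctrl_step hf i hγ ht
    have t1 : Test (fun x => f (G.mul x (γ t)) - f x) := (hf.right G _).sub hf
    have t2 : Test (fun x => f (G.mul x z) - f x) := (hf.right G _).sub hf
    have h2 := n2_right G t1.1.continuous z
    have h3 := n2_add_le (t1.right G z).memLp t2.memLp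
    rw [h2] at h3
    have e : (fun x => f (G.mul x (G.mul z (γ t))) - f x) =
      fun x => f (G.mul (G.mul x z) (γ t)) - f (G.mul x z) + (f (G.mul x z) - f x) := by
      ext1 x; rw [G.mul_assoc']; ring
    rw [e]
    refine h3.trans ?_
    have h4 : n2 volume (vfDeriv (G.Y i) f) ≤ ∑ i, n2 volume (vfDeriv (G.Y i) f) :=
      Finset.single_le_sum (f := fun i => n2 volume (vfDeriv (G.Y i) f)) (fun _ _ => n2_nonneg) (Finset.mem_univ i)
    have := mul_le_mul_of_nonneg_left h4 (abs_nonneg t)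
    linarith

/-- L2 control of small right translations -/
lemma ctrl (G : CarnotSetting N m) : ∃ C > 0, ∃ r > 0, ∀ z, ‖z‖ ≤ r → ∀ f : (Fin N → ℝ) → ℝ, Test f →
    n2 volume (fun x => f (G.mul x z) - f x) ≤ C * ‖z‖ ^ ((1:ℝ) / G.smax) * ∑ i, n2 volume (vfDeriv (G.Y i) f) := by
  obtain ⟨C, hC, r, hr, h⟩ := G.reach_small
  refine ⟨C, hC, r, hr, fun z hz f hf => ?_⟩
  obtain ⟨C', hC', hR⟩ := h z hz
  exact (hR.ctrl hf).trans (mul_le_mul_of_nonneg_right hC' (Finset.sum_nonneg fun _ _ => n2_nonneg))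

/-- local one-parameter subgroups -/
lemma exists_subgroup (G : CarnotSetting N m) (e : Fin N → ℝ) : ∃ ε > 0, ∃ c, IsCurve (G.LV e) (-ε) ε c ∧
    ∀ t s, |t| < ε / 2 → |s| < ε / 2 → c (t + s) = G.mul (c t) (c s) := by
  obtain ⟨ε, hε, c, hc⟩ := exists_curve (G.LV_contDiff e)
  obtain ⟨K, S, hS, hK⟩ := (((G.LV_contDiff e).of_le (by simp)).contDiffAt (x := 0)).exists_lipschitzOnWith
  have hc0 : ContinuousAt c 0 := (hc.2.2 0 hc.2.1).continuousAt
  have h1 : ∀ᶠ p : ℝ × ℝ in 𝓝 (0, 0), c (p.1 + p.2) ∈ S := by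
    have : Tendsto (fun p : ℝ × ℝ => c (p.1 + p.2)) (𝓝 (0, 0)) (𝓝 0) := by
      have h : Tendsto (fun p : ℝ × ℝ => p.1 + p.2) (𝓝 (0, 0)) (𝓝 0) := by
        have := (continuous_add (M := ℝ)).tendsto (0, 0); simpa using this
      have h' : Tendsto c (𝓝 0) (𝓝 0) := by simpa [ContinuousAt, hc.1] using hc0
      exact h'.comp h
    exact this hS
  have h2 : ∀ᶠ p : ℝ × ℝ in 𝓝 (0, 0), G.mul (c p.1) (c p.2) ∈ S := by
    have h' : Tendsto c (𝓝 0) (𝓝 0) := by simpa [ContinuousAt, hc.1] using hc0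
    have : Tendsto (fun p : ℝ × ℝ => G.mul (c p.1) (c p.2)) (𝓝 (0, 0)) (𝓝 0) := by
      have h := (G.continuous_mul'.tendsto (0, 0))
      rw [G.zero_mul'] at h
      rw [nhds_prod_eq] at h ⊢
      exact h.comp (h'.prodMap h')
    exact this hS
  obtain ⟨δ, hδ, hh⟩ := Metric.eventually_nhds_iff.1 (h1.and h2)
  set η := min (ε / 2) δ with hη
  have hη0 : 0 < η := lt_min (by positivity) hδ
  have hηε : η ≤ ε / 2 := min_le_left _ _
  refine ⟨η, hη0, c, ⟨hc.1, by simp [hη0], fun t ht => hc.2.2 t ⟨by linarith [ht.1], by linarith [ht.2]⟩⟩, ?_⟩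
  intro t s ht hs
  have ht' := abs_lt.1 ht
  have key : EqOn (fun s => c (t + s)) (fun s => G.mul (c t) (c s)) (Ioo (-(η/2)) (η/2)) := by
    refine ODE_solution_unique_of_mem_Ioo (v := fun _ => G.LV e) (s := fun _ => S) (K := K) (t₀ := 0)
      (fun _ _ => hK) (by constructor <;> linarith) ?_ ?_ (by simp [hc.1, G.mul_zero'])
    · intro s hs
      constructor
      · have h3 := hc.2.2 (t + s) ⟨by linarith [hs.1], by linarith [hs.2]⟩
        have := h3.scomp s ((hasDerivAt_id s).const_add t)
        simpa [Function.comp_def] using this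
      · refine (hh (y := (t, s)) ?_).1
        rw [Prod.dist_eq, dist_zero_right, dist_zero_right, Real.norm_eq_abs, Real.norm_eq_abs]
        exact max_lt (by linarith [min_le_right (ε/2) δ]) (by have := abs_lt.2 ⟨hs.1, hs.2⟩; linarith [min_le_right (ε/2) δ])
    · intro s hs
      constructor
      · exact hc.translate G (G.LV_linv e) (c t) ⟨by linarith [hs.1], by linarith [hs.2]⟩
      · refine (hh (y := (t, s)) ?_).2
        rw [Prod.dist_eq, dist_zero_right, dist_zero_right, Real.norm_eq_abs, Real.norm_eq_abs]
        exact max_lt (by linarith [min_le_right (ε/2) δ]) (by have := abs_lt.2 ⟨hs.1, hs.2⟩; linarith [min_le_right (ε/2) δ])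
  exact key (abs_lt.1 hs)
end CarnotSetting
end

end

section
open MeasureTheory Set Filter Topology
open scoped ContDiff ENNReal
noncomputable section
namespace CarnotSetting
variable {N m : ℕ}

section DO
variable {n : ℕ} {Z : Fin n → (Fin N → ℝ) → (Fin N → ℝ)}

lemma vfIter_contDiffOn' (hZ : ∀ j, ContDiff ℝ ∞ (Z j)) {u : (Fin N → ℝ) → ℝ} {O : Set (Fin N → ℝ)}
    (hO : IsOpen O) (h : ContDiffOn ℝ ∞ u O) (l : List (Fin n)) : ContDiffOn ℝ ∞ (vfIter Z l u) O := by
  induction l with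
  | nil => exact h
  | cons i l ih => exact vfDeriv_contDiffOn hO (hZ i) ih
lemma vfIter_contDiff' (hZ : ∀ j, ContDiff ℝ ∞ (Z j)) {u : (Fin N → ℝ) → ℝ}
    (h : ContDiff ℝ ∞ u) (l : List (Fin n)) : ContDiff ℝ ∞ (vfIter Z l u) := by
  induction l with
  | nil => exact h
  | cons i l ih => exact vfDeriv_contDiff (hZ i) ih

lemma diffAt_of_on {f : (Fin N → ℝ) → ℝ} {O : Set (Fin N → ℝ)} (hO : IsOpen O) (h : ContDiffOn ℝ ∞ f O)
    {x} (hx : x ∈ O) : DifferentiableAt ℝ f x :=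
  (h.contDiffAt (hO.mem_nhds hx)).differentiableAt (by simp)

/-- normal forms of differential operators -/
inductive NF (Z : Fin n → (Fin N → ℝ) → (Fin N → ℝ)) : (((Fin N → ℝ) → ℝ) → (Fin N → ℝ) → ℝ) → Prop
  | zero : NF Z (fun _ _ => 0)
  | cons {P} (c : (Fin N → ℝ) → ℝ) (J : List (Fin n)) (hc : ContDiff ℝ ∞ c) (hP : NF Z P) :
      NF Z (fun u x => c x * vfIter Z J u x + P u x)

lemma NF.smooth (hZ : ∀ j, ContDiff ℝ ∞ (Z j)) {P} (h : NF Z P) {u : (Fin N → ℝ) → ℝ} {O : Set (Fin N → ℝ)}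
    (hO : IsOpen O) (hu : ContDiffOn ℝ ∞ u O) : ContDiffOn ℝ ∞ (P u) O := by
  induction h with
  | zero => exact contDiffOn_const
  | cons c J hc hP ih => exact (hc.contDiffOn.mul (vfIter_contDiffOn' hZ hO hu J)).add ih

def IsDO (Z : Fin n → (Fin N → ℝ) → (Fin N → ℝ)) (P : ((Fin N → ℝ) → ℝ) → (Fin N → ℝ) → ℝ) : Prop :=
  ∃ P', NF Z P' ∧ ∀ O : Set (Fin N → ℝ), IsOpen O → ∀ u, ContDiffOn ℝ ∞ u O → ∀ x ∈ O, P u x = P' u x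

lemma IsDO.word (J) : IsDO Z (fun u => vfIter Z J u) :=
  ⟨_, NF.cons (fun _ => 1) J contDiff_const NF.zero, by intros; simp⟩
lemma IsDO.id : IsDO Z (fun u => u) := IsDO.word []
lemma IsDO.zero : IsDO Z (fun _ _ => 0) := ⟨_, NF.zero, by intros; simp⟩
lemma NF.add {P P'} (h : NF Z P) (h' : NF Z P') : NF Z (fun u x => P u x + P' u x) := by
  induction h with
  | zero => simpa using h'
  | cons c J hc hP ih => simpa [add_assoc] using NF.cons c J hc ih
lemma IsDO.add {P P'} (h : IsDO Z P) (h' : IsDO Z P') : IsDO Z (fun u x => P u x + P' u x) := by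
  obtain ⟨R, hR, e⟩ := h
  obtain ⟨R', hR', e'⟩ := h'
  exact ⟨_, hR.add hR', fun O hO u hu x hx => by simp only [e O hO u hu x hx, e' O hO u hu x hx]⟩
lemma NF.smul {P} {c : (Fin N → ℝ) → ℝ} (hc : ContDiff ℝ ∞ c) (h : NF Z P) : NF Z (fun u x => c x * P u x) := by
  induction h with
  | zero => simpa using NF.zero
  | cons d J hd hP ih => simpa [mul_add, mul_assoc] using NF.cons (fun x => c x * d x) J (hc.mul hd) ih
lemma IsDO.smul {P} {c : (Fin N → ℝ) → ℝ} (hc : ContDiff ℝ ∞ c) (h : IsDO Z P) : IsDO Z (fun u x => c x * P u x) := by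
  obtain ⟨R, hR, e⟩ := h
  exact ⟨_, hR.smul hc, fun O hO u hu x hx => by simp only [e O hO u hu x hx]⟩
lemma IsDO.sub {P P'} (h : IsDO Z P) (h' : IsDO Z P') : IsDO Z (fun u x => P u x - P' u x) := by
  have := h.add (h'.smul (c := fun _ => -1) contDiff_const)
  simpa [sub_eq_add_neg] using this
lemma IsDO.sum {ι : Type*} (s : Finset ι) {P : ι → ((Fin N → ℝ) → ℝ) → (Fin N → ℝ) → ℝ} (h : ∀ i, IsDO Z (P i)) :
    IsDO Z (fun u x => ∑ i ∈ s, P i u x) := by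
  classical
  induction s using Finset.induction_on with
  | empty => simpa using IsDO.zero
  | insert a s ha ih => simpa [Finset.sum_insert ha] using (h a).add ih
lemma NF.vf (hZ : ∀ j, ContDiff ℝ ∞ (Z j)) (j) {P} (h : NF Z P) : IsDO Z (fun u => vfDeriv (Z j) (P u)) := by
  induction h with
  | zero => exact ⟨_, NF.zero, fun O hO u hu x hx => vfDeriv_const 0 x⟩
  | @cons P c J hc hP ih =>
    obtain ⟨R, hR, e⟩ := ih
    refine ⟨_, NF.cons _ J (vfDeriv_contDiff (hZ j) hc) (NF.cons c (j :: J) hc hR), ?_⟩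
    intro O hO u hu x hx
    have d1 := diffAt_of_on hO (vfIter_contDiffOn' hZ hO hu J) hx
    have d2 := diffAt_of_on hO (hP.smooth hZ hO hu) hx
    have d3 : DifferentiableAt ℝ c x := hc.differentiable (by simp) x
    have d4 : DifferentiableAt ℝ (fun y => c y * vfIter Z J u y) x := d3.mul d1
    have e1 := e O hO u hu x hx
    beta_reduce at e1 ⊢
    rw [vfDeriv_add d4 d2, vfDeriv_mul d3 d1, ← e1, vfIter]; ring
lemma IsDO.smooth (hZ : ∀ j, ContDiff ℝ ∞ (Z j)) {P} (h : IsDO Z P) {u : (Fin N → ℝ) → ℝ} {O : Set (Fin N → ℝ)}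
    (hO : IsOpen O) (hu : ContDiffOn ℝ ∞ u O) : ContDiffOn ℝ ∞ (P u) O := by
  obtain ⟨R, hR, e⟩ := h
  exact (hR.smooth hZ hO hu).congr (e O hO u hu)
lemma IsDO.vf (hZ : ∀ j, ContDiff ℝ ∞ (Z j)) (j) {P} (h : IsDO Z P) : IsDO Z (fun u => vfDeriv (Z j) (P u)) := by
  obtain ⟨R, hR, e⟩ := h
  obtain ⟨R', hR', e'⟩ := hR.vf hZ j
  refine ⟨R', hR', fun O hO u hu x hx => ?_⟩
  rw [← e' O hO u hu x hx]
  refine vfDeriv_congr_nhds ?_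
  filter_upwards [hO.mem_nhds hx] with y hy using e O hO u hu y hy
/-- composition with a field in the module generated by Z -/
lemma IsDO.field (hZ : ∀ j, ContDiff ℝ ∞ (Z j)) {X : (Fin N → ℝ) → (Fin N → ℝ)} {β : Fin n → (Fin N → ℝ) → ℝ}
    (hβ : ∀ j, ContDiff ℝ ∞ (β j)) (hX : ∀ x, X x = ∑ j, β j x • Z j x) {P} (h : IsDO Z P) :
    IsDO Z (fun u => vfDeriv X (P u)) := by
  have h1 : IsDO Z (fun u x => ∑ j, β j x * vfDeriv (Z j) (P u) x) :=
    IsDO.sum _ fun j => (h.vf hZ j).smul (hβ j)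
  obtain ⟨R, hR, e⟩ := h1
  refine ⟨R, hR, fun O hO u hu x hx => ?_⟩
  rw [← e O hO u hu x hx]
  have d := diffAt_of_on hO (h.smooth hZ hO hu) hx
  beta_reduce
  rw [vfDeriv_eq _ d, hX, map_sum]
  refine Finset.sum_congr rfl fun j _ => ?_
  rw [vfDeriv_eq _ d, map_smul, smul_eq_mul]
lemma NF.bound {P} (h : NF Z P) : ∃ S : Finset (List (Fin n)), ∀ K : Set (Fin N → ℝ), IsCompact K → ∃ C, 0 ≤ C ∧
    ∀ u, ∀ x ∈ K, |P u x| ≤ C * ∑ J ∈ S, |vfIter Z J u x| := by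
  classical
  induction h with
  | zero => exact ⟨∅, fun K _ => ⟨0, le_rfl, by simp⟩⟩
  | @cons P c J hc hP ih =>
    obtain ⟨S, hS⟩ := ih
    refine ⟨insert J S, fun K hK => ?_⟩
    obtain ⟨C, hC, h⟩ := hS K hK
    obtain ⟨D, hD⟩ := hK.exists_bound_of_continuousOn hc.continuous.continuousOn
    refine ⟨|D| + C, by positivity, fun u x hx => ?_⟩
    have h1 := h u x hx
    have h2 : |c x| ≤ |D| := (hD x hx).trans (le_abs_self D)
    have h3 : |vfIter Z J u x| ≤ ∑ J ∈ insert J S, |vfIter Z J u x| :=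
      Finset.single_le_sum (f := fun J => |vfIter Z J u x|) (fun _ _ => abs_nonneg _) (Finset.mem_insert_self _ _)
    have h4 : ∑ J ∈ S, |vfIter Z J u x| ≤ ∑ J ∈ insert J S, |vfIter Z J u x| :=
      Finset.sum_le_sum_of_subset_of_nonneg (Finset.subset_insert _ _) (fun _ _ _ => abs_nonneg _)
    calc _ ≤ |c x| * |vfIter Z J u x| + |P u x| := by rw [← abs_mul]; exact abs_add_le _ _
      _ ≤ |D| * ∑ J ∈ insert J S, |vfIter Z J u x| + C * ∑ J ∈ insert J S, |vfIter Z J u x| := by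
          gcongr
          exact h1.trans (by gcongr)
      _ = _ := by ring
lemma IsDO.bound {P} (h : IsDO Z P) : ∃ S : Finset (List (Fin n)), ∀ K : Set (Fin N → ℝ), IsCompact K → ∃ C, 0 ≤ C ∧
    ∀ O : Set (Fin N → ℝ), IsOpen O → ∀ u, ContDiffOn ℝ ∞ u O → ∀ x ∈ K ∩ O, |P u x| ≤ C * ∑ J ∈ S, |vfIter Z J u x| := by
  obtain ⟨R, hR, e⟩ := h
  obtain ⟨S, hS⟩ := hR.bound
  refine ⟨S, fun K hK => ?_⟩
  obtain ⟨C, hC, h⟩ := hS K hK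
  exact ⟨C, hC, fun O hO u hu x hx => by rw [e O hO u hu x hx.2]; exact h u x hx.1⟩
end DO

/-! frames -/
/-- right-invariant frame -/
def RF (G : CarnotSetting N m) (k : Fin N) : (Fin N → ℝ) → (Fin N → ℝ) := G.RV (Pi.single k 1)
lemma RF_smooth (G : CarnotSetting N m) (k) : ContDiff ℝ ∞ (G.RF k) := G.RV_contDiff _

lemma RV_sum (G : CarnotSetting N m) (e x : Fin N → ℝ) : G.RV e x = ∑ k, e k • G.RF k x := by
  unfold RF RV
  rw [← Finset.univ_sum_single e, map_sum]
  refine Finset.sum_congr rfl fun k _ => ?_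
  rw [Finset.univ_sum_single, ← map_smul]
  congr 1
  rw [← Pi.single_smul]; simp

lemma RF_expand (G : CarnotSetting N m) {X : (Fin N → ℝ) → (Fin N → ℝ)} (hX : ContDiff ℝ ∞ X) :
    ∃ β : Fin N → (Fin N → ℝ) → ℝ, (∀ j, ContDiff ℝ ∞ (β j)) ∧ ∀ x, X x = ∑ j, β j x • G.RF j x := by
  have h1 : ContDiff ℝ ∞ (fun x => fderiv ℝ (fun w => G.mul w (G.inv x)) x (X x)) := by
    simp_rw [fderiv_mul_right_eq]
    exact ((((fderiv_contDiff G.smooth_mul).comp (contDiff_id.prodMk G.smooth_inv)).clm_comp contDiff_const)).clm_apply hX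
  refine ⟨fun j x => fderiv ℝ (fun w => G.mul w (G.inv x)) x (X x) j, fun j => contDiff_pi.1 h1 j, fun x => ?_⟩
  rw [← RV_sum, RV]
  have h2 := ((G.cmul_right (G.inv x)).differentiable (by simp) x).hasFDerivAt
  have h3 := ((G.cmul_right x).differentiable (by simp) (G.mul x (G.inv x))).hasFDerivAt
  have h4 := h3.comp x h2
  have e : (fun w => G.mul w x) ∘ (fun w => G.mul w (G.inv x)) = _root_.id := by
    ext1 w; exact G.inv_mul_cancel_right' _ _
  rw [e, G.mul_inv'] at h4
  have := h4.unique (hasFDerivAt_id x)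
  have h5 := congrArg (fun T => T (X x)) this
  exact h5.symm

/-- every word in smooth fields is a differential operator in the right-invariant frame -/
lemma RF_word (G : CarnotSetting N m) {n : ℕ} {X : Fin n → (Fin N → ℝ) → (Fin N → ℝ)} (hX : ∀ i, ContDiff ℝ ∞ (X i))
    (l : List (Fin n)) : IsDO G.RF (fun u => vfIter X l u) := by
  induction l with
  | nil => exact IsDO.id
  | cons i l ih =>
    obtain ⟨β, hβ, e⟩ := G.RF_expand (hX i)
    exact ih.field G.RF_smooth hβ e

/-- brackets are differential operators in Y -/
lemma lie_isDO (G : CarnotSetting N m) (l : List (Fin m)) : ∀ {P}, IsDO G.Y P →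
    IsDO G.Y (fun u => vfDeriv (vfIterLie G.Y l) (P u)) := by
  induction l with
  | nil =>
    intro P hP
    refine hP.field (β := fun _ _ => 0) G.Y_smooth (fun _ => contDiff_const) (fun x => by simp [vfIterLie])
  | cons i l ih =>
    cases l with
    | nil => intro P hP; exact hP.vf G.Y_smooth i
    | cons j l =>
      intro P hP
      obtain ⟨R, hR, e⟩ := (((ih hP).vf G.Y_smooth i)).sub (ih (hP.vf G.Y_smooth i))
      refine ⟨R, hR, fun O hO u hu x hx => ?_⟩
      rw [← e O hO u hu x hx]
      exact vfDeriv_comm (G.Y_smooth i) (G.vfIterLie_contDiff _) hO (hP.smooth G.Y_smooth hO hu) hx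

/-- a frame consisting of brackets -/
lemma exists_frame (G : CarnotSetting N m) : ∃ F : Fin N → List (Fin m), (∀ k, F k ≠ []) ∧
    ∃ b : Module.Basis (Fin N) ℝ (Fin N → ℝ), ∀ k, b k = vfIterLie G.Y (F k) 0 := by
  have h := G.hormander 0
  set S := {v : Fin N → ℝ | ∃ l : List (Fin m), l ≠ [] ∧ v = vfIterLie G.Y l 0} with hS
  let b0 := Module.Basis.ofSpan h.ge
  have hc : Module.finrank ℝ (Fin N → ℝ) = N := by simp
  haveI : Fintype ↑((linearIndepOn_empty ℝ _root_.id).extend (empty_subset S)) := 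
    FiniteDimensional.fintypeBasisIndex b0
  have hcard : Fintype.card ↑((linearIndepOn_empty ℝ _root_.id).extend (empty_subset S)) = Fintype.card (Fin N) := by
    rw [← Module.finrank_eq_card_basis b0, hc, Fintype.card_fin]
  let e := Fintype.equivOfCardEq hcard
  have hb : ∀ k, ∃ l : List (Fin m), l ≠ [] ∧ (b0.reindex e) k = vfIterLie G.Y l 0 := by
    intro k
    have : (b0.reindex e) k ∈ S := by
      rw [Module.Basis.reindex_apply]
      exact Module.Basis.ofSpan_subset h.ge (mem_range_self _)
    exact this
  choose F hF hF' using hb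
  exact ⟨F, hF, b0.reindex e, hF'⟩

lemma LF_expand (G : CarnotSetting N m) (b : Module.Basis (Fin N) ℝ (Fin N → ℝ)) {X : (Fin N → ℝ) → (Fin N → ℝ)} (hX : ContDiff ℝ ∞ X) :
    ∃ β : Fin N → (Fin N → ℝ) → ℝ, (∀ j, ContDiff ℝ ∞ (β j)) ∧ ∀ x, X x = ∑ j, β j x • G.LV (b j) x := by
  have h1 : ContDiff ℝ ∞ (fun x => fderiv ℝ (fun w => G.mul (G.inv x) w) x (X x)) := by
    simp_rw [fderiv_mul_left_eq]
    exact ((((fderiv_contDiff G.smooth_mul).comp (G.smooth_inv.prodMk contDiff_id)).clm_comp contDiff_const)).clm_apply hX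
  refine ⟨fun j x => b.repr (fderiv ℝ (fun w => G.mul (G.inv x) w) x (X x)) j, fun j => ?_, fun x => ?_⟩
  · exact (LinearMap.toContinuousLinearMap (b.coord j)).contDiff.comp h1
  have h2 := ((G.cmul_left (G.inv x)).differentiable (by simp) x).hasFDerivAt
  have h3 := ((G.cmul_left x).differentiable (by simp) (G.mul (G.inv x) x)).hasFDerivAt
  have h4 := h3.comp x h2
  have e : (fun w => G.mul x w) ∘ (fun w => G.mul (G.inv x) w) = _root_.id := by
    ext1 w; exact G.mul_inv_cancel_left' _ _
  rw [e, G.inv_mul'] at h4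
  have := h4.unique (hasFDerivAt_id x)
  have h5 := congrArg (fun T => T (X x)) this
  refine h5.symm.trans ?_
  unfold LV
  simp_rw [← map_smul]
  rw [← map_sum, b.sum_repr]
  rfl

/-- coordinate derivatives are differential operators in Y -/
lemma Y_field (G : CarnotSetting N m) {X : (Fin N → ℝ) → (Fin N → ℝ)} (hX : ContDiff ℝ ∞ X) {P} (hP : IsDO G.Y P) :
    IsDO G.Y (fun u => vfDeriv X (P u)) := by
  obtain ⟨F, hF, b, hb⟩ := G.exists_frame
  obtain ⟨β, hβ, e⟩ := G.LF_expand b hX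
  have h1 : IsDO G.Y (fun u x => ∑ j, β j x * vfDeriv (vfIterLie G.Y (F j)) (P u) x) :=
    IsDO.sum _ fun j => (G.lie_isDO (F j) hP).smul (hβ j)
  obtain ⟨R, hR, e'⟩ := h1
  refine ⟨R, hR, fun O hO u hu x hx => ?_⟩
  rw [← e' O hO u hu x hx]
  have d := diffAt_of_on hO (hP.smooth G.Y_smooth hO hu) hx
  beta_reduce
  rw [vfDeriv_eq _ d, e, map_sum]
  refine Finset.sum_congr rfl fun j _ => ?_
  rw [vfDeriv_eq _ d, map_smul, smul_eq_mul, hb, ← G.linv_eq_LV (G.vfIterLie_linv (F j))]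
end CarnotSetting
end

end

section
open MeasureTheory Set Filter Topology
open scoped ContDiff ENNReal
noncomputable section
namespace CarnotSetting
variable {N m : ℕ}

def Ell (Λ : ℝ) (A : Fin m → Fin m → ℝ) : Prop := (∀ i j, A i j = A j i) ∧ ∀ ξ : Fin m → ℝ,
  Λ * (∑ i, ξ i ^ 2) ≤ (∑ i, ∑ j, A i j * ξ i * ξ j) ∧ (∑ i, ∑ j, A i j * ξ i * ξ j) ≤ Λ⁻¹ * (∑ i, ξ i ^ 2)

def LA (G : CarnotSetting N m) (A : Fin m → Fin m → ℝ) (u : (Fin N → ℝ) → ℝ) (x : Fin N → ℝ) : ℝ :=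
  ∑ i, ∑ j, A i j * vfDeriv (G.Y i) (vfDeriv (G.Y j) u) x

lemma LA_contDiff (G : CarnotSetting N m) (A) {u : (Fin N → ℝ) → ℝ} (hu : ContDiff ℝ ∞ u) : ContDiff ℝ ∞ (G.LA A u) :=
  ContDiff.sum fun i _ => ContDiff.sum fun j _ => contDiff_const.mul
    (vfDeriv_contDiff (G.Y_smooth i) (vfDeriv_contDiff (G.Y_smooth j) hu))
lemma Test.LA (G : CarnotSetting N m) (A) {u : (Fin N → ℝ) → ℝ} (hu : Test u) : Test (G.LA A u) :=
  Test.sum _ fun i _ => Test.sum _ fun j _ => ((hu.Y G j).Y G i).const_mul _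

lemma exists_cutoff (N : ℕ) {r r' : ℝ} (hr' : 0 < r') (hr : r' < r) : ∃ χ : (Fin N → ℝ) → ℝ, Test χ ∧
    (∀ x, 0 ≤ χ x ∧ χ x ≤ 1) ∧ (∀ x ∈ Metric.closedBall (0:Fin N → ℝ) r', χ x = 1) ∧
    (tsupport χ ⊆ Metric.ball 0 r) := by
  let b : ContDiffBump (0 : Fin N → ℝ) := ⟨r', (r' + r) / 2, hr', by linarith⟩
  refine ⟨b, ⟨b.contDiff, b.hasCompactSupport⟩, fun x => ⟨b.nonneg, b.le_one⟩, fun x hx => b.one_of_mem_closedBall hx, ?_⟩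
  rw [b.tsupport_eq]
  exact Metric.closedBall_subset_ball (by show (r' + r) / 2 < r; linarith)

lemma caccioppoli_id (G : CarnotSetting N m) {A : Fin m → Fin m → ℝ} (hA : ∀ i j, A i j = A j i)
    {χ v : (Fin N → ℝ) → ℝ} (hχ : Test χ) (hv : ContDiff ℝ ∞ v) (hL : ∀ x, χ x ≠ 0 → G.LA A v x = 0) :
    ∫ x, ∑ i, ∑ j, A i j * vfDeriv (G.Y i) (fun y => χ y * v y) x * vfDeriv (G.Y j) (fun y => χ y * v y) x =
    ∫ x, ∑ i, ∑ j, A i j * (vfDeriv (G.Y i) χ x * v x) * (vfDeriv (G.Y j) χ x * v x) := by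
  have hχd := fun x => hχ.1.differentiable (by simp) x
  have hvd := fun x => hv.differentiable (by simp) x
  have hf : Test (fun y => χ y * v y) := hχ.mul_smooth hv
  have hF : Test (fun y => χ y * (χ y * v y)) := hf.smooth_mul hχ.1
  have hYv : ∀ j, ContDiff ℝ ∞ (vfDeriv (G.Y j) v) := fun j => vfDeriv_contDiff (G.Y_smooth j) hv
  have t1 : ∀ i j, Test (fun x => vfDeriv (G.Y i) (fun y => χ y * (χ y * v y)) x * vfDeriv (G.Y j) v x) :=
    fun i j => (hF.Y G i).mul_smooth (hYv j)
  have t2 : Test (fun x => ∑ i, ∑ j, A i j * (vfDeriv (G.Y i) χ x * v x) * (vfDeriv (G.Y j) χ x * v x)) := by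
    refine Test.sum _ fun i _ => Test.sum _ fun j _ => ?_
    exact (((hχ.Y G i).mul_smooth hv).const_mul (A i j)).mul_smooth (((hχ.Y G j).mul_smooth hv).1)
  have t3 : Test (fun x => ∑ i, ∑ j, A i j * (vfDeriv (G.Y i) (fun y => χ y * (χ y * v y)) x * vfDeriv (G.Y j) v x)) :=
    Test.sum _ fun i _ => Test.sum _ fun j _ => (t1 i j).const_mul _
  have hpt : ∀ x, ∑ i, ∑ j, A i j * vfDeriv (G.Y i) (fun y => χ y * v y) x * vfDeriv (G.Y j) (fun y => χ y * v y) x =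
      (∑ i, ∑ j, A i j * (vfDeriv (G.Y i) χ x * v x) * (vfDeriv (G.Y j) χ x * v x)) +
      ∑ i, ∑ j, A i j * (vfDeriv (G.Y i) (fun y => χ y * (χ y * v y)) x * vfDeriv (G.Y j) v x) := by
    intro x
    have e1 : ∀ i, vfDeriv (G.Y i) (fun y => χ y * v y) x = vfDeriv (G.Y i) χ x * v x + χ x * vfDeriv (G.Y i) v x :=
      fun i => vfDeriv_mul (hχd x) (hvd x)
    have e2 : ∀ i, vfDeriv (G.Y i) (fun y => χ y * (χ y * v y)) x =
        vfDeriv (G.Y i) χ x * (χ x * v x) + χ x * vfDeriv (G.Y i) (fun y => χ y * v y) x :=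
      fun i => vfDeriv_mul (hχd x) ((hχd x).mul (hvd x))
    have e3 : ∑ i, ∑ j, A i j * vfDeriv (G.Y j) χ x * (χ x * v x) * vfDeriv (G.Y i) v x =
       ∑ i, ∑ j, A i j * vfDeriv (G.Y i) χ x * (χ x * v x) * vfDeriv (G.Y j) v x := by
      rw [Finset.sum_comm]
      refine Finset.sum_congr rfl fun i _ => Finset.sum_congr rfl fun j _ => ?_
      rw [hA j i]
    have e4 : ∑ i, ∑ j, A i j * vfDeriv (G.Y i) (fun y => χ y * v y) x * vfDeriv (G.Y j) (fun y => χ y * v y) x =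
       ((∑ i, ∑ j, A i j * (vfDeriv (G.Y i) χ x * v x) * (vfDeriv (G.Y j) χ x * v x)) +
        (∑ i, ∑ j, A i j * (vfDeriv (G.Y i) χ x * (χ x * v x) + χ x * (χ x * vfDeriv (G.Y i) v x)) * vfDeriv (G.Y j) v x)) +
        ∑ i, ∑ j, A i j * vfDeriv (G.Y j) χ x * (χ x * v x) * vfDeriv (G.Y i) v x := by
      simp only [← Finset.sum_add_distrib]
      refine Finset.sum_congr rfl fun i _ => Finset.sum_congr rfl fun j _ => ?_
      rw [e1, e1]; ring
    rw [e4, e3, add_assoc]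
    congr 1
    simp only [← Finset.sum_add_distrib]
    refine Finset.sum_congr rfl fun i _ => Finset.sum_congr rfl fun j _ => ?_
    rw [e2, e1]; ring
  simp_rw [hpt]
  rw [integral_add t2.integrable t3.integrable]
  have : ∫ x, ∑ i, ∑ j, A i j * (vfDeriv (G.Y i) (fun y => χ y * (χ y * v y)) x * vfDeriv (G.Y j) v x) = 0 := by
    rw [integral_finsetSum _ fun i _ => (Test.sum _ fun j _ => (t1 i j).const_mul _).integrable]
    have h1 : ∀ i, ∫ x, ∑ j, A i j * (vfDeriv (G.Y i) (fun y => χ y * (χ y * v y)) x * vfDeriv (G.Y j) v x) =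
        ∫ x, - ∑ j, A i j * (χ x * (χ x * v x) * vfDeriv (G.Y i) (vfDeriv (G.Y j) v) x) := by
      intro i
      rw [integral_neg, integral_finsetSum _ fun j _ => ((t1 i j).const_mul _).integrable,
        integral_finsetSum _ fun j _ => ((hF.mul_smooth (vfDeriv_contDiff (G.Y_smooth i) (hYv j))).const_mul _).integrable,
        ← Finset.sum_neg_distrib]
      refine Finset.sum_congr rfl fun j _ => ?_
      rw [integral_const_mul, integral_const_mul, ibp (G.Y_smooth i) (G.Y_divFree i) hF (hYv j)]; ring
    simp_rw [h1]
    rw [← integral_finsetSum]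
    · refine integral_eq_zero_of_ae (Eventually.of_forall fun x => ?_)
      show ∑ i, - ∑ j, A i j * (χ x * (χ x * v x) * vfDeriv (G.Y i) (vfDeriv (G.Y j) v) x) = 0
      have : ∑ i, - ∑ j, A i j * (χ x * (χ x * v x) * vfDeriv (G.Y i) (vfDeriv (G.Y j) v) x) = -(χ x * (χ x * v x)) * G.LA A v x := by
        rw [LA, Finset.mul_sum]
        refine Finset.sum_congr rfl fun i _ => ?_
        rw [Finset.mul_sum, ← Finset.sum_neg_distrib]
        refine Finset.sum_congr rfl fun j _ => ?_
        ring
      rw [this]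
      by_cases h : χ x = 0
      · simp [h]
      · simp [hL x h]
    · intro i _
      exact (Test.sum _ fun j _ => ((hF.mul_smooth (vfDeriv_contDiff (G.Y_smooth i) (hYv j))).const_mul _)).integrable.neg
  rw [this, add_zero]

lemma energy_le (G : CarnotSetting N m) {Λ : ℝ} (hΛ : 0 < Λ) {A : Fin m → Fin m → ℝ} (hA : Ell Λ A)
    {f : (Fin N → ℝ) → ℝ} (hf : Test f) :
    Λ * ∑ i, n2 volume (vfDeriv (G.Y i) f) ^ 2 ≤ ∫ x, ∑ i, ∑ j, A i j * vfDeriv (G.Y i) f x * vfDeriv (G.Y j) f x := by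
  have h1 : ∑ i, n2 volume (vfDeriv (G.Y i) f) ^ 2 = ∫ x, ∑ i, vfDeriv (G.Y i) f x ^ 2 := by
    rw [integral_finsetSum]
    · exact Finset.sum_congr rfl fun i _ => n2_sq (hf.Y G i).memLp
    · intro i _; exact (hf.Y G i).memLp.integrable_sq
  rw [h1, ← integral_const_mul]
  refine integral_mono ?_ ?_ fun x => (hA.2 _).1
  · exact (integrable_finsetSum _ fun i _ => (hf.Y G i).memLp.integrable_sq).const_mul _
  · exact (Test.sum _ fun i _ => Test.sum _ fun j _ => ((hf.Y G i).const_mul (A i j)).mul_smooth (hf.Y G j).1).integrable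

/-- Caccioppoli estimate -/
lemma caccioppoli (G : CarnotSetting N m) {Λ : ℝ} (hΛ : 0 < Λ) {χ : (Fin N → ℝ) → ℝ} (hχ : Test χ) {r : ℝ}
    (hs : tsupport χ ⊆ Metric.ball 0 r) : ∃ C > 0, ∀ A, Ell Λ A → ∀ v : (Fin N → ℝ) → ℝ, ContDiff ℝ ∞ v →
      (∀ x ∈ Metric.ball (0 : Fin N → ℝ) r, G.LA A v x = 0) →
      ∑ i, n2 volume (vfDeriv (G.Y i) (fun y => χ y * v y)) ≤ C * n2 (volume.restrict (Metric.ball 0 r)) v := by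
  have hg : Test (fun x => ∑ i, vfDeriv (G.Y i) χ x ^ 2) := by
    refine Test.sum _ fun i _ => ?_
    have := (hχ.Y G i).mul_smooth (hχ.Y G i).1
    simpa [sq] using this
  obtain ⟨M, hM⟩ := hg.2.exists_bound_of_continuous hg.1.continuous
  have hM0 : 0 ≤ M := (norm_nonneg _).trans (hM 0)
  have hM' : ∀ x, ∑ i, vfDeriv (G.Y i) χ x ^ 2 ≤ M := fun x => (le_abs_self _).trans (hM x)
  refine ⟨(m:ℝ) * (Λ⁻¹ * Real.sqrt M) + 1, by positivity, fun A hA v hv hL => ?_⟩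
  set μ := (volume : Measure (Fin N → ℝ)).restrict (Metric.ball 0 r) with hμ
  have hf : Test (fun y => χ y * v y) := hχ.mul_smooth hv
  have hχr : ∀ x, χ x ≠ 0 → x ∈ Metric.ball (0 : Fin N → ℝ) r := fun x hx => hs (subset_tsupport _ hx)
  have e1 := energy_le G hΛ hA hf
  rw [G.caccioppoli_id hA.1 hχ hv (fun x hx => hL x (hχr x hx))] at e1
  have e2 : ∫ x, ∑ i, ∑ j, A i j * (vfDeriv (G.Y i) χ x * v x) * (vfDeriv (G.Y j) χ x * v x) ≤ Λ⁻¹ * M * n2 μ v ^ 2 := by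
    have hvm : MemLp v 2 μ := memLp_ball hv.continuous 0 r
    rw [n2_sq hvm, ← integral_const_mul, hμ, ← integral_indicator measurableSet_ball]
    refine integral_mono ?_ ?_ fun x => ?_
    · exact (Test.sum _ fun i _ => Test.sum _ fun j _ =>
        (((hχ.Y G i).mul_smooth hv).const_mul (A i j)).mul_smooth ((hχ.Y G j).mul_smooth hv).1).integrable
    · rw [integrable_indicator_iff measurableSet_ball]
      exact hvm.integrable_sq.const_mul _
    · refine ((hA.2 _).2).trans ?_
      by_cases hx : x ∈ Metric.ball (0 : Fin N → ℝ) r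
      · rw [indicator_of_mem hx, mul_assoc]
        refine mul_le_mul_of_nonneg_left ?_ (by positivity)
        simp_rw [mul_pow]
        rw [← Finset.sum_mul]
        exact mul_le_mul_of_nonneg_right (hM' x) (sq_nonneg _)
      · rw [indicator_of_notMem hx]
        have : ∀ i, vfDeriv (G.Y i) χ x = 0 := by
          intro i
          by_contra h
          exact hx (hs (vfDeriv_support (subset_tsupport _ h)))
        simp [this]
  have e3 : ∀ i, n2 volume (vfDeriv (G.Y i) (fun y => χ y * v y)) ≤ Λ⁻¹ * Real.sqrt M * n2 μ v := by
    intro i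
    refine abs_le_of_sq_le_sq' ?_ (by have := n2_nonneg (μ := μ) (f := v); positivity) |>.2
    have h1 : n2 volume (vfDeriv (G.Y i) (fun y => χ y * v y)) ^ 2 ≤ ∑ i, n2 volume (vfDeriv (G.Y i) (fun y => χ y * v y)) ^ 2 :=
      Finset.single_le_sum (f := fun i => n2 volume (vfDeriv (G.Y i) (fun y => χ y * v y)) ^ 2) (fun _ _ => sq_nonneg _) (Finset.mem_univ i)
    have h2 := (mul_le_mul_of_nonneg_left h1 hΛ.le).trans (e1.trans e2)
    rw [mul_pow, mul_pow, Real.sq_sqrt hM0]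
    calc _ = Λ⁻¹ * (Λ * n2 volume (vfDeriv (G.Y i) (fun y => χ y * v y)) ^ 2) := by field_simp
      _ ≤ Λ⁻¹ * (Λ⁻¹ * M * n2 μ v ^ 2) := by gcongr
      _ = _ := by ring
  calc _ ≤ ∑ i : Fin m, Λ⁻¹ * Real.sqrt M * n2 μ v := Finset.sum_le_sum fun i _ => e3 i
    _ = (m:ℝ) * (Λ⁻¹ * Real.sqrt M) * n2 μ v := by simp; ring
    _ ≤ _ := by have := n2_nonneg (μ := μ) (f := v); nlinarith
end CarnotSetting
end

end

section
open MeasureTheory Set Filter Topology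
open scoped ContDiff ENNReal
noncomputable section
namespace CarnotSetting
variable {N m : ℕ}

lemma lip_ball {E F : Type*} [NormedAddCommGroup E] [NormedSpace ℝ E] [ProperSpace E] [NormedAddCommGroup F] [NormedSpace ℝ F]
    {Φ : E → F} (h : ContDiff ℝ ∞ Φ) (R : ℝ) : ∃ C, 1 ≤ C ∧ ∀ x y, ‖x‖ ≤ R → ‖y‖ ≤ R → ‖Φ x - Φ y‖ ≤ C * ‖x - y‖ := by
  obtain ⟨C, hC⟩ := (isCompact_closedBall (0:E) R).exists_bound_of_continuousOn
    (h.continuous_fderiv (by simp)).continuousOn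
  refine ⟨max C 1, le_max_right _ _, fun x y hx hy => ?_⟩
  have := (convex_closedBall (0:E) R).norm_image_sub_le_of_norm_fderiv_le (𝕜 := ℝ) (f := Φ) (C := max C 1)
    (fun z _ => (h.differentiable (by simp)) z) (fun z hz => (hC z hz).trans (le_max_left _ _))
    (x := y) (y := x) (by simpa using hy) (by simpa using hx)
  exact this

lemma mul_near (G : CarnotSetting N m) (R : ℝ) : ∃ C, 1 ≤ C ∧ ∀ w x : Fin N → ℝ, ‖w‖ ≤ 1 → ‖x‖ ≤ R →
    ‖G.mul w x - x‖ ≤ C * ‖w‖ := by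
  obtain ⟨C, hC, h⟩ := lip_ball G.smooth_mul (max 1 R)
  refine ⟨C, hC, fun w x hw hx => ?_⟩
  have h0 : ‖x‖ ≤ max 1 R := hx.trans (le_max_right _ _)
  have := h (w, x) (0, x) (max_le (hw.trans (le_max_left _ _)) h0)
    (max_le (by simp) h0)
  simpa [G.zero_mul', Prod.norm_def] using this

lemma mul_small (G : CarnotSetting N m) (R : ℝ) : ∃ C, 1 ≤ C ∧ ∀ w x : Fin N → ℝ, ‖w‖ ≤ R → ‖x‖ ≤ R →
    ‖G.mul w x‖ ≤ C * (‖w‖ + ‖x‖) := by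
  obtain ⟨C, hC, h⟩ := lip_ball G.smooth_mul R
  refine ⟨C, hC, fun w x hw hx => ?_⟩
  have hR : 0 ≤ R := (norm_nonneg _).trans hw
  have := h (w, x) (0, 0) (by simp [Prod.norm_def, hw, hx]) (by simpa using hR)
  simp only [G.zero_mul', sub_zero, Prod.mk_zero_zero] at this
  refine this.trans ?_
  gcongr
  simp [Prod.norm_def]

lemma conj_small (G : CarnotSetting N m) (R : ℝ) : ∃ C, 1 ≤ C ∧ ∀ w x : Fin N → ℝ, ‖w‖ ≤ 1 → ‖x‖ ≤ R →
    ‖G.mul (G.inv x) (G.mul w x)‖ ≤ C * ‖w‖ := by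
  have hs : ContDiff ℝ ∞ (fun p : (Fin N → ℝ) × (Fin N → ℝ) => G.mul (G.inv p.2) (G.mul p.1 p.2)) :=
    G.cmul (G.smooth_inv.comp contDiff_snd) (G.cmul contDiff_fst contDiff_snd)
  obtain ⟨C, hC, h⟩ := lip_ball hs (max 1 R)
  refine ⟨C, hC, fun w x hw hx => ?_⟩
  have h0 : ‖x‖ ≤ max 1 R := hx.trans (le_max_right _ _)
  have := h (w, x) (0, x) (max_le (hw.trans (le_max_left _ _)) h0)
    (max_le (by simp) h0)
  simpa [G.zero_mul', G.inv_mul', Prod.norm_def] using this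

lemma enorm_sq_add_le (a b : ℝ) : ‖a + b‖ₑ ^ 2 ≤ 2 * ‖a‖ₑ ^ 2 + 2 * ‖b‖ₑ ^ 2 := by
  have h : ∀ c : ℝ, ‖c‖ₑ ^ 2 = ENNReal.ofReal (c ^ 2) := fun c => by
    rw [← sq_abs, ENNReal.ofReal_pow (abs_nonneg _), Real.enorm_eq_ofReal_abs]
  rw [h, h, h, show (2:ℝ≥0∞) = ENNReal.ofReal 2 by simp, ← ENNReal.ofReal_mul (by norm_num),
    ← ENNReal.ofReal_mul (by norm_num), ← ENNReal.ofReal_add (by positivity) (by positivity)]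
  exact ENNReal.ofReal_le_ofReal (by nlinarith [sq_nonneg (a - b)])

lemma left_diff (G : CarnotSetting N m) (R : ℝ) : ∃ C > 0, ∃ ρ > 0, ρ ≤ 1 ∧ ∀ w, ‖w‖ ≤ ρ → ∀ f : (Fin N → ℝ) → ℝ,
    Test f → (∀ x, f x ≠ 0 → ‖x‖ ≤ R) →
    n2 volume (fun x => f (G.mul w x) - f x) ≤ C * ‖w‖ ^ ((1:ℝ) / G.smax) * ∑ i, n2 volume (vfDeriv (G.Y i) f) := by
  obtain ⟨C0, hC0, r, hr, hctrl⟩ := G.ctrl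
  -- radius R1
  obtain ⟨R1, hR1⟩ : ∃ R1, ∀ w y : Fin N → ℝ, ‖w‖ ≤ 1 → ‖y‖ ≤ R → ‖G.mul (G.inv w) y‖ ≤ R1 := by
    obtain ⟨B, hB⟩ := ((isCompact_closedBall (0:Fin N → ℝ) 1).prod (isCompact_closedBall (0:Fin N → ℝ) R)).exists_bound_of_continuousOn
      (f := fun p => G.mul (G.inv p.1) p.2)
      (G.cmul (G.smooth_inv.comp contDiff_fst) contDiff_snd).continuous.continuousOn
    exact ⟨B, fun w y hw hy => hB (w, y) ⟨by simpa using hw, by simpa using hy⟩⟩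
  obtain ⟨C1, hC1, hconj⟩ := G.conj_small (max R R1)
  obtain ⟨C2, hC2, hms⟩ := G.mul_small C1
  set C' := C2 * (C1 + 1) with hC'
  have hC'1 : 1 ≤ C' := by rw [hC']; nlinarith
  set δ := (1:ℝ) / G.smax
  have hδ : 0 < δ := by have := G.smax_pos; positivity
  set D := 2 * (1 + C' ^ N) with hD
  have hDp : 0 < D := by positivity
  refine ⟨√D * C0 * C' ^ δ, by positivity, min 1 (r / C'), by positivity, min_le_left _ _, fun w hw f hf hfs => ?_⟩
  set S := ∑ i, n2 volume (vfDeriv (G.Y i) f)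
  have hS : 0 ≤ S := Finset.sum_nonneg fun i _ => n2_nonneg
  rcases eq_or_ne w 0 with rfl | hw0
  · simp only [G.zero_mul', sub_self]
    refine le_trans (le_of_eq ?_) (by positivity : (0:ℝ) ≤ _)
    simp [n2]
  set τ := ‖w‖
  have hτ : 0 < τ := norm_pos_iff.mpr hw0
  have hw1 : τ ≤ 1 := hw.trans (min_le_left _ _)
  have hwr : C' * τ ≤ r := by
    have := hw.trans (min_le_right _ _)
    rwa [le_div_iff₀ (by positivity), mul_comm] at this
  set a := C0 * (C' * τ) ^ δ * S with ha
  have ha0 : 0 ≤ a := by positivity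
  have hfc : Continuous f := hf.1.continuous
  -- control
  have hct : ∀ z, ‖z‖ ≤ C' * τ → ∫⁻ x, ‖f (G.mul x z) - f x‖ₑ ^ 2 ≤ ENNReal.ofReal (a ^ 2) := by
    intro z hz
    rw [← n2_lint ((hf.right G z).sub hf).memLp]
    refine ENNReal.ofReal_le_ofReal ?_
    refine pow_le_pow_left₀ n2_nonneg ?_ 2
    refine (hctrl z (hz.trans hwr) f hf).trans ?_
    rw [ha]; gcongr
  set Bτ := Metric.ball (0:Fin N → ℝ) τ
  set Bc := Metric.ball (0:Fin N → ℝ) (C' * τ)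
  set F : (Fin N → ℝ) → (Fin N → ℝ) → ℝ≥0∞ := fun x z => ‖f (G.mul x z) - f x‖ₑ ^ 2 with hF
  have hFc : Continuous (Function.uncurry F) := by
    have h1 : Continuous (fun p : (Fin N → ℝ) × (Fin N → ℝ) => f (G.mul p.1 p.2) - f p.1) :=
      (hfc.comp G.smooth_mul.continuous).sub (hfc.comp continuous_fst)
    exact (ENNReal.continuous_pow 2).comp h1.enorm
  have hvc : volume Bc = ENNReal.ofReal (C' ^ N) * volume Bτ := by
    have := Measure.addHaar_ball_mul_of_pos (volume : Measure (Fin N → ℝ)) (0:Fin N → ℝ) (by positivity : 0 < C') τ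
    simpa using this
  -- pointwise
  have hpt : ∀ x, volume Bτ * ‖f (G.mul w x) - f x‖ₑ ^ 2 ≤
      2 * (∫⁻ z in Bτ, F (G.mul w x) z) + 2 * ∫⁻ z in Bc, F x z := by
    intro x
    by_cases hx : f (G.mul w x) - f x = 0
    · rw [hx]; simp
    have hxR : ‖x‖ ≤ max R R1 := by
      by_cases h : f x = 0
      · have h2 : f (G.mul w x) ≠ 0 := fun h' => hx (by rw [h, h', sub_self])
        have := hR1 w _ hw1 (hfs _ h2)
        rw [G.inv_mul_cancel_left'] at this
        exact this.trans (le_max_right _ _)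
      · exact (hfs _ h).trans (le_max_left _ _)
    set y := G.mul (G.inv x) (G.mul w x)
    have hy : ‖y‖ ≤ C1 * τ := hconj w x hw1 hxR
    have hxy : ∀ z, G.mul x (G.mul y z) = G.mul (G.mul w x) z := fun z => by
      rw [← G.mul_assoc', G.mul_inv_cancel_left']
    have h2 : ∫⁻ z in Bτ, F x (G.mul y z) ≤ ∫⁻ z in Bc, F x z := by
      have hm := (G.mp_left y)
      have hmeas : Measurable (fun z => F x z) := (hFc.comp (Continuous.prodMk_right x)).measurable
      rw [← hm.setLIntegral_comp_preimage (s := Bc) (f := fun z => F x z) Metric.isOpen_ball.measurableSet hmeas]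
      refine lintegral_mono_set fun z hz => ?_
      have hz' : ‖z‖ < τ := by simpa [Bτ] using hz
      have : ‖G.mul y z‖ ≤ C2 * (‖y‖ + ‖z‖) := hms y z (hy.trans (by nlinarith)) (hz'.le.trans (by linarith))
      simp only [Bc, mem_preimage, Metric.mem_ball, dist_zero_right]
      refine this.trans_lt ?_
      rw [hC', mul_assoc]
      have : ‖y‖ + ‖z‖ < (C1 + 1) * τ := by linarith
      nlinarith
    calc volume Bτ * ‖f (G.mul w x) - f x‖ₑ ^ 2 = ∫⁻ z in Bτ, ‖f (G.mul w x) - f x‖ₑ ^ 2 := by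
          rw [setLIntegral_const, mul_comm]
      _ ≤ ∫⁻ z in Bτ, (2 * F (G.mul w x) z + 2 * F x (G.mul y z)) := by
          refine lintegral_mono fun z => ?_
          have := enorm_sq_add_le (-(f (G.mul (G.mul w x) z) - f (G.mul w x))) (f (G.mul x (G.mul y z)) - f x)
          rw [enorm_neg] at this
          refine le_trans (le_of_eq ?_) this
          rw [hxy]; congr 2; ring
      _ = 2 * (∫⁻ z in Bτ, F (G.mul w x) z) + 2 * ∫⁻ z in Bτ, F x (G.mul y z) := by
          rw [lintegral_add_left, lintegral_const_mul, lintegral_const_mul]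
          · exact (hFc.comp (continuous_const.prodMk ((G.cmul_left y).continuous))).measurable
          · exact (hFc.comp (Continuous.prodMk_right _)).measurable
          · exact ((hFc.comp (Continuous.prodMk_right _)).measurable).const_mul _
      _ ≤ _ := by gcongr
  have hI : volume Bτ * ∫⁻ x, ‖f (G.mul w x) - f x‖ₑ ^ 2 ≤ volume Bτ * ENNReal.ofReal (D * a ^ 2) := by
    have hm1 : Measurable (fun p : (Fin N → ℝ) × (Fin N → ℝ) => F (G.mul w p.1) p.2) :=
      (hFc.comp (((G.cmul_left w).continuous.comp continuous_fst).prodMk continuous_snd)).measurable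
    have hm2 : Measurable (fun p : (Fin N → ℝ) × (Fin N → ℝ) => F p.1 p.2) := hFc.measurable
    have e1 : ∫⁻ x, ∫⁻ z in Bτ, F (G.mul w x) z ≤ volume Bτ * ENNReal.ofReal (a ^ 2) := by
      rw [lintegral_lintegral_swap hm1.aemeasurable]
      calc ∫⁻ z in Bτ, ∫⁻ x, F (G.mul w x) z ≤ ∫⁻ z in Bτ, ENNReal.ofReal (a ^ 2) := by
            refine setLIntegral_mono' Metric.isOpen_ball.measurableSet fun z hz => ?_
            rw [(G.mp_left w).lintegral_comp (f := fun x => F x z) (hFc.comp (Continuous.prodMk_left z)).measurable]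
            have hz' : ‖z‖ < τ := by simpa [Bτ] using hz
            exact hct z (by nlinarith)
        _ = _ := by rw [setLIntegral_const, mul_comm]
    have e2 : ∫⁻ x, ∫⁻ z in Bc, F x z ≤ volume Bc * ENNReal.ofReal (a ^ 2) := by
      rw [lintegral_lintegral_swap hm2.aemeasurable]
      calc ∫⁻ z in Bc, ∫⁻ x, F x z ≤ ∫⁻ z in Bc, ENNReal.ofReal (a ^ 2) := by
            refine setLIntegral_mono' Metric.isOpen_ball.measurableSet fun z hz => ?_
            have hz' : ‖z‖ < C' * τ := by simpa [Bc] using hz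
            exact hct z hz'.le
        _ = _ := by rw [setLIntegral_const, mul_comm]
    rw [← lintegral_const_mul _ (by
      have h1 : Continuous (fun x => f (G.mul w x) - f x) := (hfc.comp (G.cmul_left w).continuous).sub hfc
      exact ((ENNReal.continuous_pow 2).comp h1.enorm).measurable)]
    refine (lintegral_mono hpt).trans ?_
    rw [lintegral_add_left (hm1.lintegral_prod_right'.const_mul 2),
      lintegral_const_mul _ hm1.lintegral_prod_right', lintegral_const_mul _ hm2.lintegral_prod_right']
    calc _ ≤ 2 * (volume Bτ * ENNReal.ofReal (a ^ 2)) + 2 * (volume Bc * ENNReal.ofReal (a ^ 2)) := by gcongr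
      _ = _ := by
        rw [hvc, hD, show 2 * (1 + C' ^ N) * a ^ 2 = 2 * a ^ 2 + 2 * (C' ^ N * a ^ 2) by ring,
          ENNReal.ofReal_add (by positivity) (by positivity), ENNReal.ofReal_mul (by norm_num),
          ENNReal.ofReal_mul (by norm_num), ENNReal.ofReal_mul (by positivity)]
        simp only [ENNReal.ofReal_ofNat]
        ring
  have hv0 : volume Bτ ≠ 0 := (Metric.measure_ball_pos _ _ hτ).ne'
  have hvt : volume Bτ ≠ ⊤ := measure_ball_lt_top.ne
  have hI' := (ENNReal.mul_le_mul_iff_right hv0 hvt).1 hI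
  refine (n2_le_of_lint (c := √D * a) (by positivity) ?_).trans (le_of_eq ?_)
  · rwa [mul_pow, Real.sq_sqrt hDp.le]
  · rw [ha, Real.mul_rpow (by positivity) hτ.le]; ring

/-- local Hölder estimate of solutions under left translation -/
lemma sol_left (G : CarnotSetting N m) {Λ : ℝ} (hΛ : 0 < Λ) {r r' : ℝ} (hr' : 0 < r') (hr : r' < r) :
    ∃ C > 0, ∃ ρ > 0, ∀ A, Ell Λ A → ∀ v : (Fin N → ℝ) → ℝ, ContDiff ℝ ∞ v →
      (∀ x ∈ Metric.ball (0 : Fin N → ℝ) r, G.LA A v x = 0) → ∀ w, ‖w‖ ≤ ρ →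
      n2 (volume.restrict (Metric.ball 0 r')) (fun x => v (G.mul w x) - v x) ≤
        C * ‖w‖ ^ ((1:ℝ) / G.smax) * n2 (volume.restrict (Metric.ball 0 r)) v := by
  obtain ⟨r1, h1, h2⟩ := exists_between hr
  obtain ⟨χ, hχ, -, hχ1, hχs⟩ := exists_cutoff N (hr'.trans h1) h2
  obtain ⟨Cc, hCc, hcac⟩ := caccioppoli G hΛ hχ hχs
  obtain ⟨C, hC, ρ, hρ, hρ1, hd⟩ := G.left_diff r
  obtain ⟨Cm, hCm, hmn⟩ := G.mul_near r'
  refine ⟨C * Cc, by positivity, min ρ ((r1 - r') / Cm), lt_min hρ (div_pos (by linarith) (by linarith)),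
    fun A hA v hv hL w hw => ?_⟩
  have hf : Test (fun y => χ y * v y) := hχ.mul_smooth hv
  have hw1 : ‖w‖ ≤ ρ := hw.trans (min_le_left _ _)
  have hw2 : Cm * ‖w‖ ≤ r1 - r' := by
    have := hw.trans (min_le_right _ _)
    rwa [le_div_iff₀ (by linarith), mul_comm] at this
  have h3 := hd w hw1 _ hf (fun x hx => by
    have : x ∈ tsupport χ := subset_tsupport _ (left_ne_zero_of_mul hx)
    have := hχs this
    rw [Metric.mem_ball, dist_zero_right] at this
    exact this.le)
  have h4 := hcac A hA v hv hL
  have e : n2 (volume.restrict (Metric.ball 0 r')) (fun x => v (G.mul w x) - v x) ≤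
      n2 volume (fun x => χ (G.mul w x) * v (G.mul w x) - χ x * v x) := by
    refine le_trans ?_ (n2_mono_measure ((hf.left G w).sub hf).memLp (Measure.restrict_le_self (s := Metric.ball 0 r')))
    have hm : MemLp (fun x => χ (G.mul w x) * v (G.mul w x) - χ x * v x) 2 (volume.restrict (Metric.ball 0 r')) :=
      ((hf.left G w).sub hf).memLp.restrict _
    refine (n2_le_of_ae hm zero_le_one ?_).trans (by rw [one_mul])
    refine (ae_restrict_iff' Metric.isOpen_ball.measurableSet).2 (.of_forall fun x hx => ?_)
    have hx' : ‖x‖ < r' := by simpa using hx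
    have a1 : χ x = 1 := hχ1 x (by simp; linarith)
    have a2 : χ (G.mul w x) = 1 := hχ1 _ (by
      have b := hmn w x (hw1.trans hρ1) hx'.le
      have : ‖G.mul w x‖ ≤ ‖G.mul w x - x‖ + ‖x‖ := by simpa using norm_add_le (G.mul w x - x) x
      simp; linarith)
    rw [a1, a2]; simp
  refine e.trans (h3.trans ?_)
  calc _ ≤ C * ‖w‖ ^ ((1:ℝ) / G.smax) * (Cc * n2 (volume.restrict (Metric.ball 0 r)) v) := by gcongr
    _ = _ := by ring

end CarnotSetting
end

end

section
open MeasureTheory Set Filter Topology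
open scoped ContDiff ENNReal
noncomputable section
namespace CarnotSetting
variable {N m : ℕ}

lemma LA_left (G : CarnotSetting N m) (A) {u : (Fin N → ℝ) → ℝ} (hu : ContDiff ℝ ∞ u) (z) :
    G.LA A (fun w => u (G.mul z w)) = fun x => G.LA A u (G.mul z x) := by
  ext x
  unfold LA
  refine Finset.sum_congr rfl fun i _ => Finset.sum_congr rfl fun j _ => ?_
  congr 1
  exact congrFun (G.vfIter_comp_mul hu z [i, j]) x

lemma vf_sub_fun {X : (Fin N → ℝ) → (Fin N → ℝ)} {u v : (Fin N → ℝ) → ℝ} (hu : ContDiff ℝ ∞ u) (hv : ContDiff ℝ ∞ v) :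
    vfDeriv X (fun x => u x - v x) = fun x => vfDeriv X u x - vfDeriv X v x := by
  ext x; exact vfDeriv_sub (hu.differentiable (by simp) x) (hv.differentiable (by simp) x)

lemma vf_add_fun {X : (Fin N → ℝ) → (Fin N → ℝ)} {u v : (Fin N → ℝ) → ℝ} (hu : ContDiff ℝ ∞ u) (hv : ContDiff ℝ ∞ v) :
    vfDeriv X (fun x => u x + v x) = fun x => vfDeriv X u x + vfDeriv X v x := by
  ext x; exact vfDeriv_add (hu.differentiable (by simp) x) (hv.differentiable (by simp) x)

lemma vf_cmul_fun {X : (Fin N → ℝ) → (Fin N → ℝ)} {u : (Fin N → ℝ) → ℝ} (hu : ContDiff ℝ ∞ u) (c : ℝ) :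
    vfDeriv X (fun x => c * u x) = fun x => c * vfDeriv X u x := by
  ext x; exact vfDeriv_const_mul c (hu.differentiable (by simp) x)

lemma LA_sub (G : CarnotSetting N m) (A) {u v : (Fin N → ℝ) → ℝ} (hu : ContDiff ℝ ∞ u) (hv : ContDiff ℝ ∞ v) :
    G.LA A (fun x => u x - v x) = fun x => G.LA A u x - G.LA A v x := by
  ext x
  simp only [LA, ← Finset.sum_sub_distrib]
  refine Finset.sum_congr rfl fun i _ => Finset.sum_congr rfl fun j _ => ?_
  rw [vf_sub_fun hu hv, vf_sub_fun (vfDeriv_contDiff (G.Y_smooth j) hu) (vfDeriv_contDiff (G.Y_smooth j) hv)]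
  ring

lemma LA_add (G : CarnotSetting N m) (A) {u v : (Fin N → ℝ) → ℝ} (hu : ContDiff ℝ ∞ u) (hv : ContDiff ℝ ∞ v) :
    G.LA A (fun x => u x + v x) = fun x => G.LA A u x + G.LA A v x := by
  ext x
  simp only [LA, ← Finset.sum_add_distrib]
  refine Finset.sum_congr rfl fun i _ => Finset.sum_congr rfl fun j _ => ?_
  rw [vf_add_fun hu hv, vf_add_fun (vfDeriv_contDiff (G.Y_smooth j) hu) (vfDeriv_contDiff (G.Y_smooth j) hv)]
  ring

lemma LA_cmul (G : CarnotSetting N m) (A) {u : (Fin N → ℝ) → ℝ} (hu : ContDiff ℝ ∞ u) (c : ℝ) :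
    G.LA A (fun x => c * u x) = fun x => c * G.LA A u x := by
  ext x
  simp only [LA, Finset.mul_sum]
  refine Finset.sum_congr rfl fun i _ => Finset.sum_congr rfl fun j _ => ?_
  rw [vf_cmul_fun hu, vf_cmul_fun (vfDeriv_contDiff (G.Y_smooth j) hu)]
  ring

lemma LA_RV (G : CarnotSetting N m) (A e) {u : (Fin N → ℝ) → ℝ} (hu : ContDiff ℝ ∞ u) :
    G.LA A (vfDeriv (G.RV e) u) = vfDeriv (G.RV e) (G.LA A u) := by
  ext x
  have hs : ∀ i j, ContDiff ℝ ∞ (vfDeriv (G.Y i) (vfDeriv (G.Y j) u)) := fun i j =>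
    vfDeriv_contDiff (G.Y_smooth i) (vfDeriv_contDiff (G.Y_smooth j) hu)
  have : vfDeriv (G.RV e) (G.LA A u) x = ∑ i, ∑ j, A i j * vfDeriv (G.RV e) (vfDeriv (G.Y i) (vfDeriv (G.Y j) u)) x := by
    unfold LA
    rw [vfDeriv_sum _ (fun i _ => ((ContDiff.sum fun j _ => contDiff_const.mul (hs i j)).differentiable (by simp)) x)]
    refine Finset.sum_congr rfl fun i _ => ?_
    rw [vfDeriv_sum _ (fun j _ => ((contDiff_const.mul (hs i j)).differentiable (by simp)) x)]
    exact Finset.sum_congr rfl fun j _ => vfDeriv_const_mul _ ((hs i j).differentiable (by simp) x)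
  rw [this]
  refine Finset.sum_congr rfl fun i _ => Finset.sum_congr rfl fun j _ => ?_
  rw [G.vf_RV_comm (G.Y_smooth j) (G.Y_linv j) e hu,
    G.vf_RV_comm (G.Y_smooth i) (G.Y_linv i) e (vfDeriv_contDiff (G.Y_smooth j) hu)]

lemma marchaud_gen {φ ψ : ℝ → ℝ} {T : ℝ} (hT : 0 < T)
    (hbase : ∀ t, T < 2 * t → t ≤ T → φ t ≤ ψ t)
    (hstep : ∀ t, 0 < t → 2 * t ≤ T → φ (2 * t) ≤ ψ (2 * t) → φ t ≤ ψ t) :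
    ∀ t, 0 < t → t ≤ T → φ t ≤ ψ t := by
  have key : ∀ n : ℕ, ∀ t, 0 < t → T < 2 ^ (n + 1) * t → t ≤ T → φ t ≤ ψ t := by
    intro n
    induction n with
    | zero => intro t _ h1 h2; exact hbase t (by simpa using h1) h2
    | succ n ih =>
      intro t h0 h1 h2
      by_cases h : T < 2 * t
      · exact hbase t h h2
      · push Not at h
        refine hstep t h0 h (ih _ (by linarith) ?_ h)
        rw [pow_succ] at h1; linarith
  intro t h0 h1
  obtain ⟨n, hn⟩ := pow_unbounded_of_one_lt (T / t) (by norm_num : (1:ℝ) < 2)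
  refine key n t h0 ?_ h1
  rw [div_lt_iff₀ h0] at hn
  rw [pow_succ]; nlinarith [pow_pos (by norm_num : (0:ℝ) < 2) n, mul_pos (pow_pos (by norm_num : (0:ℝ) < 2) n) h0]

lemma marchaud {b T : ℝ} (hb : 0 < b) (hb1 : b ≠ 1) (hT : 0 < T) (hT1 : T ≤ 1) : ∃ C > 0, ∀ φ : ℝ → ℝ, ∀ K B0, 0 ≤ K → 0 ≤ B0 →
    (∀ t, 0 < t → t ≤ T → φ t ≤ B0) → (∀ t, 0 < t → 2 * t ≤ T → 2 * φ t ≤ φ (2 * t) + K * t ^ b) →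
    ∀ t, 0 < t → t ≤ T → φ t ≤ C * (K + B0) * t ^ (min b 1) := by
  have hpow : ∀ t : ℝ, 0 < t → (2 * t) ^ b = 2 * (2 ^ (b - 1) * t ^ b) := fun t ht => by
    rw [Real.mul_rpow (by norm_num) ht.le, Real.rpow_sub_one (by norm_num)]; ring
  rcases lt_or_gt_of_ne hb1 with h | h
  · have h2 : (2:ℝ) ^ (b - 1) < 1 := Real.rpow_lt_one_of_one_lt_of_neg (by norm_num) (by linarith)
    refine ⟨(2 / T) ^ b + (1 - 2 ^ (b - 1))⁻¹, by have : 0 < 1 - (2:ℝ) ^ (b - 1) := by linarith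
                                                  positivity, fun φ K B0 hK hB0 hφ hs t ht htT => ?_⟩
    rw [min_eq_left h.le]
    have hd : 0 < 1 - (2:ℝ) ^ (b - 1) := by linarith
    set q := (2:ℝ) ^ (b - 1)
    set B := B0 * (2 / T) ^ b + K * (1 - q)⁻¹ with hB
    have h3 : φ t ≤ B * t ^ b := by
      refine marchaud_gen (φ := φ) (ψ := fun t => B * t ^ b) hT (fun t h1 h2 => ?_) (fun t h0 h1 h2 => ?_) t ht htT
      · have ht0 : 0 < t := by linarith
        refine (hφ t ht0 h2).trans ?_
        have : 1 ≤ (2 / T) ^ b * t ^ b := by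
          rw [← Real.mul_rpow (by positivity) ht0.le]
          refine Real.one_le_rpow ?_ hb.le
          rw [div_mul_eq_mul_div, le_div_iff₀ hT]; linarith
        have h5 : 0 ≤ K * (1 - q)⁻¹ * t ^ b := by positivity
        beta_reduce
        rw [hB]; nlinarith
      · beta_reduce at h2 ⊢
        have := hs t h0 h1
        rw [hpow t h0] at h2
        have h6 : K ≤ B * (1 - q) := by
          rw [hB, add_mul, inv_mul_cancel_right₀ hd.ne']
          have : 0 ≤ B0 * (2 / T) ^ b * (1 - q) := by positivity
          linarith
        have h7 : 0 < t ^ b := by positivity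
        nlinarith
    refine h3.trans ?_
    gcongr
    rw [hB]
    have a1 : 0 ≤ (2 / T) ^ b := by positivity
    have a2 : 0 ≤ (1 - q)⁻¹ := by positivity
    nlinarith [mul_nonneg a1 hK, mul_nonneg a2 hB0]
  · have h2 : 1 < (2:ℝ) ^ (b - 1) := Real.one_lt_rpow (by norm_num) (by linarith)
    refine ⟨2 / T + (2 ^ (b - 1) - 1)⁻¹, by have : 0 < (2:ℝ) ^ (b - 1) - 1 := by linarith
                                            positivity, fun φ K B0 hK hB0 hφ hs t ht htT => ?_⟩
    rw [min_eq_right h.le, Real.rpow_one]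
    have hd : 0 < (2:ℝ) ^ (b - 1) - 1 := by linarith
    set q := (2:ℝ) ^ (b - 1)
    set K' := K * (q - 1)⁻¹ with hK'
    have hK'0 : 0 ≤ K' := by positivity
    set B := B0 * (2 / T) + K' with hB
    have h3 : φ t ≤ B * t - K' * t ^ b := by
      refine marchaud_gen (φ := φ) (ψ := fun t => B * t - K' * t ^ b) hT (fun t h1 h2 => ?_) (fun t h0 h1 h2 => ?_) t ht htT
      · have ht0 : 0 < t := by linarith
        refine (hφ t ht0 h2).trans ?_
        have e1 : t ^ b ≤ t := by
          have := Real.rpow_le_rpow_of_exponent_ge ht0 (h2.trans hT1) h.le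
          simpa using this
        have : 1 ≤ (2 / T) * t := by rw [div_mul_eq_mul_div, le_div_iff₀ hT]; linarith
        beta_reduce
        rw [hB]
        nlinarith
      · beta_reduce at h2 ⊢
        have := hs t h0 h1
        rw [hpow t h0] at h2
        have h6 : K' * (q - 1) = K := by rw [hK', inv_mul_cancel_right₀ hd.ne']
        rw [← h6] at this
        have h8 : 0 ≤ K' * (q - 1) * t ^ b := by positivity
        linarith
    have e0 : 0 ≤ K' * t ^ b := by positivity
    have : φ t ≤ B * t := by linarith
    refine this.trans ?_
    gcongr
    rw [hB, hK']
    have a1 : 0 ≤ (2 / T) := by positivity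
    have a2 : 0 ≤ (q - 1)⁻¹ := by positivity
    nlinarith [mul_nonneg a1 hK, mul_nonneg a2 hB0]

def Hol (G : CarnotSetting N m) (Λ : ℝ) (c : ℝ → Fin N → ℝ) (a : ℝ) : Prop :=
  ∀ r' r : ℝ, 0 < r' → r' < r → ∃ C > 0, ∃ τ > 0, ∀ A, Ell Λ A → ∀ v : (Fin N → ℝ) → ℝ, ContDiff ℝ ∞ v →
      (∀ x ∈ Metric.ball (0 : Fin N → ℝ) r, G.LA A v x = 0) → ∀ t, 0 < t → t ≤ τ →
      n2 (volume.restrict (Metric.ball 0 r')) (fun x => v (G.mul (c t) x) - v x) ≤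
        C * t ^ a * n2 (volume.restrict (Metric.ball 0 r)) v

lemma curve_small {X : (Fin N → ℝ) → (Fin N → ℝ)} {a b : ℝ} {c} (h : IsCurve X a b c) :
    ∃ C > 0, ∃ τ > 0, ∀ t, |t| ≤ τ → ‖c t‖ ≤ C * |t| := by
  have h1 := (h.2.2 0 h.2.1).isBigO_sub
  obtain ⟨C, hC, hb⟩ := h1.exists_pos
  rw [Asymptotics.isBigOWith_iff] at hb
  obtain ⟨τ, hτ, hb⟩ := Metric.eventually_nhds_iff.1 hb
  refine ⟨C, hC, τ / 2, by positivity, fun t ht => ?_⟩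
  have := hb (y := t) (by simp [Real.dist_eq]; linarith)
  simpa [h.1] using this

lemma hol_init (G : CarnotSetting N m) {Λ : ℝ} (hΛ : 0 < Λ) {X} {p q : ℝ} {c} (h : IsCurve X p q c)
    {a : ℝ} (ha : a ≤ 1 / (G.smax : ℝ)) : Hol G Λ c a := by
  intro r' r h0 hr
  obtain ⟨C, hC, ρ, hρ, hs⟩ := G.sol_left hΛ h0 hr
  obtain ⟨C1, hC1, τ, hτ, hc⟩ := curve_small h
  set δ := (1:ℝ) / G.smax
  have hδ : 0 < δ := by have := G.smax_pos; positivity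
  refine ⟨C * C1 ^ δ, by positivity, min 1 (min τ (ρ / C1)), by positivity, fun A hA v hv hL t ht htτ => ?_⟩
  have t1 : t ≤ 1 := htτ.trans (min_le_left _ _)
  have t2 : t ≤ τ := htτ.trans ((min_le_right _ _).trans (min_le_left _ _))
  have t3 : t ≤ ρ / C1 := htτ.trans ((min_le_right _ _).trans (min_le_right _ _))
  have hct := hc t (by rwa [abs_of_pos ht])
  rw [abs_of_pos ht] at hct
  rw [le_div_iff₀ hC1] at t3
  refine (hs A hA v hv hL (c t) (hct.trans (by linarith))).trans ?_
  refine mul_le_mul_of_nonneg_right ?_ n2_nonneg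
  calc C * ‖c t‖ ^ δ ≤ C * (C1 * t) ^ δ := by gcongr
    _ = C * C1 ^ δ * t ^ δ := by rw [Real.mul_rpow hC1.le ht.le]; ring
    _ ≤ _ := by
      have := Real.rpow_le_rpow_of_exponent_ge ht t1 ha
      gcongr

lemma hol_double (G : CarnotSetting N m) {Λ : ℝ} {X} {ε : ℝ} {c} (h : IsCurve X (-ε) ε c)
    (hε : 0 < ε) (hc2 : ∀ t s, |t| < ε / 2 → |s| < ε / 2 → c (t + s) = G.mul (c t) (c s))
    {a : ℝ} (ha : 0 < a) (ha1 : 2 * a ≠ 1) (H : Hol G Λ c a) : Hol G Λ c (min (2 * a) 1) := by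
  intro r' r h0 hr
  obtain ⟨r1, h1, h2⟩ := exists_between hr
  obtain ⟨C1, hC1, τ1, hτ1, H1⟩ := H r1 r (h0.trans h1) h2
  obtain ⟨C2, hC2, τ2, hτ2, H2⟩ := H r' r1 h0 h1
  obtain ⟨C3, hC3, τ3, hτ3, H3⟩ := H r' r h0 hr
  obtain ⟨C4, hC4, τ4, hτ4, hcs⟩ := curve_small h
  obtain ⟨Cm, hCm, hmn⟩ := G.mul_near r1
  set T := min (min 1 (ε / 4)) (min (min τ1 τ2) (min (min τ3 τ4) (min (1 / C4) ((r - r1) / (Cm * C4))))) with hT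
  have hT0 : 0 < T := by
    have : 0 < r - r1 := by linarith
    positivity
  have T1 : T ≤ 1 := by rw [hT]; simp
  have T2 : T ≤ ε / 4 := by rw [hT]; simp
  have T3 : T ≤ τ1 := by rw [hT]; simp
  have T4 : T ≤ τ2 := by rw [hT]; simp
  have T5 : T ≤ τ3 := by rw [hT]; simp
  have T6 : T ≤ τ4 := by rw [hT]; simp
  have T7 : T ≤ 1 / C4 := by rw [hT]; simp
  have T8 : T ≤ (r - r1) / (Cm * C4) := by rw [hT]; simp
  rw [le_div_iff₀ (by positivity)] at T7 T8
  obtain ⟨C, hC, hmar⟩ := marchaud (b := 2 * a) (by linarith) ha1 hT0 T1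
  refine ⟨C * (C2 * C1 + C3), by positivity, T, hT0, fun A hA v hv hL t ht htT => ?_⟩
  set M := n2 (volume.restrict (Metric.ball 0 r)) v
  have hM : 0 ≤ M := n2_nonneg
  refine (hmar (fun t => n2 (volume.restrict (Metric.ball 0 r')) (fun x => v (G.mul (c t) x) - v x))
    (C2 * C1 * M) (C3 * M) (by positivity) (by positivity) ?_ ?_ t ht htT).trans (le_of_eq (by ring))
  · intro t ht htT
    refine (H3 A hA v hv hL t ht (htT.trans T5)).trans ?_
    have : t ^ a ≤ 1 := Real.rpow_le_one ht.le (htT.trans T1) ha.le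
    gcongr
    nlinarith
  · intro t ht htT
    have tT : t ≤ T := by linarith
    have hct : ‖c t‖ ≤ C4 * t := by simpa [abs_of_pos ht] using hcs t (by rw [abs_of_pos ht]; linarith)
    set g := fun x => v (G.mul (c t) x) - v x with hg
    have hvl : ContDiff ℝ ∞ (fun x => v (G.mul (c t) x)) := hv.comp (G.cmul_left _)
    have hgs : ContDiff ℝ ∞ g := hvl.sub hv
    have hgL : ∀ x ∈ Metric.ball (0 : Fin N → ℝ) r1, G.LA A g x = 0 := by
      intro x hx
      rw [hg, G.LA_sub A hvl hv, G.LA_left A hv]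
      have hx' : ‖x‖ < r1 := by simpa using hx
      have e1 := hmn (c t) x (hct.trans (by nlinarith)) hx'.le
      have e2 : ‖G.mul (c t) x‖ ≤ ‖G.mul (c t) x - x‖ + ‖x‖ := by simpa using norm_add_le (G.mul (c t) x - x) x
      have e3 : Cm * ‖c t‖ ≤ r - r1 := by
        calc Cm * ‖c t‖ ≤ Cm * (C4 * t) := by gcongr
          _ ≤ Cm * (C4 * T) := by gcongr
          _ = T * (Cm * C4) := by ring
          _ ≤ _ := T8
      beta_reduce
      rw [hL _ (by simp; linarith), hL _ (by simp; linarith), sub_zero]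
    have k1 := H2 A hA g hgs hgL t ht (tT.trans T4)
    have k2 := H1 A hA v hv hL t ht (tT.trans T3)
    have hcc : c (2 * t) = G.mul (c t) (c t) := by
      rw [two_mul]; exact hc2 t t (by rw [abs_of_pos ht]; linarith) (by rw [abs_of_pos ht]; linarith)
    have hml : ∀ z, MemLp (fun x => v (G.mul z x) - v x) 2 (volume.restrict (Metric.ball 0 r')) := fun z =>
      memLp_ball ((hv.comp (G.cmul_left z)).sub hv).continuous _ _
    have hmg : MemLp (fun x => g (G.mul (c t) x) - g x) 2 (volume.restrict (Metric.ball 0 r')) :=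
      memLp_ball ((hgs.comp (G.cmul_left _)).sub hgs).continuous _ _
    have k3 : 2 * n2 (volume.restrict (Metric.ball 0 r')) (fun x => v (G.mul (c t) x) - v x) ≤
        n2 (volume.restrict (Metric.ball 0 r')) (fun x => v (G.mul (c (2 * t)) x) - v x) +
        n2 (volume.restrict (Metric.ball 0 r')) (fun x => g (G.mul (c t) x) - g x) := by
      refine le_trans (le_of_eq ?_) (n2_sub_le (hml (c (2 * t))) hmg)
      have := n2_const_mul (μ := volume.restrict (Metric.ball 0 r')) (f := fun x => v (G.mul (c t) x) - v x) 2
      rw [abs_two] at this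
      rw [← this]
      congr 1; ext x
      rw [hg, hcc, G.mul_assoc']; beta_reduce; ring
    refine k3.trans (add_le_add le_rfl (k1.trans ?_))
    calc C2 * t ^ a * n2 (volume.restrict (Metric.ball 0 r1)) g ≤ C2 * t ^ a * (C1 * t ^ a * M) := by gcongr
      _ = C2 * C1 * M * (t ^ a * t ^ a) := by ring
      _ = _ := by rw [← Real.rpow_add ht, ← two_mul]

lemma hol_one (G : CarnotSetting N m) {Λ : ℝ} (hΛ : 0 < Λ) {X} {ε : ℝ} {c} (h : IsCurve X (-ε) ε c)
    (hε : 0 < ε) (hc2 : ∀ t s, |t| < ε / 2 → |s| < ε / 2 → c (t + s) = G.mul (c t) (c s)) : Hol G Λ c 1 := by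
  have key : ∀ n : ℕ, Hol G Λ c (2 / 3 * (1/2) ^ n) → Hol G Λ c (2 / 3) := by
    intro n
    induction n with
    | zero => intro h; simpa using h
    | succ n ih =>
      intro h'
      refine ih ?_
      have hp : (1/2:ℝ) ^ n ≤ 1 := pow_le_one₀ (by norm_num) (by norm_num)
      have hp0 : 0 < (1/2:ℝ) ^ n := by positivity
      have := G.hol_double h hε hc2 (by positivity) (by rw [pow_succ]; nlinarith) h'
      rwa [min_eq_left (by rw [pow_succ]; nlinarith), show 2 * (2 / 3 * (1/2:ℝ) ^ (n + 1)) = 2 / 3 * (1/2) ^ n by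
        rw [pow_succ]; ring] at this
  have hsm := G.smax_pos
  obtain ⟨n, hn⟩ := exists_pow_lt_of_lt_one (show (0:ℝ) < 1 / G.smax by positivity) (by norm_num : (1/2:ℝ) < 1)
  have h1 := key n (G.hol_init hΛ h (by have : 0 < (1/2:ℝ) ^ n := by positivity
                                        linarith))
  have := G.hol_double h hε hc2 (by norm_num) (by norm_num) h1
  rwa [min_eq_right (by norm_num)] at this

/-- right-invariant derivative estimate -/
lemma reg_RV (G : CarnotSetting N m) {Λ : ℝ} (hΛ : 0 < Λ) (e) {r r' : ℝ} (hr' : 0 < r') (hr : r' < r) :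
    ∃ C > 0, ∀ A, Ell Λ A → ∀ v : (Fin N → ℝ) → ℝ, ContDiff ℝ ∞ v →
      (∀ x ∈ Metric.ball (0 : Fin N → ℝ) r, G.LA A v x = 0) →
      n2 (volume.restrict (Metric.ball 0 r')) (vfDeriv (G.RV e) v) ≤ C * n2 (volume.restrict (Metric.ball 0 r)) v := by
  obtain ⟨ε, hε, c, hc, hc2⟩ := G.exists_subgroup e
  obtain ⟨C, hC, τ, hτ, H⟩ := G.hol_one hΛ hc hε hc2 r' r hr' hr
  refine ⟨C, hC, fun A hA v hv hL => ?_⟩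
  set M := n2 (volume.restrict (Metric.ball 0 r)) v
  have hM : 0 ≤ M := n2_nonneg
  refine n2_le_of_lint (by positivity) ?_
  set t : ℕ → ℝ := fun n => τ / (n + 1)
  have ht0 : ∀ n, 0 < t n := fun n => by positivity
  have htt : Tendsto t atTop (𝓝[>] 0) := by
    refine tendsto_nhdsWithin_iff.2 ⟨tendsto_const_div_atTop_nhds_zero_nat τ |>.comp (tendsto_add_atTop_nat 1) |>.congr
      (fun n => by simp [t]), .of_forall fun n => ht0 n⟩
  set D : ℕ → (Fin N → ℝ) → ℝ := fun n x => (t n)⁻¹ * (v (G.mul (c (t n)) x) - v x)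
  have hDs : ∀ n, ContDiff ℝ ∞ (D n) := fun n => contDiff_const.mul ((hv.comp (G.cmul_left _)).sub hv)
  have hlim : ∀ x, Tendsto (fun n => D n x) atTop (𝓝 (vfDeriv (G.RV e) v x)) := by
    intro x
    have hc0 : HasDerivAt c e 0 := by
      have := hc.2.2 0 hc.2.1
      rwa [hc.1, G.LV_zero] at this
    have h1 : HasFDerivAt (fun w => G.mul w x) (fderiv ℝ (fun w => G.mul w x) 0) (c 0) := by
      rw [hc.1]; exact ((G.cmul_right x).differentiable (by simp) 0).hasFDerivAt
    have h2 := h1.comp_hasDerivAt 0 hc0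
    have h3 : HasFDerivAt v (fderiv ℝ v x) (((fun w => G.mul w x) ∘ c) 0) := by
      simp only [Function.comp, hc.1, G.zero_mul']; exact (hv.differentiable (by simp) x).hasFDerivAt
    have h4 := (h3.comp_hasDerivAt 0 h2).tendsto_slope_zero_right
    have h5 := h4.comp htt
    rw [vfDeriv_eq _ (hv.differentiable (by simp) x)]
    refine h5.congr fun n => ?_
    simp [D, hc.1, G.zero_mul']
  have hb : ∀ n, ∫⁻ x in Metric.ball 0 r', ‖D n x‖ₑ ^ 2 ≤ ENNReal.ofReal ((C * M) ^ 2) := by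
    intro n
    rw [← n2_lint (memLp_ball (hDs n).continuous _ _)]
    refine ENNReal.ofReal_le_ofReal (pow_le_pow_left₀ n2_nonneg ?_ 2)
    have h1 := H A hA v hv hL (t n) (ht0 n) (div_le_self hτ.le (by have : (0:ℝ) ≤ n := n.cast_nonneg
                                                                   linarith))
    simp only [D]
    rw [n2_const_mul, abs_of_pos (inv_pos.2 (ht0 n)), inv_mul_le_iff₀ (ht0 n)]
    rw [Real.rpow_one] at h1
    linarith
  calc ∫⁻ x in Metric.ball 0 r', ‖vfDeriv (G.RV e) v x‖ₑ ^ 2 = ∫⁻ x in Metric.ball 0 r', liminf (fun n => ‖D n x‖ₑ ^ 2) atTop := by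
        refine lintegral_congr fun x => ?_
        have : Tendsto (fun n => ‖D n x‖ₑ ^ 2) atTop (𝓝 (‖vfDeriv (G.RV e) v x‖ₑ ^ 2)) :=
          ((ENNReal.continuous_pow 2).tendsto _).comp ((hlim x).enorm)
        exact this.liminf_eq.symm
    _ ≤ liminf (fun n => ∫⁻ x in Metric.ball 0 r', ‖D n x‖ₑ ^ 2) atTop :=
        lintegral_liminf_le fun n => ((ENNReal.continuous_pow 2).comp (hDs n).continuous.enorm).measurable
    _ ≤ _ := by
        refine (liminf_le_liminf (.of_forall hb)).trans ?_
        simp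

lemma reg_RF (G : CarnotSetting N m) {Λ : ℝ} (hΛ : 0 < Λ) (J : List (Fin N)) : ∀ {r r' : ℝ}, 0 < r' → r' < r →
    ∃ C > 0, ∀ A, Ell Λ A → ∀ v : (Fin N → ℝ) → ℝ, ContDiff ℝ ∞ v →
      (∀ x ∈ Metric.ball (0 : Fin N → ℝ) r, G.LA A v x = 0) →
      (∀ x ∈ Metric.ball (0 : Fin N → ℝ) r', G.LA A (vfIter G.RF J v) x = 0) ∧
      n2 (volume.restrict (Metric.ball 0 r')) (vfIter G.RF J v) ≤ C * n2 (volume.restrict (Metric.ball 0 r)) v := by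
  induction J with
  | nil =>
    intro r r' h0 hr
    refine ⟨1, one_pos, fun A hA v hv hL => ⟨fun x hx => hL x (Metric.ball_subset_ball hr.le hx), ?_⟩⟩
    rw [one_mul]
    exact n2_mono_measure (memLp_ball hv.continuous _ _) (Measure.restrict_mono (Metric.ball_subset_ball hr.le) le_rfl)
  | cons k J ih =>
    intro r r' h0 hr
    obtain ⟨r1, h1, h2⟩ := exists_between hr
    obtain ⟨C1, hC1, H1⟩ := ih (h0.trans h1) h2
    obtain ⟨C2, hC2, H2⟩ := G.reg_RV hΛ (Pi.single k 1) h0 h1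
    refine ⟨C2 * C1, by positivity, fun A hA v hv hL => ?_⟩
    obtain ⟨e1, e2⟩ := H1 A hA v hv hL
    have hs : ContDiff ℝ ∞ (vfIter G.RF J v) := vfIter_contDiff' G.RF_smooth hv J
    refine ⟨fun x hx => ?_, ?_⟩
    · change G.LA A (vfDeriv (G.RV (Pi.single k 1)) (vfIter G.RF J v)) x = 0
      rw [G.LA_RV A _ hs]
      have : G.LA A (vfIter G.RF J v) =ᶠ[𝓝 x] fun _ => 0 := by
        filter_upwards [Metric.isOpen_ball.mem_nhds (Metric.ball_subset_ball h1.le hx)] with y hy using e1 y hy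
      rw [vfDeriv_congr_nhds this]
      exact vfDeriv_const _ _
    · refine (H2 A hA _ hs e1).trans ?_
      rw [mul_assoc]; gcongr

end CarnotSetting
end

end

section
open MeasureTheory Set Filter Topology
open scoped ContDiff ENNReal
noncomputable section
namespace CarnotSetting
variable {N m : ℕ}

/-- constant coordinate fields -/
def cF (N : ℕ) (i : Fin N) : (Fin N → ℝ) → (Fin N → ℝ) := fun _ => Pi.single i 1

lemma cF_smooth (i : Fin N) : ContDiff ℝ ∞ (cF N i) := contDiff_const

lemma one_dim {g : (Fin N → ℝ) → ℝ} (hg : Test g) (i : Fin N) (x) :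
    ‖g x‖ₑ ≤ ∫⁻ t, ‖vfDeriv (cF N i) g (Function.update x i t)‖ₑ := by
  set f : ℝ → ℝ := fun t => g (Function.update x i t) with hf
  have hu : ∀ t, HasDerivAt (fun t => Function.update x i t) (Pi.single i 1) t := fun t => hasDerivAt_update x i t
  have hd : ∀ t, HasDerivAt f (vfDeriv (cF N i) g (Function.update x i t)) t := by
    intro t
    rw [vfDeriv_eq _ (hg.1.differentiable (by simp) _)]
    exact (hg.1.differentiable (by simp) _).hasFDerivAt.comp_hasDerivAt t (hu t)
  have hfc : ContDiff ℝ 1 f := (hg.1.of_le (by simp)).comp (contDiff_update 1 x i)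
  have hcs : HasCompactSupport f := by
    obtain ⟨R, hR⟩ := hg.2.isBounded.subset_closedBall 0
    refine HasCompactSupport.intro (isCompact_closedBall (0:ℝ) R) fun t ht => ?_
    by_contra h
    have h1 := hR (subset_tsupport _ h)
    simp only [Metric.mem_closedBall, dist_zero_right] at h1 ht
    apply ht
    have := norm_le_pi_norm (Function.update x i t) i
    simp at this ⊢
    linarith
  have h1 := hcs.enorm_le_lintegral_Ici_deriv hfc (x i)
  have e : f (x i) = g x := by simp [hf]
  rw [e] at h1
  refine h1.trans ?_
  refine (setLIntegral_le_lintegral _ _).trans (le_of_eq ?_)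
  exact lintegral_congr fun t => by rw [(hd t).deriv]

lemma sobolev_aux (s : Finset (Fin N)) : ∃ l : List (Fin N), ∀ g : (Fin N → ℝ) → ℝ, Test g → ∀ x,
    ‖g x‖ₑ ≤ lmarginal (fun _ : Fin N => (volume : Measure ℝ)) s (fun y => ‖vfIter (cF N) l g y‖ₑ) x := by
  induction s using Finset.induction with
  | empty => exact ⟨[], fun g hg x => by simp [vfIter]⟩
  | insert i s hi ih =>
    obtain ⟨l, hl⟩ := ih
    refine ⟨l ++ [i], fun g hg x => ?_⟩
    have hs : ContDiff ℝ ∞ (vfIter (cF N) (l ++ [i]) g) := vfIter_contDiff' cF_smooth hg.1 _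
    rw [lmarginal_insert _ hs.continuous.enorm.measurable hi]
    refine (one_dim hg i x).trans (lintegral_mono fun t => ?_)
    have := hl _ (hg.vf (cF_smooth i)) (Function.update x i t)
    rw [vfIter_append]
    exact this

lemma cutoff_DO (G : CarnotSetting N m) {χ : (Fin N → ℝ) → ℝ} (hχ : ContDiff ℝ ∞ χ) (l : List (Fin N)) :
    IsDO G.RF (fun u => vfIter (cF N) l (fun x => χ x * u x)) := by
  induction l with
  | nil => exact IsDO.id.smul hχ
  | cons i l ih =>
    obtain ⟨β, hβ, hX⟩ := G.RF_expand (cF_smooth i)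
    exact IsDO.field G.RF_smooth hβ hX ih

lemma vfIter_support' {n : ℕ} {Z : Fin n → (Fin N → ℝ) → (Fin N → ℝ)} (l) (g : (Fin N → ℝ) → ℝ) :
    tsupport (vfIter Z l g) ⊆ tsupport g := by
  induction l with
  | nil => exact Subset.rfl
  | cons i l ih => exact vfDeriv_support.trans ih

lemma reg_sup (G : CarnotSetting N m) {Λ : ℝ} (hΛ : 0 < Λ) {r : ℝ} (hr : 0 < r) :
    ∃ C > 0, ∀ A, Ell Λ A → ∀ v : (Fin N → ℝ) → ℝ, ContDiff ℝ ∞ v →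
      (∀ x ∈ Metric.ball (0 : Fin N → ℝ) r, G.LA A v x = 0) →
      |v 0| ≤ C * n2 (volume.restrict (Metric.ball 0 r)) v := by
  set r1 := r / 2
  have hr1 : 0 < r1 := by positivity
  obtain ⟨χ, hχ, -, hχ1, hχs⟩ := exists_cutoff N (half_pos hr1) (half_lt_self hr1)
  obtain ⟨l, hl⟩ := sobolev_aux (Finset.univ : Finset (Fin N))
  obtain ⟨S, hS⟩ := (G.cutoff_DO hχ.1 l).bound
  obtain ⟨C1, hC1, hb⟩ := hS _ (isCompact_closedBall (0:Fin N → ℝ) r1)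
  choose C2 hC2 H2 using fun J => G.reg_RF hΛ J hr1 (half_lt_self hr : r1 < r)
  set B := Metric.ball (0:Fin N → ℝ) r1
  set V := (volume B).toReal
  refine ⟨√V * (C1 * ∑ J ∈ S, C2 J) + 1, by have : 0 ≤ ∑ J ∈ S, C2 J := Finset.sum_nonneg fun J _ => (hC2 J).le
                                            positivity, fun A hA v hv hL => ?_⟩
  set M := n2 (volume.restrict (Metric.ball 0 r)) v
  have hM : 0 ≤ M := n2_nonneg
  set f := fun x => χ x * v x
  have hf : Test f := hχ.mul_smooth hv
  set g := vfIter (cF N) l f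
  have hgs : ContDiff ℝ ∞ g := vfIter_contDiff' cF_smooth hf.1 l
  have h1 := hl f hf 0
  rw [lmarginal_univ] at h1
  have h0 : f 0 = v 0 := by simp [f, hχ1 0 (by simp; positivity)]
  rw [h0] at h1
  have hsupp : ∀ x, x ∉ B → g x = 0 := fun x hx => by
    by_contra h
    exact hx (hχs (tsupport_mul_subset_left (vfIter_support' l f (subset_tsupport _ h))))
  have h2 : ∫⁻ y, ‖g y‖ₑ = ∫⁻ y in B, ‖g y‖ₑ := by
    symm
    refine setLIntegral_eq_of_support_subset ?_
    intro x hx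
    by_contra h
    exact hx (by simp [hsupp x h])
  have hgM : MemLp g 2 (volume.restrict B) := memLp_ball hgs.continuous _ _
  have h3 : ‖v 0‖ₑ ^ 2 ≤ ENNReal.ofReal (V * n2 (volume.restrict B) g ^ 2) := by
    calc ‖v 0‖ₑ ^ 2 ≤ (∫⁻ y in B, ‖g y‖ₑ) ^ 2 := by
          gcongr
          exact h2 ▸ h1
      _ ≤ _ := lint_sq_le _ hgs.continuous.enorm.measurable.aemeasurable
      _ = _ := by
          rw [← n2_lint hgM, ENNReal.ofReal_mul ENNReal.toReal_nonneg, ENNReal.ofReal_toReal measure_ball_lt_top.ne,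
            Measure.restrict_apply_univ]
  have h4 : |v 0| ≤ √V * n2 (volume.restrict B) g := by
    have e : ‖v 0‖ₑ ^ 2 = ENNReal.ofReal (v 0 ^ 2) := by
      rw [← sq_abs, ENNReal.ofReal_pow (abs_nonneg _), Real.enorm_eq_ofReal_abs]
    have hV : 0 ≤ V := ENNReal.toReal_nonneg
    rw [e, ENNReal.ofReal_le_ofReal_iff (by positivity)] at h3
    refine abs_le_of_sq_le_sq ?_ (by have := n2_nonneg (μ := volume.restrict B) (f := g); positivity)
    rwa [mul_pow, Real.sq_sqrt hV]
  have hJm : ∀ J, MemLp (fun x => |vfIter G.RF J v x|) 2 (volume.restrict B) := fun J =>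
    memLp_ball (vfIter_contDiff' G.RF_smooth hv J).continuous.abs _ _
  have h5 : n2 (volume.restrict B) g ≤ C1 * ∑ J ∈ S, C2 J * M := by
    have a1 : n2 (volume.restrict B) g ≤ C1 * n2 (volume.restrict B) (fun x => ∑ J ∈ S, |vfIter G.RF J v x|) := by
      refine n2_le_of_ae (memLp_finsetSum _ fun J _ => hJm J) hC1 ?_
      refine (ae_restrict_iff' Metric.isOpen_ball.measurableSet).2 (.of_forall fun x hx => ?_)
      refine (hb univ isOpen_univ v hv.contDiffOn x ⟨Metric.ball_subset_closedBall hx, trivial⟩).trans ?_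
      gcongr
      exact le_abs_self _
    refine a1.trans ?_
    gcongr
    refine (n2_sum_le _ _ fun J _ => hJm J).trans ?_
    gcongr with J hJ
    refine le_trans (le_of_eq ?_) (H2 J A hA v hv hL).2
    unfold n2
    congr 1
    exact eLpNorm_norm (vfIter G.RF J v)
  calc |v 0| ≤ √V * (C1 * ∑ J ∈ S, C2 J * M) := h4.trans (by gcongr)
    _ = (√V * (C1 * ∑ J ∈ S, C2 J)) * M := by rw [← Finset.sum_mul]; ring
    _ ≤ _ := by nlinarith

lemma reg (G : CarnotSetting N m) {Λ : ℝ} (hΛ : 0 < Λ) (H : List (Fin m)) {r : ℝ} (hr : 0 < r) :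
    ∃ C > 0, ∀ A, Ell Λ A → ∀ v : (Fin N → ℝ) → ℝ, ContDiff ℝ ∞ v →
      (∀ x ∈ Metric.ball (0 : Fin N → ℝ) r, G.LA A v x = 0) →
      |vfIter G.Y H v 0| ≤ C * n2 (volume.restrict (Metric.ball 0 r)) v := by
  obtain ⟨S, hS⟩ := (G.RF_word G.Y_smooth H).bound
  obtain ⟨C1, hC1, hb⟩ := hS _ (isCompact_singleton (x := (0:Fin N → ℝ)))
  obtain ⟨C3, hC3, H3⟩ := G.reg_sup hΛ (half_pos hr)
  choose C2 hC2 H2 using fun J => G.reg_RF hΛ J (half_pos hr) (half_lt_self hr)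
  refine ⟨C1 * ∑ J ∈ S, C3 * C2 J + 1, by
    have : 0 ≤ ∑ J ∈ S, C3 * C2 J := Finset.sum_nonneg fun J _ => mul_nonneg hC3.le (hC2 J).le
    positivity, fun A hA v hv hL => ?_⟩
  set M := n2 (volume.restrict (Metric.ball 0 r)) v
  have hM : 0 ≤ M := n2_nonneg
  have h1 := hb univ isOpen_univ v hv.contDiffOn 0 ⟨rfl, trivial⟩
  calc |vfIter G.Y H v 0| ≤ C1 * ∑ J ∈ S, |vfIter G.RF J v 0| := h1
    _ ≤ C1 * ∑ J ∈ S, C3 * (C2 J * M) := by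
      gcongr with J hJ
      obtain ⟨e1, e2⟩ := H2 J A hA v hv hL
      exact (H3 A hA _ (vfIter_contDiff' G.RF_smooth hv J) e1).trans (by gcongr)
    _ = (C1 * ∑ J ∈ S, C3 * C2 J) * M := by
      rw [mul_assoc, Finset.sum_mul]; simp only [mul_assoc]
    _ ≤ _ := by nlinarith

end CarnotSetting
end

end

section
open MeasureTheory Set Filter Topology
open scoped ContDiff ENNReal
noncomputable section
namespace CarnotSetting
variable {N m : ℕ}

/-! homogeneous norm -/
def rho (G : CarnotSetting N m) (x : Fin N → ℝ) : ℝ := homNorm G.σ x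
def qq (G : CarnotSetting N m) : ℝ := ∑ i, (G.σ i : ℝ)
lemma qq_cast (G : CarnotSetting N m) : G.qq = ((∑ i, G.σ i : ℕ) : ℝ) := by simp [qq]
lemma qq_gt (G : CarnotSetting N m) : 2 < G.qq := by
  rw [qq_cast]; exact_mod_cast G.Q_gt_two

def rexp (G : CarnotSetting N m) : ℕ := 2 * Nat.factorial (Finset.univ.sup G.σ)
def rhoS (G : CarnotSetting N m) (x : Fin N → ℝ) : ℝ := ∑ i, |x i| ^ (G.rexp / G.σ i)

lemma rexp_pos (G : CarnotSetting N m) : 0 < G.rexp := by unfold rexp; positivity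
lemma rexp_div (G : CarnotSetting N m) (i) : ∃ k, 0 < k ∧ G.rexp / G.σ i = 2 * k ∧ G.σ i * (2 * k) = G.rexp := by
  have h1 : G.σ i ∣ Nat.factorial (Finset.univ.sup G.σ) :=
    Nat.dvd_factorial (G.σ_ge_one i) (Finset.le_sup (Finset.mem_univ i))
  obtain ⟨k, hk⟩ := h1
  have hp := Nat.factorial_pos (Finset.univ.sup G.σ)
  have hs := G.σ_ge_one i
  refine ⟨k, ?_, ?_, ?_⟩
  · rcases Nat.eq_zero_or_pos k with rfl | h
    · simp at hk; omega
    · exact h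
  · unfold rexp; rw [hk]
    apply Nat.div_eq_of_eq_mul_left (by omega); ring
  · unfold rexp; rw [hk]; ring

lemma rho_def (G : CarnotSetting N m) (x) : G.rho x = G.rhoS x ^ ((1:ℝ) / G.rexp) := by
  unfold rho homNorm rhoS rexp; push_cast; rfl

lemma rhoS_nonneg (G : CarnotSetting N m) (x) : 0 ≤ G.rhoS x := by unfold rhoS; positivity
lemma rho_nonneg (G : CarnotSetting N m) (x) : 0 ≤ G.rho x := by
  rw [rho_def]; exact Real.rpow_nonneg (G.rhoS_nonneg x) _

lemma rhoS_pos (G : CarnotSetting N m) {x : Fin N → ℝ} (hx : x ≠ 0) : 0 < G.rhoS x := by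
  obtain ⟨i, hi⟩ := Function.ne_iff.1 hx
  refine (Finset.sum_pos' (fun i _ => by positivity) ⟨i, Finset.mem_univ i, ?_⟩)
  have : 0 < |x i| := abs_pos.2 hi
  positivity
lemma rho_pos (G : CarnotSetting N m) {x : Fin N → ℝ} (hx : x ≠ 0) : 0 < G.rho x := by
  rw [rho_def]; exact Real.rpow_pos_of_pos (G.rhoS_pos hx) _
lemma rho_zero (G : CarnotSetting N m) : G.rho 0 = 0 := by
  rw [rho_def]
  have : G.rhoS 0 = 0 := by
    unfold rhoS
    apply Finset.sum_eq_zero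
    intro i _
    obtain ⟨k, h0, h1, -⟩ := G.rexp_div i
    rw [h1]; simp; omega
  rw [this]
  apply Real.zero_rpow
  have := G.rexp_pos
  positivity
lemma rho_eq_zero (G : CarnotSetting N m) {x} : G.rho x = 0 ↔ x = 0 :=
  ⟨fun h => by_contra fun h' => (G.rho_pos h').ne' h, fun h => h ▸ G.rho_zero⟩
lemma ne_zero_of_rho (G : CarnotSetting N m) {x} (h : 0 < G.rho x) : x ≠ 0 := by
  rintro rfl; simp [rho_zero] at h

lemma rhoS_dil (G : CarnotSetting N m) {l : ℝ} (hl : 0 < l) (x) :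
    G.rhoS (dil G.σ l x) = l ^ G.rexp * G.rhoS x := by
  unfold rhoS
  rw [Finset.mul_sum]
  refine Finset.sum_congr rfl fun i _ => ?_
  obtain ⟨k, h0, h1, h2⟩ := G.rexp_div i
  rw [h1, ← h2, dil, abs_mul, mul_pow, abs_of_pos (by positivity), ← pow_mul]

lemma rho_dil (G : CarnotSetting N m) {l : ℝ} (hl : 0 < l) (x) : G.rho (dil G.σ l x) = l * G.rho x := by
  rw [rho_def, rho_def, rhoS_dil G hl, Real.mul_rpow (by positivity) (G.rhoS_nonneg x)]
  congr 1
  rw [one_div, Real.pow_rpow_inv_natCast hl.le G.rexp_pos.ne']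

lemma rho_pow (G : CarnotSetting N m) (x) : G.rho x ^ G.rexp = G.rhoS x := by
  rw [rho_def, one_div, Real.rpow_inv_natCast_pow (G.rhoS_nonneg x) G.rexp_pos.ne']

lemma abs_le_rho (G : CarnotSetting N m) (x) (i) : |x i| ≤ G.rho x ^ G.σ i := by
  obtain ⟨k, h0, h1, h2⟩ := G.rexp_div i
  have h : |x i| ^ (2 * k) ≤ (G.rho x ^ G.σ i) ^ (2 * k) := by
    rw [← pow_mul, h2, rho_pow, ← h1]
    exact Finset.single_le_sum (f := fun i => |x i| ^ (G.rexp / G.σ i)) (fun i _ => by positivity) (Finset.mem_univ i)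
  have := G.rho_nonneg x
  exact (pow_le_pow_iff_left₀ (abs_nonneg _) (by positivity) (by omega)).1 h

lemma rhoS_contDiff (G : CarnotSetting N m) : ContDiff ℝ ∞ G.rhoS := by
  unfold rhoS
  apply ContDiff.sum
  intro i _
  obtain ⟨k, h0, h1, h2⟩ := G.rexp_div i
  simp_rw [h1, pow_mul, sq_abs]
  fun_prop

lemma rho_continuous (G : CarnotSetting N m) : Continuous G.rho := by
  have : G.rho = fun x => G.rhoS x ^ ((1:ℝ) / G.rexp) := funext fun x => G.rho_def x
  rw [this]
  exact G.rhoS_contDiff.continuous.rpow_const (fun x => Or.inr (by positivity))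

lemma rho_smooth (G : CarnotSetting N m) : ContDiffOn ℝ ∞ G.rho {0}ᶜ := by
  have : G.rho = fun x => G.rhoS x ^ ((1:ℝ) / G.rexp) := funext fun x => G.rho_def x
  rw [this]
  exact G.rhoS_contDiff.contDiffOn.rpow_const_of_ne (fun x hx => (G.rhoS_pos hx).ne')

lemma isCompact_rho_le (G : CarnotSetting N m) (R : ℝ) : IsCompact {x | G.rho x ≤ R} := by
  apply Metric.isCompact_of_isClosed_isBounded (isClosed_le G.rho_continuous continuous_const)
  refine (isBounded_iff_forall_norm_le).2 ⟨∑ i, R ^ G.σ i + |R|, fun x hx => ?_⟩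
  have hR : 0 ≤ R := (G.rho_nonneg x).trans hx
  refine (pi_norm_le_iff_of_nonneg (by positivity)).2 fun i => ?_
  refine (G.abs_le_rho x i).trans ?_
  refine (pow_le_pow_left₀ (G.rho_nonneg x) hx _).trans ?_
  have := Finset.single_le_sum (f := fun i => R ^ G.σ i) (fun i _ => by positivity) (Finset.mem_univ i)
  have := abs_nonneg R
  linarith

lemma isCompact_rho_sphere (G : CarnotSetting N m) : IsCompact {x | G.rho x = 1} :=
  (G.isCompact_rho_le 1).of_isClosed_subset (isClosed_eq G.rho_continuous continuous_const) (fun _ h => le_of_eq h)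

lemma rho_le_of_norm (G : CarnotSetting N m) (R : ℝ) : ∃ C, 0 < C ∧ ∀ x : Fin N → ℝ, ‖x‖ ≤ R → G.rho x ≤ C := by
  obtain ⟨C, hC⟩ := (isCompact_closedBall (0 : Fin N → ℝ) R).exists_bound_of_continuousOn G.rho_continuous.continuousOn
  refine ⟨max C 1, by positivity, fun x hx => le_max_of_le_left ?_⟩
  exact (le_abs_self _).trans (hC x (by simpa using hx))

lemma norm_le_of_rho (G : CarnotSetting N m) (R : ℝ) : ∃ C, 0 < C ∧ ∀ x : Fin N → ℝ, G.rho x ≤ R → ‖x‖ ≤ C := by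
  obtain ⟨C, hC⟩ := (G.isCompact_rho_le R).exists_bound_of_continuousOn continuousOn_id
  exact ⟨max C 1, by positivity, fun x hx => le_max_of_le_left (hC x hx)⟩

lemma rho_nhds (G : CarnotSetting N m) {r : ℝ} (hr : 0 < r) : ∃ δ > 0, ∀ x : Fin N → ℝ, G.rho x ≤ δ → ‖x‖ < r := by
  by_contra! h
  -- scale: a point with rho = δ small and norm ≥ r
  obtain ⟨C, hC, h1⟩ := G.norm_le_of_rho 1
  have h2 : ∃ δ : ℝ, 0 < δ ∧ δ ≤ 1 ∧ δ * C < r := by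
    refine ⟨min 1 (r / (2 * C)), by positivity, min_le_left _ _, ?_⟩
    have : min 1 (r / (2 * C)) * C ≤ r / (2 * C) * C := by gcongr; exact min_le_right _ _
    have e : r / (2 * C) * C = r / 2 := by field_simp
    linarith
  obtain ⟨δ, h0, h3, h4⟩ := h2
  obtain ⟨x, hx, hx'⟩ := h δ h0
  have : ‖dil G.σ δ⁻¹ x‖ ≤ C := h1 _ (by
    rw [rho_dil G (by positivity)]; rw [inv_mul_le_iff₀ h0]; simpa)
  have h5 : ‖x‖ ≤ δ * C := by
    refine (pi_norm_le_iff_of_nonneg (by positivity)).2 fun i => ?_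
    have : ‖δ⁻¹ ^ G.σ i * x i‖ ≤ C := (norm_le_pi_norm (dil G.σ δ⁻¹ x) i).trans this
    rw [norm_mul, Real.norm_of_nonneg (by positivity), inv_pow, inv_mul_le_iff₀ (by positivity)] at this
    refine this.trans ?_
    have h6 : δ ^ G.σ i ≤ δ ^ 1 := pow_le_pow_of_le_one h0.le h3 (G.σ_ge_one i)
    rw [pow_one] at h6
    gcongr
  linarith

/-- normalisation -/
lemma rho_normalize (G : CarnotSetting N m) {x} (hx : x ≠ 0) :
    G.rho (dil G.σ (G.rho x)⁻¹ x) = 1 ∧ x = dil G.σ (G.rho x) (dil G.σ (G.rho x)⁻¹ x) := by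
  have h := G.rho_pos hx
  refine ⟨?_, (dil_dil_inv G.σ h x).symm⟩
  rw [rho_dil G (by positivity), inv_mul_cancel₀ h.ne']

def Hom (G : CarnotSetting N m) (d : ℝ) (g : (Fin N → ℝ) → ℝ) : Prop :=
  ∀ l : ℝ, 0 < l → ∀ x, x ≠ 0 → g (dil G.σ l x) = l ^ d * g x

lemma Hom.le (G : CarnotSetting N m) {d : ℝ} {g : (Fin N → ℝ) → ℝ} (h : G.Hom d g) {C : ℝ}
    (hC : ∀ w, G.rho w = 1 → |g w| ≤ C) {x} (hx : x ≠ 0) : |g x| ≤ C * G.rho x ^ d := by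
  obtain ⟨h1, h2⟩ := G.rho_normalize hx
  have h3 := G.rho_pos hx
  have hne : dil G.σ (G.rho x)⁻¹ x ≠ 0 := fun h => by rw [h, rho_zero] at h1; simp at h1
  rw [h2, h _ h3 _ hne, abs_mul, abs_of_pos (Real.rpow_pos_of_pos h3 d), ← h2, mul_comm]
  gcongr
  exact hC _ h1

lemma sphere_ne (G : CarnotSetting N m) {w} (h : G.rho w = 1) : w ≠ 0 := G.ne_zero_of_rho (by rw [h]; norm_num)

lemma Hom.exists_le (G : CarnotSetting N m) {d : ℝ} {g : (Fin N → ℝ) → ℝ} (h : G.Hom d g)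
    (hc : ContinuousOn g {0}ᶜ) : ∃ C, 0 ≤ C ∧ ∀ x, x ≠ 0 → |g x| ≤ C * G.rho x ^ d := by
  obtain ⟨C, hC⟩ := G.isCompact_rho_sphere.exists_bound_of_continuousOn (hc.mono fun w hw => G.sphere_ne hw)
  exact ⟨max C 0, le_max_right _ _, fun x hx => h.le G (fun w hw => le_max_of_le_left (hC w hw)) hx⟩

lemma rho_rpow_hom (G : CarnotSetting N m) (d : ℝ) : G.Hom d (fun x => G.rho x ^ d) := by
  intro l hl x _
  simp only [rho_dil G hl]
  rw [Real.mul_rpow hl.le (G.rho_nonneg x)]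

/-- local integrability -/
lemma rho_lintegral (G : CarnotSetting N m) {d : ℝ} (hd : -G.qq < d) (R : ℝ) :
    ∫⁻ x in {x | G.rho x ≤ R}, ENNReal.ofReal (G.rho x ^ d) < ⊤ := by
  wlog hR : 0 < R generalizing R
  · refine lt_of_le_of_lt (lintegral_mono_set ?_) (this 1 one_pos)
    intro x (hx : G.rho x ≤ R)
    exact hx.trans (by push Not at hR; linarith)
  set A : ℕ → Set (Fin N → ℝ) := fun k => {x | R * 2⁻¹ ^ (k+1) < G.rho x ∧ G.rho x ≤ R * 2⁻¹ ^ k} with hA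
  have hAm : ∀ k, MeasurableSet (A k) := fun k =>
    (measurableSet_lt measurable_const G.rho_continuous.measurable).inter
      (measurableSet_le G.rho_continuous.measurable measurable_const)
  have hcov : {x | G.rho x ≤ R} ⊆ {0} ∪ ⋃ k, A k := by
    intro x hx
    by_cases h0 : x = 0
    · exact Or.inl h0
    right
    have hp := G.rho_pos h0
    have hlim : Tendsto (fun k : ℕ => R * (2⁻¹ : ℝ) ^ k) atTop (𝓝 0) := by
      simpa using (tendsto_pow_atTop_nhds_zero_of_lt_one (r := (2⁻¹:ℝ)) (by norm_num) (by norm_num)).const_mul R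
    have hex : ∃ k : ℕ, R * (2⁻¹ : ℝ) ^ k < G.rho x := (hlim.eventually (gt_mem_nhds hp)).exists
    classical
    have hs := Nat.find_spec hex
    have hmin := fun k => Nat.find_min hex (m := k)
    obtain ⟨j, hj⟩ : ∃ j, Nat.find hex = j + 1 := by
      refine Nat.exists_eq_succ_of_ne_zero fun h => ?_
      rw [h] at hs; simp at hs; exact absurd hx (not_le.2 hs)
    rw [hj] at hs hmin
    exact mem_iUnion.2 ⟨j, hs, not_lt.1 (hmin j (by omega))⟩
  have hAk : ∀ k, ∫⁻ x in A k, ENNReal.ofReal (G.rho x ^ d)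
      = ENNReal.ofReal ((2⁻¹ ^ (d + G.qq)) ^ k) * ∫⁻ x in A 0, ENNReal.ofReal (G.rho x ^ d) := by
    intro k
    rw [← lintegral_indicator (hAm k), ← lintegral_indicator (hAm 0)]
    have h2 : (0:ℝ) < 2⁻¹ ^ k := by positivity
    have := lintegral_dil G.σ h2 ((A k).indicator fun x => ENNReal.ofReal (G.rho x ^ d))
    have e : ∀ x, (A k).indicator (fun x => ENNReal.ofReal (G.rho x ^ d)) (dil G.σ (2⁻¹ ^ k) x) =
        ENNReal.ofReal (((2⁻¹:ℝ) ^ k) ^ d) * (A 0).indicator (fun x => ENNReal.ofReal (G.rho x ^ d)) x := by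
      intro x
      have hiff : dil G.σ (2⁻¹ ^ k) x ∈ A k ↔ x ∈ A 0 := by
        simp only [hA, mem_setOf_eq, rho_dil G h2]
        constructor
        · rintro ⟨h, h'⟩
          exact ⟨by rw [pow_succ'] at h; simp; exact (mul_lt_mul_iff_right₀ h2).1 (by linarith),
            by simp; exact (mul_le_mul_iff_right₀ h2).1 (by linarith)⟩
        · rintro ⟨h, h'⟩
          simp at h h'
          have := mul_lt_mul_of_pos_left h h2
          have := mul_le_mul_of_nonneg_left h' h2.le
          exact ⟨by rw [pow_succ']; linarith, by linarith⟩
      by_cases hx : x ∈ A 0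
      · rw [indicator_of_mem (hiff.2 hx), indicator_of_mem hx, rho_dil G h2, Real.mul_rpow h2.le (G.rho_nonneg x),
          ENNReal.ofReal_mul (by positivity)]
      · rw [indicator_of_notMem (fun h => hx (hiff.1 h)), indicator_of_notMem hx, mul_zero]
    simp_rw [e] at this
    rw [lintegral_const_mul' _ _ ENNReal.ofReal_ne_top] at this
    have h3 : ENNReal.ofReal ((2⁻¹ ^ (d + G.qq)) ^ k) = ENNReal.ofReal ((2⁻¹ ^ k) ^ (∑ i, G.σ i)) * ENNReal.ofReal (((2⁻¹:ℝ) ^ k) ^ d) := by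
      rw [← ENNReal.ofReal_mul (by positivity)]
      congr 1
      rw [← Real.rpow_natCast _ (∑ i, G.σ i), ← qq_cast, ← Real.rpow_add h2, ← Real.rpow_natCast, ← Real.rpow_natCast,
        ← Real.rpow_mul (by norm_num), ← Real.rpow_mul (by norm_num)]
      congr 1; ring
    rw [h3, mul_assoc, this, ← mul_assoc, ← ENNReal.ofReal_mul (by positivity), mul_inv_cancel₀ (by positivity)]
    simp
  have hA0 : ∫⁻ x in A 0, ENNReal.ofReal (G.rho x ^ d) < ⊤ := by
    have hsub : A 0 ⊆ {x | R * 2⁻¹ ≤ G.rho x} ∩ {x | G.rho x ≤ R} := by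
      rintro x ⟨h, h'⟩; simp at h h'; exact ⟨h.le, h'⟩
    have hK : IsCompact ({x | R * 2⁻¹ ≤ G.rho x} ∩ {x | G.rho x ≤ R}) :=
      (G.isCompact_rho_le R).inter_left (isClosed_le continuous_const G.rho_continuous)
    have hi : IntegrableOn (fun x => G.rho x ^ d) ({x | R * 2⁻¹ ≤ G.rho x} ∩ {x | G.rho x ≤ R}) := by
      apply ContinuousOn.integrableOn_compact hK
      refine G.rho_continuous.continuousOn.rpow_const fun x hx => Or.inl ?_
      have : R * 2⁻¹ ≤ G.rho x := hx.1
      have : 0 < R * 2⁻¹ := by positivity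
      linarith
    refine lt_of_le_of_lt (lintegral_mono_set hsub) ?_
    have := hi.2
    rw [hasFiniteIntegral_iff_ofReal (Eventually.of_forall fun x => Real.rpow_nonneg (G.rho_nonneg x) _)] at this
    exact this
  have hnull : ∫⁻ x in ({0} : Set (Fin N → ℝ)), ENNReal.ofReal (G.rho x ^ d) = 0 := by
    haveI : Nonempty (Fin N) := ⟨⟨0, G.N_pos⟩⟩
    have : (volume : Measure (Fin N → ℝ)) {0} = 0 := measure_singleton 0
    rw [Measure.restrict_eq_zero.2 this]; simp
  calc ∫⁻ x in {x | G.rho x ≤ R}, ENNReal.ofReal (G.rho x ^ d)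
      ≤ ∫⁻ x in {0} ∪ ⋃ k, A k, ENNReal.ofReal (G.rho x ^ d) := lintegral_mono_set hcov
    _ ≤ (∫⁻ x in ({0} : Set (Fin N → ℝ)), ENNReal.ofReal (G.rho x ^ d)) + ∫⁻ x in ⋃ k, A k, ENNReal.ofReal (G.rho x ^ d) := lintegral_union_le _ _ _
    _ ≤ 0 + ∑' k, ∫⁻ x in A k, ENNReal.ofReal (G.rho x ^ d) := by
        rw [hnull]; gcongr; exact lintegral_iUnion_le _ _
    _ = (∑' k, ENNReal.ofReal (2⁻¹ ^ (d + G.qq)) ^ k) * ∫⁻ x in A 0, ENNReal.ofReal (G.rho x ^ d) := by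
        rw [zero_add, ← ENNReal.tsum_mul_right]
        refine tsum_congr fun k => ?_
        rw [hAk k, ENNReal.ofReal_pow (by positivity)]
    _ < ⊤ := by
        refine ENNReal.mul_lt_top ?_ hA0
        rw [ENNReal.tsum_geometric]
        refine ENNReal.inv_lt_top.2 (tsub_pos_of_lt ?_)
        rw [← ENNReal.ofReal_one]
        refine (ENNReal.ofReal_lt_ofReal_iff one_pos).2 ?_
        exact Real.rpow_lt_one (by norm_num) (by norm_num) (by linarith)

lemma meas_off_zero (G : CarnotSetting N m) {g : (Fin N → ℝ) → ℝ} (hc : ContinuousOn g {0}ᶜ) :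
    AEStronglyMeasurable g volume := by
  haveI : Nonempty (Fin N) := ⟨⟨0, G.N_pos⟩⟩
  have h := hc.aestronglyMeasurable (μ := volume) (measurableSet_singleton (0 : Fin N → ℝ)).compl
  rwa [Measure.restrict_eq_self_of_ae_mem] at h
  simp [ae_iff]

lemma ae_ne_zero (G : CarnotSetting N m) : ∀ᵐ x : Fin N → ℝ, x ≠ 0 := by
  haveI : Nonempty (Fin N) := ⟨⟨0, G.N_pos⟩⟩
  simp [ae_iff]

lemma Hom.integrable_mul (G : CarnotSetting N m) {d : ℝ} (hd : -G.qq < d) {g : (Fin N → ℝ) → ℝ} (h : G.Hom d g)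
    (hc : ContinuousOn g {0}ᶜ) {φ : (Fin N → ℝ) → ℝ} (hφ : Continuous φ) (hs : HasCompactSupport φ) :
    Integrable (fun x => g x * φ x) := by
  obtain ⟨C, hC0, hC⟩ := h.exists_le G hc
  obtain ⟨B, hB⟩ := hφ.bounded_above_of_compact_support hs
  obtain ⟨R, hR⟩ := hs.isCompact.exists_bound_of_continuousOn G.rho_continuous.continuousOn
  have hi : IntegrableOn (fun x => G.rho x ^ d) {x | G.rho x ≤ R} := by
    refine ⟨(G.rho_continuous.measurable.pow_const d).aestronglyMeasurable, ?_⟩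
    rw [hasFiniteIntegral_iff_ofReal (Eventually.of_forall fun x => Real.rpow_nonneg (G.rho_nonneg x) _)]
    exact G.rho_lintegral hd R
  have hi2 := (integrable_indicator_iff (measurableSet_le G.rho_continuous.measurable measurable_const)).2 hi
  refine (hi2.const_mul (C * B)).mono' ((G.meas_off_zero hc).mul hφ.aestronglyMeasurable) ?_
  filter_upwards [G.ae_ne_zero] with x hx
  by_cases hm : x ∈ tsupport φ
  · have : x ∈ {x | G.rho x ≤ R} := (le_abs_self _).trans (hR x hm)
    rw [indicator_of_mem this, norm_mul]
    have h1 := hC x hx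
    have h2 := hB x
    have h3 : 0 ≤ G.rho x ^ d := Real.rpow_nonneg (G.rho_nonneg x) _
    calc ‖g x‖ * ‖φ x‖ ≤ (C * G.rho x ^ d) * B := mul_le_mul h1 h2 (norm_nonneg _) (by positivity)
      _ = _ := by ring
  · rw [image_eq_zero_of_notMem_tsupport hm]
    simp only [mul_zero, norm_zero]
    have hB0 : 0 ≤ B := (norm_nonneg _).trans (hB x)
    refine mul_nonneg (by positivity) (indicator_nonneg (fun y _ => Real.rpow_nonneg (G.rho_nonneg y) _) x)

end CarnotSetting
end

end

section
open MeasureTheory Set Filter Topology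
open scoped ContDiff ENNReal
noncomputable section
namespace CarnotSetting
variable {N m : ℕ}

lemma isOpen_ne0 : IsOpen ({0}ᶜ : Set (Fin N → ℝ)) := isOpen_compl_singleton

lemma Hom.vf (G : CarnotSetting N m) {X} {k : ℕ} (hX : HomV G.σ k X) {d : ℝ} {g : (Fin N → ℝ) → ℝ}
    (h : G.Hom d g) (hg : ContDiffOn ℝ ∞ g {0}ᶜ) : G.Hom (d - k) (vfDeriv X g) := by
  intro l hl x hx
  have hx' : dil G.σ l x ≠ 0 := fun h => hx ((dil_eq_zero G.σ hl).1 h)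
  have h1 := vfDeriv_comp_dil G hX hl x (diffAt_of_on isOpen_ne0 hg hx')
  have h2 : vfDeriv X (fun w => g (dil G.σ l w)) x = vfDeriv X (fun w => l ^ d * g w) x := by
    apply vfDeriv_congr_nhds
    filter_upwards [isOpen_ne0.mem_nhds hx] with w hw
    exact h l hl w hw
  rw [h2, vfDeriv_const_mul _ (diffAt_of_on isOpen_ne0 hg hx)] at h1
  rw [Real.rpow_sub hl, Real.rpow_natCast, div_mul_eq_mul_div, eq_div_iff (by positivity), h1]
  ring

lemma Hom.iter (G : CarnotSetting N m) {d : ℝ} {g : (Fin N → ℝ) → ℝ}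
    (h : G.Hom d g) (hg : ContDiffOn ℝ ∞ g {0}ᶜ) (H : List (Fin m)) : G.Hom (d - H.length) (vfIter G.Y H g) := by
  induction H with
  | nil => simpa [vfIter] using h
  | cons i H ih =>
    have := ih.vf G (G.Y_homV i) (vfIter_contDiffOn G isOpen_ne0 hg H)
    simp only [vfIter, List.length_cons]
    push_cast at this ⊢
    convert this using 1; ring

lemma Hom.congr_deg {G : CarnotSetting N m} {d d' : ℝ} {g : (Fin N → ℝ) → ℝ} (h : G.Hom d g) (e : d = d') : G.Hom d' g := e ▸ h

lemma Hom.sum (G : CarnotSetting N m) {d : ℝ} {κ : Type*} (s : Finset κ) {g : κ → (Fin N → ℝ) → ℝ} (h : ∀ i ∈ s, G.Hom d (g i)) :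
    G.Hom d (fun x => ∑ i ∈ s, g i x) := by
  intro l hl x hx
  simp only [Finset.mul_sum]
  exact Finset.sum_congr rfl fun i hi => h i hi l hl x hx

structure HomFam (G : CarnotSetting N m) (d : ℝ) {ι : Type*} (g : ι → (Fin N → ℝ) → ℝ) : Prop where
  smooth : ∀ i, ContDiffOn ℝ ∞ (g i) {0}ᶜ
  hom : ∀ i, G.Hom d (g i)
  bdd : ∀ H : List (Fin m), ∃ C, 0 ≤ C ∧ ∀ i w, G.rho w = 1 → |vfIter G.Y H (g i) w| ≤ C

lemma HomFam.bddK {G : CarnotSetting N m} {d : ℝ} {ι : Type*} {g : ι → (Fin N → ℝ) → ℝ} (h : G.HomFam d g)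
    {K : Set (Fin N → ℝ)} (hK : IsCompact K) (hK0 : (0 : Fin N → ℝ) ∉ K) (H : List (Fin m)) :
    ∃ C, 0 ≤ C ∧ ∀ i, ∀ w ∈ K, |vfIter G.Y H (g i) w| ≤ C := by
  obtain ⟨C, hC, hb⟩ := h.bdd H
  have hc : ContinuousOn (fun x => G.rho x ^ (d - H.length)) K := by
    refine G.rho_continuous.continuousOn.rpow_const fun x hx => Or.inl ?_
    exact (G.rho_pos (by rintro rfl; exact hK0 hx)).ne'
  obtain ⟨B, hB⟩ := hK.exists_bound_of_continuousOn hc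
  refine ⟨C * max B 0, by positivity, fun i w hw => ?_⟩
  have hw0 : w ≠ 0 := by rintro rfl; exact hK0 hw
  refine (((h.hom i).iter G (h.smooth i) H).le G (hb i) hw0).trans ?_
  gcongr
  exact le_max_of_le_left ((le_abs_self _).trans (hB w hw))

lemma IsDO.words (G : CarnotSetting N m) {P} (hP : IsDO G.Y P) (H : List (Fin m)) :
    IsDO G.Y (fun u => vfIter G.Y H (P u)) := by
  induction H with
  | nil => exact hP
  | cons i H ih => exact ih.vf G.Y_smooth i

lemma HomFam.DO {G : CarnotSetting N m} {d d' : ℝ} {ι : Type*} {g : ι → (Fin N → ℝ) → ℝ} (h : G.HomFam d g)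
    {P} (hP : IsDO G.Y P) (hd : ∀ i, G.Hom d' (P (g i))) : G.HomFam d' (fun i => P (g i)) where
  smooth i := hP.smooth G.Y_smooth isOpen_ne0 (h.smooth i)
  hom := hd
  bdd H := by
    obtain ⟨S, hS⟩ := (hP.words G H).bound
    obtain ⟨C, hC, hb⟩ := hS _ G.isCompact_rho_sphere
    choose B hB0 hB using h.bdd
    refine ⟨C * ∑ J ∈ S, B J, mul_nonneg hC (Finset.sum_nonneg fun J _ => hB0 J), fun i w hw => ?_⟩
    refine (hb _ isOpen_ne0 _ (h.smooth i) w ⟨hw, G.sphere_ne hw⟩).trans ?_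
    gcongr with J hJ
    exact hB J i w hw

/-! inversion -/
lemma fderiv_inv_Y (G : CarnotSetting N m) {X} (hX : G.LInv X) (x) :
    fderiv ℝ G.inv x (X x) = - G.RV (X 0) (G.inv x) := by
  -- differentiate inv (x*w) = inv w * inv x at w = 0 in direction X 0
  have h0 : HasFDerivAt G.inv (-(ContinuousLinearMap.id ℝ (Fin N → ℝ))) 0 := by
    have hi := (G.smooth_inv.differentiable (by simp) 0).hasFDerivAt
    have hm := (G.smooth_mul.differentiable (by simp) (0, G.inv 0)).hasFDerivAt
    have h1 := hm.comp (0 : Fin N → ℝ) ((hasFDerivAt_id (0 : Fin N → ℝ)).prodMk hi)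
    have e : (fun p : (Fin N → ℝ) × (Fin N → ℝ) => G.mul p.1 p.2) ∘ (fun x => (_root_.id x, G.inv x)) = fun _ => 0 := by
      ext1 x; exact G.mul_inv' x
    rw [e, G.inv_zero'] at h1
    have h2 := h1.unique (hasFDerivAt_const _ _)
    have h3 : fderiv ℝ G.inv 0 = -(ContinuousLinearMap.id ℝ (Fin N → ℝ)) := by
      ext1 v
      have h4 := congrArg (fun T => T v) h2
      simp only [ContinuousLinearMap.comp_apply] at h4
      have h5 : ((ContinuousLinearMap.id ℝ (Fin N → ℝ)).prod (fderiv ℝ G.inv 0)) v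
        = (ContinuousLinearMap.inl ℝ (Fin N → ℝ) (Fin N → ℝ)) v + (ContinuousLinearMap.inr ℝ (Fin N → ℝ) (Fin N → ℝ)) (fderiv ℝ G.inv 0 v) := by
        ext <;> simp
      have h6 := congrArg (fun T => T v) (G.fderiv_mul_zero_right 0)
      have h7 := congrArg (fun T => T (fderiv ℝ G.inv 0 v)) (G.fderiv_mul_zero_left 0)
      rw [fderiv_mul_right_eq] at h6
      rw [fderiv_mul_left_eq] at h7
      simp only [ContinuousLinearMap.comp_apply] at h6 h7
      rw [h5, map_add] at h4
      rw [h6, h7] at h4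
      simp only [ContinuousLinearMap.id_apply, ContinuousLinearMap.zero_apply] at h4
      simpa using (eq_neg_of_add_eq_zero_right h4)
    rw [← h3]; exact hi
  have hx : X x = fderiv ℝ (fun w => G.mul x w) 0 (X 0) := by
    have := hX x 0
    rwa [G.mul_zero'] at this
  have hl := ((G.cmul_left x).differentiable (by simp) 0).hasFDerivAt
  have hi := (G.smooth_inv.differentiable (by simp) (G.mul x 0)).hasFDerivAt
  have c1 := hi.comp (0 : Fin N → ℝ) hl
  have hr := ((G.cmul_right (G.inv x)).differentiable (by simp) (G.inv 0)).hasFDerivAt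
  have c2 := hr.comp (0 : Fin N → ℝ) h0
  have e : G.inv ∘ (fun w => G.mul x w) = (fun w => G.mul w (G.inv x)) ∘ G.inv := by
    ext1 w; exact G.inv_mul_rev' x w
  rw [e] at c1
  have := congrArg (fun T => T (X 0)) (c1.unique c2)
  rw [hx]
  simp only [ContinuousLinearMap.comp_apply, G.mul_zero', G.inv_zero'] at this
  rw [this]
  simp [RV]

lemma vf_comp_inv (G : CarnotSetting N m) {X} (hX : G.LInv X) {g : (Fin N → ℝ) → ℝ} {x}
    (hg : DifferentiableAt ℝ g (G.inv x)) :
    vfDeriv X (fun w => g (G.inv w)) x = - vfDeriv (G.RV (X 0)) g (G.inv x) := by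
  have hi := (G.smooth_inv.differentiable (by simp) x)
  have := (hg.hasFDerivAt.comp x hi.hasFDerivAt).fderiv
  have e : (fun w => g (G.inv w)) = g ∘ G.inv := rfl
  rw [e, vfDeriv_eq _ (hg.comp x hi), vfDeriv_eq _ hg, this, ContinuousLinearMap.comp_apply, fderiv_inv_Y G hX]
  simp

def RY (G : CarnotSetting N m) (i : Fin m) : (Fin N → ℝ) → (Fin N → ℝ) := G.RV (G.Y i 0)
lemma RY_smooth (G : CarnotSetting N m) (i) : ContDiff ℝ ∞ (G.RY i) := G.RV_contDiff _

lemma vfIter_comp_inv (G : CarnotSetting N m) {g : (Fin N → ℝ) → ℝ} (hg : ContDiffOn ℝ ∞ g {0}ᶜ) (H : List (Fin m)) :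
    ∀ x, x ≠ 0 → vfIter G.Y H (fun w => g (G.inv w)) x = (-1) ^ H.length * vfIter G.RY H g (G.inv x) := by
  induction H with
  | nil => intro x hx; simp [vfIter]
  | cons i H ih =>
    intro x hx
    simp only [vfIter]
    have hs := vfIter_contDiffOn' G.RY_smooth isOpen_ne0 hg H
    have hx' : G.inv x ∈ ({0}ᶜ : Set (Fin N → ℝ)) := fun h => hx (G.inv_eq_zero'.1 h)
    have hd := diffAt_of_on isOpen_ne0 hs hx'
    have h1 : vfDeriv (G.Y i) (vfIter G.Y H fun w => g (G.inv w)) x =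
        vfDeriv (G.Y i) (fun x => (-1) ^ H.length * vfIter G.RY H g (G.inv x)) x := by
      apply vfDeriv_congr_nhds
      filter_upwards [isOpen_ne0.mem_nhds hx] with w hw
      exact ih w hw
    have hd2 : DifferentiableAt ℝ (fun x => vfIter G.RY H g (G.inv x)) x :=
      hd.comp x (G.smooth_inv.differentiable (by simp) x)
    rw [h1, vfDeriv_const_mul _ hd2,
      vf_comp_inv G (G.Y_linv i) hd]
    simp only [List.length_cons, pow_succ, RY]; ring

lemma RY_word (G : CarnotSetting N m) (H : List (Fin m)) : IsDO G.Y (fun u => vfIter G.RY H u) := by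
  induction H with
  | nil => exact IsDO.id
  | cons i H ih => exact G.Y_field (G.RY_smooth i) ih

lemma HomFam.inv {G : CarnotSetting N m} {d : ℝ} {ι : Type*} {g : ι → (Fin N → ℝ) → ℝ} (h : G.HomFam d g) :
    G.HomFam d (fun i x => g i (G.inv x)) where
  smooth i := (h.smooth i).comp G.smooth_inv.contDiffOn (fun x hx h0 => hx (G.inv_eq_zero'.1 h0))
  hom i l hl x hx := by
    simp only [G.inv_dil hl]
    exact h.hom i l hl _ (fun h0 => hx (G.inv_eq_zero'.1 h0))
  bdd H := by
    have hK : IsCompact (G.inv '' {x | G.rho x = 1}) := G.isCompact_rho_sphere.image G.smooth_inv.continuous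
    have hK0 : (0 : Fin N → ℝ) ∉ G.inv '' {x | G.rho x = 1} := by
      rintro ⟨x, hx, h0⟩; exact G.sphere_ne hx (G.inv_eq_zero'.1 h0)
    obtain ⟨S, hS⟩ := (G.RY_word H).bound
    obtain ⟨C, hC, hb⟩ := hS _ hK
    choose B hB0 hB using h.bddK hK hK0
    refine ⟨C * ∑ J ∈ S, B J, mul_nonneg hC (Finset.sum_nonneg fun J _ => hB0 J), fun i w hw => ?_⟩
    rw [vfIter_comp_inv G (h.smooth i) H w (G.sphere_ne hw), abs_mul, abs_pow, abs_neg, abs_one, one_pow, one_mul]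
    have hm : G.inv w ∈ G.inv '' {x | G.rho x = 1} := ⟨w, hw, rfl⟩
    refine (hb _ isOpen_ne0 _ (h.smooth i) _ ⟨hm, fun h0 => hK0 (h0 ▸ hm)⟩).trans ?_
    gcongr with J hJ
    exact hB J i _ hm

lemma RY_homV (G : CarnotSetting N m) (i) : HomV G.σ 1 (G.RY i) := by
  intro l hl x
  -- mul (dil l w) (dil l x) = dil l (mul w x), differentiate in w at 0 along Y_i 0
  have h1 := ((G.cmul_right (dil G.σ l x)).differentiable (by simp) (dil G.σ l 0)).hasFDerivAt.comp (0 : Fin N → ℝ)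
    (dil_hasFDerivAt G.σ l 0)
  have h2 := (dil_hasFDerivAt G.σ l (G.mul 0 x)).comp (0 : Fin N → ℝ) ((G.cmul_right x).differentiable (by simp) 0).hasFDerivAt
  have e : (fun w => G.mul w (dil G.σ l x)) ∘ dil G.σ l = dil G.σ l ∘ (fun w => G.mul w x) := by
    ext1 w; exact G.dil_auto l hl w x
  rw [e] at h1
  have h3 := congrArg (fun T => T (G.Y i 0)) (h1.unique h2)
  have h4 := G.Y_homV i l hl 0
  simp only [ContinuousLinearMap.comp_apply, dil_zero', dilL_apply] at h3 h4
  rw [← h4] at h3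
  simp only [pow_one, map_smul] at h3 ⊢
  exact h3

lemma RY_divFree (G : CarnotSetting N m) (i) : DivFree (G.RY i) :=
  divFree_of_homV G (G.RY_smooth i) le_rfl (G.RY_homV i)

end CarnotSetting
end

end

section
open MeasureTheory Set Filter Topology
open scoped ContDiff ENNReal
noncomputable section
namespace CarnotSetting
variable {N m : ℕ}

/-- Lie bracket derivations as sums of words, with the outermost derivative separated. -/
lemma lie_words (G : CarnotSetting N m) (l : List (Fin m)) (hl : l ≠ []) :
    ∃ (n : ℕ) (s : Fin n → ℝ) (j : Fin n → Fin m) (w : Fin n → List (Fin m)), (∀ k, (w k).length + 1 = l.length) ∧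
    ∀ O : Set (Fin N → ℝ), IsOpen O → ∀ u, ContDiffOn ℝ ∞ u O → ∀ x ∈ O,
      vfDeriv (vfIterLie G.Y l) u x = ∑ k, s k * vfDeriv (G.Y (j k)) (vfIter G.Y (w k) u) x := by
  induction l with
  | nil => exact absurd rfl hl
  | cons i l ih =>
    cases l with
    | nil =>
      refine ⟨1, fun _ => 1, fun _ => i, fun _ => [], by simp, fun O hO u hu x hx => ?_⟩
      simp [vfIterLie, vfIter]
    | cons i' l =>
      obtain ⟨n, s, j, w, hw, h⟩ := ih (by simp)
      refine ⟨n + n, Fin.addCases s (fun k => - s k), Fin.addCases (fun _ => i) j,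
        Fin.addCases (fun k => j k :: w k) (fun k => w k ++ [i]), fun k => ?_, fun O hO u hu x hx => ?_⟩
      · refine Fin.addCases (fun k => ?_) (fun k => ?_) k
        · beta_reduce; rw [Fin.addCases_left]; simp [hw k]
        · beta_reduce; rw [Fin.addCases_right]; simp [hw k]
      · rw [Fin.sum_univ_add]
        simp only [Fin.addCases_left, Fin.addCases_right, vfIterLie]
        rw [vfDeriv_comm (G.Y_smooth i) (G.vfIterLie_contDiff _) hO hu hx,
          h O hO _ (vfDeriv_contDiffOn hO (G.Y_smooth i) hu) x hx]
        have h1 : vfDeriv (G.Y i) (vfDeriv (vfIterLie G.Y (i' :: l)) u) x =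
            vfDeriv (G.Y i) (fun x => ∑ k, s k * vfDeriv (G.Y (j k)) (vfIter G.Y (w k) u) x) x := by
          apply vfDeriv_congr_nhds
          filter_upwards [hO.mem_nhds hx] with y hy
          exact h O hO u hu y hy
        have hd : ∀ k, DifferentiableAt ℝ (vfDeriv (G.Y (j k)) (vfIter G.Y (w k) u)) x := fun k =>
          diffAt_of_on hO (vfIter_contDiffOn G hO hu (j k :: w k)) hx
        rw [h1, vfDeriv_sum _ (fun k _ => (hd k).const_mul _), sub_eq_add_neg, ← Finset.sum_neg_distrib]
        congr 1
        · refine Finset.sum_congr rfl fun k _ => ?_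
          rw [vfDeriv_const_mul _ (hd k)]; rfl
        · refine Finset.sum_congr rfl fun k _ => ?_
          rw [vfIter_append, neg_mul]; rfl

def eul (G : CarnotSetting N m) (x : Fin N → ℝ) : Fin N → ℝ := fun i => G.σ i * x i
lemma eul_smooth (G : CarnotSetting N m) : ContDiff ℝ ∞ G.eul := by
  unfold eul; fun_prop

lemma eul_hom (G : CarnotSetting N m) {d : ℝ} {g : (Fin N → ℝ) → ℝ} (h : G.Hom d g) {x} (hx : x ≠ 0)
    (hg : DifferentiableAt ℝ g x) : vfDeriv G.eul g x = d * g x := by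
  rw [vfDeriv_eq _ hg]
  have h1 : HasDerivAt (fun l : ℝ => dil G.σ l x) (G.eul x) 1 := by
    rw [hasDerivAt_pi]; intro i
    have := (hasDerivAt_pow (G.σ i) (1:ℝ)).mul_const (x i)
    simpa [dil, eul] using this
  have hg' : HasFDerivAt g (fderiv ℝ g x) (dil G.σ 1 x) := by rw [dil_one']; exact hg.hasFDerivAt
  have h2 := hg'.comp_hasDerivAt (1:ℝ) h1
  have h3 : HasDerivAt (fun l : ℝ => l ^ d * g x) (d * 1 ^ (d - 1) * g x) 1 :=
    (Real.hasDerivAt_rpow_const (Or.inl one_ne_zero)).mul_const _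
  have h4 : (g ∘ fun l : ℝ => dil G.σ l x) =ᶠ[𝓝 1] fun l : ℝ => l ^ d * g x := by
    filter_upwards [lt_mem_nhds (show (0:ℝ) < 1 by norm_num)] with l hl
    exact h l hl x hx
  have := (h2.congr_of_eventuallyEq h4.symm).unique h3
  simpa using this

lemma eul_frame (G : CarnotSetting N m) : ∃ (F : Fin N → List (Fin m)) (c : Fin N → (Fin N → ℝ) → ℝ),
    (∀ k, F k ≠ []) ∧ (∀ k, ContDiff ℝ ∞ (c k)) ∧ (∀ k, G.Hom ((F k).length) (c k)) ∧
    (∀ x, G.eul x = ∑ k, c k x • vfIterLie G.Y (F k) x) ∧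
    ∀ x, ∑ k, vfDeriv (vfIterLie G.Y (F k)) (c k) x = G.qq := by
  obtain ⟨F, hF, b, hb⟩ := G.exists_frame
  obtain ⟨c, hc, he⟩ := G.LF_expand b G.eul_smooth
  have hLV : ∀ k, G.LV (b k) = vfIterLie G.Y (F k) := fun k => by
    rw [hb k]; exact (G.linv_eq_LV (G.vfIterLie_linv (F k))).symm
  simp_rw [hLV] at he
  refine ⟨F, c, hF, hc, fun k l hl x hx => ?_, he, fun x => ?_⟩
  · -- independence
    have hli : LinearIndependent ℝ (fun k => vfIterLie G.Y (F k) x) := by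
      have : (fun k => vfIterLie G.Y (F k) x) = (fderiv ℝ (fun w => G.mul x w) 0) ∘ b := by
        ext1 k; rw [← hLV k]; rfl
      rw [this]
      refine b.linearIndependent.map' (fderiv ℝ (fun w => G.mul x w) 0).toLinearMap ?_
      have h := G.det_mul_left x 0
      refine LinearMap.ker_eq_bot.2 ?_
      have hu : IsUnit (LinearMap.det (fderiv ℝ (fun w => G.mul x w) 0).toLinearMap) := by
        have e : LinearMap.det (fderiv ℝ (fun w => G.mul x w) 0).toLinearMap = 1 := h
        rw [e]; exact isUnit_one
      exact ((Module.End.isUnit_iff _).1 ((LinearMap.isUnit_iff_isUnit_det _).2 hu)).1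
    have h1 : G.eul (dil G.σ l x) = dil G.σ l (G.eul x) := by
      ext i; simp [eul, dil]; ring
    rw [he, he x] at h1
    have h2 := congrArg (dilL G.σ l⁻¹) h1
    rw [dilL_apply, dilL_apply, dil_inv_dil _ hl] at h2
    have h3 : dil G.σ l⁻¹ (∑ k, c k (dil G.σ l x) • vfIterLie G.Y (F k) (dil G.σ l x)) =
        ∑ k, (c k (dil G.σ l x) * (l ^ (F k).length)⁻¹) • vfIterLie G.Y (F k) x := by
      rw [← dilL_apply, map_sum]
      refine Finset.sum_congr rfl fun k _ => ?_
      have h4 := G.vfIterLie_homV (F k) l hl x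
      have h5 : vfIterLie G.Y (F k) (dil G.σ l x) = (l ^ (F k).length)⁻¹ • dil G.σ l (vfIterLie G.Y (F k) x) := by
        rw [← h4, smul_smul, inv_mul_cancel₀ (by positivity), one_smul]
      rw [h5, map_smul, map_smul, dilL_apply, dil_inv_dil _ hl, smul_smul]
    rw [h3] at h2
    have h6 := sub_eq_zero.2 h2
    rw [← Finset.sum_sub_distrib] at h6
    simp_rw [← sub_smul] at h6
    have h7 := Fintype.linearIndependent_iff.1 hli _ h6 k
    rw [Real.rpow_natCast]
    have : (0:ℝ) < l ^ (F k).length := by positivity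
    field_simp at h7
    linarith
  · -- divergence
    have hV : ∀ k, ContDiff ℝ ∞ (vfIterLie G.Y (F k)) := fun k => G.vfIterLie_contDiff _
    have hdiv : ∀ k, DivFree (vfIterLie G.Y (F k)) := fun k =>
      divFree_of_homV G (hV k) (List.length_pos_iff.2 (hF k)) (G.vfIterLie_homV _)
    have h1 : ∀ j, fderiv ℝ (fun w => G.eul w j) x (Pi.single j 1) = G.σ j := by
      intro j
      have : (fun w => G.eul w j) = fun w => (G.σ j : ℝ) * w j := rfl
      rw [this]
      have h := ((hasFDerivAt_apply (𝕜 := ℝ) j x).const_mul (G.σ j : ℝ)).fderiv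
      rw [h]; simp
    have h2 : ∀ j, fderiv ℝ (fun w => G.eul w j) x (Pi.single j 1) =
        ∑ k, vfIterLie G.Y (F k) x j * fderiv ℝ (c k) x (Pi.single j 1) := by
      intro j
      have e : (fun w => G.eul w j) = fun w => ∑ k, c k w * vfIterLie G.Y (F k) w j := by
        ext1 w; rw [he w]; simp
      have hc' : ∀ k, DifferentiableAt ℝ (c k) x := fun k => (hc k).differentiable (by simp) x
      have hV' : ∀ k, DifferentiableAt ℝ (fun w => vfIterLie G.Y (F k) w j) x := fun k =>
        ((coord_contDiff j).comp (hV k)).differentiable (by simp) x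
      rw [e, fderiv_fun_sum (fun k _ => (hc' k).fun_mul (hV' k)), ContinuousLinearMap.sum_apply]
      refine Finset.sum_congr rfl fun k _ => ?_
      rw [fderiv_fun_mul (hc' k) (hV' k)]
      simp [hdiv k j x]
    have h3 : ∀ k, vfDeriv (vfIterLie G.Y (F k)) (c k) x = ∑ j, vfIterLie G.Y (F k) x j * fderiv ℝ (c k) x (Pi.single j 1) := fun k => by
      rw [vfDeriv_eq _ ((hc k).differentiable (by simp) x)]; exact fderiv_apply_eq_sum _ _
    simp_rw [h3]
    rw [Finset.sum_comm]
    unfold qq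
    refine Finset.sum_congr rfl fun j _ => ?_
    rw [← h2, h1]

lemma NF.comp_words (G : CarnotSetting N m) {P} (h : IsDO G.Y P) {c : (Fin N → ℝ) → ℝ} (hc : ContDiff ℝ ∞ c)
    (w : List (Fin m)) : IsDO G.Y (fun u => vfIter G.Y w (fun x => c x * P u x)) :=
  (IsDO.smul hc h).words G w

/-- Euler identity in divergence form -/
lemma euler (G : CarnotSetting N m) : ∃ T : Fin m → ((Fin N → ℝ) → ℝ) → (Fin N → ℝ) → ℝ,
    (∀ j, IsDO G.Y (T j)) ∧
    (∀ j d g, ContDiffOn ℝ ∞ g {0}ᶜ → G.Hom d g → G.Hom (d + 1) (T j g)) ∧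
    ∀ d g, ContDiffOn ℝ ∞ g {0}ᶜ → G.Hom d g → ∀ x, x ≠ 0 →
      (d + G.qq) * g x = ∑ j, vfDeriv (G.Y j) (T j g) x := by
  obtain ⟨F, c, hF, hc, hcH, he, hq⟩ := G.eul_frame
  choose n s j w hw hwords using fun k => G.lie_words (F k) (hF k)
  classical
  have hDO : ∀ k (w : List (Fin m)), IsDO G.Y (fun u => vfIter G.Y w (fun x => c k x * u x)) := fun k w =>
    (IsDO.smul (hc k) IsDO.id).words G w
  have hcg : ∀ k {g : (Fin N → ℝ) → ℝ}, ContDiffOn ℝ ∞ g {0}ᶜ → ContDiffOn ℝ ∞ (fun x => c k x * g x) {0}ᶜ :=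
    fun k g hg => (hc k).contDiffOn.mul hg
  refine ⟨fun j' u x => ∑ k, ∑ p, (if j k p = j' then s k p else 0) * vfIter G.Y (w k p) (fun x => c k x * u x) x,
    fun j' => ?_, fun j' d g hg h => ?_, fun d g hg h x hx => ?_⟩
  · exact IsDO.sum _ fun k => IsDO.sum _ fun p => IsDO.smul (c := fun _ => if j k p = j' then s k p else 0) contDiff_const (hDO k _)
  · refine Hom.sum G _ fun k _ => Hom.sum G _ fun p _ => ?_
    have h1 : G.Hom ((F k).length + d) (fun x => c k x * g x) := by
      intro l hl x hx
      simp only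
      rw [hcH k l hl x hx, h l hl x hx, Real.rpow_add hl]; ring
    have h2 := (h1.iter G (hcg k hg) (w k p)).congr_deg (d' := d + 1) (by rw [← hw k p]; push_cast; ring)
    intro l hl x hx
    simp only [h2 l hl x hx]; ring
  · have hgd := diffAt_of_on isOpen_ne0 hg hx
    have hcd : ∀ k, DifferentiableAt ℝ (c k) x := fun k => (hc k).differentiable (by simp) x
    have h1 : ∑ k, vfDeriv (vfIterLie G.Y (F k)) (fun x => c k x * g x) x = (d + G.qq) * g x := by
      simp_rw [fun k => vfDeriv_mul (X := vfIterLie G.Y (F k)) (hcd k) hgd]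
      rw [Finset.sum_add_distrib, ← Finset.sum_mul, hq x, add_mul, add_comm]
      congr 1
      rw [← G.eul_hom h hx hgd, vfDeriv_eq _ hgd, he x, map_sum]
      refine Finset.sum_congr rfl fun k _ => ?_
      rw [map_smul, vfDeriv_eq _ hgd]; rfl
    rw [← h1]
    have hd : ∀ k p, DifferentiableAt ℝ (vfIter G.Y (w k p) (fun x => c k x * g x)) x := fun k p =>
      diffAt_of_on isOpen_ne0 (vfIter_contDiffOn G isOpen_ne0 (hcg k hg) _) hx
    simp_rw [fun k => hwords k _ isOpen_ne0 _ (hcg k hg) x hx]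
    have h2 : ∀ j', vfDeriv (G.Y j') (fun x => ∑ k, ∑ p, (if j k p = j' then s k p else 0) * vfIter G.Y (w k p) (fun x => c k x * g x) x) x
      = ∑ k, ∑ p, (if j k p = j' then s k p else 0) * vfDeriv (G.Y j') (vfIter G.Y (w k p) (fun x => c k x * g x)) x := by
      intro j'
      rw [vfDeriv_sum _ (fun k _ => DifferentiableAt.fun_sum fun p _ => (hd k p).const_mul _)]
      refine Finset.sum_congr rfl fun k _ => ?_
      rw [vfDeriv_sum _ (fun p _ => (hd k p).const_mul _)]
      refine Finset.sum_congr rfl fun p _ => ?_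
      rw [vfDeriv_const_mul _ (hd k p)]
    simp_rw [h2]
    rw [Finset.sum_comm]
    refine Finset.sum_congr rfl fun k _ => ?_
    rw [Finset.sum_comm]
    refine Finset.sum_congr rfl fun p _ => ?_
    simp [ite_mul]

end CarnotSetting
end

end

section
open MeasureTheory Set Filter Topology
open scoped ContDiff ENNReal
noncomputable section
namespace CarnotSetting
variable {N m : ℕ}

lemma contDiff_off_zero {f : (Fin N → ℝ) → ℝ} (h : ContDiffOn ℝ ∞ f {0}ᶜ) (h0 : ∀ᶠ x in 𝓝 (0 : Fin N → ℝ), f x = 0) :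
    ContDiff ℝ ∞ f := by
  rw [contDiff_iff_contDiffAt]
  intro x
  by_cases hx : x = 0
  · subst hx
    exact (contDiffAt_const (c := (0:ℝ))).congr_of_eventuallyEq h0
  · exact h.contDiffAt (isOpen_ne0.mem_nhds hx)

/-- cutoff `1 - χ(D_n x)` package -/
lemma exists_rho_support (G : CarnotSetting N m) {χ : (Fin N → ℝ) → ℝ} (h : HasCompactSupport χ) :
    ∃ R, 0 < R ∧ ∀ x, χ x ≠ 0 → G.rho x ≤ R := by
  obtain ⟨C, hC⟩ := h.isCompact.exists_bound_of_continuousOn G.rho_continuous.continuousOn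
  refine ⟨max C 1, by positivity, fun x hx => ?_⟩
  have := hC x (subset_tsupport _ hx)
  rw [Real.norm_eq_abs, abs_of_nonneg (G.rho_nonneg x)] at this
  exact this.trans (le_max_left _ _)

lemma sing_ibp (G : CarnotSetting N m) {X : (Fin N → ℝ) → (Fin N → ℝ)} (hX : ContDiff ℝ ∞ X) (hd : DivFree X)
    (hh : HomV G.σ 1 X) {d : ℝ} (hdq : 1 - G.qq < d) {g : (Fin N → ℝ) → ℝ} (hg : ContDiffOn ℝ ∞ g {0}ᶜ)
    (hgh : G.Hom d g) {φ : (Fin N → ℝ) → ℝ} (hφ : Test φ) :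
    ∫ x, vfDeriv X g x * φ x = - ∫ x, g x * vfDeriv X φ x := by
  obtain ⟨χ, hχ, hχ01, hχ1, hχs⟩ := exists_cutoff N (r := 2) (r' := 1) one_pos one_lt_two
  obtain ⟨R, hR, hRχ⟩ := exists_rho_support G hχ.2
  set e : ℕ → (Fin N → ℝ) → ℝ := fun n x => 1 - χ (dil G.σ (n+1) x) with he
  have hn : ∀ n : ℕ, (0:ℝ) < n + 1 := fun n => by positivity
  have hes : ∀ n, ContDiff ℝ ∞ (e n) := fun n => contDiff_const.sub (hχ.1.comp (dil_contDiff _ _))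
  have he01 : ∀ n x, |e n x| ≤ 1 := fun n x => by
    rw [abs_le]; have := hχ01 (dil G.σ (n+1) x); simp only [he]; constructor <;> linarith
  have hlim : ∀ x, x ≠ 0 → ∀ᶠ n in atTop, e n x = 1 := by
    intro x hx
    have hρ := G.rho_pos hx
    filter_upwards [eventually_gt_atTop ⌈R / G.rho x⌉₊] with n hn'
    have : χ (dil G.σ (n+1) x) = 0 := by
      by_contra h
      have h1 := hRχ _ h
      rw [G.rho_dil (hn n)] at h1
      have h2 : R / G.rho x < n := (Nat.le_ceil _).trans_lt (by exact_mod_cast hn')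
      rw [div_lt_iff₀ hρ] at h2
      nlinarith
    simp [he, this]
  have hsm : ∀ n, ContDiff ℝ ∞ (fun x => g x * e n x) := by
    intro n
    refine contDiff_off_zero (hg.mul (hes n).contDiffOn) ?_
    have hc : Continuous (fun x => dil G.σ ((n:ℝ)+1) x) := (dil_contDiff _ _).continuous
    have h0 : ∀ᶠ x in 𝓝 (0:Fin N → ℝ), dil G.σ ((n:ℝ)+1) x ∈ Metric.ball (0:Fin N → ℝ) 1 :=
      hc.continuousAt.eventually_mem (Metric.isOpen_ball.mem_nhds (by simp [dil_zero']))
    filter_upwards [h0] with x hx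
    simp only [he]
    rw [hχ1 _ (Metric.ball_subset_closedBall hx)]; simp
  have hXg : G.Hom (d - 1) (vfDeriv X g) := by simpa using hgh.vf G hh hg
  have hXgs : ContDiffOn ℝ ∞ (vfDeriv X g) {0}ᶜ := vfDeriv_contDiffOn isOpen_ne0 hX hg
  have i1 : Integrable (fun x => vfDeriv X g x * φ x) :=
    hXg.integrable_mul G (by linarith) hXgs.continuousOn hφ.1.continuous hφ.2
  have i2 : Integrable (fun x => g x * vfDeriv X φ x) :=
    hgh.integrable_mul G (by linarith) hg.continuousOn (hφ.vf hX).1.continuous (hφ.vf hX).2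
  have i3 : Integrable (fun x => g x * vfDeriv X χ x) :=
    hgh.integrable_mul G (by linarith) hg.continuousOn (hχ.vf hX).1.continuous (hχ.vf hX).2
  have key : ∀ n, (∫ x, e n x * (vfDeriv X g x * φ x)) + (∫ x, g x * vfDeriv X (e n) x * φ x)
      = - ∫ x, e n x * (g x * vfDeriv X φ x) := by
    intro n
    have h := ibp' hX hd (hsm n) hφ
    rw [show (fun x => e n x * (g x * vfDeriv X φ x)) = fun x => g x * e n x * vfDeriv X φ x by ext x; ring, ← h]
    rw [← integral_add]
    · refine integral_congr_ae ?_
      filter_upwards [G.ae_ne_zero] with x hx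
      rw [vfDeriv_mul (diffAt_of_on isOpen_ne0 hg hx) ((hes n).differentiable (by simp) x)]
      ring
    · exact i1.bdd_mul (hes n).continuous.aestronglyMeasurable (Eventually.of_forall (fun x => he01 n x))
    · have := hgh.integrable_mul G (by linarith) hg.continuousOn (φ := fun x => vfDeriv X (e n) x * φ x)
        ((vfDeriv_contDiff hX (hes n)).mul hφ.1).continuous hφ.2.mul_left
      refine this.congr (Eventually.of_forall fun x => by simp only; ring)
  have hve : ∀ n x, vfDeriv X (e n) x = - ((n+1) * vfDeriv X χ (dil G.σ (n+1) x)) := by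
    intro n x
    simp only [he]
    have h2 : DifferentiableAt ℝ (fun w => χ (dil G.σ ((n:ℝ)+1) w)) x :=
      ((hχ.1.comp (dil_contDiff _ _)).differentiable (by simp)) x
    rw [vfDeriv_sub (differentiableAt_const _) h2, vfDeriv_const, vfDeriv_comp_dil G hh (hn n) x (hχ.1.differentiable (by simp) _)]
    simp
  obtain ⟨M, hM⟩ := hφ.1.continuous.bounded_above_of_compact_support hφ.2
  have hM0 : 0 ≤ M := (norm_nonneg _).trans (hM 0)
  set I := ∫ x, |g x * vfDeriv X χ x| with hI
  have err : ∀ n : ℕ, |∫ x, g x * vfDeriv X (e n) x * φ x| ≤ ((n:ℝ)+1) ^ (1 - d - G.qq) * (M * I) := by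
    intro n
    have hI2 : ∫ x, |g (dil G.σ (n+1) x) * vfDeriv X χ (dil G.σ (n+1) x)| = (((n:ℝ)+1) ^ (∑ i, G.σ i))⁻¹ * I :=
      integral_dil G.σ (hn n) (fun x => |g x * vfDeriv X χ x|)
    have hi2 : Integrable (fun x => |g (dil G.σ (n+1) x) * vfDeriv X χ (dil G.σ (n+1) x)|) :=
      (integrable_dil G.σ (hn n) (f := fun x => |g x * vfDeriv X χ x|)).2 i3.abs
    have : |∫ x, g x * vfDeriv X (e n) x * φ x| ≤
        ∫ x, (((n:ℝ)+1) ^ (1-d) * M) * |g (dil G.σ (n+1) x) * vfDeriv X χ (dil G.σ (n+1) x)| := by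
      rw [← Real.norm_eq_abs]
      refine norm_integral_le_of_norm_le (hi2.const_mul _) ?_
      filter_upwards [G.ae_ne_zero] with x hx
      rw [hgh _ (hn n) x hx, hve, norm_mul, Real.norm_eq_abs, abs_mul, abs_mul, abs_mul, abs_neg, abs_mul,
        abs_of_pos (hn n), abs_of_pos (Real.rpow_pos_of_pos (hn n) d), Real.rpow_sub (hn n), Real.rpow_one]
      have := hM x
      have hp := Real.rpow_pos_of_pos (hn n) d
      have e1 : (((n:ℝ)+1) / ((n:ℝ)+1)^d * M) * (((n:ℝ)+1)^d * |g x| * |vfDeriv X χ (dil G.σ (n+1) x)|)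
        = |g x| * (((n:ℝ)+1) * |vfDeriv X χ (dil G.σ (n+1) x)|) * M := by field_simp
      rw [e1]
      gcongr
    refine this.trans (le_of_eq ?_)
    rw [integral_const_mul, hI2, Real.rpow_sub (hn n) (1-d), qq_cast, Real.rpow_natCast]
    field_simp
  have l0 : Tendsto (fun n : ℕ => ∫ x, g x * vfDeriv X (e n) x * φ x) atTop (𝓝 0) := by
    refine squeeze_zero_norm err ?_
    have h1 : Tendsto (fun n : ℕ => ((n:ℝ)+1) ^ (1 - d - G.qq)) atTop (𝓝 0) := by
      have := (tendsto_rpow_neg_atTop (y := d + G.qq - 1) (by linarith)).comp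
        (tendsto_atTop_add_const_right atTop (1:ℝ) tendsto_natCast_atTop_atTop)
      convert this using 2 with n
      simp only [Function.comp]; congr 1; ring
    simpa using h1.mul_const (M * I)
  have dct : ∀ F : (Fin N → ℝ) → ℝ, Integrable F → Tendsto (fun n => ∫ x, e n x * F x) atTop (𝓝 (∫ x, F x)) := by
    intro F hF
    refine tendsto_integral_of_dominated_convergence (fun x => |F x|) (fun n => ?_) hF.abs (fun n => ?_) ?_
    · exact (hes n).continuous.aestronglyMeasurable.mul hF.1
    · refine Eventually.of_forall fun x => ?_
      rw [norm_mul]; exact mul_le_of_le_one_left (norm_nonneg _) (he01 n x)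
    · filter_upwards [G.ae_ne_zero] with x hx
      refine tendsto_const_nhds.congr' ?_
      filter_upwards [hlim x hx] with n h; rw [h, one_mul]
  have L1 := (dct _ i1).add l0
  have L2 := (dct _ i2).neg
  rw [add_zero] at L1
  exact tendsto_nhds_unique L1 (L2.congr fun n => (key n).symm)

lemma Hom.integrable_mul' (G : CarnotSetting N m) {d : ℝ} (hd : -G.qq < d) {g : (Fin N → ℝ) → ℝ} (h : G.Hom d g)
    (hc : ContinuousOn g {0}ᶜ) {φ : (Fin N → ℝ) → ℝ} (hφ : Test φ) : Integrable (fun x => g x * φ x) :=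
  h.integrable_mul G hd hc hφ.1.continuous hφ.2

/-- Hardy inequality -/
lemma hardy (G : CarnotSetting N m) : ∃ C, 0 < C ∧ ∀ ψ : (Fin N → ℝ) → ℝ, Test ψ →
    Integrable (fun x => (G.rho x ^ (-2:ℝ)) * ψ x ^ 2) ∧
    ∫ x, (G.rho x ^ (-2:ℝ)) * ψ x ^ 2 ≤ C * ∑ j, n2 volume (vfDeriv (G.Y j) ψ) ^ 2 := by
  obtain ⟨T, hT, hTh, hTe⟩ := G.euler
  have hq := G.qq_gt
  have hr : G.Hom (-2) (fun x => G.rho x ^ (-2:ℝ)) := G.rho_rpow_hom (-2)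
  have hrs : ContDiffOn ℝ ∞ (fun x => G.rho x ^ (-2:ℝ)) {0}ᶜ :=
    G.rho_smooth.rpow_const_of_ne (fun x hx => (G.rho_pos hx).ne')
  set K := fun j => T j (fun x => G.rho x ^ (-2:ℝ)) with hK
  have hKs : ∀ j, ContDiffOn ℝ ∞ (K j) {0}ᶜ := fun j => (hT j).smooth G.Y_smooth isOpen_ne0 hrs
  have hKh : ∀ j, G.Hom (-1) (K j) := fun j => (hTh j _ _ hrs hr).congr_deg (by norm_num)
  choose B hB0 hB using fun j => (hKh j).exists_le G (hKs j).continuousOn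
  set M : ℝ := ∑ j, B j with hM
  have hM0 : 0 ≤ M := Finset.sum_nonneg fun j _ => hB0 j
  -- constant
  set q := G.qq - 2 with hqd
  have hq0 : 0 < q := by linarith
  refine ⟨4 * (M + 1) ^ 2 * (m + 1) / q ^ 2, by positivity, fun ψ hψ => ?_⟩
  have hψ2 : Test (fun x => ψ x * ψ x) := hψ.mul_smooth hψ.1
  have i0 : Integrable (fun x => (G.rho x ^ (-2:ℝ)) * ψ x ^ 2) := by
    refine (hr.integrable_mul' G (by linarith) hrs.continuousOn hψ2).congr (Eventually.of_forall fun x => ?_)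
    simp only; ring
  refine ⟨i0, ?_⟩
  set J := ∫ x, (G.rho x ^ (-2:ℝ)) * ψ x ^ 2 with hJ
  have iK : ∀ j, Integrable (fun x => vfDeriv (G.Y j) (K j) x * (ψ x * ψ x)) := fun j =>
    ((hKh j).vf G (G.Y_homV j) (hKs j)).integrable_mul' G (by norm_num; linarith)
      (vfDeriv_contDiffOn isOpen_ne0 (G.Y_smooth j) (hKs j)).continuousOn hψ2
  have h1 : q * J = ∑ j, ∫ x, vfDeriv (G.Y j) (K j) x * (ψ x * ψ x) := by
    rw [hJ, ← integral_const_mul, ← integral_finsetSum _ (fun j _ => iK j)]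
    refine integral_congr_ae ?_
    filter_upwards [G.ae_ne_zero] with x hx
    have := hTe _ _ hrs hr x hx
    rw [← Finset.sum_mul, ← this, hqd]; ring
  have h2 : ∀ j, ∫ x, vfDeriv (G.Y j) (K j) x * (ψ x * ψ x) ≤
      q / (2 * (m+1)) * J + 2 * (M+1)^2 * (m+1) / q * n2 volume (vfDeriv (G.Y j) ψ) ^ 2 := by
    intro j
    rw [sing_ibp G (G.Y_smooth j) (G.Y_divFree j) (G.Y_homV j) (d := -1) (by linarith) (hKs j) (hKh j) hψ2]
    rw [n2_sq (hψ.Y G j).memLp, hJ, ← integral_const_mul, ← integral_const_mul, ← integral_neg, ← integral_add (i0.const_mul _)]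
    · refine integral_mono_ae ?_ ?_ ?_
      · exact ((hKh j).integrable_mul' G (by linarith) (hKs j).continuousOn (hψ2.Y G j)).neg
      · refine (i0.const_mul _).add (Integrable.const_mul ?_ _)
        have := ((hψ.Y G j).mul_smooth (hψ.Y G j).1).integrable
        refine this.congr (Eventually.of_forall fun x => ?_)
        simp only; ring
      · filter_upwards [G.ae_ne_zero] with x hx
        have hρ := G.rho_pos hx
        have hb := hB j x hx
        have hBM : B j ≤ M + 1 := (Finset.single_le_sum (f := B) (fun j _ => hB0 j) (Finset.mem_univ j)).trans (by linarith)
        have e2 : G.rho x ^ (-2:ℝ) = ((G.rho x)⁻¹) ^ 2 := by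
          rw [Real.rpow_neg hρ.le]; norm_num
        have e1 : G.rho x ^ (-1:ℝ) = (G.rho x)⁻¹ := by
          rw [Real.rpow_neg hρ.le]; norm_num
        rw [vfDeriv_mul (hψ.1.differentiable (by simp) x) (hψ.1.differentiable (by simp) x), e2]
        rw [e1] at hb
        have hr0 : 0 ≤ (G.rho x)⁻¹ := by positivity
        set r := (G.rho x)⁻¹
        set a := ψ x
        set b := vfDeriv (G.Y j) ψ x
        have hk : |K j x| ≤ (M+1) * r := hb.trans (by gcongr)
        have s1 : -(K j x * (b * a + a * b)) ≤ 2 * ((M+1) * |b|) * (r * |a|) := by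
          calc -(K j x * (b * a + a * b)) ≤ |K j x * (b * a + a * b)| := neg_le_abs _
            _ = |K j x| * (2 * (|a| * |b|)) := by
                rw [abs_mul, show b * a + a * b = 2 * (a*b) by ring, abs_mul, abs_mul]; norm_num
            _ ≤ (M+1) * r * (2 * (|a| * |b|)) := by gcongr
            _ = _ := by ring
        refine s1.trans ?_
        set p : ℝ := q / (m+1) with hp
        have hp0 : 0 < p := by positivity
        have e3 : q / (2 * (m+1)) = p / 2 := by rw [hp]; field_simp
        have e4 : 2 * (M+1)^2 * (m+1) / q = 2 * (M+1)^2 / p := by rw [hp]; field_simp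
        rw [e3, e4, ← sq_abs a, ← sq_abs b]
        have : 0 ≤ (p * (r * |a|) - 2 * ((M+1) * |b|))^2 / (2 * p) := by positivity
        have e5 : (p * (r * |a|) - 2 * ((M+1) * |b|))^2 / (2 * p) = p / 2 * (r^2 * |a|^2) + 2 * (M+1)^2 / p * |b|^2
          - 2 * ((M+1) * |b|) * (r * |a|) := by field_simp; ring
        linarith
    · refine Integrable.const_mul ?_ _
      have := ((hψ.Y G j).mul_smooth (hψ.Y G j).1).integrable
      refine this.congr (Eventually.of_forall fun x => ?_)
      simp only; ring
  have hJ0 : 0 ≤ J := integral_nonneg fun x => mul_nonneg (Real.rpow_nonneg (G.rho_nonneg x) _) (sq_nonneg _)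
  have h3 : q * J ≤ m * (q / (2 * (m+1)) * J) + 2 * (M+1)^2 * (m+1) / q * ∑ j, n2 volume (vfDeriv (G.Y j) ψ) ^ 2 := by
    rw [h1]
    refine (Finset.sum_le_sum fun j _ => h2 j).trans (le_of_eq ?_)
    rw [Finset.sum_add_distrib, Finset.sum_const, ← Finset.mul_sum]; simp
  have h4 : (m:ℝ) * (q / (2 * (m+1)) * J) ≤ q / 2 * J := by
    rw [← mul_assoc]
    refine mul_le_mul_of_nonneg_right ?_ hJ0
    rw [mul_div_assoc', div_le_div_iff₀ (by positivity) (by norm_num)]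
    nlinarith
  have h5 : q / 2 * J ≤ 2 * (M+1)^2 * (m+1) / q * ∑ j, n2 volume (vfDeriv (G.Y j) ψ) ^ 2 := by linarith
  calc J = 2 / q * (q / 2 * J) := by field_simp
    _ ≤ 2 / q * (2 * (M+1)^2 * (m+1) / q * ∑ j, n2 volume (vfDeriv (G.Y j) ψ) ^ 2) := by gcongr
    _ = _ := by field_simp; ring

end CarnotSetting
end

end

section
open MeasureTheory Set Filter Topology
open scoped ContDiff ENNReal
noncomputable section
namespace CarnotSetting
variable {N m : ℕ}

lemma n2_eq_norm {f : (Fin N → ℝ) → ℝ} (h : MemLp f 2 volume) : ‖h.toLp f‖ = n2 volume f := Lp.norm_toLp f h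

lemma riesz_abs {V H : Type*} [AddCommGroup V] [Module ℝ V] [NormedAddCommGroup H] [InnerProductSpace ℝ H] [CompleteSpace H]
    (Φ : V →ₗ[ℝ] H) (ℓ : V →ₗ[ℝ] ℝ) {C : ℝ} (hC : 0 ≤ C) (hb : ∀ f : V, |ℓ f| ≤ C * ‖Φ f‖) :
    ∃ h : H, ‖h‖ ≤ C ∧ ∀ f, ℓ f = inner ℝ h (Φ f) := by
  obtain ⟨s, hs⟩ := Φ.rangeRestrict.exists_rightInverse_of_surjective Φ.range_rangeRestrict
  have hs' : ∀ y, Φ (s y) = y := fun y => by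
    have := LinearMap.congr_fun hs y
    exact congrArg Subtype.val this
  let L : Φ.range →L[ℝ] ℝ := (ℓ.comp s).mkContinuous C (fun y => by
    have := hb (s y); rw [hs'] at this; exact this)
  obtain ⟨g, hg1, hg2⟩ := exists_extension_norm_eq (𝕜 := ℝ) Φ.range L
  refine ⟨(InnerProductSpace.toDual ℝ H).symm g, ?_, fun f => ?_⟩
  · rw [LinearIsometryEquiv.norm_map, hg2]
    exact LinearMap.mkContinuous_norm_le _ hC _
  · rw [InnerProductSpace.toDual_symm_apply]
    have e1 : g (Φ f) = ℓ (s ⟨Φ f, LinearMap.mem_range_self _ _⟩) := hg1 ⟨Φ f, LinearMap.mem_range_self _ _⟩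
    have e2 := hb (f - s ⟨Φ f, LinearMap.mem_range_self _ _⟩)
    rw [map_sub, map_sub, hs', sub_self, norm_zero, mul_zero] at e2
    rw [e1]; exact sub_eq_zero.1 (abs_nonpos_iff.1 e2)

lemma riesz (V : Submodule ℝ ((Fin N → ℝ) → ℝ)) (Φ : ((Fin N → ℝ) → ℝ) → (Fin N → ℝ) → ℝ)
    (hadd : ∀ f ∈ V, ∀ g ∈ V, Φ (f + g) = Φ f + Φ g) (hsmul : ∀ c : ℝ, ∀ f ∈ V, Φ (c • f) = c • Φ f)
    (hmem : ∀ f ∈ V, MemLp (Φ f) 2 volume) (ℓ : ((Fin N → ℝ) → ℝ) → ℝ)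
    (ladd : ∀ f ∈ V, ∀ g ∈ V, ℓ (f + g) = ℓ f + ℓ g) (lsmul : ∀ c : ℝ, ∀ f ∈ V, ℓ (c • f) = c * ℓ f)
    {C : ℝ} (hC : 0 ≤ C) (hb : ∀ f ∈ V, |ℓ f| ≤ C * n2 volume (Φ f)) :
    ∃ h, MemLp h 2 volume ∧ n2 volume h ≤ C ∧ ∀ f ∈ V, ℓ f = ∫ x, h x * Φ f x := by
  let Φ' : V →ₗ[ℝ] Lp ℝ 2 (volume : Measure (Fin N → ℝ)) :=
    { toFun := fun f => (hmem f f.2).toLp (Φ f)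
      map_add' := fun f g => by
        rw [← MemLp.toLp_add]
        exact MemLp.toLp_congr _ _ (by rw [← hadd f f.2 g g.2]; rfl)
      map_smul' := fun c f => by
        rw [RingHom.id_apply, ← MemLp.toLp_const_smul]
        exact MemLp.toLp_congr _ _ (by rw [← hsmul c f f.2]; rfl) }
  let ℓ' : V →ₗ[ℝ] ℝ :=
    { toFun := fun f => ℓ f
      map_add' := fun f g => ladd f f.2 g g.2
      map_smul' := fun c f => lsmul c f f.2 }
  have hb' : ∀ f : V, |ℓ' f| ≤ C * ‖Φ' f‖ := fun f => by
    have := hb f f.2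
    rw [← n2_eq_norm (hmem f f.2)] at this; exact this
  obtain ⟨h, hn, hh⟩ := riesz_abs Φ' ℓ' hC hb'
  refine ⟨h, Lp.memLp h, hn, fun f hf => ?_⟩
  have h1 : ℓ f = inner ℝ h (Φ' ⟨f, hf⟩) := hh ⟨f, hf⟩
  rw [h1, L2.inner_def]
  refine integral_congr_ae ?_
  have := (hmem f hf).coeFn_toLp
  filter_upwards [this] with x hx
  have e : (Φ' ⟨f, hf⟩ : (Fin N → ℝ) → ℝ) x = Φ f x := hx
  rw [e]; simp [mul_comm]

lemma cs (f g : (Fin N → ℝ) → ℝ) (hf : MemLp f 2 volume) (hg : MemLp g 2 volume) :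
    |∫ x, f x * g x| ≤ n2 volume f * n2 volume g := by
  have h := norm_inner_le_norm (𝕜 := ℝ) (hf.toLp f) (hg.toLp g)
  rw [n2_eq_norm, n2_eq_norm, L2.inner_def] at h
  refine le_trans (le_of_eq ?_) h
  rw [← Real.norm_eq_abs]; congr 1
  refine integral_congr_ae ?_
  filter_upwards [hf.coeFn_toLp, hg.coeFn_toLp] with x h1 h2
  rw [h1, h2]; simp [mul_comm]

def tests (N : ℕ) : Submodule ℝ ((Fin N → ℝ) → ℝ) where
  carrier := {f | Test f}
  add_mem' h h' := h.add h'
  zero_mem' := Test.zero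
  smul_mem' c _ h := h.const_mul c

def wt (G : CarnotSetting N m) (x : Fin N → ℝ) : ℝ := 1 + G.rho x
lemma wt_pos (G : CarnotSetting N m) (x) : 0 < G.wt x := by have := G.rho_nonneg x; unfold wt; linarith
lemma wt_ge (G : CarnotSetting N m) (x) : 1 ≤ G.wt x := by have := G.rho_nonneg x; unfold wt; linarith
lemma wt_cont (G : CarnotSetting N m) : Continuous G.wt := continuous_const.add G.rho_continuous

lemma memLp_cc {f g : (Fin N → ℝ) → ℝ} (hf : Test f) (hg : Continuous g) : MemLp (fun x => g x * f x) 2 volume :=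
  (hg.mul hf.1.continuous).memLp_of_hasCompactSupport hf.2.mul_left

lemma wt_inv_cont (G : CarnotSetting N m) : Continuous (fun x => (G.wt x)⁻¹) := G.wt_cont.inv₀ fun x => (G.wt_pos x).ne'

lemma LA_ibp (G : CarnotSetting N m) {A : Fin m → Fin m → ℝ} {f g : (Fin N → ℝ) → ℝ} (hf : ContDiff ℝ ∞ f) (hg : Test g) :
    ∫ x, f x * G.LA A g x = - ∫ x, ∑ i, ∑ j, A i j * vfDeriv (G.Y i) f x * vfDeriv (G.Y j) g x := by
  have t : ∀ i j, Test (fun x => f x * vfDeriv (G.Y i) (vfDeriv (G.Y j) g) x) := fun i j => ((hg.Y G j).Y G i).smooth_mul hf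
  have t2 : ∀ i j, Test (fun x => vfDeriv (G.Y i) f x * vfDeriv (G.Y j) g x) := fun i j =>
    (hg.Y G j).smooth_mul (vfDeriv_contDiff (G.Y_smooth i) hf)
  have e1 : ∫ x, f x * G.LA A g x = ∑ i, ∑ j, A i j * ∫ x, f x * vfDeriv (G.Y i) (vfDeriv (G.Y j) g) x := by
    simp_rw [← integral_const_mul]
    simp_rw [← integral_finsetSum _ (fun j _ => (t _ j).integrable.const_mul (A _ j))]
    rw [← integral_finsetSum _ (fun i _ => integrable_finsetSum _ (fun j _ => (t i j).integrable.const_mul (A i j)))]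
    refine integral_congr_ae (Eventually.of_forall fun x => ?_)
    simp only [LA, Finset.mul_sum]
    refine Finset.sum_congr rfl fun i _ => Finset.sum_congr rfl fun j _ => by ring
  have e2 : ∫ x, ∑ i, ∑ j, A i j * vfDeriv (G.Y i) f x * vfDeriv (G.Y j) g x
      = ∑ i, ∑ j, A i j * ∫ x, vfDeriv (G.Y i) f x * vfDeriv (G.Y j) g x := by
    simp_rw [← integral_const_mul]
    simp_rw [← integral_finsetSum _ (fun j _ => (t2 _ j).integrable.const_mul (A _ j))]
    rw [← integral_finsetSum _ (fun i _ => integrable_finsetSum _ (fun j _ => (t2 i j).integrable.const_mul (A i j)))]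
    refine integral_congr_ae (Eventually.of_forall fun x => ?_)
    refine Finset.sum_congr rfl fun i _ => Finset.sum_congr rfl fun j _ => by ring
  rw [e1, e2, ← Finset.sum_neg_distrib]
  refine Finset.sum_congr rfl fun i _ => ?_
  rw [← Finset.sum_neg_distrib]
  refine Finset.sum_congr rfl fun j _ => ?_
  rw [ibp' (G.Y_smooth i) (G.Y_divFree i) hf (hg.Y G j)]; ring

lemma LA_ibp' (G : CarnotSetting N m) {A : Fin m → Fin m → ℝ} {f g : (Fin N → ℝ) → ℝ} (hg : Test g) (hf : ContDiff ℝ ∞ f) :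
    ∫ x, g x * G.LA A f x = - ∫ x, ∑ i, ∑ j, A i j * vfDeriv (G.Y i) g x * vfDeriv (G.Y j) f x := by
  have t : ∀ i j, Test (fun x => g x * vfDeriv (G.Y i) (vfDeriv (G.Y j) f) x) := fun i j =>
    hg.mul_smooth (vfDeriv_contDiff (G.Y_smooth i) (vfDeriv_contDiff (G.Y_smooth j) hf))
  have t2 : ∀ i j, Test (fun x => vfDeriv (G.Y i) g x * vfDeriv (G.Y j) f x) := fun i j =>
    (hg.Y G i).mul_smooth (vfDeriv_contDiff (G.Y_smooth j) hf)
  have e1 : ∫ x, g x * G.LA A f x = ∑ i, ∑ j, A i j * ∫ x, g x * vfDeriv (G.Y i) (vfDeriv (G.Y j) f) x := by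
    simp_rw [← integral_const_mul]
    simp_rw [← integral_finsetSum _ (fun j _ => (t _ j).integrable.const_mul (A _ j))]
    rw [← integral_finsetSum _ (fun i _ => integrable_finsetSum _ (fun j _ => (t i j).integrable.const_mul (A i j)))]
    refine integral_congr_ae (Eventually.of_forall fun x => ?_)
    simp only [LA, Finset.mul_sum]
    refine Finset.sum_congr rfl fun i _ => Finset.sum_congr rfl fun j _ => by ring
  have e2 : ∫ x, ∑ i, ∑ j, A i j * vfDeriv (G.Y i) g x * vfDeriv (G.Y j) f x
      = ∑ i, ∑ j, A i j * ∫ x, vfDeriv (G.Y i) g x * vfDeriv (G.Y j) f x := by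
    simp_rw [← integral_const_mul]
    simp_rw [← integral_finsetSum _ (fun j _ => (t2 _ j).integrable.const_mul (A _ j))]
    rw [← integral_finsetSum _ (fun i _ => integrable_finsetSum _ (fun j _ => (t2 i j).integrable.const_mul (A i j)))]
    refine integral_congr_ae (Eventually.of_forall fun x => ?_)
    refine Finset.sum_congr rfl fun i _ => Finset.sum_congr rfl fun j _ => by ring
  rw [e1, e2, ← Finset.sum_neg_distrib]
  refine Finset.sum_congr rfl fun i _ => ?_
  rw [← Finset.sum_neg_distrib]
  refine Finset.sum_congr rfl fun j _ => ?_
  rw [ibp (G.Y_smooth i) (G.Y_divFree i) hg (vfDeriv_contDiff (G.Y_smooth j) hf)]; ring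

lemma LA_symm (G : CarnotSetting N m) {A : Fin m → Fin m → ℝ} (hA : ∀ i j, A i j = A j i)
    {f g : (Fin N → ℝ) → ℝ} (hf : ContDiff ℝ ∞ f) (hg : Test g) :
    ∫ x, f x * G.LA A g x = ∫ x, g x * G.LA A f x := by
  rw [LA_ibp G hf hg, LA_ibp' G hg hf]
  congr 1
  refine integral_congr_ae (Eventually.of_forall fun x => ?_)
  simp only
  rw [Finset.sum_comm]
  refine Finset.sum_congr rfl fun i _ => Finset.sum_congr rfl fun j _ => ?_
  rw [hA]; ring

/-- a priori weighted inequality -/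
lemma apriori (G : CarnotSetting N m) {Λ : ℝ} (hΛ : 0 < Λ) : ∃ C, 0 < C ∧ ∀ A, Ell Λ A → ∀ ψ : (Fin N → ℝ) → ℝ, Test ψ →
    n2 volume (fun x => (G.wt x)⁻¹ * ψ x) ≤ C * n2 volume (fun x => G.wt x * G.LA A ψ x) := by
  obtain ⟨C, hC, hH⟩ := G.hardy
  refine ⟨C / Λ, by positivity, fun A hA ψ hψ => ?_⟩
  obtain ⟨i0, hle⟩ := hH ψ hψ
  have m1 := memLp_cc hψ G.wt_inv_cont
  have m2 := memLp_cc (hψ.LA G A) G.wt_cont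
  set a := n2 volume (fun x => (G.wt x)⁻¹ * ψ x) with ha
  set b := n2 volume (fun x => G.wt x * G.LA A ψ x) with hb
  have h1 : a ^ 2 ≤ ∫ x, (G.rho x ^ (-2:ℝ)) * ψ x ^ 2 := by
    rw [ha, n2_sq m1]
    refine integral_mono_ae m1.integrable_sq i0 ?_
    filter_upwards [G.ae_ne_zero] with x hx
    have hρ := G.rho_pos hx
    have e2 : G.rho x ^ (-2:ℝ) = ((G.rho x)⁻¹) ^ 2 := by
      rw [Real.rpow_neg hρ.le]; norm_num
    rw [e2, mul_pow]
    have : (G.wt x)⁻¹ ≤ (G.rho x)⁻¹ := inv_anti₀ hρ (by unfold wt; linarith)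
    have h0 : 0 ≤ (G.wt x)⁻¹ := (inv_pos.2 (G.wt_pos x)).le
    gcongr
  have h2 := energy_le G hΛ hA hψ
  have h3 : ∫ x, ∑ i, ∑ j, A i j * vfDeriv (G.Y i) ψ x * vfDeriv (G.Y j) ψ x ≤ a * b := by
    have := LA_ibp G (A := A) hψ.1 hψ
    have e : ∫ x, ψ x * G.LA A ψ x = ∫ x, ((G.wt x)⁻¹ * ψ x) * (G.wt x * G.LA A ψ x) := by
      refine integral_congr_ae (Eventually.of_forall fun x => ?_)
      have := (G.wt_pos x).ne'
      field_simp
    have hcs := cs _ _ m1 m2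
    rw [← e, this, abs_neg] at hcs
    exact (le_abs_self _).trans hcs
  have h4 : ∑ j, n2 volume (vfDeriv (G.Y j) ψ) ^ 2 ≤ a * b / Λ := by
    rw [le_div_iff₀ hΛ]; linarith
  have h5 : a ^ 2 ≤ C * (a * b / Λ) := h1.trans (hle.trans (by gcongr))
  have ha0 : 0 ≤ a := n2_nonneg
  have hb0 : 0 ≤ b := n2_nonneg
  rcases ha0.eq_or_lt with h | h
  · rw [← h]; positivity
  · have : a * a ≤ a * (C / Λ * b) := by
      calc a * a = a^2 := by ring
        _ ≤ _ := h5
        _ = _ := by ring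
    exact le_of_mul_le_mul_left this h

/-- weak solution of `L v = f` in the weighted space -/
def Weak (G : CarnotSetting N m) (A : Fin m → Fin m → ℝ) (f v : (Fin N → ℝ) → ℝ) : Prop :=
  MemLp (fun x => (G.wt x)⁻¹ * v x) 2 volume ∧ ∀ ψ, Test ψ → ∫ x, v x * G.LA A ψ x = ∫ x, f x * ψ x

lemma exists_weak (G : CarnotSetting N m) {Λ : ℝ} (hΛ : 0 < Λ) : ∃ C, 0 < C ∧ ∀ A, Ell Λ A →
    ∀ f : (Fin N → ℝ) → ℝ, Test f → ∃ v, G.Weak A f v ∧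
      n2 volume (fun x => (G.wt x)⁻¹ * v x) ≤ C * n2 volume (fun x => G.wt x * f x) := by
  obtain ⟨C, hC, hap⟩ := G.apriori hΛ
  refine ⟨C, hC, fun A hA f hf => ?_⟩
  have mf := memLp_cc hf G.wt_cont
  obtain ⟨h, hh, hn, hr⟩ := riesz (tests N) (fun ψ x => G.wt x * G.LA A ψ x)
    (fun f hf g hg => by
      have : G.LA A (f + g) = fun x => G.LA A f x + G.LA A g x := LA_add G A hf.1 hg.1
      ext x; simp only [this, Pi.add_apply]; ring)
    (fun c f hf => by
      have : G.LA A (c • f) = fun x => c * G.LA A f x := LA_cmul G A hf.1 c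
      ext x; simp only [this, Pi.smul_apply, smul_eq_mul]; ring)
    (fun f hf => memLp_cc (Test.LA G A hf) G.wt_cont)
    (fun ψ => ∫ x, f x * ψ x)
    (fun g hg g' hg' => by
      rw [← integral_add (hf.mul_smooth hg.1).integrable (hf.mul_smooth hg'.1).integrable]
      refine integral_congr_ae (Eventually.of_forall fun x => ?_); simp only [Pi.add_apply]; ring)
    (fun c g hg => by
      rw [← integral_const_mul]
      refine integral_congr_ae (Eventually.of_forall fun x => ?_); simp only [Pi.smul_apply, smul_eq_mul]; ring)
    (C := C * n2 volume (fun x => G.wt x * f x)) (mul_nonneg hC.le n2_nonneg)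
    (fun ψ hψ => by
      have m1 := memLp_cc hψ G.wt_inv_cont
      have h1 := cs _ _ mf m1
      have e : ∫ x, (G.wt x * f x) * ((G.wt x)⁻¹ * ψ x) = ∫ x, f x * ψ x := by
        refine integral_congr_ae (Eventually.of_forall fun x => ?_)
        have := (G.wt_pos x).ne'
        simp only; field_simp
      rw [e] at h1
      have h2 := hap A hA ψ hψ
      calc _ ≤ _ := h1
        _ ≤ n2 volume (fun x => G.wt x * f x) * (C * n2 volume (fun x => G.wt x * G.LA A ψ x)) := by
          gcongr; exact n2_nonneg
        _ = _ := by ring)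
  have e : (fun x => (G.wt x)⁻¹ * (G.wt x * h x)) = h := by
    ext x; have := (G.wt_pos x).ne'; field_simp
  refine ⟨fun x => G.wt x * h x, ⟨?_, fun ψ hψ => ?_⟩, ?_⟩
  · simp only [e]; exact hh
  · rw [hr ψ hψ]
    refine integral_congr_ae (Eventually.of_forall fun x => ?_); simp only; ring
  · simp only [e]; exact hn

end CarnotSetting
end

end

section
open MeasureTheory Set Filter Topology
open scoped ContDiff ENNReal
noncomputable section
namespace CarnotSetting
variable {N m : ℕ}

def prj (i : Fin N) : (Fin N → ℝ) →L[ℝ] ℝ := ContinuousLinearMap.proj i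
@[simp] lemma prj_apply (i : Fin N) (x) : prj i x = x i := rfl

lemma fderiv_cF {g : (Fin N → ℝ) → ℝ} {x} (h : DifferentiableAt ℝ g x) :
    HasFDerivAt g (∑ i, vfDeriv (cF N i) g x • prj i) x := by
  have e : ∑ i, vfDeriv (cF N i) g x • prj i = fderiv ℝ g x := by
    ext1 v
    rw [fderiv_apply_eq_sum (fderiv ℝ g x) v]
    simp [vfDeriv_eq _ h, cF, ContinuousLinearMap.sum_apply, mul_comm]
  rw [e]; exact h.hasFDerivAt

lemma lim_hasFDeriv {f : ℕ → (Fin N → ℝ) → ℝ} {U : Set (Fin N → ℝ)} (hU : IsOpen U) (hf : ∀ n, ContDiff ℝ ∞ (f n))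
    {F : (Fin N → ℝ) → ℝ} {F' : Fin N → (Fin N → ℝ) → ℝ} (h0 : ∀ x ∈ U, Tendsto (fun n => f n x) atTop (𝓝 (F x)))
    (h1 : ∀ i, TendstoUniformlyOn (fun n => vfDeriv (cF N i) (f n)) (F' i) atTop U) {x} (hx : x ∈ U) :
    HasFDerivAt F (∑ i, F' i x • prj i) x := by
  refine hasFDerivAt_of_tendstoUniformlyOn (l := atTop) hU (f := f)
    (f' := fun n x => ∑ i, vfDeriv (cF N i) (f n) x • prj i)
    (g' := fun x => ∑ i, F' i x • prj i) ?_
    (fun n x _ => fderiv_cF ((hf n).differentiable (by simp) x)) h0 hx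
  rw [Metric.tendstoUniformlyOn_iff]
  intro ε hε
  have : ∀ i, ∀ᶠ n in atTop, ∀ x ∈ U, dist (F' i x) (vfDeriv (cF N i) (f n) x) < ε / (N + 1) := fun i =>
    Metric.tendstoUniformlyOn_iff.1 (h1 i) _ (by positivity)
  filter_upwards [eventually_all.2 this] with n hn x hx
  rw [dist_eq_norm, ← Finset.sum_sub_distrib]
  calc _ ≤ ∑ i : Fin N, ε / (N + 1) := by
        refine (norm_sum_le _ _).trans (Finset.sum_le_sum fun i _ => ?_)
        rw [← sub_smul, norm_smul, ← dist_eq_norm]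
        have h2 : ‖prj i‖ ≤ 1 :=
          ContinuousLinearMap.opNorm_le_bound _ zero_le_one fun y => by simpa using norm_le_pi_norm y i
        calc _ ≤ (ε / (N + 1)) * 1 := mul_le_mul (hn i x hx).le h2 (norm_nonneg _) (by positivity)
          _ = _ := mul_one _
    _ = N * (ε / (N + 1)) := by simp
    _ < ε := by rw [mul_div_assoc', div_lt_iff₀ (by positivity)]; nlinarith

lemma lim_smooth {f : ℕ → (Fin N → ℝ) → ℝ} {U : Set (Fin N → ℝ)} (hU : IsOpen U) (hf : ∀ n, ContDiff ℝ ∞ (f n))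
    (h : ∀ l : List (Fin N), UniformCauchySeqOn (fun n => vfIter (cF N) l (f n)) atTop U) :
    ∃ u, ContDiffOn ℝ ∞ u U ∧ ∀ l, ∀ x ∈ U, Tendsto (fun n => vfIter (cF N) l (f n) x) atTop (𝓝 (vfIter (cF N) l u x)) := by
  let F : List (Fin N) → (Fin N → ℝ) → ℝ := fun l x => limUnder atTop (fun n => vfIter (cF N) l (f n) x)
  have h0 : ∀ l, ∀ x ∈ U, Tendsto (fun n => vfIter (cF N) l (f n) x) atTop (𝓝 (F l x)) := fun l x hx =>
    ((h l).cauchySeq hx).tendsto_limUnder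
  have h1 : ∀ l, TendstoUniformlyOn (fun n => vfIter (cF N) l (f n)) (F l) atTop U := fun l =>
    (h l).tendstoUniformlyOn_of_tendsto (h0 l)
  have hd : ∀ l, ∀ x ∈ U, HasFDerivAt (F l) (∑ i, F (i :: l) x • prj i) x :=
    fun l x hx => lim_hasFDeriv hU (fun n => vfIter_contDiff' cF_smooth (hf n) l) (h0 l) (fun i => h1 (i :: l)) hx
  have hk : ∀ k : ℕ, ∀ l, ContDiffOn ℝ k (F l) U := by
    intro k
    induction k with
    | zero =>
      intro l
      rw [Nat.cast_zero, contDiffOn_zero]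
      exact fun x hx => (hd l x hx).continuousAt.continuousWithinAt
    | succ k ih =>
      intro l
      rw [Nat.cast_succ, contDiffOn_succ_iff_fderiv_of_isOpen hU]
      refine ⟨fun x hx => (hd l x hx).differentiableAt.differentiableWithinAt, by simp, ?_⟩
      refine ContDiffOn.congr (f := fun x => ∑ i, F (i :: l) x • prj i) ?_
        (fun x hx => (hd l x hx).fderiv)
      exact ContDiffOn.sum fun i _ => (ih (i :: l)).smul contDiffOn_const
  have hw : ∀ l, ∀ x ∈ U, vfIter (cF N) l (F []) x = F l x := by
    intro l
    induction l with
    | nil => intro x _; rfl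
    | cons i l ih =>
      intro x hx
      show vfDeriv (cF N i) (vfIter (cF N) l (F [])) x = _
      rw [vfDeriv_congr_nhds (eventually_of_mem (hU.mem_nhds hx) ih), vfDeriv_eq _ (hd l x hx).differentiableAt, (hd l x hx).fderiv]
      simp [ContinuousLinearMap.sum_apply, cF, Pi.single_apply]
  exact ⟨F [], contDiffOn_infty.2 fun k => hk k [], fun l x hx => by rw [hw l x hx]; exact h0 l x hx⟩

lemma NF.lim {P} (hP : NF (cF N) P) {f : ℕ → (Fin N → ℝ) → ℝ} {u x}
    (h : ∀ l, Tendsto (fun n => vfIter (cF N) l (f n) x) atTop (𝓝 (vfIter (cF N) l u x))) :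
    Tendsto (fun n => P (f n) x) atTop (𝓝 (P u x)) := by
  induction hP with
  | zero => exact tendsto_const_nhds
  | cons c J hc hP ih => exact ((h J).const_mul _).add ih

lemma Y_cF (G : CarnotSetting N m) {P} (hP : IsDO (cF N) P) (i) : IsDO (cF N) (fun u => vfDeriv (G.Y i) (P u)) := by
  refine hP.field cF_smooth (β := fun j x => G.Y i x j) (fun j => ?_) fun x => ?_
  · exact (coord_contDiff j).comp (G.Y_smooth i)
  · ext k; simp [cF, Pi.single_apply]

lemma LA_cF (G : CarnotSetting N m) (A) : IsDO (cF N) (fun u => G.LA A u) :=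
  IsDO.sum _ fun i => IsDO.sum _ fun j => (Y_cF G (Y_cF G IsDO.id j) i).smul contDiff_const

lemma cF_Y (G : CarnotSetting N m) (l) : IsDO G.Y (fun u => vfIter (cF N) l u) := by
  induction l with
  | nil => exact IsDO.id
  | cons i l ih => exact Y_field G (cF_smooth i) ih

lemma vfIter_sub' {n : ℕ} {Z : Fin n → (Fin N → ℝ) → (Fin N → ℝ)} (hZ : ∀ j, ContDiff ℝ ∞ (Z j)) {f g : (Fin N → ℝ) → ℝ}
    (hf : ContDiff ℝ ∞ f) (hg : ContDiff ℝ ∞ g) (l) :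
    vfIter Z l (fun x => f x - g x) = fun x => vfIter Z l f x - vfIter Z l g x := by
  induction l with
  | nil => rfl
  | cons i l ih =>
    show vfDeriv (Z i) (vfIter Z l (fun x => f x - g x)) = _
    rw [ih]
    ext x
    exact vfDeriv_sub ((vfIter_contDiff' hZ hf l).differentiable (by simp) x) ((vfIter_contDiff' hZ hg l).differentiable (by simp) x)

/-- Uniform Cauchy in all Y-words on a compact neighbourhood gives smooth limit. -/
lemma cauchy_cF (G : CarnotSetting N m) {f : ℕ → (Fin N → ℝ) → ℝ} {U : Set (Fin N → ℝ)} (hU : Bornology.IsBounded U)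
    (hf : ∀ n, ContDiff ℝ ∞ (f n)) (h : ∀ H, UniformCauchySeqOn (fun n => vfIter G.Y H (f n)) atTop U) (l) :
    UniformCauchySeqOn (fun n => vfIter (cF N) l (f n)) atTop U := by
  obtain ⟨S, hS⟩ := (cF_Y G l).bound
  obtain ⟨C, hC, hb⟩ := hS (closure U) hU.isCompact_closure
  rw [Metric.uniformCauchySeqOn_iff]
  intro ε hε
  have hS' : ∀ H : List (Fin m), ∃ n0, ∀ n ≥ n0, ∀ k ≥ n0, ∀ x ∈ U, dist (vfIter G.Y H (f n) x) (vfIter G.Y H (f k) x) < ε / (C * S.card + 1) :=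
    fun H => Metric.uniformCauchySeqOn_iff.1 (h H) _ (by positivity)
  choose n0 hn0 using hS'
  refine ⟨S.sup n0, fun n hn k hk x hx => ?_⟩
  have h1 := hb univ isOpen_univ (fun x => f n x - f k x) ((hf n).sub (hf k)).contDiffOn x ⟨subset_closure hx, trivial⟩
  beta_reduce at h1
  rw [vfIter_sub' cF_smooth (hf n) (hf k)] at h1
  rw [Real.dist_eq]
  refine h1.trans_lt ?_
  calc _ ≤ C * ∑ J ∈ S, ε / (C * S.card + 1) := by
        refine mul_le_mul_of_nonneg_left (Finset.sum_le_sum fun J hJ => ?_) hC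
        rw [vfIter_sub' G.Y_smooth (hf n) (hf k), ← Real.dist_eq]
        exact (hn0 J n ((Finset.le_sup hJ).trans hn) k ((Finset.le_sup hJ).trans hk) x hx).le
    _ = C * S.card * (ε / (C * S.card + 1)) := by simp; ring
    _ < ε := by rw [mul_div_assoc', div_lt_iff₀ (by positivity)]; nlinarith

end CarnotSetting
end

end

section
open MeasureTheory Set Filter Topology
open scoped ContDiff ENNReal
noncomputable section
namespace CarnotSetting
variable {N m : ℕ}

def moll (G : CarnotSetting N m) (η v : (Fin N → ℝ) → ℝ) (x : Fin N → ℝ) : ℝ := ∫ z, η z * v (G.mul z x)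

lemma moll_smooth (G : CarnotSetting N m) {η v : (Fin N → ℝ) → ℝ} (hη : Test η) (hv : LocallyIntegrable v volume) :
    ContDiff ℝ ∞ (G.moll η v) := by
  rw [contDiff_iff_contDiffAt]
  intro x0
  have hk : IsCompact ((fun p : (Fin N → ℝ) × (Fin N → ℝ) => - G.mul p.1 p.2) '' (tsupport η ×ˢ Metric.closedBall x0 1)) :=
    (hη.2.isCompact.prod (isCompact_closedBall _ _)).image G.continuous_mul'.neg
  have h := contDiffOn_convolution_right_with_param (𝕜 := ℝ) (n := ⊤) (ContinuousLinearMap.mul ℝ ℝ) (μ := volume) (f := v)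
    (g := fun p t => η (G.mul (-t) (G.inv p))) (s := Metric.ball x0 1) Metric.isOpen_ball hk (fun p t hp ht => by
      by_contra h0
      refine ht ⟨(G.mul (-t) (G.inv p), p), ⟨subset_tsupport _ h0, Metric.ball_subset_closedBall hp⟩, ?_⟩
      simp only [inv_mul_cancel_right', neg_neg]) hv (by
      refine ContDiff.contDiffOn ?_
      exact hη.1.comp (G.cmul (contDiff_snd.neg) (G.smooth_inv.comp contDiff_fst)))
  have h2 : ContDiffOn ℝ ∞ (G.moll η v) (Metric.ball x0 1) := by
    have h3 := h.comp (f := fun p : Fin N → ℝ => (p, (0 : Fin N → ℝ))) (s := Metric.ball x0 1)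
      (contDiff_id.prodMk contDiff_const).contDiffOn (fun p hp => ⟨hp, trivial⟩)
    refine h3.congr fun x hx => ?_
    unfold moll
    rw [← G.integral_right (G.inv x)]
    simp only [Function.comp, convolution, ContinuousLinearMap.mul_apply', inv_mul_cancel_right', zero_sub, neg_neg]
    refine integral_congr_ae (Eventually.of_forall fun y => ?_)
    exact mul_comm _ _
  exact h2.contDiffAt (Metric.ball_mem_nhds _ one_pos)

lemma mink {η : (Fin N → ℝ) → ℝ} (hη : Test η) (h0 : ∀ z, 0 ≤ η z) (h1 : ∫ z, η z = 1)
    {F : (Fin N → ℝ) → (Fin N → ℝ) → ℝ} (hF : Measurable (Function.uncurry F)) {c : ℝ}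
    (h : ∀ z, η z ≠ 0 → ∫⁻ x, ‖F z x‖ₑ ^ 2 ≤ ENNReal.ofReal (c ^ 2)) :
    ∫⁻ x, ‖∫ z, η z * F z x‖ₑ ^ 2 ≤ ENNReal.ofReal (c ^ 2) := by
  let μ : Measure (Fin N → ℝ) := volume.withDensity (fun z => ‖η z‖ₑ)
  have hm : Measurable (fun z => ‖η z‖ₑ) := hη.1.continuous.measurable.enorm
  have e1 : ∫⁻ z, ‖η z‖ₑ = 1 := by
    have := ofReal_integral_eq_lintegral_ofReal (hη.integrable) (Eventually.of_forall h0)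
    rw [h1, ENNReal.ofReal_one] at this
    rw [this]
    exact lintegral_congr fun z => Real.enorm_of_nonneg (h0 z)
  have hμ : μ univ = 1 := by simp [μ, e1]
  have hFz : ∀ x, Measurable (fun z => ‖F z x‖ₑ) := fun x => (hF.comp (measurable_id.prodMk measurable_const)).enorm
  have h2 : ∀ x, ‖∫ z, η z * F z x‖ₑ ^ 2 ≤ ∫⁻ z, ‖η z‖ₑ * ‖F z x‖ₑ ^ 2 := fun x => by
    calc _ ≤ (∫⁻ z, ‖η z‖ₑ * ‖F z x‖ₑ) ^ 2 := by
          gcongr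
          refine (enorm_integral_le_lintegral_enorm _).trans (le_of_eq (lintegral_congr fun z => by rw [enorm_mul]))
      _ = (∫⁻ z, ‖F z x‖ₑ ∂μ) ^ 2 := by
          rw [lintegral_withDensity_eq_lintegral_mul _ hm (hFz x)]; rfl
      _ ≤ _ := (lint_sq_le _ (hFz x).aemeasurable)
      _ = _ := by
          rw [hμ, one_mul, lintegral_withDensity_eq_lintegral_mul _ hm ((hFz x).pow_const 2)]; rfl
  refine (lintegral_mono h2).trans ?_
  rw [lintegral_lintegral_swap (f := fun x z => ‖η z‖ₑ * ‖F z x‖ₑ ^ 2)]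
  · calc _ ≤ ∫⁻ z, ‖η z‖ₑ * ENNReal.ofReal (c ^ 2) := by
          refine lintegral_mono fun z => ?_
          beta_reduce
          rw [lintegral_const_mul]
          · by_cases hz : η z = 0
            · simp [hz]
            · gcongr; exact h z hz
          · exact ((hF.comp (measurable_const.prodMk measurable_id)).enorm).pow_const 2
      _ = _ := by rw [lintegral_mul_const _ hm, e1, one_mul]
  · exact ((hm.comp measurable_snd).mul ((hF.comp measurable_swap).enorm.pow_const 2)).aemeasurable

lemma memLp_left (G : CarnotSetting N m) {v : (Fin N → ℝ) → ℝ} (hv : MemLp v 2 volume) (z) :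
    MemLp (fun x => v (G.mul z x)) 2 volume := hv.comp_measurePreserving (G.mp_left z)
lemma n2_left' (G : CarnotSetting N m) {v : (Fin N → ℝ) → ℝ} (hv : MemLp v 2 volume) (z) :
    n2 volume (fun x => v (G.mul z x)) = n2 volume v := by
  unfold n2
  rw [← eLpNorm_comp_measurePreserving hv.1 (G.mp_left z)]; rfl

lemma trans_cont_cc (G : CarnotSetting N m) {g : (Fin N → ℝ) → ℝ} (hg : Continuous g) (hs : HasCompactSupport g) :
    Tendsto (fun z => n2 volume (fun x => g (G.mul z x) - g x)) (𝓝 0) (𝓝 0) := by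
  have hm : ∀ z, MemLp (fun x => g (G.mul z x) - g x) 2 volume := fun z =>
    (memLp_left G (hg.memLp_of_hasCompactSupport hs) z).sub (hg.memLp_of_hasCompactSupport hs)
  suffices h : Tendsto (fun z => ∫ x, (g (G.mul z x) - g x) ^ 2) (𝓝 0) (𝓝 0) by
    have h2 := h.sqrt
    rw [Real.sqrt_zero] at h2
    refine h2.congr fun z => ?_
    rw [← n2_sq (hm z), Real.sqrt_sq n2_nonneg]
  obtain ⟨B, hB⟩ := hs.exists_bound_of_continuous hg
  let K : Set (Fin N → ℝ) := (fun p : (Fin N → ℝ) × (Fin N → ℝ) => G.mul (G.inv p.1) p.2) '' (Metric.closedBall 0 1 ×ˢ tsupport g)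
  have hK : IsCompact K := ((isCompact_closedBall _ _).prod hs.isCompact).image
    (G.continuous_mul'.comp (((G.smooth_inv.continuous).comp continuous_fst).prodMk continuous_snd))
  have h0 : ∫ _ : Fin N → ℝ, (0 : ℝ) = 0 := by simp
  rw [← h0]
  refine tendsto_integral_filter_of_dominated_convergence (K.indicator fun _ => (2 * B) ^ 2) (Eventually.of_forall fun z => ?_) ?_ ?_ ?_
  · exact ((hm z).1.pow 2)
  · filter_upwards [Metric.closedBall_mem_nhds (0 : Fin N → ℝ) one_pos] with z hz
    refine Eventually.of_forall fun x => ?_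
    by_cases hx : x ∈ K
    · rw [indicator_of_mem hx, norm_pow]
      gcongr
      refine (norm_sub_le _ _).trans ?_
      linarith [hB x, hB (G.mul z x)]
    · have h1 : g x = 0 := by
        by_contra h; exact hx ⟨(0, x), ⟨Metric.mem_closedBall_self zero_le_one, subset_tsupport _ h⟩, by simp [inv_zero', G.zero_mul']⟩
      have h2 : g (G.mul z x) = 0 := by
        by_contra h; exact hx ⟨(z, G.mul z x), ⟨hz, subset_tsupport _ h⟩, by simp [inv_mul_cancel_left']⟩
      simp [h1, h2, hx]
  · exact (integrable_indicator_iff hK.measurableSet).2 (integrableOn_const hK.measure_lt_top.ne)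
  · refine Eventually.of_forall fun x => ?_
    have : Continuous (fun z => (g (G.mul z x) - g x) ^ 2) := ((hg.comp (G.cmul_right x).continuous).sub continuous_const).pow 2
    have h3 := this.tendsto 0
    simpa [G.zero_mul'] using h3

lemma trans_cont (G : CarnotSetting N m) {v : (Fin N → ℝ) → ℝ} (hv : MemLp v 2 volume) {ε : ℝ} (hε : 0 < ε) :
    ∃ δ > 0, ∀ z, ‖z‖ < δ → n2 volume (fun x => v (G.mul z x) - v x) ≤ ε := by
  obtain ⟨g, hs, hvg, hg, hgm⟩ := hv.exists_hasCompactSupport_eLpNorm_sub_le (by simp) (ε := ENNReal.ofReal (ε / 3)) (by simp; linarith)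
  have h1 := (trans_cont_cc G hg hs).eventually (gt_mem_nhds (show (0:ℝ) < ε / 3 by linarith))
  obtain ⟨δ, hδ, hb⟩ := Metric.eventually_nhds_iff.1 h1
  have hd : n2 volume (fun x => v x - g x) ≤ ε / 3 := by
    refine ENNReal.toReal_le_of_le_ofReal (by linarith) hvg
  have hdm : MemLp (fun x => v x - g x) 2 volume := hv.sub hgm
  refine ⟨δ, hδ, fun z hz => ?_⟩
  have h2 := hb (y := z) (by simpa using hz)
  have e : (fun x => v (G.mul z x) - v x) = fun x => ((v (G.mul z x) - g (G.mul z x)) + (g (G.mul z x) - g x)) - (v x - g x) := by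
    ext x; ring
  have hl := memLp_left G hdm z
  have hl2 : MemLp (fun x => g (G.mul z x) - g x) 2 volume := (memLp_left G hgm z).sub hgm
  rw [e]
  have hl3 : MemLp (fun x => (v (G.mul z x) - g (G.mul z x)) + (g (G.mul z x) - g x)) 2 volume := hl.add hl2
  refine (n2_sub_le hl3 hdm).trans ?_
  have h3 := n2_add_le hl hl2
  have h4 := n2_left' G hdm z
  linarith

lemma exists_mollifier (N : ℕ) {δ : ℝ} (hδ : 0 < δ) : ∃ η : (Fin N → ℝ) → ℝ, Test η ∧ (∀ z, 0 ≤ η z) ∧ ∫ z, η z = 1 ∧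
    ∀ z, η z ≠ 0 → ‖z‖ < δ := by
  obtain ⟨χ, hχ, h01, h1, hs⟩ := exists_cutoff N (half_pos hδ) (half_lt_self hδ)
  have hpos : 0 < ∫ z, χ z := by
    refine (integral_pos_iff_support_of_nonneg (fun z => (h01 z).1) hχ.integrable).2 ?_
    refine lt_of_lt_of_le (Metric.measure_ball_pos volume (0 : Fin N → ℝ) (half_pos hδ)) (measure_mono fun z hz => ?_)
    rw [Function.mem_support, h1 z (Metric.ball_subset_closedBall hz)]; exact one_ne_zero
  refine ⟨fun z => (∫ z, χ z)⁻¹ * χ z, hχ.const_mul _, fun z => mul_nonneg (inv_nonneg.2 hpos.le) (h01 z).1, ?_, fun z hz => ?_⟩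
  · rw [integral_const_mul, inv_mul_cancel₀ hpos.ne']
  · have := hs (subset_tsupport _ (right_ne_zero_of_mul hz))
    rwa [Metric.mem_ball, dist_zero_right] at this

lemma moll_int (G : CarnotSetting N m) {η v : (Fin N → ℝ) → ℝ} (hη : Test η) (hv : LocallyIntegrable v volume) (x) :
    Integrable (fun z => η z * v (G.mul z x)) := by
  have h : Integrable (fun y => η (G.mul y (G.inv x)) * v y) := by
    have ht := hη.right G (G.inv x)
    exact hv.integrable_smul_left_of_hasCompactSupport ht.1.continuous ht.2
  have := (G.mp_right x).integrable_comp_of_integrable h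
  refine this.congr (Eventually.of_forall fun z => ?_)
  simp [Function.comp, mul_inv_cancel_right']

lemma moll_near (G : CarnotSetting N m) {v : (Fin N → ℝ) → ℝ} (hm : Measurable v) (hv : MemLp v 2 volume) {ε : ℝ} (hε : 0 < ε) :
    ∃ δ > 0, ∀ η, Test η → (∀ z, 0 ≤ η z) → ∫ z, η z = 1 → (∀ z, η z ≠ 0 → ‖z‖ < δ) →
      MemLp (G.moll η v) 2 volume ∧ n2 volume (fun x => G.moll η v x - v x) ≤ ε := by
  obtain ⟨δ, hδ, hb⟩ := trans_cont G hv hε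
  refine ⟨δ, hδ, fun η hη h0 h1 hs => ?_⟩
  have hl := hv.locallyIntegrable (by norm_num)
  have e : (fun x => G.moll η v x - v x) = fun x => ∫ z, η z * (v (G.mul z x) - v x) := by
    ext x
    simp only [mul_sub]
    rw [integral_sub (moll_int G hη hl x) (hη.integrable.mul_const _), integral_mul_const, h1, one_mul]; rfl
  have hc : ∫⁻ x, ‖G.moll η v x - v x‖ₑ ^ 2 ≤ ENNReal.ofReal (ε ^ 2) := by
    have := mink (c := ε) hη h0 h1 (F := fun z x => v (G.mul z x) - v x)
      ((hm.comp G.continuous_mul'.measurable).sub (hm.comp measurable_snd)) (fun z hz => by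
        have hmm : MemLp (fun x => v (G.mul z x) - v x) 2 volume := (memLp_left G hv z).sub hv
        rw [← n2_lint hmm]
        exact ENNReal.ofReal_le_ofReal (pow_le_pow_left₀ n2_nonneg (hb z (hs z hz)) 2))
    have e' : ∀ x, G.moll η v x - v x = ∫ z, η z * (v (G.mul z x) - v x) := fun x => congrFun e x
    simp only [e']; exact this
  have hsm : Continuous (G.moll η v) := (moll_smooth G hη hl).continuous
  refine ⟨?_, n2_le_of_lint hε.le hc⟩
  have hd : MemLp (fun x => G.moll η v x - v x) 2 volume := by
    refine ⟨hsm.aestronglyMeasurable.sub hv.1, ?_⟩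
    have : eLpNorm (fun x => G.moll η v x - v x) 2 volume ^ 2 < ⊤ := by
      rw [eLpNorm_sq]; exact hc.trans_lt ENNReal.ofReal_lt_top
    by_contra h
    rw [not_lt, top_le_iff] at h
    rw [h] at this; simp at this
  refine (hd.add hv).congr_norm hsm.aestronglyMeasurable (Eventually.of_forall fun x => by simp)

end CarnotSetting
end

end

section
open MeasureTheory Set Filter Topology
open scoped ContDiff ENNReal
noncomputable section
namespace CarnotSetting
variable {N m : ℕ}

lemma zero_of_test {O : Set (Fin N → ℝ)} (hO : IsOpen O) {f : (Fin N → ℝ) → ℝ} (hf : ContinuousOn f O)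
    (h : ∀ ψ, Test ψ → tsupport ψ ⊆ O → ∫ x, ψ x * f x = 0) : ∀ x ∈ O, f x = 0 := by
  have h1 := hO.ae_eq_zero_of_integral_contDiff_smul_eq_zero (μ := volume) (hf.locallyIntegrableOn hO.measurableSet)
    (fun g hg hc hs => h g ⟨hg, hc⟩ hs)
  have h2 : f =ᵐ[volume.restrict O] (fun _ => 0) := (ae_restrict_iff' hO.measurableSet).2 h1
  exact fun x hx => Measure.eqOn_open_of_ae_eq h2 hO hf continuousOn_const hx

lemma tube (G : CarnotSetting N m) {K O : Set (Fin N → ℝ)} (hK : IsCompact K) (hO : IsOpen O) (h : K ⊆ O) :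
    ∃ s > 0, ∀ x ∈ K, ∀ z, ‖z‖ < s → G.mul x z ∈ O ∧ G.mul z x ∈ O := by
  obtain ⟨u, v, -, hv, hu', hv', huv⟩ := generalized_tube_lemma hK (isCompact_singleton (x := (0 : Fin N → ℝ)))
    (n := {p | G.mul p.1 p.2 ∈ O ∧ G.mul p.2 p.1 ∈ O})
    ((hO.preimage G.continuous_mul').inter (hO.preimage (G.continuous_mul'.comp continuous_swap)))
    (by rintro ⟨x, z⟩ ⟨hx, hz⟩
        have hz' : z = 0 := hz
        subst hz'
        exact ⟨by simpa [G.mul_zero'] using h hx, by simpa [G.zero_mul'] using h hx⟩)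
  obtain ⟨s, hs, hb⟩ := Metric.isOpen_iff.1 hv 0 (hv' rfl)
  exact ⟨s, hs, fun x hx z hz => huv (Set.mk_mem_prod (hu' hx) (hb (by rwa [Metric.mem_ball, dist_zero_right])))⟩

lemma moll_harm (G : CarnotSetting N m) {A : Fin m → Fin m → ℝ} (hA : ∀ i j, A i j = A j i) {v : (Fin N → ℝ) → ℝ} (hm : Measurable v)
    (hv : MemLp v 2 volume) {U O : Set (Fin N → ℝ)} (hU : IsOpen U)
    (h : ∀ ψ, Test ψ → tsupport ψ ⊆ O → ∫ x, v x * G.LA A ψ x = 0) {η : (Fin N → ℝ) → ℝ} (hη : Test η)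
    (hs : ∀ z, η z ≠ 0 → ∀ x ∈ U, G.mul z x ∈ O) : ∀ x ∈ U, G.LA A (G.moll η v) x = 0 := by
  have hl := hv.locallyIntegrable (by norm_num)
  have hsm := moll_smooth G hη hl
  refine zero_of_test hU (LA_contDiff G A hsm).continuous.continuousOn fun ψ hψ hψs => ?_
  rw [← LA_symm G hA hsm hψ]
  have hLm := (hψ.LA G A).memLp
  have hLmeas : Measurable (G.LA A ψ) := (hψ.LA G A).1.continuous.measurable
  have hmeas : Measurable (fun p : (Fin N → ℝ) × (Fin N → ℝ) => η p.1 * (v (G.mul p.1 p.2) * G.LA A ψ p.2)) :=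
    (hη.1.continuous.measurable.comp measurable_fst).mul ((hm.comp G.continuous_mul'.measurable).mul
      (hLmeas.comp measurable_snd))
  have hI : Integrable (fun p : (Fin N → ℝ) × (Fin N → ℝ) => η p.1 * (v (G.mul p.1 p.2) * G.LA A ψ p.2))
      ((volume : Measure (Fin N → ℝ)).prod volume) := by
    rw [integrable_prod_iff hmeas.aestronglyMeasurable]
    constructor
    · refine Eventually.of_forall fun z => ?_
      have hi : Integrable (fun x => v (G.mul z x) * G.LA A ψ x) := (memLp_left G hv z).integrable_mul hLm
      exact hi.const_mul (η z)
    · refine Integrable.mono' (g := fun z => ‖η z‖ * (n2 volume v * n2 volume (G.LA A ψ))) (hη.integrable.norm.mul_const _)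
        hmeas.aestronglyMeasurable.norm.integral_prod_right' (Eventually.of_forall fun z => ?_)
      have h1 := cs _ _ (memLp_left G hv z).norm hLm.norm
      have hn : ∀ f : (Fin N → ℝ) → ℝ, n2 volume (fun x => ‖f x‖) = n2 volume f := fun f => by
        unfold n2; rw [eLpNorm_norm]
      rw [hn, hn, n2_left' G hv z] at h1
      simp only [norm_mul]
      rw [integral_const_mul, norm_mul, norm_norm]
      exact mul_le_mul_of_nonneg_left h1 (norm_nonneg _)
  calc ∫ x, G.moll η v x * G.LA A ψ x = ∫ x, ∫ z, η z * (v (G.mul z x) * G.LA A ψ x) := by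
        refine integral_congr_ae (Eventually.of_forall fun x => ?_)
        unfold moll
        beta_reduce
        rw [← integral_mul_const]
        refine integral_congr_ae (Eventually.of_forall fun z => ?_)
        exact mul_assoc _ _ _
    _ = ∫ z, ∫ x, η z * (v (G.mul z x) * G.LA A ψ x) := (integral_integral_swap (f := fun z x => η z * (v (G.mul z x) * G.LA A ψ x)) hI).symm
    _ = ∫ z : Fin N → ℝ, (0 : ℝ) := by
        refine integral_congr_ae (Eventually.of_forall fun z => ?_)
        beta_reduce
        rw [integral_const_mul]
        by_cases hz : η z = 0
        · simp [hz]
        · have h2 := h (fun y => ψ (G.mul (G.inv z) y)) (hψ.left G _) (by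
            intro y hy
            have := tsupport_comp_subset_preimage ψ (f := fun y => G.mul (G.inv z) y) (G.cmul_left _).continuous hy
            have h3 := hs z hz _ (hψs this)
            rwa [mul_inv_cancel_left'] at h3)
          rw [LA_left G A hψ.1, ← G.integral_left z] at h2
          simp only [inv_mul_cancel_left'] at h2
          rw [h2, mul_zero]
    _ = 0 := by simp

/-- Interior estimate near an arbitrary point. -/
lemma reg_loc (G : CarnotSetting N m) {Λ : ℝ} (hΛ : 0 < Λ) (H : List (Fin m)) {s : ℝ} (hs : 0 < s) :
    ∃ C > 0, ∀ A, Ell Λ A → ∀ x, ∀ O : Set (Fin N → ℝ), IsOpen O → (∀ z, ‖z‖ < s → G.mul x z ∈ O) → ∀ u : (Fin N → ℝ) → ℝ, ContDiffOn ℝ ∞ u O →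
      (∀ y ∈ O, G.LA A u y = 0) → MemLp u 2 (volume.restrict O) →
      |vfIter G.Y H u x| ≤ C * n2 (volume.restrict O) u := by
  obtain ⟨C, hC, hr⟩ := reg G hΛ H (half_pos hs)
  obtain ⟨χ, hχ, h01, h1, hsup⟩ := exists_cutoff N (half_pos hs) (half_lt_self hs)
  refine ⟨C, hC, fun A hA x O hO hxO u hu hL hm => ?_⟩
  let ut : (Fin N → ℝ) → ℝ := fun y => χ (G.mul (G.inv x) y) * u y
  have hinv : ∀ y, ‖G.mul (G.inv x) y‖ < s → y ∈ O := fun y hy => by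
    have := hxO _ hy; rwa [mul_inv_cancel_left'] at this
  have hsm : ContDiff ℝ ∞ ut := by
    rw [contDiff_iff_contDiffAt]
    intro y
    by_cases hy : G.mul (G.inv x) y ∈ tsupport χ
    · have hyO : y ∈ O := hinv y (by have := hsup hy; rwa [Metric.mem_ball, dist_zero_right] at this)
      exact (hχ.1.comp (G.cmul_left _)).contDiffAt.mul (hu.contDiffAt (hO.mem_nhds hyO))
    · have : ∀ᶠ y' in 𝓝 y, ut y' = 0 := by
        have hop : IsOpen {y' | G.mul (G.inv x) y' ∈ (tsupport χ)ᶜ} := (isClosed_tsupport χ).isOpen_compl.preimage (G.cmul_left _).continuous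
        filter_upwards [hop.mem_nhds hy] with y' hy'
        simp only [ut, image_eq_zero_of_notMem_tsupport hy', zero_mul]
      exact (contDiffAt_const (c := (0:ℝ))).congr_of_eventuallyEq this
  let V : Set (Fin N → ℝ) := {y | ‖G.mul (G.inv x) y‖ < s / 2}
  have hV : IsOpen V := isOpen_lt ((G.cmul_left _).continuous.norm) continuous_const
  have hVO : V ⊆ O := fun y hy => hinv y (lt_trans hy (half_lt_self hs))
  have hxV : x ∈ V := by simp only [V, mem_setOf_eq, G.inv_mul', norm_zero]; exact half_pos hs
  have hut : ∀ y ∈ V, ut y = u y := fun y hy => by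
    simp only [ut]; rw [h1 _ (by rw [Metric.mem_closedBall, dist_zero_right]; exact le_of_lt hy), one_mul]
  have hw : ∀ l, ∀ y ∈ V, vfIter G.Y l ut y = vfIter G.Y l u y := fun l => vfIter_congr_on hV hut l
  have hLA : ∀ y ∈ V, G.LA A ut y = 0 := fun y hy => by
    rw [← hL y (hVO hy)]
    unfold LA
    refine Finset.sum_congr rfl fun i _ => Finset.sum_congr rfl fun j _ => ?_
    rw [show vfDeriv (G.Y i) (vfDeriv (G.Y j) ut) y = _ from hw [i, j] y hy]; rfl
  have h2 := hr A hA (fun z => ut (G.mul x z)) (hsm.comp (G.cmul_left x)) (fun z hz => by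
    rw [LA_left G A hsm]
    refine hLA _ ?_
    simp only [V, mem_setOf_eq, inv_mul_cancel_left']
    rwa [Metric.mem_ball, dist_zero_right] at hz)
  rw [vfIter_comp_mul G hsm] at h2
  beta_reduce at h2
  rw [G.mul_zero', hw H x hxV] at h2
  refine h2.trans (mul_le_mul_of_nonneg_left ?_ hC.le)
  refine n2_le_of_lint n2_nonneg ?_
  rw [n2_lint hm]
  have hpre : Metric.ball (0 : Fin N → ℝ) (s / 2) = (fun z => G.mul x z) ⁻¹' V := by
    ext z; simp [V, inv_mul_cancel_left']
  rw [hpre, (G.mp_left x).setLIntegral_comp_preimage_emb (G.homeoL x).measurableEmbedding (fun y => ‖ut y‖ₑ ^ 2)]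
  calc _ = ∫⁻ y in V, ‖u y‖ₑ ^ 2 := setLIntegral_congr_fun hV.measurableSet (fun y hy => by beta_reduce; rw [hut y hy])
    _ ≤ _ := lintegral_mono_set hVO

lemma reg_on (G : CarnotSetting N m) {Λ : ℝ} (hΛ : 0 < Λ) (H : List (Fin m)) {K O : Set (Fin N → ℝ)} (hK : IsCompact K) (hO : IsOpen O)
    (hKO : K ⊆ O) : ∃ C > 0, ∀ A, Ell Λ A → ∀ u : (Fin N → ℝ) → ℝ, ContDiffOn ℝ ∞ u O →
      (∀ y ∈ O, G.LA A u y = 0) → MemLp u 2 (volume.restrict O) → ∀ x ∈ K, |vfIter G.Y H u x| ≤ C * n2 (volume.restrict O) u := by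
  obtain ⟨s, hs, hb⟩ := tube G hK hO hKO
  obtain ⟨C, hC, h⟩ := reg_loc G hΛ H hs
  exact ⟨C, hC, fun A hA u hu hL hm x hx => h A hA x O hO (fun z hz => (hb x hx z hz).1) u hu hL hm⟩

end CarnotSetting
end

end

section
open MeasureTheory Set Filter Topology
open scoped ContDiff ENNReal
noncomputable section
namespace CarnotSetting
variable {N m : ℕ}

lemma weyl_meas (G : CarnotSetting N m) {Λ : ℝ} (hΛ : 0 < Λ) {A : Fin m → Fin m → ℝ} (hA : Ell Λ A) {v : (Fin N → ℝ) → ℝ} (hmv : Measurable v)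
    (hv : MemLp v 2 volume) {O : Set (Fin N → ℝ)} (hO : IsOpen O)
    (h : ∀ ψ, Test ψ → tsupport ψ ⊆ O → ∫ x, v x * G.LA A ψ x = 0) :
    ∃ u, ContDiffOn ℝ ∞ u O ∧ (∀ᵐ x, x ∈ O → u x = v x) ∧ ∀ x ∈ O, G.LA A u x = 0 := by
  have hl := hv.locallyIntegrable (by norm_num)
  have hE : ∀ n : ℕ, ∃ η : (Fin N → ℝ) → ℝ, Test η ∧ (∀ z, η z ≠ 0 → ‖z‖ < 1 / ((n:ℝ) + 1)) ∧
      MemLp (G.moll η v) 2 volume ∧ n2 volume (fun x => G.moll η v x - v x) ≤ 1 / ((n:ℝ) + 1) := by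
    intro n
    obtain ⟨δ, hδ, hd⟩ := moll_near G hmv hv (ε := 1 / ((n:ℝ) + 1)) (by positivity)
    obtain ⟨η, h1, h2, h3, h4⟩ := exists_mollifier N (δ := min δ (1 / ((n:ℝ) + 1))) (lt_min hδ (by positivity))
    have := hd η h1 h2 h3 fun z hz => (h4 z hz).trans_le (min_le_left _ _)
    exact ⟨η, h1, fun z hz => (h4 z hz).trans_le (min_le_right _ _), this.1, this.2⟩
  choose η hη hηs hfm hfn using hE
  let f : ℕ → (Fin N → ℝ) → ℝ := fun n => G.moll (η n) v
  have hf : ∀ n, ContDiff ℝ ∞ (f n) := fun n => moll_smooth G (hη n) hl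
  have hdm : ∀ n, MemLp (fun x => f n x - v x) 2 volume := fun n => (hfm n).sub hv
  have hfk : ∀ n k, n2 volume (fun x => f n x - f k x) ≤ 1 / ((n:ℝ) + 1) + 1 / ((k:ℝ) + 1) := fun n k => by
    have e : (fun x => f n x - f k x) = fun x => (f n x - v x) - (f k x - v x) := by ext x; ring
    rw [e]
    exact (n2_sub_le (hdm n) (hdm k)).trans (add_le_add (hfn n) (hfn k))
  have h1n : Tendsto (fun n : ℕ => 1 / ((n:ℝ) + 1)) atTop (𝓝 0) := tendsto_one_div_add_atTop_nhds_zero_nat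
  -- local statement
  have hloc : ∀ x0 ∈ O, ∃ U, IsOpen U ∧ x0 ∈ U ∧ U ⊆ O ∧ ∃ u, ContDiffOn ℝ ∞ u U ∧ (∀ x ∈ U, G.LA A u x = 0) ∧
      ∀ x ∈ U, Tendsto (fun n => f n x) atTop (𝓝 (u x)) := by
    intro x0 hx0
    obtain ⟨r, hr, hrO⟩ := Metric.isOpen_iff.1 hO x0 hx0
    have hsub : Metric.closedBall x0 (r / 2) ⊆ O := (Metric.closedBall_subset_ball (half_lt_self hr)).trans hrO
    obtain ⟨s, hs, hst⟩ := tube G (isCompact_closedBall x0 (r / 2)) hO hsub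
    obtain ⟨n0, hn0⟩ := (h1n.eventually (gt_mem_nhds hs)).exists_forall_of_atTop
    have hharm : ∀ n ≥ n0, ∀ x ∈ Metric.ball x0 (r / 2), G.LA A (f n) x = 0 := fun n hn =>
      moll_harm G hA.1 hmv hv Metric.isOpen_ball h (hη n) fun z hz x hx =>
        (hst x (Metric.ball_subset_closedBall hx) z ((hηs n z hz).trans (hn0 n hn))).2
    have hKsub : Metric.closedBall x0 (r / 4) ⊆ Metric.ball x0 (r / 2) := Metric.closedBall_subset_ball (by linarith)
    have hC : ∀ H, UniformCauchySeqOn (fun n => vfIter G.Y H (f n)) atTop (Metric.ball x0 (r / 4)) := by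
      intro H
      obtain ⟨C, hC, hb⟩ := reg_on G hΛ H (isCompact_closedBall x0 (r / 4)) Metric.isOpen_ball hKsub
      rw [Metric.uniformCauchySeqOn_iff]
      intro ε hε
      obtain ⟨n1, hn1⟩ := (h1n.eventually (gt_mem_nhds (show (0:ℝ) < ε / (2 * C) by positivity))).exists_forall_of_atTop
      refine ⟨max n0 n1, fun n hn k hk x hx => ?_⟩
      have hmem : MemLp (fun x => f n x - f k x) 2 volume := (hfm n).sub (hfm k)
      have h2 := hb A hA (fun x => f n x - f k x) ((hf n).sub (hf k)).contDiffOn (fun y hy => by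
        rw [LA_sub G A (hf n) (hf k)]
        beta_reduce
        rw [hharm n (le_of_max_le_left hn) y hy, hharm k (le_of_max_le_left hk) y hy, sub_zero])
        (hmem.mono_measure Measure.restrict_le_self) x (Metric.ball_subset_closedBall hx)
      rw [vfIter_sub' G.Y_smooth (hf n) (hf k)] at h2
      rw [Real.dist_eq]
      refine h2.trans_lt ?_
      have h3 := (n2_mono_measure hmem (Measure.restrict_le_self (s := Metric.ball x0 (r / 2)))).trans (hfk n k)
      have h4 := hn1 n (le_of_max_le_right hn)
      have h5 := hn1 k (le_of_max_le_right hk)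
      calc _ ≤ C * (1 / ((n:ℝ) + 1) + 1 / ((k:ℝ) + 1)) := mul_le_mul_of_nonneg_left h3 hC.le
        _ < C * (ε / (2 * C) + ε / (2 * C)) := by gcongr
        _ = ε := by field_simp; norm_num
    obtain ⟨u, hu, hlim⟩ := lim_smooth Metric.isOpen_ball hf (cauchy_cF G Metric.isBounded_ball hf hC)
    refine ⟨_, Metric.isOpen_ball, Metric.mem_ball_self (by linarith), (Metric.ball_subset_ball (by linarith)).trans hrO, u, hu, fun x hx => ?_, fun x hx => hlim [] x hx⟩
    obtain ⟨P', hP', he⟩ := LA_cF G A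
    beta_reduce at he
    have h6 : Tendsto (fun n => G.LA A (f n) x) atTop (𝓝 (G.LA A u x)) := by
      have := hP'.lim (f := f) (u := u) (x := x) (fun l => hlim l x hx)
      rw [he _ Metric.isOpen_ball u hu x hx]
      exact this.congr fun n => (he univ isOpen_univ (f n) (hf n).contDiffOn x trivial).symm
    refine tendsto_nhds_unique h6 (tendsto_const_nhds.congr' ?_)
    filter_upwards [eventually_ge_atTop n0] with n hn
    exact (hharm n hn x (Metric.ball_subset_ball (by linarith) hx)).symm
  let u : (Fin N → ℝ) → ℝ := fun x => limUnder atTop (fun n => f n x)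
  have hcon : ∀ x ∈ O, Tendsto (fun n => f n x) atTop (𝓝 (u x)) := fun x hx => by
    obtain ⟨U, -, hxU, -, u', -, -, hu'⟩ := hloc x hx
    exact (hu' x hxU).cauchySeq.tendsto_limUnder
  have heq : ∀ x0 ∈ O, ∃ U, IsOpen U ∧ x0 ∈ U ∧ ContDiffOn ℝ ∞ u U ∧ (∀ x ∈ U, G.LA A u x = 0) := by
    intro x0 hx0
    obtain ⟨U, hU, hxU, hUO, u', hu', hL, hlim⟩ := hloc x0 hx0
    have e : ∀ x ∈ U, u x = u' x := fun x hx => tendsto_nhds_unique (hcon x (hUO hx)) (hlim x hx)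
    refine ⟨U, hU, hxU, hu'.congr e, fun x hx => ?_⟩
    rw [← hL x hx]
    unfold LA
    refine Finset.sum_congr rfl fun i _ => Finset.sum_congr rfl fun j _ => ?_
    rw [show vfDeriv (G.Y i) (vfDeriv (G.Y j) u) x = _ from vfIter_congr_on hU e [i, j] x hx]; rfl
  refine ⟨u, fun x hx => ?_, ?_, fun x hx => ?_⟩
  · obtain ⟨U, hU, hxU, hu, -⟩ := heq x hx
    exact (hu.contDiffAt (hU.mem_nhds hxU)).contDiffWithinAt
  · have h7 : Tendsto (fun n => eLpNorm (f n - v) 2 volume) atTop (𝓝 0) := by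
      have h8 : Tendsto (fun n : ℕ => ENNReal.ofReal (1 / ((n:ℝ) + 1))) atTop (𝓝 0) := by
        have := (ENNReal.continuous_ofReal.tendsto 0).comp h1n
        rwa [ENNReal.ofReal_zero] at this
      refine tendsto_of_tendsto_of_tendsto_of_le_of_le tendsto_const_nhds h8 (fun _ => zero_le) fun n => ?_
      exact (ENNReal.le_ofReal_iff_toReal_le (hdm n).2.ne (by positivity)).2 (hfn n)
    obtain ⟨ns, hns, hae⟩ := (tendstoInMeasure_of_tendsto_eLpNorm (by norm_num) (fun n => (hfm n).1) hv.1 h7).exists_seq_tendsto_ae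
    filter_upwards [hae] with x hx hxO
    exact tendsto_nhds_unique ((hcon x hxO).comp hns.tendsto_atTop) hx
  · obtain ⟨U, hU, hxU, -, hu⟩ := heq x hx
    exact hu x hxU

lemma weyl (G : CarnotSetting N m) {Λ : ℝ} (hΛ : 0 < Λ) {A : Fin m → Fin m → ℝ} (hA : Ell Λ A) {v : (Fin N → ℝ) → ℝ}
    (hv : MemLp v 2 volume) {O : Set (Fin N → ℝ)} (hO : IsOpen O)
    (h : ∀ ψ, Test ψ → tsupport ψ ⊆ O → ∫ x, v x * G.LA A ψ x = 0) :
    ∃ u, ContDiffOn ℝ ∞ u O ∧ (∀ᵐ x, x ∈ O → u x = v x) ∧ ∀ x ∈ O, G.LA A u x = 0 := by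
  have he := hv.1.ae_eq_mk
  obtain ⟨u, h1, h2, h3⟩ := weyl_meas G hΛ hA (v := hv.1.mk v) hv.1.stronglyMeasurable_mk.measurable (hv.ae_eq he) hO
    (fun ψ hψ hs => by
      rw [← h ψ hψ hs]
      refine integral_congr_ae ?_
      filter_upwards [he] with x hx
      rw [hx])
  refine ⟨u, h1, ?_, h3⟩
  filter_upwards [h2, he] with x hx hx2 hxO
  rw [hx hxO, hx2]

end CarnotSetting
end

end

section
open MeasureTheory Set Filter Topology
open scoped ContDiff ENNReal
noncomputable section
namespace CarnotSetting
variable {N m : ℕ}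

lemma LA_dil (G : CarnotSetting N m) (A : Fin m → Fin m → ℝ) {l : ℝ} (hl : 0 < l) {ψ : (Fin N → ℝ) → ℝ} (h : ContDiff ℝ ∞ ψ) (x) :
    G.LA A (fun w => ψ (dil G.σ l w)) x = l ^ 2 * G.LA A ψ (dil G.σ l x) := by
  unfold LA
  rw [Finset.mul_sum]
  refine Finset.sum_congr rfl fun i _ => ?_
  rw [Finset.mul_sum]
  refine Finset.sum_congr rfl fun j _ => ?_
  have h1 : vfDeriv (G.Y j) (fun w => ψ (dil G.σ l w)) = fun w => l * vfDeriv (G.Y j) ψ (dil G.σ l w) := by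
    funext w
    rw [G.vfDeriv_comp_dil (G.Y_homV j) hl w (h.differentiable (by simp) _), pow_one]
  have hd : ContDiff ℝ ∞ (vfDeriv (G.Y j) ψ) := vfDeriv_contDiff (G.Y_smooth j) h
  rw [h1, vfDeriv_const_mul, G.vfDeriv_comp_dil (G.Y_homV i) hl x (hd.differentiable (by simp) _), pow_one]
  · ring
  · exact (hd.comp (dil_contDiff G.σ l)).differentiable (by simp) _

lemma LA_supp (G : CarnotSetting N m) (A : Fin m → Fin m → ℝ) {ψ : (Fin N → ℝ) → ℝ} {x} (h : x ∉ tsupport ψ) : G.LA A ψ x = 0 := by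
  unfold LA
  refine Finset.sum_eq_zero fun i _ => Finset.sum_eq_zero fun j _ => ?_
  have : vfDeriv (G.Y i) (vfDeriv (G.Y j) ψ) x = 0 :=
    image_eq_zero_of_notMem_tsupport fun hx => h (vfIter_support' (Z := G.Y) [i, j] ψ hx)
  rw [this, mul_zero]

lemma ae_dil (G : CarnotSetting N m) {l : ℝ} (hl : 0 < l) {P : (Fin N → ℝ) → Prop} (h : ∀ᵐ x, P x) : ∀ᵐ x, P (dil G.σ l x) := by
  have : Measure.QuasiMeasurePreserving (dil G.σ l) volume volume :=
    ⟨(dil_continuous G.σ l).measurable, by rw [map_dil G.σ hl]; exact Measure.smul_absolutelyContinuous⟩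
  exact this.ae h

lemma memLp_dil (G : CarnotSetting N m) {l : ℝ} (hl : 0 < l) {f : (Fin N → ℝ) → ℝ} (h : MemLp f 2 volume) :
    MemLp (fun x => f (dil G.σ l x)) 2 volume := by
  have h1 : MemLp f 2 (Measure.map (dil G.σ l) volume) := by
    rw [map_dil G.σ hl]; exact h.smul_measure ENNReal.ofReal_ne_top
  exact (memLp_map_measure_iff h1.1 (dil_continuous G.σ l).aemeasurable).1 h1

lemma n2_dil (G : CarnotSetting N m) {l : ℝ} (hl : 0 < l) {f : (Fin N → ℝ) → ℝ} (h : MemLp f 2 volume) :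
    n2 volume (fun x => f (dil G.σ l x)) ^ 2 = (l ^ (∑ i, G.σ i))⁻¹ * n2 volume f ^ 2 := by
  rw [n2_sq (G.memLp_dil hl h), n2_sq h, integral_dil G.σ hl (fun x => f x ^ 2)]

lemma Weak.int {G : CarnotSetting N m} {A : Fin m → Fin m → ℝ} {f v φ : (Fin N → ℝ) → ℝ} (h : G.Weak A f v) (hφ : Test φ) :
    Integrable (fun x => v x * φ x) := by
  have h1 : Integrable (fun x => ((G.wt x)⁻¹ * v x) * (G.wt x * φ x)) := h.1.integrable_mul (memLp_cc hφ G.wt_cont)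
  refine h1.congr (Eventually.of_forall fun x => ?_)
  have := (G.wt_pos x).ne'
  field_simp

lemma Weak.add {G : CarnotSetting N m} {A : Fin m → Fin m → ℝ} {f v g w : (Fin N → ℝ) → ℝ} (h : G.Weak A f v) (h' : G.Weak A g w)
    (hf : Test f) (hg : Test g) : G.Weak A (f + g) (v + w) := by
  refine ⟨?_, fun ψ hψ => ?_⟩
  · have := h.1.add h'.1
    convert this using 1
    funext x; simp [mul_add]
  · simp only [Pi.add_apply, add_mul]
    rw [integral_add (h.int (hψ.LA G A)) (h'.int (hψ.LA G A)), integral_add (hf.mul_smooth hψ.1).integrable (hg.mul_smooth hψ.1).integrable, h.2 ψ hψ, h'.2 ψ hψ]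

lemma Weak.smul {G : CarnotSetting N m} {A : Fin m → Fin m → ℝ} {f v : (Fin N → ℝ) → ℝ} (h : G.Weak A f v) (c : ℝ) :
    G.Weak A (c • f) (c • v) := by
  refine ⟨?_, fun ψ hψ => ?_⟩
  · have := h.1.const_smul c
    convert this using 1
    funext x; simp; ring
  · simp only [Pi.smul_apply, smul_eq_mul, mul_assoc]
    rw [integral_const_mul, integral_const_mul, h.2 ψ hψ]

lemma wt_dil (G : CarnotSetting N m) {l : ℝ} (hl : 0 < l) (x) : G.wt (dil G.σ l x) ≤ max 1 l * G.wt x := by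
  unfold wt
  rw [G.rho_dil hl]
  have := G.rho_nonneg x
  have h1 := le_max_left 1 l
  have h2 := mul_le_mul_of_nonneg_right (le_max_right 1 l) this
  linarith

lemma dil_bd (G : CarnotSetting N m) {l : ℝ} (hl : 0 < l) (v : (Fin N → ℝ) → ℝ) (x) :
    |(G.wt x)⁻¹ * v (dil G.σ l x)| ≤ max 1 l * |(G.wt (dil G.σ l x))⁻¹ * v (dil G.σ l x)| := by
  rw [abs_mul, abs_mul, ← mul_assoc, abs_of_pos (inv_pos.2 (G.wt_pos _)), abs_of_pos (inv_pos.2 (G.wt_pos _))]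
  gcongr
  rw [← div_eq_mul_inv, le_div_iff₀ (G.wt_pos _), inv_mul_le_iff₀ (G.wt_pos _)]
  rw [mul_comm]; exact G.wt_dil hl x

lemma Weak.dila {G : CarnotSetting N m} {A : Fin m → Fin m → ℝ} {f v : (Fin N → ℝ) → ℝ} (h : G.Weak A f v) {l : ℝ} (hl : 0 < l) :
    G.Weak A (fun x => l ^ 2 * f (dil G.σ l x)) (fun x => v (dil G.σ l x)) := by
  refine ⟨?_, fun ψ hψ => ?_⟩
  · have h1 := G.memLp_dil hl h.1
    refine h1.of_le_mul (c := max 1 l) ?_ (Eventually.of_forall fun x => G.dil_bd hl v x)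
    have h2 : AEStronglyMeasurable (fun x => (G.wt x)⁻¹ * (G.wt (dil G.σ l x) * ((G.wt (dil G.σ l x))⁻¹ * v (dil G.σ l x)))) volume :=
      G.wt_inv_cont.aestronglyMeasurable.mul ((G.wt_cont.comp (dil_continuous G.σ l)).aestronglyMeasurable.mul h1.1)
    refine h2.congr (Eventually.of_forall fun x => ?_)
    have := (G.wt_pos (dil G.σ l x)).ne'
    beta_reduce
    rw [mul_inv_cancel_left₀ this]
  · set ψ' : (Fin N → ℝ) → ℝ := fun x => ψ (dil G.σ l⁻¹ x) with hψ'
    have ht : Test ψ' := hψ.dil G.σ (inv_pos.2 hl)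
    have e : ψ = fun x => ψ' (dil G.σ l x) := by
      funext x; simp only [hψ']; rw [dil_inv_dil G.σ hl]
    have e2 : ∀ x, v (dil G.σ l x) * G.LA A ψ x = l ^ 2 * ((fun y => v y * G.LA A ψ' y) (dil G.σ l x)) := by
      intro x
      conv_lhs => rw [e, G.LA_dil A hl ht.1]
      ring
    have e3 : ∀ x, l ^ 2 * f (dil G.σ l x) * ψ x = l ^ 2 * ((fun y => f y * ψ' y) (dil G.σ l x)) := by
      intro x
      conv_lhs => rw [e]
      ring
    simp only [e2, e3]
    rw [integral_const_mul, integral_const_mul, integral_dil G.σ hl (fun y => v y * G.LA A ψ' y), integral_dil G.σ hl (fun y => f y * ψ' y), h.2 ψ' ht]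

def rb (G : CarnotSetting N m) (a : ℝ) : Set (Fin N → ℝ) := {x | G.rho x < a}
lemma rb_open (G : CarnotSetting N m) (a : ℝ) : IsOpen (G.rb a) := isOpen_lt G.rho_continuous continuous_const

lemma harm_on (G : CarnotSetting N m) {Λ : ℝ} (hΛ : 0 < Λ) {A : Fin m → Fin m → ℝ} (hA : Ell Λ A) {f v : (Fin N → ℝ) → ℝ}
    (h : G.Weak A f v) {a : ℝ} (ha : 0 < a) (hf : ∀ x ∈ G.rb a, f x = 0) :
    ∃ u, ContDiffOn ℝ ∞ u (G.rb a) ∧ (∀ᵐ x, x ∈ G.rb a → u x = v x) ∧ (∀ x ∈ G.rb a, G.LA A u x = 0) ∧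
      MemLp u 2 (volume.restrict (G.rb a)) ∧ n2 (volume.restrict (G.rb a)) u ≤ (1 + a) * n2 volume (fun x => (G.wt x)⁻¹ * v x) := by
  have hb : ∀ x, ‖(G.rb a).indicator v x‖ ≤ (1 + a) * ‖(G.wt x)⁻¹ * v x‖ := by
    intro x
    by_cases hx : x ∈ G.rb a
    · rw [indicator_of_mem hx, norm_mul, norm_inv, Real.norm_eq_abs (G.wt x), abs_of_pos (G.wt_pos x), ← mul_assoc]
      refine le_mul_of_one_le_left (norm_nonneg _) ?_
      rw [← div_eq_mul_inv, one_le_div (G.wt_pos x)]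
      have : G.rho x < a := hx
      unfold wt; linarith
    · rw [indicator_of_notMem hx, norm_zero]; positivity
  have hvm : AEStronglyMeasurable v volume := by
    have h2 : AEStronglyMeasurable (fun x => G.wt x * ((G.wt x)⁻¹ * v x)) volume := G.wt_cont.aestronglyMeasurable.mul h.1.1
    refine h2.congr (Eventually.of_forall fun x => ?_)
    beta_reduce
    rw [mul_inv_cancel_left₀ (G.wt_pos x).ne']
  have hv1 : MemLp ((G.rb a).indicator v) 2 volume :=
    h.1.of_le_mul (hvm.indicator (G.rb_open a).measurableSet) (Eventually.of_forall hb)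
  have hn : n2 volume ((G.rb a).indicator v) ≤ (1 + a) * n2 volume (fun x => (G.wt x)⁻¹ * v x) :=
    n2_le_of_ae h.1 (by positivity) (Eventually.of_forall hb)
  obtain ⟨u, hu, hae, hL⟩ := G.weyl hΛ hA hv1 (G.rb_open a) (fun ψ hψ hs => by
    have e : ∀ x, (G.rb a).indicator v x * G.LA A ψ x = v x * G.LA A ψ x := by
      intro x
      by_cases hx : x ∈ G.rb a
      · rw [indicator_of_mem hx]
      · have : G.LA A ψ x = 0 := by
          exact G.LA_supp A fun h => hx (hs h)
        simp [this]
    simp only [e]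
    rw [h.2 ψ hψ]
    refine integral_eq_zero_of_ae (Eventually.of_forall fun x => ?_)
    by_cases hx : x ∈ G.rb a
    · simp [hf x hx]
    · simp [image_eq_zero_of_notMem_tsupport fun h => hx (hs h)])
  have hae' : ∀ᵐ x, x ∈ G.rb a → u x = v x := by
    filter_upwards [hae] with x hx hm
    rw [hx hm, indicator_of_mem hm]
  have heq : u =ᵐ[volume.restrict (G.rb a)] (G.rb a).indicator v := by
    rw [Filter.EventuallyEq, ae_restrict_iff' (G.rb_open a).measurableSet]; exact hae
  refine ⟨u, hu, hae', hL, (memLp_congr_ae heq).2 (hv1.restrict _), le_trans ?_ hn⟩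
  have : n2 (volume.restrict (G.rb a)) u = n2 (volume.restrict (G.rb a)) ((G.rb a).indicator v) := by
    unfold n2; rw [eLpNorm_congr_ae heq]
  rw [this]
  exact n2_mono_measure hv1 Measure.restrict_le_self

lemma liouville (G : CarnotSetting N m) {Λ : ℝ} (hΛ : 0 < Λ) {A : Fin m → Fin m → ℝ} (hA : Ell Λ A) {v : (Fin N → ℝ) → ℝ}
    (h : G.Weak A 0 v) : ∀ᵐ x, v x = 0 := by
  obtain ⟨C, hC, hreg⟩ := G.reg_on hΛ [] (G.isCompact_rho_le 1) (G.rb_open 2) (fun x (hx : G.rho x ≤ 1) => show G.rho x < 2 by linarith)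
  set M := n2 volume (fun x => (G.wt x)⁻¹ * v x) with hM
  have hM0 : 0 ≤ M := n2_nonneg
  have key : ∀ n : ℕ, ∀ᵐ y, G.rho y ≤ (n + 1 : ℝ) → |v y| ≤ C * (3 * (M / √(n + 1))) := by
    intro n
    set R : ℝ := n + 1 with hR
    have hR1 : 1 ≤ R := by simp [hR]
    have hR0 : 0 < R := by linarith
    have hw : G.Weak A 0 (fun x => v (dil G.σ R x)) := by
      have := h.dila hR0
      convert this using 1
      funext x; simp
    obtain ⟨u, hu, hae, hL, hm, hn⟩ := G.harm_on hΛ hA hw (a := 2) (by norm_num) (fun _ _ => rfl)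
    have hs : n2 volume (fun x => (G.wt x)⁻¹ * v (dil G.σ R x)) ≤ M / √R := by
      have h1 : n2 volume (fun x => (G.wt x)⁻¹ * v (dil G.σ R x)) ≤ R * n2 volume (fun x => (fun y => (G.wt y)⁻¹ * v y) (dil G.σ R x)) := by
        refine n2_le_of_ae (G.memLp_dil hR0 h.1) hR0.le (Eventually.of_forall fun x => ?_)
        have := G.dil_bd hR0 v x
        rwa [max_eq_right hR1] at this
      refine h1.trans ?_
      have h2 := G.n2_dil hR0 h.1
      rw [le_div_iff₀ (Real.sqrt_pos.2 hR0)]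
      refine abs_le_of_sq_le_sq' ?_ hM0 |>.2
      rw [mul_pow, mul_pow, Real.sq_sqrt hR0.le, h2]
      have h3 : R ^ 3 ≤ R ^ (∑ i, G.σ i) := pow_le_pow_right₀ hR1 G.Q_gt_two
      have h4 : R ^ 3 * (R ^ (∑ i, G.σ i))⁻¹ ≤ 1 := by
        rw [← div_eq_mul_inv, div_le_one (by positivity)]; exact h3
      calc _ = R ^ 3 * (R ^ (∑ i, G.σ i))⁻¹ * M ^ 2 := by ring
        _ ≤ 1 * M ^ 2 := by gcongr
        _ = _ := one_mul _
    have h5 := hreg A hA u hu hL hm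
    have h6 : ∀ᵐ x, G.rho x ≤ 1 → |v (dil G.σ R x)| ≤ C * (3 * (M / √R)) := by
      filter_upwards [hae] with x hx hr
      rw [← hx (show G.rho x < 2 by linarith)]
      refine (h5 x hr).trans ?_
      gcongr
      refine hn.trans ?_
      have : (1:ℝ) + 2 = 3 := by norm_num
      rw [this]
      gcongr
    have h7 := G.ae_dil (inv_pos.2 hR0) h6
    filter_upwards [h7] with y hy hr
    rw [G.rho_dil (inv_pos.2 hR0), dil_dil_inv G.σ hR0] at hy
    exact hy (by rw [inv_mul_le_iff₀ hR0]; simpa using hr)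
  filter_upwards [ae_all_iff.2 key] with y hy
  have hlim : Tendsto (fun n : ℕ => C * (3 * (M / √((n:ℝ) + 1)))) atTop (𝓝 0) := by
    have h1 : Tendsto (fun n : ℕ => √((n:ℝ) + 1)) atTop atTop :=
      Real.tendsto_sqrt_atTop.comp (tendsto_natCast_atTop_atTop.atTop_add tendsto_const_nhds)
    have := ((h1.const_div_atTop M).const_mul 3).const_mul C
    simpa using this
  have : |v y| ≤ 0 := by
    refine ge_of_tendsto hlim ?_
    obtain ⟨n0, hn0⟩ := exists_nat_ge (G.rho y)
    filter_upwards [eventually_ge_atTop n0] with n hn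
    refine hy n ?_
    have : (n0:ℝ) ≤ n := by exact_mod_cast hn
    linarith
  simpa using this

def IsT (G : CarnotSetting N m) (A : Fin m → Fin m → ℝ) (f : (Fin N → ℝ) → ℝ) (c : ℝ) : Prop :=
  ∃ v, ∃ r > 0, G.Weak A f v ∧ ContinuousOn v (Metric.ball 0 r) ∧ v 0 = c

lemma IsT.add {G : CarnotSetting N m} {A : Fin m → Fin m → ℝ} {f g : (Fin N → ℝ) → ℝ} {c d : ℝ} (h : G.IsT A f c) (h' : G.IsT A g d)
    (hf : Test f) (hg : Test g) : G.IsT A (f + g) (c + d) := by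
  obtain ⟨v, r, hr, hv, hc, rfl⟩ := h
  obtain ⟨w, s, hs, hw, hd, rfl⟩ := h'
  exact ⟨v + w, min r s, lt_min hr hs, hv.add hw hf hg,
    (hc.mono (Metric.ball_subset_ball (min_le_left _ _))).add (hd.mono (Metric.ball_subset_ball (min_le_right _ _))), rfl⟩

lemma IsT.smul {G : CarnotSetting N m} {A : Fin m → Fin m → ℝ} {f : (Fin N → ℝ) → ℝ} {c : ℝ} (h : G.IsT A f c) (t : ℝ) :
    G.IsT A (t • f) (t * c) := by
  obtain ⟨v, r, hr, hv, hc, rfl⟩ := h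
  exact ⟨t • v, r, hr, hv.smul t, hc.const_smul t, rfl⟩

lemma IsT.unique {G : CarnotSetting N m} {Λ : ℝ} (hΛ : 0 < Λ) {A : Fin m → Fin m → ℝ} (hA : Ell Λ A) {f : (Fin N → ℝ) → ℝ} {c d : ℝ}
    (hf : Test f) (h : G.IsT A f c) (h' : G.IsT A f d) : c = d := by
  have hd := h.add (h'.smul (-1)) hf (by have := hf.const_mul (-1); exact this)
  have e : f + (-1 : ℝ) • f = 0 := by funext x; simp
  rw [e] at hd
  obtain ⟨v, r, hr, hv, hc, h0⟩ := hd
  have hz := G.liouville hΛ hA hv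
  have := zero_of_test Metric.isOpen_ball hc (fun ψ _ _ => integral_eq_zero_of_ae (by
    filter_upwards [hz] with x hx; simp [hx])) 0 (Metric.mem_ball_self hr)
  linarith

lemma IsT.dila {G : CarnotSetting N m} {A : Fin m → Fin m → ℝ} {f : (Fin N → ℝ) → ℝ} {c : ℝ} (h : G.IsT A f c) {l : ℝ} (hl : 0 < l) :
    G.IsT A (fun x => l ^ 2 * f (dil G.σ l x)) c := by
  obtain ⟨v, r, hr, hv, hc, rfl⟩ := h
  have : (dil G.σ l) ⁻¹' Metric.ball 0 r ∈ 𝓝 (0 : Fin N → ℝ) :=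
    (dil_continuous G.σ l).continuousAt.preimage_mem_nhds (by rw [dil_zero']; exact Metric.ball_mem_nhds _ hr)
  obtain ⟨s, hs, hss⟩ := Metric.mem_nhds_iff.1 this
  exact ⟨_, s, hs, hv.dila hl, hc.comp (dil_continuous G.σ l).continuousOn hss, by rw [dil_zero']⟩

lemma isT_LA (G : CarnotSetting N m) {Λ : ℝ} {A : Fin m → Fin m → ℝ} (hA : Ell Λ A) {ψ : (Fin N → ℝ) → ℝ} (h : Test ψ) :
    G.IsT A (G.LA A ψ) (ψ 0) := by
  refine ⟨ψ, 1, one_pos, ⟨memLp_cc h G.wt_inv_cont, fun φ hφ => ?_⟩, h.1.continuous.continuousOn, rfl⟩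
  rw [G.LA_symm hA.1 h.1 hφ]
  simp only [mul_comm]

lemma isT_exists (G : CarnotSetting N m) {Λ : ℝ} (hΛ : 0 < Λ) {a R : ℝ} (ha : 0 < a) (hR : 0 < R) : ∃ C > 0, ∀ A, Ell Λ A →
    ∀ f : (Fin N → ℝ) → ℝ, Test f → (∀ x, f x ≠ 0 → a ≤ G.rho x ∧ G.rho x ≤ R) → ∃ c, G.IsT A f c ∧ |c| ≤ C * n2 volume f := by
  obtain ⟨C1, hC1, hw⟩ := G.exists_weak hΛ
  have h0 : (0 : Fin N → ℝ) ∈ G.rb a := by show G.rho 0 < a; rw [G.rho_zero]; exact ha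
  obtain ⟨C2, hC2, hreg⟩ := G.reg_on hΛ [] (K := {0}) isCompact_singleton (G.rb_open a) (by simpa using h0)
  refine ⟨C2 * ((1 + a) * (C1 * (1 + R))), by positivity, fun A hA f hf hs => ?_⟩
  obtain ⟨v, hv, hn⟩ := hw A hA f hf
  obtain ⟨u, hu, hae, hL, hm, hb⟩ := G.harm_on hΛ hA hv ha (fun x hx => by
    by_contra h; exact absurd (hs x h).1 (not_le.2 hx))
  classical
  set v' : (Fin N → ℝ) → ℝ := fun x => if x ∈ G.rb a then u x else v x with hv'
  have heq : v' =ᵐ[volume] v := by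
    filter_upwards [hae] with x hx
    simp only [hv']
    split_ifs with h
    · exact hx h
    · rfl
  have hW : G.Weak A f v' := by
    refine ⟨(memLp_congr_ae (heq.mono fun x hx => ?_)).1 hv.1, fun ψ hψ => ?_⟩
    · beta_reduce; rw [hx]
    · rw [← hv.2 ψ hψ]
      exact integral_congr_ae (heq.mono fun x hx => by beta_reduce; rw [hx])
  obtain ⟨r, hr, hrr⟩ := Metric.isOpen_iff.1 (G.rb_open a) 0 h0
  refine ⟨u 0, ⟨v', r, hr, hW, ?_, by simp [hv', h0]⟩, ?_⟩
  · refine (hu.continuousOn.mono hrr).congr fun x hx => ?_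
    simp [hv', hrr hx]
  · have h1 : n2 volume (fun x => G.wt x * f x) ≤ (1 + R) * n2 volume f := by
      refine n2_le_of_ae hf.memLp (by positivity) (Eventually.of_forall fun x => ?_)
      rw [abs_mul, abs_of_pos (G.wt_pos x)]
      by_cases h : f x = 0
      · simp [h]
      · gcongr
        unfold wt; linarith [(hs x h).2]
    refine (hreg A hA u hu hL hm 0 rfl).trans ?_
    rw [mul_assoc]
    gcongr
    refine hb.trans ?_
    rw [mul_assoc]
    gcongr
    refine hn.trans ?_
    rw [mul_assoc]
    gcongr

end CarnotSetting
end

end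

section
open MeasureTheory Set Filter Topology
open scoped ContDiff ENNReal
noncomputable section
namespace CarnotSetting
variable {N m : ℕ}

def ann (G : CarnotSetting N m) : Set (Fin N → ℝ) := {x | 1 / 4 < G.rho x ∧ G.rho x < 8}
lemma ann_open (G : CarnotSetting N m) : IsOpen G.ann :=
  (isOpen_lt continuous_const G.rho_continuous).inter (isOpen_lt G.rho_continuous continuous_const)

def annV (G : CarnotSetting N m) : Submodule ℝ ((Fin N → ℝ) → ℝ) where
  carrier := {f | Test f ∧ ∀ x, x ∉ G.ann → f x = 0}
  zero_mem' := ⟨Test.zero, fun _ _ => rfl⟩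
  add_mem' := fun {f g} hf hg => ⟨hf.1.add hg.1, fun x hx => by simp [hf.2 x hx, hg.2 x hx]⟩
  smul_mem' := fun c f hf => ⟨hf.1.const_mul c, fun x hx => by simp [hf.2 x hx]⟩

lemma exists_gam' (G : CarnotSetting N m) {Λ : ℝ} (hΛ : 0 < Λ) : ∃ C, 0 ≤ C ∧ ∀ A, Ell Λ A → ∃ g : (Fin N → ℝ) → ℝ,
    ContDiffOn ℝ ∞ g G.ann ∧ (∀ x ∈ G.ann, G.LA A g x = 0) ∧ MemLp g 2 (volume.restrict G.ann) ∧
    n2 (volume.restrict G.ann) g ≤ C ∧ ∀ f ∈ G.annV, G.IsT A f (∫ x, g x * f x) := by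
  obtain ⟨C, hC, hT⟩ := G.isT_exists hΛ (a := 1 / 4) (R := 8) (by norm_num) (by norm_num)
  refine ⟨C, hC.le, fun A hA => ?_⟩
  have hT' : ∀ f ∈ G.annV, ∃ c, G.IsT A f c ∧ |c| ≤ C * n2 volume f := fun f hf => by
    refine hT A hA f hf.1 fun x hx => ?_
    have : x ∈ G.ann := by by_contra h; exact hx (hf.2 x h)
    exact ⟨this.1.le, this.2.le⟩
  classical
  set ℓ : ((Fin N → ℝ) → ℝ) → ℝ := fun f => if h : f ∈ G.annV then (hT' f h).choose else 0 with hℓ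
  have hℓ1 : ∀ f ∈ G.annV, G.IsT A f (ℓ f) ∧ |ℓ f| ≤ C * n2 volume f := fun f hf => by
    simp only [hℓ, dif_pos hf]; exact (hT' f hf).choose_spec
  obtain ⟨h, hm, hn, hrep⟩ := riesz G.annV id (fun _ _ _ _ => rfl) (fun _ _ _ => rfl) (fun f hf => hf.1.memLp) ℓ
    (fun f hf g hg => IsT.unique hΛ hA (hf.1.add hg.1) (hℓ1 _ (add_mem hf hg)).1 ((hℓ1 f hf).1.add (hℓ1 g hg).1 hf.1 hg.1))
    (fun c f hf => IsT.unique hΛ hA (hf.1.const_mul c) (hℓ1 _ (G.annV.smul_mem c hf)).1 ((hℓ1 f hf).1.smul c))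
    hC.le (fun f hf => (hℓ1 f hf).2)
  have hLV : ∀ ψ, Test ψ → tsupport ψ ⊆ G.ann → G.LA A ψ ∈ G.annV := fun ψ hψ hs =>
    ⟨hψ.LA G A, fun x hx => G.LA_supp A fun h => hx (hs h)⟩
  obtain ⟨u, hu, hae, hL⟩ := G.weyl hΛ hA hm G.ann_open (fun ψ hψ hs => by
    have h1 := hrep _ (hLV ψ hψ hs)
    have h2 := IsT.unique hΛ hA (hψ.LA G A) (hℓ1 _ (hLV ψ hψ hs)).1 (G.isT_LA hA hψ)
    have h3 : ψ 0 = 0 := image_eq_zero_of_notMem_tsupport fun h => by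
      have := (hs h).1
      rw [G.rho_zero] at this; norm_num at this
    simp only [id] at h1
    rw [← h1, h2, h3])
  have heq : u =ᵐ[volume.restrict G.ann] h := by
    rw [Filter.EventuallyEq, ae_restrict_iff' G.ann_open.measurableSet]; exact hae
  refine ⟨u, hu, hL, (memLp_congr_ae heq).2 (hm.restrict _), ?_, fun f hf => ?_⟩
  · have : n2 (volume.restrict G.ann) u = n2 (volume.restrict G.ann) h := by
      unfold n2; rw [eLpNorm_congr_ae heq]
    rw [this]
    exact (n2_mono_measure hm Measure.restrict_le_self).trans hn
  · have h1 := (hℓ1 f hf).1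
    rw [hrep f hf] at h1
    convert h1 using 1
    refine integral_congr_ae ?_
    filter_upwards [hae] with x hx
    by_cases hxa : x ∈ G.ann
    · simp [hx hxa]
    · simp [hf.2 x hxa]

lemma Test.supp_int {f : (Fin N → ℝ) → ℝ} (hf : Test f) {O : Set (Fin N → ℝ)} (hO : IsOpen O) (hs : tsupport f ⊆ O)
    {g : (Fin N → ℝ) → ℝ} (hg : ContinuousOn g O) : Integrable (fun x => f x * g x) := by
  have hc : ContinuousOn (fun x => f x * g x) O := hf.1.continuous.continuousOn.mul hg
  have h1 : IntegrableOn (fun x => f x * g x) (tsupport f) := (hc.mono hs).integrableOn_compact hf.2.isCompact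
  rwa [integrableOn_iff_integrable_of_support_subset] at h1
  intro x hx
  refine subset_tsupport f fun h => hx ?_
  simp [h]

lemma gam'_hom (G : CarnotSetting N m) {Λ : ℝ} (hΛ : 0 < Λ) {A} (hA : Ell Λ A) {g : (Fin N → ℝ) → ℝ}
    (hg : ContDiffOn ℝ ∞ g G.ann) (hT : ∀ f ∈ G.annV, G.IsT A f (∫ x, g x * f x)) {l : ℝ} (hl : 0 < l) {y} (hy : y ∈ G.ann)
    (hy' : dil G.σ l⁻¹ y ∈ G.ann) : g y = l ^ (2 - G.qq) * g (dil G.σ l⁻¹ y) := by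
  set O : Set (Fin N → ℝ) := G.ann ∩ dil G.σ l⁻¹ ⁻¹' G.ann with hO
  have hOo : IsOpen O := G.ann_open.inter (G.ann_open.preimage (dil_continuous _ _))
  have hgc : ContinuousOn g O := hg.continuousOn.mono inter_subset_left
  have hgc' : ContinuousOn (fun y => g (dil G.σ l⁻¹ y)) O :=
    hg.continuousOn.comp (dil_continuous _ _).continuousOn (fun x hx => hx.2)
  have := zero_of_test hOo (f := fun y => g y - l ^ (2 - G.qq) * g (dil G.σ l⁻¹ y)) (hgc.sub (continuousOn_const.mul hgc')) (fun f hf hs => by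
    have hV : f ∈ G.annV := ⟨hf, fun x hx => image_eq_zero_of_notMem_tsupport fun h => hx (hs h).1⟩
    have hV' : (fun x => l ^ 2 * f (dil G.σ l x)) ∈ G.annV := by
      refine ⟨(hf.dil G.σ hl).const_mul _, fun x hx => ?_⟩
      have h0 : f (dil G.σ l x) = 0 := image_eq_zero_of_notMem_tsupport fun h => hx (by
        have := (hs h).2
        rwa [mem_preimage, dil_inv_dil G.σ hl] at this)
      beta_reduce; rw [h0, mul_zero]
    have h1 := IsT.unique hΛ hA hV'.1 (hT _ hV') ((hT f hV).dila hl)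
    have h2 : ∫ x, g x * (l ^ 2 * f (dil G.σ l x)) = l ^ (2 - G.qq) * ∫ x, f x * g (dil G.σ l⁻¹ x) := by
      have e : ∀ x, g x * (l ^ 2 * f (dil G.σ l x)) = l ^ 2 * ((fun y => f y * g (dil G.σ l⁻¹ y)) (dil G.σ l x)) := by
        intro x; beta_reduce; rw [dil_inv_dil G.σ hl]; ring
      simp only [e]
      rw [integral_const_mul, integral_dil G.σ hl (fun y => f y * g (dil G.σ l⁻¹ y)), Real.rpow_sub hl, qq_cast, Real.rpow_natCast,
        show (2:ℝ) = ((2:ℕ):ℝ) by norm_num, Real.rpow_natCast]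
      field_simp
    have i1 := hf.supp_int hOo hs hgc
    have i2 := (hf.supp_int hOo hs hgc').const_mul (l ^ (2 - G.qq))
    have e : ∀ x, f x * (g x - l ^ (2 - G.qq) * g (dil G.σ l⁻¹ x)) = f x * g x - l ^ (2 - G.qq) * (f x * g (dil G.σ l⁻¹ x)) := fun x => by ring
    simp only [e]
    rw [integral_sub i1 i2, integral_const_mul, ← h2, h1]
    simp only [mul_comm, sub_self]) y ⟨hy, hy'⟩
  linarith

lemma Hom.LA {G : CarnotSetting N m} {d : ℝ} {g : (Fin N → ℝ) → ℝ} (h : G.Hom d g) (hg : ContDiffOn ℝ ∞ g {0}ᶜ) (A) :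
    G.Hom (d - 2) (G.LA A g) := by
  refine Hom.sum G _ fun i _ => Hom.sum G _ fun j _ => ?_
  intro l hl x hx
  have := (h.iter G hg [i, j]).congr_deg (d' := d - 2) (by simp) l hl x hx
  have e : ∀ y, vfIter G.Y [i, j] g y = vfDeriv (G.Y i) (vfDeriv (G.Y j) g) y := fun _ => rfl
  rw [e, e] at this
  beta_reduce
  rw [this]; ring

lemma LA_congr_on (G : CarnotSetting N m) (A : Fin m → Fin m → ℝ) {u v : (Fin N → ℝ) → ℝ} {U : Set (Fin N → ℝ)} (hU : IsOpen U)
    (e : ∀ x ∈ U, u x = v x) : ∀ x ∈ U, G.LA A u x = G.LA A v x := by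
  intro x hx
  unfold CarnotSetting.LA; refine Finset.sum_congr rfl fun i _ => Finset.sum_congr rfl fun j _ => ?_
  rw [show vfDeriv (G.Y i) (vfDeriv (G.Y j) u) x = _ from vfIter_congr_on hU e [i, j] x hx]; rfl

lemma exists_gam (G : CarnotSetting N m) {Λ : ℝ} (hΛ : 0 < Λ) : ∃ g : {A : Fin m → Fin m → ℝ // Ell Λ A} → (Fin N → ℝ) → ℝ,
    G.HomFam (2 - G.qq) g ∧ ∀ A, (∀ x, x ≠ 0 → G.LA A.1 (g A) x = 0) ∧ ∀ f ∈ G.annV, G.IsT A.1 f (∫ x, g A x * f x) := by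
  obtain ⟨C, hC, h⟩ := G.exists_gam' hΛ
  choose! g0 hs hL hm hn hT using h
  set g : {A : Fin m → Fin m → ℝ // Ell Λ A} → (Fin N → ℝ) → ℝ :=
    fun A x => G.rho x ^ (2 - G.qq) * g0 A.1 (dil G.σ (G.rho x)⁻¹ x) with hgd
  have hsph : ∀ w, G.rho w = 1 → w ∈ G.ann := fun w hw => by constructor <;> rw [hw] <;> norm_num
  have hann0 : ∀ x ∈ G.ann, x ≠ 0 := fun x hx => G.ne_zero_of_rho (lt_trans (by norm_num) hx.1)
  have heq : ∀ A, ∀ x ∈ G.ann, g A x = g0 A.1 x := fun A x hx =>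
    (G.gam'_hom hΛ A.2 (hs A.1 A.2) (hT A.1 A.2) (G.rho_pos (hann0 x hx)) hx (hsph _ (G.rho_normalize (hann0 x hx)).1)).symm
  have hsm : ∀ A, ContDiffOn ℝ ∞ (g A) {0}ᶜ := by
    intro A
    have h1 : ContDiffOn ℝ ∞ (fun x : Fin N → ℝ => G.rho x ^ (2 - G.qq)) {0}ᶜ :=
      G.rho_smooth.rpow_const_of_ne fun x hx => (G.rho_pos hx).ne'
    have h2 : ContDiffOn ℝ ∞ (fun x : Fin N → ℝ => dil G.σ (G.rho x)⁻¹ x) {0}ᶜ := by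
      rw [contDiffOn_pi]
      intro i
      exact ((G.rho_smooth.inv fun x hx => (G.rho_pos hx).ne').pow _).mul (contDiff_apply ℝ ℝ i).contDiffOn
    exact h1.mul ((hs A.1 A.2).comp h2 fun x hx => hsph _ (G.rho_normalize hx).1)
  have hh : ∀ A, G.Hom (2 - G.qq) (g A) := by
    intro A l hl x hx
    simp only [hgd]
    have hr := G.rho_pos hx
    rw [G.rho_dil hl, Real.mul_rpow hl.le hr.le, dil_dil, show (l * G.rho x)⁻¹ * l = (G.rho x)⁻¹ by field_simp]
    ring
  refine ⟨g, ⟨hsm, hh, fun H => ?_⟩, fun A => ⟨?_, fun f hf => ?_⟩⟩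
  · obtain ⟨C', hC', hr⟩ := G.reg_on hΛ H G.isCompact_rho_sphere G.ann_open hsph
    refine ⟨C' * C, by positivity, fun A w hw => ?_⟩
    rw [vfIter_congr_on G.ann_open (heq A) H w (hsph w hw)]
    refine (hr A.1 A.2 _ (hs _ A.2) (hL _ A.2) (hm _ A.2) w hw).trans ?_
    gcongr
    exact hn _ A.2
  · intro x hx
    have h1 := (hh A).LA (hsm A) A.1
    obtain ⟨h2, h3⟩ := G.rho_normalize hx
    rw [h3, h1 _ (G.rho_pos hx) _ (G.sphere_ne h2), G.LA_congr_on A.1 G.ann_open (heq A) _ (hsph _ h2), hL _ A.2 _ (hsph _ h2), mul_zero]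
  · convert hT A.1 A.2 f hf using 1
    refine integral_congr_ae (Eventually.of_forall fun x => ?_)
    by_cases hxa : x ∈ G.ann
    · simp [heq A x hxa]
    · simp [hf.2 x hxa]

end CarnotSetting
end

end

section
open MeasureTheory Set Filter Topology
open scoped ContDiff ENNReal
noncomputable section
namespace CarnotSetting
variable {N m : ℕ}

lemma flux (G : CarnotSetting N m) {B : Fin m → (Fin N → ℝ) → ℝ} (hB : ∀ j, ContDiffOn ℝ ∞ (B j) {0}ᶜ) (hBh : ∀ j, G.Hom (1 - G.qq) (B j))
    (hdiv : ∀ x, x ≠ 0 → ∑ j, vfDeriv (G.Y j) (B j) x = 0) : ∃ K : ℝ, ∀ φ : (Fin N → ℝ) → ℝ, Test φ →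
    ∫ x, ∑ j, B j x * vfDeriv (G.Y j) φ x = φ 0 * K := by
  obtain ⟨χ, hχ, hχ01, hχ1, hχs⟩ := exists_cutoff N (r := 2) (r' := 1) one_pos one_lt_two
  refine ⟨∫ x, ∑ j, B j x * vfDeriv (G.Y j) χ x, fun φ hφ => ?_⟩
  obtain ⟨R, hR, hRχ⟩ := exists_rho_support G hχ.2
  set e : ℕ → (Fin N → ℝ) → ℝ := fun n x => 1 - χ (dil G.σ (n+1) x) with he
  have hn : ∀ n : ℕ, (0:ℝ) < n + 1 := fun n => by positivity
  have hes : ∀ n, ContDiff ℝ ∞ (e n) := fun n => contDiff_const.sub (hχ.1.comp (dil_contDiff _ _))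
  have he01 : ∀ n x, |e n x| ≤ 1 := fun n x => by
    rw [abs_le]; have := hχ01 (dil G.σ (n+1) x); simp only [he]; constructor <;> linarith
  have hlim : ∀ x, x ≠ 0 → ∀ᶠ n in atTop, e n x = 1 := by
    intro x hx
    have hρ := G.rho_pos hx
    filter_upwards [eventually_gt_atTop ⌈R / G.rho x⌉₊] with n hn'
    have : χ (dil G.σ (n+1) x) = 0 := by
      by_contra h
      have h1 := hRχ _ h
      rw [G.rho_dil (hn n)] at h1
      have h2 : R / G.rho x < n := (Nat.le_ceil _).trans_lt (by exact_mod_cast hn')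
      rw [div_lt_iff₀ hρ] at h2
      nlinarith
    simp [he, this]
  have hsm : ∀ n j, ContDiff ℝ ∞ (fun x => B j x * e n x) := by
    intro n j
    refine contDiff_off_zero ((hB j).mul (hes n).contDiffOn) ?_
    have hc : Continuous (fun x => dil G.σ ((n:ℝ)+1) x) := (dil_contDiff _ _).continuous
    have h0 : ∀ᶠ x in 𝓝 (0:Fin N → ℝ), dil G.σ ((n:ℝ)+1) x ∈ Metric.ball (0:Fin N → ℝ) 1 :=
      hc.continuousAt.eventually_mem (Metric.isOpen_ball.mem_nhds (by simp [dil_zero']))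
    filter_upwards [h0] with x hx
    simp only [he]
    rw [hχ1 _ (Metric.ball_subset_closedBall hx)]; simp
  have hInt : ∀ ψ : (Fin N → ℝ) → ℝ, Test ψ → Integrable (fun x => ∑ j, B j x * vfDeriv (G.Y j) ψ x) := fun ψ hψ =>
    integrable_finsetSum _ fun j _ => (hBh j).integrable_mul G (by linarith) (hB j).continuousOn (hψ.Y G j).1.continuous (hψ.Y G j).2
  have hve : ∀ n j x, vfDeriv (G.Y j) (e n) x = - ((n+1) * vfDeriv (G.Y j) χ (dil G.σ (n+1) x)) := by
    intro n j x
    simp only [he]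
    have h2 : DifferentiableAt ℝ (fun w => χ (dil G.σ ((n:ℝ)+1) w)) x :=
      ((hχ.1.comp (dil_contDiff _ _)).differentiable (by simp)) x
    rw [vfDeriv_sub (differentiableAt_const _) h2, vfDeriv_const, vfDeriv_comp_dil G (G.Y_homV j) (hn n) x (hχ.1.differentiable (by simp) _)]
    simp
  have key : ∀ n : ℕ, ∫ x, e n x * ∑ j, B j x * vfDeriv (G.Y j) φ x =
      ∫ x, (∑ j, B j x * vfDeriv (G.Y j) χ x) * φ (dil G.σ ((n:ℝ)+1)⁻¹ x) := by
    intro n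
    have h1 : ∀ j, ∫ x, B j x * e n x * vfDeriv (G.Y j) φ x = - ∫ x, vfDeriv (G.Y j) (fun x => B j x * e n x) x * φ x := fun j => by
      rw [ibp' (G.Y_smooth j) (G.Y_divFree j) (hsm n j) hφ, neg_neg]
    have h2 : ∫ x, e n x * ∑ j, B j x * vfDeriv (G.Y j) φ x = ∫ x, ∑ j, - (vfDeriv (G.Y j) (fun x => B j x * e n x) x * φ x) := by
      rw [integral_finsetSum]
      · simp only [integral_neg]
        rw [← Finset.sum_congr rfl fun j _ => h1 j, ← integral_finsetSum]
        · refine integral_congr_ae (Eventually.of_forall fun x => ?_)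
          beta_reduce
          rw [Finset.mul_sum]
          exact Finset.sum_congr rfl fun j _ => by ring
        · exact fun j _ => ((hφ.Y G j).smooth_mul (hsm n j)).integrable
      · exact fun j _ => (hφ.smooth_mul (vfDeriv_contDiff (G.Y_smooth j) (hsm n j))).integrable.neg
    rw [h2]
    set F : (Fin N → ℝ) → ℝ := fun x => (∑ j, B j x * vfDeriv (G.Y j) χ x) * φ (dil G.σ ((n:ℝ)+1)⁻¹ x) with hF
    have h3 : ∫ x, F (dil G.σ (n+1) x) = (((n:ℝ)+1) ^ (∑ i, G.σ i))⁻¹ * ∫ x, F x := integral_dil G.σ (hn n) F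
    have h4 : ∫ x, F x = ∫ x, ((n:ℝ)+1) ^ (∑ i, G.σ i) * F (dil G.σ (n+1) x) := by
      rw [integral_const_mul, h3, mul_inv_cancel_left₀ (pow_pos (hn n) _).ne']
    rw [h4]
    refine integral_congr_ae ?_
    filter_upwards [G.ae_ne_zero] with x hx
    have h5 : ∀ j, vfDeriv (G.Y j) (fun x => B j x * e n x) x = vfDeriv (G.Y j) (B j) x * e n x - (n+1) * (B j x * vfDeriv (G.Y j) χ (dil G.σ (n+1) x)) := fun j => by
      rw [vfDeriv_mul (diffAt_of_on isOpen_ne0 (hB j) hx) ((hes n).differentiable (by simp) x), hve]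
      ring
    have h6 : ∑ j, - (vfDeriv (G.Y j) (fun x => B j x * e n x) x * φ x) = (n+1) * (∑ j, B j x * vfDeriv (G.Y j) χ (dil G.σ (n+1) x)) * φ x := by
      simp only [h5]
      rw [Finset.sum_neg_distrib, ← Finset.sum_mul, Finset.sum_sub_distrib, ← Finset.sum_mul, hdiv x hx, Finset.mul_sum]
      ring
    rw [h6]
    simp only [hF]
    rw [dil_inv_dil G.σ (hn n), ← mul_assoc, Finset.mul_sum, Finset.mul_sum]
    congr 1
    refine Finset.sum_congr rfl fun j _ => ?_
    rw [hBh j _ (hn n) x hx, Real.rpow_sub (hn n), Real.rpow_one, qq_cast, Real.rpow_natCast]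
    have := (pow_pos (hn n) (∑ i, G.σ i)).ne'
    field_simp
  have L1 : Tendsto (fun n => ∫ x, e n x * ∑ j, B j x * vfDeriv (G.Y j) φ x) atTop (𝓝 (∫ x, ∑ j, B j x * vfDeriv (G.Y j) φ x)) := by
    refine tendsto_integral_of_dominated_convergence (fun x => |∑ j, B j x * vfDeriv (G.Y j) φ x|) (fun n => ?_) (hInt φ hφ).abs (fun n => ?_) ?_
    · exact (hes n).continuous.aestronglyMeasurable.mul (hInt φ hφ).1
    · refine Eventually.of_forall fun x => ?_
      rw [norm_mul]; exact mul_le_of_le_one_left (norm_nonneg _) (he01 n x)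
    · filter_upwards [G.ae_ne_zero] with x hx
      refine tendsto_const_nhds.congr' ?_
      filter_upwards [hlim x hx] with n h; rw [h, one_mul]
  obtain ⟨M, hM⟩ := hφ.1.continuous.bounded_above_of_compact_support hφ.2
  have L2 : Tendsto (fun n : ℕ => ∫ x, (∑ j, B j x * vfDeriv (G.Y j) χ x) * φ (dil G.σ ((n:ℝ)+1)⁻¹ x)) atTop
      (𝓝 (∫ x, (∑ j, B j x * vfDeriv (G.Y j) χ x) * φ 0)) := by
    refine tendsto_integral_of_dominated_convergence (fun x => |∑ j, B j x * vfDeriv (G.Y j) χ x| * M) (fun n => ?_) ((hInt χ hχ).abs.mul_const M) (fun n => ?_) ?_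
    · exact (hInt χ hχ).1.mul (hφ.1.continuous.comp (dil_continuous _ _)).aestronglyMeasurable
    · refine Eventually.of_forall fun x => ?_
      rw [norm_mul, Real.norm_eq_abs]; gcongr; exact hM _
    · refine Eventually.of_forall fun x => ?_
      refine tendsto_const_nhds.mul ?_
      have h1 : Tendsto (fun n : ℕ => ((n:ℝ)+1)⁻¹) atTop (𝓝[>] 0) :=
        tendsto_inv_atTop_nhdsGT_zero.comp (tendsto_atTop_add_const_right atTop (1:ℝ) tendsto_natCast_atTop_atTop)
      exact (hφ.1.continuous.tendsto 0).comp ((G.dil_tendsto x).comp h1)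
  have := tendsto_nhds_unique L1 (L2.congr fun n => (key n).symm)
  rw [this, integral_mul_const, mul_comm]

def rcut (G : CarnotSetting N m) (x : Fin N → ℝ) : ℝ := Real.smoothTransition (2 - G.rhoS x)
lemma rcut_test (G : CarnotSetting N m) : Test G.rcut := by
  refine ⟨Real.smoothTransition.contDiff.comp (contDiff_const.sub G.rhoS_contDiff), ?_⟩
  refine HasCompactSupport.of_support_subset_isCompact (G.isCompact_rho_le 2) fun x hx => ?_
  by_contra h
  have h1 : 2 < G.rho x := not_le.1 h
  refine hx (Real.smoothTransition.zero_of_nonpos ?_)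
  rw [← G.rho_pow]
  have : G.rho x ^ 1 ≤ G.rho x ^ G.rexp := pow_le_pow_right₀ (by linarith) G.rexp_pos
  linarith
lemma rcut_one (G : CarnotSetting N m) {x} (h : G.rho x ≤ 1) : G.rcut x = 1 := by
  refine Real.smoothTransition.one_of_one_le ?_
  rw [← G.rho_pow]
  have : G.rho x ^ G.rexp ≤ 1 := pow_le_one₀ (G.rho_nonneg x) h
  linarith
lemma rcut_ann (G : CarnotSetting N m) (A : Fin m → Fin m → ℝ) : G.LA A G.rcut ∈ G.annV := by
  refine ⟨G.rcut_test.LA G A, fun x hx => ?_⟩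
  by_cases h : G.rho x < 1
  · rw [G.LA_congr_on A (G.rb_open 1) (v := fun _ => 1) (fun y hy => G.rcut_one (le_of_lt hy)) x h]
    unfold LA
    refine Finset.sum_eq_zero fun i _ => Finset.sum_eq_zero fun j _ => ?_
    have : vfDeriv (G.Y j) (fun _ => (1:ℝ)) = fun _ => 0 := by funext y; rw [vfDeriv_const]
    rw [this, vfDeriv_const, mul_zero]
  · refine G.LA_supp A fun hs => hx ⟨by linarith, ?_⟩
    have : tsupport G.rcut ⊆ {x | G.rho x ≤ 2} := by
      refine closure_minimal (fun y hy => ?_) (G.isCompact_rho_le 2).isClosed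
      by_contra h
      have h1 : 2 < G.rho y := not_le.1 h
      refine hy (Real.smoothTransition.zero_of_nonpos ?_)
      rw [← G.rho_pow]
      have : G.rho y ^ 1 ≤ G.rho y ^ G.rexp := pow_le_pow_right₀ (by linarith) G.rexp_pos
      linarith
    have h2 : G.rho x ≤ 2 := this hs
    linarith

theorem fund (G : CarnotSetting N m) {Λ : ℝ} (hΛ : 0 < Λ) : ∃ g : {A : Fin m → Fin m → ℝ // Ell Λ A} → (Fin N → ℝ) → ℝ,
    G.HomFam (2 - G.qq) g ∧ ∀ A, ∀ φ, Test φ → ∀ x, φ x = ∫ z, g A z * G.LA A.1 φ (G.mul x z) := by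
  obtain ⟨g, hg, hA⟩ := G.exists_gam hΛ
  refine ⟨g, hg, fun A => ?_⟩
  obtain ⟨hL, hT⟩ := hA A
  set B : Fin m → (Fin N → ℝ) → ℝ := fun j x => ∑ i, A.1 i j * vfDeriv (G.Y i) (g A) x with hBd
  have hYs : ∀ i, ContDiffOn ℝ ∞ (vfDeriv (G.Y i) (g A)) {0}ᶜ := fun i => vfDeriv_contDiffOn isOpen_ne0 (G.Y_smooth i) (hg.smooth A)
  have hYh : ∀ i, G.Hom (1 - G.qq) (vfDeriv (G.Y i) (g A)) := fun i =>
    ((hg.hom A).vf G (G.Y_homV i) (hg.smooth A)).congr_deg (by push_cast; ring)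
  have hB : ∀ j, ContDiffOn ℝ ∞ (B j) {0}ᶜ := fun j => ContDiffOn.sum fun i _ => contDiffOn_const.mul (hYs i)
  have hBh : ∀ j, G.Hom (1 - G.qq) (B j) := fun j => Hom.sum G _ fun i _ l hl x hx => by
    beta_reduce; rw [hYh i l hl x hx]; ring
  obtain ⟨K, hK⟩ := G.flux hB hBh (fun x hx => by
    rw [← hL x hx]
    unfold LA
    refine Finset.sum_congr rfl fun j _ => ?_
    simp only [hBd]
    rw [vfDeriv_sum]
    · refine Finset.sum_congr rfl fun i _ => ?_
      rw [vfDeriv_const_mul _ (diffAt_of_on isOpen_ne0 (hYs i) hx), A.2.1 i j]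
    · exact fun i _ => (diffAt_of_on isOpen_ne0 (hYs i) hx).const_mul _)
  have h1 : ∀ φ, Test φ → ∫ x, g A x * G.LA A.1 φ x = φ 0 * (-K) := by
    intro φ hφ
    have hi : ∀ i j, Integrable (fun x => A.1 i j * (g A x * vfDeriv (G.Y i) (vfDeriv (G.Y j) φ) x)) := fun i j =>
      ((hg.hom A).integrable_mul G (by linarith) (hg.smooth A).continuousOn ((hφ.Y G j).Y G i).1.continuous ((hφ.Y G j).Y G i).2).const_mul _
    have hi' : ∀ i j, Integrable (fun x => A.1 i j * (vfDeriv (G.Y i) (g A) x * vfDeriv (G.Y j) φ x)) := fun i j =>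
      ((hYh i).integrable_mul G (by linarith) (hYs i).continuousOn (hφ.Y G j).1.continuous (hφ.Y G j).2).const_mul _
    have e1 : ∫ x, g A x * G.LA A.1 φ x = ∑ i, ∑ j, A.1 i j * ∫ x, g A x * vfDeriv (G.Y i) (vfDeriv (G.Y j) φ) x := by
      simp only [← integral_const_mul]
      simp only [← integral_finsetSum _ fun j _ => hi _ j]
      rw [← integral_finsetSum _ fun i _ => integrable_finsetSum _ fun j _ => hi i j]
      refine integral_congr_ae (Eventually.of_forall fun x => ?_)
      simp only [LA, Finset.mul_sum]
      exact Finset.sum_congr rfl fun i _ => Finset.sum_congr rfl fun j _ => by ring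
    have e2 : ∫ x, ∑ j, B j x * vfDeriv (G.Y j) φ x = ∑ j, ∑ i, A.1 i j * ∫ x, vfDeriv (G.Y i) (g A) x * vfDeriv (G.Y j) φ x := by
      simp only [← integral_const_mul]
      simp only [← integral_finsetSum _ fun i _ => hi' i _]
      rw [← integral_finsetSum _ fun j _ => integrable_finsetSum _ fun i _ => hi' i j]
      refine integral_congr_ae (Eventually.of_forall fun x => ?_)
      simp only [hBd, Finset.sum_mul]
      exact Finset.sum_congr rfl fun i _ => Finset.sum_congr rfl fun j _ => by ring
    rw [mul_neg, ← hK φ hφ, e1, e2, Finset.sum_comm, ← Finset.sum_neg_distrib]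
    refine Finset.sum_congr rfl fun j _ => ?_
    rw [← Finset.sum_neg_distrib]
    refine Finset.sum_congr rfl fun i _ => ?_
    rw [G.sing_ibp (G.Y_smooth i) (G.Y_divFree i) (G.Y_homV i) (by linarith) (hg.smooth A) (hg.hom A) (hφ.Y G j)]
    ring
  have hK1 : -K = 1 := by
    have a1 := h1 _ G.rcut_test
    have a2 := IsT.unique hΛ A.2 (G.rcut_ann A.1).1 (hT _ (G.rcut_ann A.1)) (G.isT_LA A.2 G.rcut_test)
    rw [a2, G.rcut_one (by rw [G.rho_zero]; norm_num), one_mul] at a1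
    exact a1.symm
  intro φ hφ x
  have a1 := h1 _ (hφ.left G x)
  rw [hK1, G.mul_zero', mul_one] at a1
  rw [← a1, G.LA_left A.1 hφ.1 x]

end CarnotSetting
end

end

section
open MeasureTheory Set Filter Topology
open scoped ContDiff ENNReal
noncomputable section
namespace CarnotSetting
variable {N m : ℕ}

lemma RY_smooth_iter (G : CarnotSetting N m) {u : (Fin N → ℝ) → ℝ} (hu : ContDiff ℝ ∞ u) (l : List (Fin m)) :
    ContDiff ℝ ∞ (vfIter G.RY l u) := by
  induction l with
  | nil => exact hu
  | cons i l ih => exact vfDeriv_contDiff (G.RY_smooth i) ih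

lemma Test.RYiter (G : CarnotSetting N m) {u : (Fin N → ℝ) → ℝ} (hu : Test u) (l : List (Fin m)) :
    Test (vfIter G.RY l u) := by
  induction l with
  | nil => exact hu
  | cons i l ih => exact ih.vf (G.RY_smooth i)

lemma RY_Y_comm (G : CarnotSetting N m) (i) {u : (Fin N → ℝ) → ℝ} (hu : ContDiff ℝ ∞ u) (l : List (Fin m)) :
    vfDeriv (G.RY i) (vfIter G.Y l u) = vfIter G.Y l (vfDeriv (G.RY i) u) := by
  induction l with
  | nil => rfl
  | cons j l ih =>
    simp only [vfIter]
    rw [← ih]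
    exact (G.vf_RV_comm (G.Y_smooth j) (G.Y_linv j) _ (vfIter_contDiff G hu l)).symm

lemma Y_at_zero (G : CarnotSetting N m) (l : List (Fin m)) : ∀ {u : (Fin N → ℝ) → ℝ}, ContDiff ℝ ∞ u →
    vfIter G.Y l u 0 = vfIter G.RY l.reverse u 0 := by
  induction l with
  | nil => intros; rfl
  | cons i l ih =>
    intro u hu
    have h1 : vfIter G.Y (i :: l) u 0 = vfDeriv (G.RY i) (vfIter G.Y l u) 0 := by
      simp only [vfIter, vfDeriv, RY, RV_zero]
    rw [h1, G.RY_Y_comm i hu, ih (vfDeriv_contDiff (G.RY_smooth i) hu), List.reverse_cons, vfIter_append]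
    rfl

lemma LA_RY (G : CarnotSetting N m) (A) {u : (Fin N → ℝ) → ℝ} (hu : ContDiff ℝ ∞ u) (l : List (Fin m)) :
    G.LA A (vfIter G.RY l u) = vfIter G.RY l (G.LA A u) := by
  induction l with
  | nil => rfl
  | cons j l ih =>
    simp only [vfIter]
    rw [← ih]
    exact G.LA_RV A _ (G.RY_smooth_iter hu l)

lemma ker_step (G : CarnotSetting N m) {ι : Type*} {g : ι → (Fin N → ℝ) → ℝ} (hg : G.HomFam (2 - G.qq) g) (i : Fin m) :
    ∃ h : Fin m → ι → (Fin N → ℝ) → ℝ, (∀ j, G.HomFam (2 - G.qq) (h j)) ∧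
      ∀ a ψ, Test ψ → ∫ z, g a z * vfDeriv (G.RY i) ψ z = ∑ j, ∫ z, h j a z * vfDeriv (G.Y j) ψ z := by
  obtain ⟨T, hT, hTh, hTe⟩ := G.euler
  have hq := G.qq_gt
  have hK : G.HomFam (1 - G.qq) (fun a => vfDeriv (G.RY i) (g a)) := by
    refine hg.DO (P := fun u => vfDeriv (G.RY i) u) (G.Y_field (G.RY_smooth i) IsDO.id) fun a => ?_
    have := (hg.hom a).vf G (G.RY_homV i) (hg.smooth a)
    convert this using 1
    push_cast; ring
  have hh : ∀ j, G.HomFam (2 - G.qq) (fun a => T j (vfDeriv (G.RY i) (g a))) := fun j => by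
    refine hK.DO (hT j) fun a => ?_
    have := hTh j _ _ (hK.smooth a) (hK.hom a)
    convert this using 1
    ring
  refine ⟨fun j a => T j (vfDeriv (G.RY i) (g a)), hh, fun a ψ hψ => ?_⟩
  have e1 := G.sing_ibp (G.RY_smooth i) (G.RY_divFree i) (G.RY_homV i) (by linarith) (hg.smooth a) (hg.hom a) hψ
  have e2 : ∫ z, vfDeriv (G.RY i) (g a) z * ψ z = ∫ z, ∑ j, vfDeriv (G.Y j) (T j (vfDeriv (G.RY i) (g a))) z * ψ z := by
    refine integral_congr_ae ?_
    filter_upwards [G.ae_ne_zero] with z hz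
    have := hTe _ _ (hK.smooth a) (hK.hom a) z hz
    rw [← Finset.sum_mul, ← this]
    ring
  have hi : ∀ j, Integrable (fun z => vfDeriv (G.Y j) (T j (vfDeriv (G.RY i) (g a))) z * ψ z) := fun j => by
    refine ((hh j).hom a |>.vf G (G.Y_homV j) ((hh j).smooth a)).integrable_mul' G ?_
      (vfDeriv_contDiffOn isOpen_ne0 (G.Y_smooth j) ((hh j).smooth a)).continuousOn hψ
    push_cast; linarith
  rw [integral_finsetSum _ fun j _ => hi j] at e2
  have e3 : ∀ j, ∫ z, vfDeriv (G.Y j) (T j (vfDeriv (G.RY i) (g a))) z * ψ z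
      = - ∫ z, T j (vfDeriv (G.RY i) (g a)) z * vfDeriv (G.Y j) ψ z := fun j =>
    G.sing_ibp (G.Y_smooth j) (G.Y_divFree j) (G.Y_homV j) (by linarith) ((hh j).smooth a) ((hh j).hom a) hψ
  simp only [e3, Finset.sum_neg_distrib] at e2
  linarith

lemma ker_iter (G : CarnotSetting N m) {ι : Type*} {g : ι → (Fin N → ℝ) → ℝ} (hg : G.HomFam (2 - G.qq) g) (k : ℕ) :
    ∀ I : List (Fin m), I.length = k → ∃ h : (Fin k → Fin m) → ι → (Fin N → ℝ) → ℝ, (∀ J, G.HomFam (2 - G.qq) (h J)) ∧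
      ∀ a ψ, Test ψ → ∫ z, g a z * vfIter G.RY I.reverse ψ z = ∑ J, ∫ z, h J a z * vfIter G.Y (List.ofFn J) ψ z := by
  induction k with
  | zero =>
    intro I hI
    obtain rfl := List.length_eq_zero_iff.1 hI
    refine ⟨fun _ => g, fun _ => hg, fun a ψ _ => ?_⟩
    simp [vfIter]
  | succ k ih =>
    intro I hI
    obtain ⟨i, l, rfl⟩ := List.exists_cons_of_length_eq_add_one hI
    obtain ⟨h, hh, he⟩ := ih l (by simpa using hI)
    choose h' hh' he' using fun J => G.ker_step (hh J) i
    refine ⟨fun J => h' (Fin.tail J) (J 0), fun J => hh' _ _, fun a ψ hψ => ?_⟩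
    rw [List.reverse_cons, vfIter_append]
    have e1 := he a _ (hψ.vf (G.RY_smooth i))
    have e0 : vfIter G.RY [i] ψ = vfDeriv (G.RY i) ψ := rfl
    rw [e0, e1]
    have e2 : ∀ J, ∫ z, h J a z * vfIter G.Y (List.ofFn J) (vfDeriv (G.RY i) ψ) z =
        ∑ j, ∫ z, h' J j a z * vfDeriv (G.Y j) (vfIter G.Y (List.ofFn J) ψ) z := fun J => by
      rw [← G.RY_Y_comm i hψ.1]
      exact he' J a _ (hψ.iter G _)
    simp only [e2]
    rw [← (Fin.consEquiv (fun _ : Fin (k+1) => Fin m)).sum_comp, Fintype.sum_prod_type, Finset.sum_comm]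
    refine Finset.sum_congr rfl fun j _ => Finset.sum_congr rfl fun J _ => ?_
    simp [Fin.consEquiv, vfIter]

/-- representation formula for test functions -/
theorem rep_test (G : CarnotSetting N m) {Λ : ℝ} (hΛ : 0 < Λ) (k : ℕ) :
    ∃ g : (Fin k → Fin m) → (Fin k → Fin m) → {A : Fin m → Fin m → ℝ // Ell Λ A} → (Fin N → ℝ) → ℝ,
      (∀ I J, G.HomFam (2 - G.qq) (g I J)) ∧ ∀ I A φ, Test φ → ∀ x,
        vfIter G.Y (List.ofFn I) φ x = ∑ J, ∫ y, g I J A (G.mul (G.inv y) x) * vfIter G.Y (List.ofFn J) (G.LA A.1 φ) y := by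
  obtain ⟨g, hg, he⟩ := G.fund hΛ
  choose h hh hhe using fun I : Fin k → Fin m => G.ker_iter hg k (List.ofFn I) (List.length_ofFn)
  refine ⟨fun I J A x => h I J A (G.inv x), fun I J => (hh I J).inv, fun I A φ hφ x => ?_⟩
  have hl := hφ.left G x
  have e1 := congrFun (G.vfIter_comp_mul hφ.1 x (List.ofFn I)) 0
  rw [G.mul_zero'] at e1
  rw [← e1, G.Y_at_zero _ hl.1, he A _ (hl.RYiter G _) 0]
  simp only [G.zero_mul']
  rw [G.LA_RY _ hl.1, hhe I A _ (hl.LA G A.1)]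
  refine Finset.sum_congr rfl fun J _ => ?_
  symm
  rw [← G.integral_left x]
  refine integral_congr_ae (Eventually.of_forall fun z => ?_)
  beta_reduce
  rw [G.LA_left A.1 hφ.1, G.vfIter_comp_mul (LA_contDiff G A.1 hφ.1), G.inv_mul_rev', G.inv_inv', G.inv_mul_cancel_left']

end CarnotSetting
end

end

section
open MeasureTheory Set Filter Topology
open scoped ContDiff ENNReal
noncomputable section
namespace CarnotSetting
variable {N m : ℕ}

lemma lip_glue {F : Type*} [PseudoMetricSpace F] {γ : ℝ → F} {K : NNReal} {a b c : ℝ} (h1 : LipschitzOnWith K γ (Icc a b))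
    (h2 : LipschitzOnWith K γ (Icc b c)) : LipschitzOnWith K γ (Icc a c) := by
  have key : ∀ s ∈ Icc a c, ∀ t ∈ Icc a c, s ≤ t → dist (γ s) (γ t) ≤ K * dist s t := by
    intro s hs t ht hst
    rcases le_total t b with h | h
    · exact h1.dist_le_mul _ ⟨hs.1, hst.trans h⟩ _ ⟨ht.1, h⟩
    rcases le_total b s with h' | h'
    · exact h2.dist_le_mul _ ⟨h', hs.2⟩ _ ⟨h, ht.2⟩
    have e1 := h1.dist_le_mul s ⟨hs.1, h'⟩ b ⟨hs.1.trans h', le_rfl⟩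
    have e2 := h2.dist_le_mul b ⟨le_rfl, h.trans ht.2⟩ t ⟨h, ht.2⟩
    rw [Real.dist_eq, abs_of_nonpos (by linarith)] at e1 e2 ⊢
    linarith [dist_triangle (γ s) (γ b) (γ t)]
  refine LipschitzOnWith.of_dist_le_mul fun s hs t ht => ?_
  rcases le_total s t with h | h
  · exact key s hs t ht h
  · rw [dist_comm, dist_comm s]; exact key t ht s hs h

lemma reach_path {G : CarnotSetting N m} {z C} (h : Reach G z C) (x : Fin N → ℝ) :
    ∃ (γ : ℝ → (Fin N → ℝ)) (c : Fin m → ℝ → ℝ) (K : NNReal), LipschitzOnWith K γ (Icc 0 C) ∧ γ 0 = x ∧ γ C = G.mul x z ∧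
      (∀ᵐ t : ℝ, t ∈ Ioo 0 C → HasDerivAt γ (∑ i, c i t • G.Y i (γ t)) t) ∧ ∀ i t, |c i t| ≤ 1 := by
  induction h with
  | one =>
    refine ⟨fun _ => x, fun _ _ => 0, 0, ?_, rfl, (G.mul_zero' x).symm, Eventually.of_forall fun t ht => ?_, by simp⟩
    · exact LipschitzWith.lipschitzOnWith (LipschitzWith.const x)
    · simpa using hasDerivAt_const t x
  | @step z C a b γ₂ t i hz hγ ht ih =>
    obtain ⟨γ₁, c₁, K, hK, h0, h1, hd, hc⟩ := ih
    have hC := hz.nonneg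
    obtain ⟨s, hs, hst⟩ : ∃ s : ℝ, |s| ≤ 1 ∧ s * |t| = t := by
      rcases le_total 0 t with h | h
      · exact ⟨1, by simp, by rw [abs_of_nonneg h, one_mul]⟩
      · exact ⟨-1, by simp, by rw [abs_of_nonpos h]; ring⟩
    set β : ℝ → (Fin N → ℝ) := fun τ => G.mul (G.mul x z) (γ₂ (s * (τ - C))) with hβ
    have hβd : ∀ τ ∈ Icc C (C + |t|), HasDerivAt β (s • G.Y i (β τ)) τ := by
      intro τ hτ
      have hm : s * (τ - C) ∈ Ioo a b := by
        have hab := hγ.2.1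
        rcases (abs_nonneg t).eq_or_lt with h | h
        · have : τ = C := by linarith [hτ.1, hτ.2]
          rw [this]; simpa using hab
        · have hr : (τ - C) / |t| ∈ Icc (0:ℝ) 1 :=
            ⟨div_nonneg (by linarith [hτ.1]) h.le, (div_le_one h).2 (by linarith [hτ.2])⟩
          have e : s * (τ - C) = (1 - (τ - C) / |t|) * 0 + ((τ - C) / |t|) * t := by
            have : (τ - C) / |t| * t = (τ - C) / |t| * (s * |t|) := by rw [hst]
            rw [this]
            field_simp
            ring
          rw [e]
          exact (convex_Ioo a b) hab ht (by linarith [hr.2]) hr.1 (by ring)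
      have e1 := hγ.translate G (G.Y_linv i) (G.mul x z) hm
      have e2 : HasDerivAt (fun τ => s * (τ - C)) s τ := by
        simpa using ((hasDerivAt_id τ).sub_const C).const_mul s
      exact e1.scomp τ e2
    have hβc : ContinuousOn β (Icc C (C + |t|)) := fun τ hτ => (hβd τ hτ).continuousAt.continuousWithinAt
    obtain ⟨B, hB⟩ := isCompact_Icc.exists_bound_of_continuousOn (((G.Y_smooth i).continuous.comp_continuousOn hβc).const_smul s)
    have hβL : LipschitzOnWith (Real.toNNReal B) β (Icc C (C + |t|)) := by
      refine (convex_Icc C (C + |t|)).lipschitzOnWith_of_nnnorm_hasDerivWithin_le (fun τ hτ => (hβd τ hτ).hasDerivWithinAt) fun τ hτ => ?_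
      exact NNReal.le_toNNReal_of_coe_le (hB τ hτ)
    have hglue : γ₁ C = β C := by
      rw [h1]; simp only [hβ, sub_self, mul_zero, hγ.1, G.mul_zero']
    set γ : ℝ → (Fin N → ℝ) := fun τ => if τ ≤ C then γ₁ τ else β τ with hγd
    have g1 : EqOn γ γ₁ (Iic C) := fun τ hτ => if_pos hτ
    have g2 : EqOn γ β (Ici C) := fun τ hτ => by
      rcases eq_or_lt_of_le (show C ≤ τ from hτ) with h | h
      · subst h; simp only [hγd, le_refl, if_true]; exact hglue
      · exact if_neg (not_le.2 h)
    refine ⟨γ, fun j τ => if τ ≤ C then c₁ j τ else if j = i then s else 0, max K (Real.toNNReal B), ?_, ?_, ?_, ?_, ?_⟩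
    · refine lip_glue (b := C) ?_ ?_
      · refine LipschitzOnWith.of_dist_le_mul fun s hs t ht => ?_
        rw [g1 hs.2, g1 ht.2]
        exact (hK.dist_le_mul _ hs _ ht).trans (mul_le_mul_of_nonneg_right (NNReal.coe_le_coe.2 (le_max_left _ _)) dist_nonneg)
      · refine LipschitzOnWith.of_dist_le_mul fun s hs t ht => ?_
        rw [g2 hs.1, g2 ht.1]
        exact (hβL.dist_le_mul _ hs _ ht).trans (mul_le_mul_of_nonneg_right (NNReal.coe_le_coe.2 (le_max_right _ _)) dist_nonneg)
    · rw [g1 hC, h0]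
    · rw [g2 (show C ≤ C + |t| by linarith [abs_nonneg t]), ← G.mul_assoc']
      simp only [hβ, add_sub_cancel_left, hst]
    · have hne : ∀ᵐ τ : ℝ, τ ≠ C := by
        simp [ae_iff, measure_singleton]
      filter_upwards [hd, hne] with τ hτ hτC hmem
      rcases lt_or_gt_of_ne hτC with h | h
      · have e : γ =ᶠ[𝓝 τ] γ₁ := by
          filter_upwards [Iio_mem_nhds h] with r hr using g1 (mem_Iic.2 (le_of_lt hr))
        have := (hτ ⟨hmem.1, h⟩).congr_of_eventuallyEq e
        simpa only [if_pos h.le, g1 h.le] using this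
      · have e : γ =ᶠ[𝓝 τ] β := by
          filter_upwards [Ioi_mem_nhds h] with r hr using g2 (mem_Ici.2 (le_of_lt hr))
        have := (hβd τ ⟨h.le, hmem.2.le⟩).congr_of_eventuallyEq e
        simpa [if_neg (not_le.2 h), g2 h.le] using this
    · intro j τ
      beta_reduce
      split_ifs
      · exact hc j τ
      · exact hs
      · simp

lemma dY_le_reach {G : CarnotSetting N m} {z C} (h : Reach G z C) (x : Fin N → ℝ) : G.dY x (G.mul x z) ≤ C := by
  refine le_of_forall_gt_imp_ge_of_dense fun δ hδ => ?_
  have hC := h.nonneg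
  obtain ⟨γ, c, K, hK, h0, h1, hd, hc⟩ := reach_path h x
  refine csInf_le ⟨0, fun _ hy => hy.1.le⟩ ⟨hC.trans_lt hδ, fun t => γ (C * t), fun i t => C * c i (C * t), K * Real.toNNReal C, ?_, ?_, ?_, ?_, ?_⟩
  · refine LipschitzOnWith.of_dist_le_mul fun s hs t ht => ?_
    refine (hK.dist_le_mul _ ⟨mul_nonneg hC hs.1, mul_le_of_le_one_right hC hs.2⟩ _ ⟨mul_nonneg hC ht.1, mul_le_of_le_one_right hC ht.2⟩).trans ?_
    rw [Real.dist_eq, Real.dist_eq, ← mul_sub, abs_mul, abs_of_nonneg hC]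
    simp [hC, mul_assoc]
  · simp [h0]
  · simp [h1]
  · rw [ae_restrict_iff' measurableSet_Ioo]
    rcases hC.eq_or_lt with h | h
    · refine Eventually.of_forall fun t _ => ?_
      simpa [← h] using hasDerivAt_const t (γ 0)
    · have h2 : ∀ᵐ t : ℝ, C * t ∈ Ioo 0 C → HasDerivAt γ (∑ i, c i (C * t) • G.Y i (γ (C * t))) (C * t) := by
        rw [ae_iff] at hd ⊢
        have := Real.volume_preimage_mul_left h.ne' {a | ¬(a ∈ Ioo 0 C → HasDerivAt γ (∑ i, c i a • G.Y i (γ a)) a)}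
        rw [hd, mul_zero] at this
        exact this
      filter_upwards [h2] with t ht hm
      have e1 := ht ⟨mul_pos h hm.1, mul_lt_of_lt_one_right h hm.2⟩
      have e2 : HasDerivAt (fun t => C * t) C t := by simpa using (hasDerivAt_id t).const_mul C
      have := e1.scomp t e2
      simpa [Finset.smul_sum, smul_smul, Function.comp_def] using this
  · intro i t _
    rw [abs_mul, abs_of_nonneg hC]
    exact (mul_le_of_le_one_right hC (hc i _)).trans_lt hδ

lemma dY_nonneg (G : CarnotSetting N m) (x y) : 0 ≤ G.dY x y := Real.sInf_nonneg fun _ h => h.1.le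

lemma cont_of_holder (G : CarnotSetting N m) {α : ℝ} (hα : 0 < α) {v : (Fin N → ℝ) → ℝ} {C : ℝ} (hC : 0 ≤ C)
    (h : holderBoundOn G.dY α univ v C) : Continuous v := by
  rw [continuous_iff_continuousAt]
  intro x
  obtain ⟨B, hB, r, hr, hR⟩ := G.reach_small
  have hz : Tendsto (fun y => G.mul (G.inv x) y) (𝓝 x) (𝓝 0) := by
    have := (G.cmul_left (G.inv x)).continuous.tendsto x
    rwa [G.inv_mul'] at this
  have hz' : Tendsto (fun y => ‖G.mul (G.inv x) y‖) (𝓝 x) (𝓝 0) := by simpa using hz.norm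
  have hs : (0:ℝ) < 1 / G.smax := by
    have := G.smax_pos
    positivity
  have hl : Tendsto (fun y => C * (B * ‖G.mul (G.inv x) y‖ ^ ((1:ℝ) / G.smax)) ^ α) (𝓝 x) (𝓝 0) := by
    have e := (((hz'.rpow_const (Or.inr hs.le)).const_mul B).rpow_const (Or.inr hα.le)).const_mul C
    rw [Real.zero_rpow hs.ne', mul_zero, Real.zero_rpow hα.ne', mul_zero] at e
    exact e
  rw [ContinuousAt, tendsto_iff_dist_tendsto_zero]
  refine squeeze_zero' (Eventually.of_forall fun y => dist_nonneg) ?_ hl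
  filter_upwards [hz'.eventually (Iic_mem_nhds hr)] with y hy
  obtain ⟨C', hC', hre⟩ := hR _ hy
  have e1 := dY_le_reach hre x
  rw [G.mul_inv_cancel_left'] at e1
  rw [dist_comm, Real.dist_eq]
  refine (h x (mem_univ _) y (mem_univ _)).trans ?_
  exact mul_le_mul_of_nonneg_left (Real.rpow_le_rpow (G.dY_nonneg x y) (e1.trans hC') hα.le) hC

end CarnotSetting
end

end

section
open MeasureTheory Set Filter Topology
open scoped ContDiff ENNReal
noncomputable section
namespace CarnotSetting
variable {N m : ℕ}

lemma deriv_nonpos_of_max {f : ℝ → ℝ} {D : ℝ} (h : HasDerivAt f D 0) (hm : ∀ᶠ t in 𝓝[>] (0:ℝ), f t ≤ f 0) : D ≤ 0 := by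
  have h1 := h.tendsto_slope_zero_right
  refine le_of_tendsto h1 ?_
  filter_upwards [hm, self_mem_nhdsWithin] with t ht h0
  rw [zero_add, smul_eq_mul]
  exact mul_nonpos_of_nonneg_of_nonpos (inv_nonneg.2 (le_of_lt h0)) (by linarith)

/-- A comparison principle by the doubling-of-variables argument: a continuous function which has at every
point a line derivative along `X`, bounded above near an integral curve of `X`, grows at most linearly on it. -/
lemma visc {X : (Fin N → ℝ) → (Fin N → ℝ)} (hX : ContDiff ℝ ∞ X) {u g : (Fin N → ℝ) → ℝ} (hu : UniformContinuous u)
    (hg : UniformContinuous g) {M : ℝ} (hM : ∀ x, |u x| ≤ M) (hl : ∀ x, HasLineDerivAt ℝ u (g x) x (X x))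
    {Φ : ℝ → (Fin N → ℝ)} {τ : ℝ} (hτ : 0 ≤ τ) (hΦ : ∀ s ∈ Icc 0 τ, HasDerivAt Φ (X (Φ s)) s)
    {κ η : ℝ} (hη : 0 < η) (hκ : ∀ s ∈ Icc 0 τ, g (Φ s) + η ≤ κ) : u (Φ τ) ≤ u (Φ 0) + κ * τ := by
  by_contra hcon
  push Not at hcon
  set gap := u (Φ τ) - (u (Φ 0) + κ * τ) with hgap
  have hgap0 : 0 < gap := by rw [hgap]; linarith
  have hM0 : 0 ≤ M := (abs_nonneg _).trans (hM 0)
  have hΦc : ContinuousOn Φ (Icc 0 τ) := fun s hs => (hΦ s hs).continuousAt.continuousWithinAt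
  obtain ⟨R, hR⟩ := isCompact_Icc.exists_bound_of_continuousOn hΦc
  obtain ⟨L, hL1, hL⟩ := lip_ball hX (R + 1)
  set q : ℝ := min gap (η / 2 / (2 * N * L + 1)) with hq
  have hq0 : 0 < q := lt_min hgap0 (by positivity)
  have hqL : 2 * N * L * q < η / 2 := by
    have h1 : q ≤ η / 2 / (2 * N * L + 1) := min_le_right _ _
    rw [le_div_iff₀ (by positivity)] at h1
    nlinarith
  obtain ⟨ρ₁, hρ₁, hu'⟩ := Metric.uniformContinuous_iff.1 hu q hq0
  obtain ⟨ρ₂, hρ₂, hg'⟩ := Metric.uniformContinuous_iff.1 hg (η / 2) (by positivity)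
  set ρ := min (min ρ₁ ρ₂) 1 with hρ
  have hρ0 : 0 < ρ := by positivity
  set e : ℝ := ρ ^ 2 / (2 * M + 1) with he
  have he0 : 0 < e := by positivity
  have heM : 2 * M * e < ρ ^ 2 := by
    have : e * (2 * M + 1) = ρ ^ 2 := by rw [he]; field_simp
    nlinarith
  set Θ : ℝ × (Fin N → ℝ) → ℝ := fun p => u p.2 - κ * p.1 - (∑ j, (p.2 j - Φ p.1 j) ^ 2) / e with hΘ
  have hΘc : ContinuousOn Θ (Icc 0 τ ×ˢ Metric.closedBall 0 (R + 1)) := by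
    have h1 : ContinuousOn (fun p : ℝ × (Fin N → ℝ) => Φ p.1) (Icc 0 τ ×ˢ Metric.closedBall 0 (R + 1)) :=
      hΦc.comp continuousOn_fst fun p hp => hp.1
    refine ((hu.continuous.comp continuous_snd).continuousOn.sub (continuousOn_const.mul continuousOn_fst)).sub (ContinuousOn.div_const ?_ _)
    refine continuousOn_finsetSum _ fun j _ => ContinuousOn.pow ?_ 2
    exact ((continuous_apply j).comp continuous_snd).continuousOn.sub ((continuous_apply j).comp_continuousOn h1)
  have hR0 : 0 ≤ R := (norm_nonneg _).trans (hR 0 ⟨le_rfl, hτ⟩)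
  obtain ⟨⟨s, x⟩, hp, hmax⟩ := (isCompact_Icc.prod (isCompact_closedBall (0 : Fin N → ℝ) (R + 1))).exists_isMaxOn
    ⟨(0, 0), ⟨le_rfl, hτ⟩, by simp; linarith⟩ hΘc
  have hs : s ∈ Icc 0 τ := hp.1
  have hmem : ∀ r ∈ Icc 0 τ, (r, Φ r) ∈ Icc 0 τ ×ˢ Metric.closedBall (0 : Fin N → ℝ) (R + 1) := fun r hr =>
    ⟨hr, by rw [mem_closedBall_zero_iff]; linarith [hR r hr]⟩
  set d := x - Φ s with hd
  set S := ∑ j, (x j - Φ s j) ^ 2 with hS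
  have hdS : ‖d‖ ^ 2 ≤ S := by
    have h1 : ‖d‖ ≤ √S := by
      refine (pi_norm_le_iff_of_nonneg (Real.sqrt_nonneg _)).2 fun j => ?_
      refine Real.abs_le_sqrt ?_
      exact Finset.single_le_sum (f := fun j => (x j - Φ s j) ^ 2) (fun j _ => sq_nonneg _) (Finset.mem_univ j)
    have h0 : 0 ≤ S := Finset.sum_nonneg fun j _ => sq_nonneg _
    calc ‖d‖ ^ 2 ≤ √S ^ 2 := by gcongr
      _ = S := Real.sq_sqrt h0
  have hpen : S / e ≤ u x - u (Φ s) := by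
    have := hmax (hmem s hs)
    simp only [hΘ, sub_self, mem_setOf_eq, ne_eq, OfNat.ofNat_ne_zero, not_false_eq_true, zero_pow, Finset.sum_const_zero, zero_div, sub_zero] at this
    linarith
  have hdρ : ‖d‖ < ρ := by
    have h1 : u x - u (Φ s) ≤ 2 * M := by linarith [(abs_le.1 (hM x)).2, (abs_le.1 (hM (Φ s))).1]
    have h2 := hpen.trans h1
    rw [div_le_iff₀ he0] at h2
    exact lt_of_pow_lt_pow_left₀ 2 hρ0.le (by linarith)
  have hdist : dist x (Φ s) < ρ := by rwa [dist_eq_norm]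
  have hux := hu' (lt_of_lt_of_le hdist ((min_le_left _ _).trans (min_le_left _ _)))
  have hgx := hg' (lt_of_lt_of_le hdist ((min_le_left _ _).trans (min_le_right _ _)))
  rw [Real.dist_eq] at hux hgx
  have hSe : S / e < q := hpen.trans_lt (abs_lt.1 hux).2
  have hS0 : 0 ≤ S / e := div_nonneg ((sq_nonneg _).trans hdS) he0.le
  rcases hs.1.eq_or_lt with h0 | hs0
  · subst h0
    have := hmax (hmem τ ⟨hτ, le_rfl⟩)
    simp only [hΘ, sub_self, mem_setOf_eq, ne_eq, OfNat.ofNat_ne_zero, not_false_eq_true, zero_pow, Finset.sum_const_zero, zero_div, sub_zero, mul_zero] at this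
    have h2 : q ≤ gap := min_le_left _ _
    linarith [(abs_lt.1 hux).2]
  · have hxR : ‖x‖ < R + 1 := by
      have h1 : ‖x‖ ≤ ‖d‖ + ‖Φ s‖ := by
        have : x = d + Φ s := by rw [hd]; abel
        rw [this]; simpa [hd] using norm_add_le d (Φ s)
      have h2 : ρ ≤ 1 := min_le_right _ _
      linarith [hR s hs]
    set D : ℝ := -g x + κ - (∑ j, 2 * (x j - Φ s j) * (X (Φ s) j - X x j)) / e with hD
    have hder : HasDerivAt (fun t : ℝ => Θ (s - t, x + (-t) • X x)) D 0 := by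
      have d1 : HasDerivAt (fun t : ℝ => u (x + (-t) • X x)) (-g x) 0 := by
        have h1 := hl x
        unfold HasLineDerivAt at h1
        have h2 : HasDerivAt (fun t : ℝ => -t) (-1) 0 := (hasDerivAt_id (0:ℝ)).neg
        rw [show (0:ℝ) = -0 by simp] at h1
        have := h1.scomp (0:ℝ) h2
        simpa [Function.comp_def] using this
      have d2 : HasDerivAt (fun t : ℝ => κ * (s - t)) (-κ) 0 := by
        simpa using ((hasDerivAt_id (0:ℝ)).const_sub s).const_mul κ
      have d3 : HasDerivAt (fun t : ℝ => Φ (s - t)) (-X (Φ s)) 0 := by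
        have h1 := hΦ s hs
        have h2 : HasDerivAt (fun t : ℝ => s - t) (-1) 0 := by simpa using (hasDerivAt_id (0:ℝ)).const_sub s
        rw [show s = s - 0 by simp] at h1
        have := h1.scomp (0:ℝ) h2
        simpa [Function.comp_def] using this
      have d4 : ∀ j, HasDerivAt (fun t : ℝ => ((x + (-t) • X x) j - Φ (s - t) j) ^ 2) (2 * (x j - Φ s j) * (X (Φ s) j - X x j)) 0 := by
        intro j
        have h1 := (hasDerivAt_pi.1 d3) j
        have h2 : HasDerivAt (fun t : ℝ => (x + (-t) • X x) j) (- X x j) 0 := by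
          simpa using ((hasDerivAt_id (0:ℝ)).neg.mul_const (X x j)).const_add (x j)
        have h3 := (h2.fun_sub h1).fun_pow 2
        refine h3.congr_deriv ?_
        simp only [neg_zero, zero_smul, add_zero, sub_zero, Pi.neg_apply]
        norm_num
        left; ring
      have d5 := HasDerivAt.fun_sum (u := Finset.univ) fun j _ => d4 j
      refine ((d1.fun_sub d2).fun_sub (d5.div_const e)).congr_deriv ?_
      rw [hD]; ring
    have hD0 : D ≤ 0 := by
      refine deriv_nonpos_of_max hder ?_
      have c1 : ∀ᶠ t in 𝓝[>] (0:ℝ), t < s := nhdsWithin_le_nhds (Iio_mem_nhds hs0)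
      have c2 : ∀ᶠ t in 𝓝[>] (0:ℝ), ‖x + (-t) • X x‖ < R + 1 := by
        refine nhdsWithin_le_nhds ?_
        have : Continuous (fun t : ℝ => ‖x + (-t) • X x‖) := by fun_prop
        exact this.continuousAt.eventually_lt continuousAt_const (by simpa using hxR)
      filter_upwards [c1, c2, self_mem_nhdsWithin] with t h1 h2 h3
      have h3' : (0:ℝ) < t := h3
      have := hmax (show (s - t, x + (-t) • X x) ∈ Icc 0 τ ×ˢ Metric.closedBall (0 : Fin N → ℝ) (R + 1) from
        ⟨⟨by linarith, by linarith [hs.2]⟩, by rw [mem_closedBall_zero_iff]; exact h2.le⟩)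
      simpa using this
    have hsum : ∑ j, 2 * (x j - Φ s j) * (X (Φ s) j - X x j) ≤ 2 * N * L * S := by
      have h1 : ∀ j, 2 * (x j - Φ s j) * (X (Φ s) j - X x j) ≤ 2 * L * S := fun j => by
        have a1 : |x j - Φ s j| ≤ ‖d‖ := norm_le_pi_norm d j
        have a2 : |X (Φ s) j - X x j| ≤ L * ‖d‖ := by
          refine (norm_le_pi_norm (X (Φ s) - X x) j).trans ?_
          rw [hd, norm_sub_rev x]
          exact hL _ _ (by linarith [hR s hs]) hxR.le
        have a3 : (x j - Φ s j) * (X (Φ s) j - X x j) ≤ ‖d‖ * (L * ‖d‖) := by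
          refine (le_abs_self _).trans ?_
          rw [abs_mul]
          exact mul_le_mul a1 a2 (abs_nonneg _) (norm_nonneg _)
        nlinarith
      refine (Finset.sum_le_sum fun j _ => h1 j).trans ?_
      simp
      linarith
    have hsum' : (∑ j, 2 * (x j - Φ s j) * (X (Φ s) j - X x j)) / e ≤ 2 * N * L * (S / e) := by
      rw [← mul_div_assoc]; gcongr
    have hb : 2 * N * L * (S / e) ≤ 2 * N * L * q := by
      have : (0:ℝ) ≤ 2 * N * L := by positivity
      exact mul_le_mul_of_nonneg_left hSe.le this
    have := hκ s hs
    linarith [(abs_lt.1 hgx).2]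

end CarnotSetting
end

end

section
open MeasureTheory Set Filter Topology
open scoped ContDiff ENNReal
noncomputable section
namespace CarnotSetting
variable {N m : ℕ}

lemma flow_bound (G : CarnotSetting N m) (i : Fin m) {u g : (Fin N → ℝ) → ℝ} (hu : Continuous u) (hus : HasCompactSupport u)
    (hg : Continuous g) (hgs : HasCompactSupport g) (hl : ∀ x, HasLineDerivAt ℝ u (g x) x (G.Y i x)) {ε : ℝ} {c}
    (hc : IsCurve (G.Y i) (-ε) ε c) (y) {s : ℝ} (hs : 0 < s) (hsε : s < ε) {a η : ℝ} (hη : 0 < η)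
    (h : ∀ r ∈ Icc 0 s, |g (G.mul y (c r)) - a| ≤ η) : |s⁻¹ * (u (G.mul y (c s)) - u y) - a| ≤ 2 * η := by
  obtain ⟨M, hM⟩ := hu.bounded_above_of_compact_support hus
  have hΦ : ∀ r ∈ Icc 0 s, HasDerivAt (fun r => G.mul y (c r)) (G.Y i (G.mul y (c r))) r := fun r hr =>
    hc.translate G (G.Y_linv i) y ⟨by linarith [hr.1], by linarith [hr.2]⟩
  have huu : UniformContinuous u := hus.uniformContinuous_of_continuous hu
  have hgu : UniformContinuous g := hgs.uniformContinuous_of_continuous hg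
  have h1 := visc (G.Y_smooth i) huu hgu hM hl hs.le hΦ hη (κ := a + 2 * η)
    fun r hr => by linarith [(abs_le.1 (h r hr)).2]
  have h2 := visc (G.Y_smooth i) huu.neg hgu.neg (M := M) (fun x => by simpa using hM x)
    (fun x => by
      have := hl x
      unfold HasLineDerivAt at this ⊢
      exact this.neg) hs.le hΦ hη (κ := -a + 2 * η)
    fun r hr => by
      have := (abs_le.1 (h r hr)).1
      linarith
  simp only [Pi.neg_apply, hc.1, G.mul_zero'] at h1 h2
  have e : s⁻¹ * (u (G.mul y (c s)) - u y) - a = s⁻¹ * (u (G.mul y (c s)) - u y - a * s) := by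
    field_simp
  rw [e, abs_mul, abs_of_pos (inv_pos.2 hs), inv_mul_le_iff₀ hs, abs_le]
  constructor <;> linarith

lemma flow_slope (G : CarnotSetting N m) (i : Fin m) {u g : (Fin N → ℝ) → ℝ} (hu : Continuous u) (hus : HasCompactSupport u)
    (hg : Continuous g) (hgs : HasCompactSupport g) (hl : ∀ x, HasLineDerivAt ℝ u (g x) x (G.Y i x)) {ε : ℝ} {c}
    (hc : IsCurve (G.Y i) (-ε) ε c) (y) :
    Tendsto (fun s => s⁻¹ * (u (G.mul y (c s)) - u y)) (𝓝[>] 0) (𝓝 (g y)) := by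
  have hε : 0 < ε := hc.2.1.2
  rw [Metric.tendsto_nhds]
  intro e he
  have hcont : ContinuousAt (fun r => g (G.mul y (c r))) 0 :=
    (hg.comp (G.cmul_left y).continuous).continuousAt.comp (hc.2.2 0 hc.2.1).continuousAt
  obtain ⟨δ, hδ, hd⟩ := Metric.continuousAt_iff.1 hcont (e / 4) (by positivity)
  have h1 : ∀ᶠ s in 𝓝[>] (0:ℝ), s < min δ ε := nhdsWithin_le_nhds (Iio_mem_nhds (by positivity))
  filter_upwards [h1, self_mem_nhdsWithin] with s hs h0
  have h0' : (0:ℝ) < s := h0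
  have hh := G.flow_bound i hu hus hg hgs hl hc y h0' (hs.trans_le (min_le_right _ _)) (a := g y) (η := e / 4) (by positivity)
    fun r hr => by
      have : dist r 0 < δ := by
        rw [Real.dist_eq, sub_zero, abs_of_nonneg hr.1]
        exact hr.2.trans_lt (hs.trans_le (min_le_left _ _))
      have := hd this
      rw [hc.1, G.mul_zero', Real.dist_eq] at this
      exact this.le
  rw [Real.dist_eq]
  linarith

lemma moll_vf (G : CarnotSetting N m) (i : Fin m) {u g : (Fin N → ℝ) → ℝ} (hu : Continuous u) (hus : HasCompactSupport u)
    (hg : Continuous g) (hgs : HasCompactSupport g) (hl : ∀ x, HasLineDerivAt ℝ u (g x) x (G.Y i x)) {η} (hη : Test η) :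
    vfDeriv (G.Y i) (G.moll η u) = G.moll η g := by
  ext x
  obtain ⟨ε, hε, c, hc⟩ := exists_curve (G.Y_smooth i)
  have hsm := moll_smooth G hη hu.locallyIntegrable
  have hd : DifferentiableAt ℝ (G.moll η u) x := hsm.differentiable (by simp) x
  have h1 : HasDerivAt (fun s => G.moll η u (G.mul x (c s))) (vfDeriv (G.Y i) (G.moll η u) x) 0 := by
    rw [vfDeriv_eq _ hd]
    have a1 := hc.translate G (G.Y_linv i) x hc.2.1
    rw [hc.1, G.mul_zero'] at a1
    have a2 : HasFDerivAt (G.moll η u) (fderiv ℝ (G.moll η u) x) (G.mul x (c 0)) := by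
      rw [hc.1, G.mul_zero']; exact hd.hasFDerivAt
    exact a2.comp_hasDerivAt 0 a1
  have h2 := h1.tendsto_slope_zero_right
  obtain ⟨M, hM⟩ := hg.bounded_above_of_compact_support hgs
  have hM0 : 0 ≤ M := (norm_nonneg _).trans (hM 0)
  have h3 : Tendsto (fun s => ∫ z, η z * (s⁻¹ * (u (G.mul (G.mul z x) (c s)) - u (G.mul z x)))) (𝓝[>] 0) (𝓝 (∫ z, η z * g (G.mul z x))) := by
    refine tendsto_integral_filter_of_dominated_convergence (fun z => |η z| * (2 * (M + 1))) ?_ ?_ (hη.integrable.abs.mul_const _) ?_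
    · refine Eventually.of_forall fun s => Continuous.aestronglyMeasurable ?_
      have e1 : Continuous (fun z => G.mul z x) := (G.cmul_right x).continuous
      have e2 : Continuous (fun z => G.mul z (c s)) := (G.cmul_right (c s)).continuous
      exact hη.1.continuous.mul (continuous_const.mul ((hu.comp (e2.comp e1)).sub (hu.comp e1)))
    · have h1 : ∀ᶠ s in 𝓝[>] (0:ℝ), s < ε := nhdsWithin_le_nhds (Iio_mem_nhds hε)
      filter_upwards [h1, self_mem_nhdsWithin] with s hs h0
      refine Eventually.of_forall fun z => ?_
      rw [Real.norm_eq_abs, abs_mul]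
      refine mul_le_mul_of_nonneg_left ?_ (abs_nonneg _)
      have := G.flow_bound i hu hus hg hgs hl hc (G.mul z x) h0 hs (a := 0) (η := M + 1) (by linarith)
        fun r _ => by
          have := hM (G.mul (G.mul z x) (c r))
          rw [Real.norm_eq_abs] at this
          rw [sub_zero]; linarith
      simpa using this
    · exact Eventually.of_forall fun z => (G.flow_slope i hu hus hg hgs hl hc (G.mul z x)).const_mul _
  refine tendsto_nhds_unique (h2.congr fun s => ?_) h3
  simp only [zero_add, hc.1, G.mul_zero', smul_eq_mul, moll]
  rw [← integral_sub (moll_int G hη hu.locallyIntegrable _) (moll_int G hη hu.locallyIntegrable _), ← integral_const_mul]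
  refine integral_congr_ae (Eventually.of_forall fun z => ?_)
  beta_reduce
  rw [← G.mul_assoc']
  ring

end CarnotSetting
end

end

section
open MeasureTheory Set Filter Topology
open scoped ContDiff ENNReal
noncomputable section
namespace CarnotSetting
variable {N m : ℕ}

/-- continuous horizontal derivatives up to order `n`, compact support -/
structure Good (G : CarnotSetting N m) (n : ℕ) (u : (Fin N → ℝ) → ℝ) : Prop where
  cont : ∀ l : List (Fin m), l.length ≤ n → Continuous (vfIter G.Y l u)
  supp : HasCompactSupport u
  diff : ∀ l : List (Fin m), l.length < n → ∀ i x, LineDifferentiableAt ℝ (vfIter G.Y l u) x (G.Y i x)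

lemma Good.suppI {G : CarnotSetting N m} {n u} (h : G.Good n u) (l) : HasCompactSupport (vfIter G.Y l u) :=
  h.supp.isCompact.of_isClosed_subset (isClosed_tsupport _) (vfIter_support' l u)

lemma Good.moll {G : CarnotSetting N m} {n u} (h : G.Good n u) {η} (hη : Test η) (l : List (Fin m)) (hl : l.length ≤ n) :
    vfIter G.Y l (G.moll η u) = G.moll η (vfIter G.Y l u) := by
  induction l with
  | nil => rfl
  | cons i l ih =>
    have hl' : l.length < n := by simpa using hl
    change vfDeriv (G.Y i) (vfIter G.Y l (G.moll η u)) = _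
    rw [ih hl'.le]
    exact G.moll_vf i (h.cont l hl'.le) (h.suppI l) (h.cont (i :: l) hl) (h.suppI (i :: l))
      (fun x => (h.diff l hl' i x).hasLineDerivAt) hη

lemma Good.op_exp {G : CarnotSetting N m} {n u} (h : G.Good (n + 2) u) (a : Fin m → Fin m → (Fin N → ℝ) → ℝ) (xb)
    (l : List (Fin m)) (hl : l.length ≤ n) :
    vfIter G.Y l (opLFrozen G.Y a xb u) = (fun x => ∑ i, ∑ j, a i j xb * vfIter G.Y (l ++ [i, j]) u x) ∧
    (l.length < n → ∀ i x, HasLineDerivAt ℝ (vfIter G.Y l (opLFrozen G.Y a xb u))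
      (∑ i', ∑ j, a i' j xb * vfIter G.Y (i :: l ++ [i', j]) u x) x (G.Y i x)) := by
  have key : ∀ l : List (Fin m), l.length < n →
    vfIter G.Y l (opLFrozen G.Y a xb u) = (fun x => ∑ i, ∑ j, a i j xb * vfIter G.Y (l ++ [i, j]) u x) → ∀ i x,
      HasLineDerivAt ℝ (vfIter G.Y l (opLFrozen G.Y a xb u))
      (∑ i', ∑ j, a i' j xb * vfIter G.Y (i :: l ++ [i', j]) u x) x (G.Y i x) := by
    intro l hl e i x
    rw [e]
    unfold HasLineDerivAt
    refine HasDerivAt.fun_sum fun i' _ => HasDerivAt.fun_sum fun j _ => HasDerivAt.const_mul _ ?_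
    exact (h.diff (l ++ [i', j]) (by simp; omega) i x).hasLineDerivAt
  have e : vfIter G.Y l (opLFrozen G.Y a xb u) = fun x => ∑ i, ∑ j, a i j xb * vfIter G.Y (l ++ [i, j]) u x := by
    induction l with
    | nil => rfl
    | cons i l ih =>
      have hl' : l.length < n := by simpa using hl
      ext x
      exact (key l hl' (ih hl'.le) i x).lineDeriv
  exact ⟨e, fun hl i x => key l hl e i x⟩

lemma Good.op {G : CarnotSetting N m} {n u} (h : G.Good (n + 2) u) (a : Fin m → Fin m → (Fin N → ℝ) → ℝ) (xb) :
    G.Good n (opLFrozen G.Y a xb u) where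
  cont l hl := by
    rw [(h.op_exp a xb l hl).1]
    exact continuous_finsetSum _ fun i _ => continuous_finsetSum _ fun j _ => continuous_const.mul
      (h.cont _ (by simp; omega))
  supp := by
    refine HasCompactSupport.intro h.supp.isCompact fun x hx => ?_
    refine Finset.sum_eq_zero fun i _ => Finset.sum_eq_zero fun j _ => ?_
    have : vfIter G.Y [i, j] u x = 0 := image_eq_zero_of_notMem_tsupport fun hh => hx (vfIter_support' _ _ hh)
    rw [this, mul_zero]
  diff l hl i x := ((h.op_exp a xb l hl.le).2 hl i x).lineDifferentiableAt

lemma Good.LA_moll {G : CarnotSetting N m} {n u} (h : G.Good (n + 2) u) (a : Fin m → Fin m → (Fin N → ℝ) → ℝ) (xb)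
    {η} (hη : Test η) : G.LA (fun i j => a i j xb) (G.moll η u) = G.moll η (opLFrozen G.Y a xb u) := by
  ext x
  have e : ∀ i j, vfDeriv (G.Y i) (vfDeriv (G.Y j) (G.moll η u)) = G.moll η (vfIter G.Y [i, j] u) := fun i j =>
    h.moll hη [i, j] (by simp)
  have hc : ∀ i j, LocallyIntegrable (vfIter G.Y [i, j] u) volume := fun i j => (h.cont [i, j] (by simp)).locallyIntegrable
  simp only [LA, e]
  simp only [CarnotSetting.moll, opLFrozen, Finset.mul_sum]
  have hii : ∀ i j, Integrable (fun z => η z * (a i j xb * vfIter G.Y [i, j] u (G.mul z x))) := fun i j => by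
    refine ((moll_int G hη (hc i j) x).const_mul (a i j xb)).congr (Eventually.of_forall fun z => ?_)
    beta_reduce; ring
  rw [integral_finsetSum _ fun i _ => integrable_finsetSum _ fun j _ => hii i j]
  refine Finset.sum_congr rfl fun i _ => ?_
  rw [integral_finsetSum _ fun j _ => hii i j]
  refine Finset.sum_congr rfl fun j _ => ?_
  rw [← integral_const_mul]
  refine integral_congr_ae (Eventually.of_forall fun z => ?_)
  beta_reduce; ring

lemma moll_supp (G : CarnotSetting N m) {w : (Fin N → ℝ) → ℝ} (hs : HasCompactSupport w) :
    ∃ K : Set (Fin N → ℝ), IsCompact K ∧ ∀ η : (Fin N → ℝ) → ℝ, (∀ z, η z ≠ 0 → ‖z‖ < 1) → ∀ y ∉ K, G.moll η w y = 0 := by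
  have hf : Continuous fun p : (Fin N → ℝ) × (Fin N → ℝ) => G.mul (G.inv p.1) p.2 :=
    G.continuous_mul'.comp ((G.smooth_inv.continuous.comp continuous_fst).prodMk continuous_snd)
  refine ⟨_, ((isCompact_closedBall (0 : Fin N → ℝ) 1).prod hs.isCompact).image hf, fun η hη y hy => ?_⟩
  refine integral_eq_zero_of_ae (Eventually.of_forall fun z => ?_)
  by_contra hne
  refine hy ⟨(z, G.mul z y), ⟨?_, ?_⟩, G.inv_mul_cancel_left' z y⟩
  · exact mem_closedBall_zero_iff.2 (hη z (left_ne_zero_of_mul hne)).le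
  · exact subset_tsupport _ (right_ne_zero_of_mul hne)

lemma moll_test (G : CarnotSetting N m) {w : (Fin N → ℝ) → ℝ} (hw : Continuous w) (hs : HasCompactSupport w) {η} (hη : Test η)
    (h1 : ∀ z, η z ≠ 0 → ‖z‖ < 1) : Test (G.moll η w) := by
  obtain ⟨K, hK, h⟩ := G.moll_supp hs
  exact ⟨moll_smooth G hη hw.locallyIntegrable, HasCompactSupport.intro hK (h η h1)⟩

lemma moll_bound (G : CarnotSetting N m) {w : (Fin N → ℝ) → ℝ} (hw : Continuous w) {η} (hη : Test η) (h0 : ∀ z, 0 ≤ η z)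
    (h1 : ∫ z, η z = 1) {y c e : _} (h : ∀ z, η z ≠ 0 → |w (G.mul z y) - c| ≤ e) : |G.moll η w y - c| ≤ e := by
  have hi := moll_int G hη hw.locallyIntegrable y
  have e1 : G.moll η w y - c = ∫ z, η z * (w (G.mul z y) - c) := by
    have : (fun z => η z * (w (G.mul z y) - c)) = fun z => η z * w (G.mul z y) - η z * c := by ext z; ring
    rw [this, integral_sub hi (hη.integrable.mul_const c), integral_mul_const, h1, one_mul]; rfl
  have e2 : e = ∫ z, η z * e := by rw [integral_mul_const, h1, one_mul]
  rw [e1, e2, ← Real.norm_eq_abs]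
  refine norm_integral_le_of_norm_le (hη.integrable.mul_const e) (Eventually.of_forall fun z => ?_)
  rw [Real.norm_eq_abs, abs_mul, abs_of_nonneg (h0 z)]
  by_cases hz : η z = 0
  · rw [hz]; simp
  · exact mul_le_mul_of_nonneg_left (h z hz) (h0 z)

/-- a sequence of mollifiers -/
structure MSeq (η : ℕ → (Fin N → ℝ) → ℝ) : Prop where
  test : ∀ n, Test (η n)
  nn : ∀ n z, 0 ≤ η n z
  one : ∀ n, ∫ z, η n z = 1
  small : ∀ n z, η n z ≠ 0 → ‖z‖ < 1 / ((n:ℝ) + 1)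

lemma MSeq.lt_one {η : ℕ → (Fin N → ℝ) → ℝ} (h : MSeq η) (n z) (hz : η n z ≠ 0) : ‖z‖ < 1 := by
  refine (h.small n z hz).trans_le ?_
  rw [div_le_one (by positivity)]
  have : (0:ℝ) ≤ n := n.cast_nonneg
  linarith

lemma MSeq.tendsto {η : ℕ → (Fin N → ℝ) → ℝ} (h : MSeq η) (G : CarnotSetting N m) {w : (Fin N → ℝ) → ℝ} (hw : Continuous w) (y) :
    Tendsto (fun n => G.moll (η n) w y) atTop (𝓝 (w y)) := by
  rw [Metric.tendsto_atTop]
  intro e he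
  have hc : ContinuousAt (fun z => w (G.mul z y)) 0 := (hw.comp (G.cmul_right y).continuous).continuousAt
  obtain ⟨δ, hδ, hd⟩ := Metric.continuousAt_iff.1 hc (e / 2) (by positivity)
  obtain ⟨n0, hn0⟩ := exists_nat_one_div_lt hδ
  refine ⟨n0, fun n hn => ?_⟩
  rw [Real.dist_eq]
  refine (G.moll_bound hw (h.test n) (h.nn n) (h.one n) (e := e / 2) fun z hz => ?_).trans_lt (by linarith)
  have h1 : dist z 0 < δ := by
    rw [dist_zero_right]
    exact ((h.small n z hz).trans_le (Nat.one_div_le_one_div hn)).trans hn0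
  have := hd h1
  rw [G.zero_mul', Real.dist_eq] at this
  exact this.le

lemma ker_integrable {G : CarnotSetting N m} {g : (Fin N → ℝ) → ℝ} (h : G.HomFam (2 - G.qq) (fun _ : Unit => g)) (x)
    {φ : (Fin N → ℝ) → ℝ} (hφ : Continuous φ) (hs : HasCompactSupport φ) :
    Integrable (fun y => g (G.mul (G.inv y) x) * φ y) := by
  have h1 := (h.inv.hom ()).integrable_mul G (by linarith) (h.inv.smooth ()).continuousOn
    (φ := fun z => φ (G.mul x z)) (hφ.comp (G.cmul_left x).continuous) (hs.comp_homeomorph (G.homeoL x))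
  have := (G.mp_left (G.inv x)).integrable_comp_of_integrable h1
  refine this.congr (Eventually.of_forall fun y => ?_)
  simp only [Function.comp_def, G.inv_mul_rev', G.inv_inv', G.mul_inv_cancel_left']

lemma MSeq.tendsto_int {η : ℕ → (Fin N → ℝ) → ℝ} (h : MSeq η) {G : CarnotSetting N m} {g : (Fin N → ℝ) → ℝ}
    (hg : G.HomFam (2 - G.qq) (fun _ : Unit => g)) {w : (Fin N → ℝ) → ℝ} (hw : Continuous w) (hs : HasCompactSupport w) (x) :
    Tendsto (fun n => ∫ y, g (G.mul (G.inv y) x) * G.moll (η n) w y) atTop (𝓝 (∫ y, g (G.mul (G.inv y) x) * w y)) := by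
  obtain ⟨K, hK, hKs⟩ := G.moll_supp hs
  obtain ⟨R, hR⟩ := hK.isBounded.exists_norm_le
  obtain ⟨χ, hχ, h01, h1, -⟩ := exists_cutoff N (show 0 < |R| + 1 by positivity) (show |R| + 1 < |R| + 2 by linarith)
  obtain ⟨M, hM⟩ := hw.bounded_above_of_compact_support hs
  have hb := (ker_integrable hg x hχ.1.continuous hχ.2).norm.mul_const M
  refine tendsto_integral_of_dominated_convergence _ (fun n => ?_) hb (fun n => Eventually.of_forall fun y => ?_)
    (Eventually.of_forall fun y => (h.tendsto G hw y).const_mul _)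
  · have ht := G.moll_test hw hs (h.test n) (h.lt_one n)
    exact (ker_integrable hg x ht.1.continuous ht.2).aestronglyMeasurable
  · have hM0 : 0 ≤ M := (norm_nonneg _).trans (hM 0)
    by_cases hy : y ∈ K
    · have e : χ y = 1 := h1 y (mem_closedBall_zero_iff.2 (by linarith [le_abs_self R, hR y hy]))
      rw [e, mul_one, norm_mul]
      refine mul_le_mul_of_nonneg_left ?_ (norm_nonneg _)
      have := G.moll_bound hw (h.test n) (h.nn n) (h.one n) (y := y) (c := 0) (e := M) fun z _ => by
        rw [sub_zero]; exact hM _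
      rwa [sub_zero] at this
    · rw [hKs _ (h.lt_one n) y hy]
      simp only [mul_zero, norm_zero]
      positivity

theorem rep_good (G : CarnotSetting N m) {k : ℕ} (a : Fin m → Fin m → (Fin N → ℝ) → ℝ) (xb)
    {g : (Fin k → Fin m) → (Fin N → ℝ) → ℝ} (hg : ∀ J, G.HomFam (2 - G.qq) (fun _ : Unit => g J)) (I : Fin k → Fin m)
    (hrep : ∀ φ, Test φ → ∀ x, vfIter G.Y (List.ofFn I) φ x =
      ∑ J, ∫ y, g J (G.mul (G.inv y) x) * vfIter G.Y (List.ofFn J) (G.LA (fun i j => a i j xb) φ) y)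
    {u : (Fin N → ℝ) → ℝ} (hu : G.Good (k + 2) u) (x) :
    vfIter G.Y (List.ofFn I) u x = ∑ J, ∫ y, g J (G.mul (G.inv y) x) * vfIter G.Y (List.ofFn J) (opLFrozen G.Y a xb u) y := by
  choose η h1 h2 h3 h4 using fun n : ℕ => exists_mollifier N (show 0 < 1 / ((n:ℝ) + 1) by positivity)
  have hη : MSeq η := ⟨h1, h2, h3, h4⟩
  have hI : (List.ofFn I).length ≤ k + 2 := by simp
  have hop := hu.op a xb
  have hJ : ∀ J : Fin k → Fin m, (List.ofFn J).length ≤ k := fun J => by simp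
  have hu0 : Continuous u := hu.cont [] (by simp)
  have l1 := hη.tendsto G (hu.cont _ hI) x
  have l2 : Tendsto (fun n => ∑ J, ∫ y, g J (G.mul (G.inv y) x) * G.moll (η n) (vfIter G.Y (List.ofFn J) (opLFrozen G.Y a xb u)) y)
      atTop (𝓝 (∑ J, ∫ y, g J (G.mul (G.inv y) x) * vfIter G.Y (List.ofFn J) (opLFrozen G.Y a xb u) y)) :=
    tendsto_finsetSum _ fun J _ => hη.tendsto_int (hg J) (hop.cont _ (hJ J)) (hop.suppI _) x
  refine tendsto_nhds_unique l1 (l2.congr fun n => ?_)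
  rw [← hu.moll (h1 n) _ hI, hrep _ (G.moll_test hu0 hu.supp (h1 n) (hη.lt_one n)) x]
  refine Finset.sum_congr rfl fun J _ => ?_
  rw [hu.LA_moll a xb (h1 n), hop.moll (h1 n) _ (hJ J)]

lemma good_of_mem (G : CarnotSetting N m) {α : ℝ} (hα : 0 < α) {n : ℕ} {u : (Fin N → ℝ) → ℝ}
    (h : MemCkAlpha G.Y G.dY α n univ u) (hs : HasCompactSupport u) : G.Good n u where
  cont l hl := by
    obtain ⟨-, C, hC, hb⟩ := h.1 l hl
    exact cont_of_holder G hα hC hb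
  supp := hs
  diff l hl i x := h.2 l hl i x (mem_univ _)

end CarnotSetting

end

end

/-- **Representation formula for higher order derivatives** (Theorem 4.1):
`Y_I u = ∑_{|J|=k} Γ_{x̄}^{I;J} * (Y_J L_{x̄} u)`, with kernels smooth outside the
origin, `(2-Q)`-homogeneous, and with bounds on the unit sphere uniform in `x̄`. -/
theorem representation_formula_higher_derivatives {N m : ℕ} (G : CarnotSetting N m)
    (Λ α : ℝ) (hΛ : Λ ∈ Set.Ioo (0:ℝ) 1) (hα : α ∈ Set.Ioo (0:ℝ) 1)
    (a : Fin m → Fin m → (Fin N → ℝ) → ℝ)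
    (ha_ell : EllipticSym a Λ) :
    ∀ k : ℕ, 1 ≤ k →
    ∃ C : ℕ → ℝ, ∀ xb : Fin N → ℝ,
    ∃ Γ : (Fin k → Fin m) → (Fin k → Fin m) → (Fin N → ℝ) → ℝ,
      (∀ I J, ContDiffOn ℝ (⊤ : ℕ∞) (Γ I J) {(0 : Fin N → ℝ)}ᶜ) ∧
      (∀ I J, ∀ l : ℝ, 0 < l → ∀ w : Fin N → ℝ, w ≠ 0 →
        Γ I J (dil G.σ l w) = l ^ ((2:ℝ) - ∑ i, (G.σ i : ℝ)) * Γ I J w) ∧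
      (∀ I J, ∀ p : ℕ, ∀ H : List (Fin m), H.length ≤ p → ∀ w : Fin N → ℝ,
        homNorm G.σ w = 1 → |vfIter G.Y H (Γ I J) w| ≤ C p) ∧
      (∀ u : (Fin N → ℝ) → ℝ,
        MemCkAlpha G.Y G.dY α (k + 2) Set.univ u → HasCompactSupport u →
        ∀ I : Fin k → Fin m, ∀ x : Fin N → ℝ,
          vfIter G.Y (List.ofFn I) u x =
            ∑ J : Fin k → Fin m, ∫ y, Γ I J (G.mul (G.inv y) x) *
              vfIter G.Y (List.ofFn J) (opLFrozen G.Y a xb u) y) := by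
  intro k _
  obtain ⟨g, hg, hrep⟩ := G.rep_test hΛ.1 k
  choose B hB0 hB using fun I J => (hg I J).bdd
  refine ⟨fun p => ∑ n ∈ Finset.range (p + 1), ∑ f : Fin n → Fin m, ∑ I, ∑ J, B I J (List.ofFn f), fun xb => ?_⟩
  refine ⟨fun I J => g I J ⟨fun i j => a i j xb, ha_ell xb⟩, fun I J => (hg I J).smooth _, fun I J => (hg I J).hom _, ?_, ?_⟩
  · intro I J p H hH w hw
    refine (hB I J H _ w hw).trans ?_
    have e : B I J H = B I J (List.ofFn H.get) := by rw [List.ofFn_get]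
    rw [e]
    refine le_trans ?_ (Finset.single_le_sum (f := fun n => ∑ f : Fin n → Fin m, ∑ I, ∑ J, B I J (List.ofFn f))
      (fun n _ => Finset.sum_nonneg fun f _ => Finset.sum_nonneg fun I _ => Finset.sum_nonneg fun J _ => hB0 I J _)
      (Finset.mem_range.2 (Nat.lt_succ_of_le hH)))
    refine le_trans ?_ (Finset.single_le_sum (f := fun f : Fin H.length → Fin m => ∑ I, ∑ J, B I J (List.ofFn f))
      (fun f _ => Finset.sum_nonneg fun I _ => Finset.sum_nonneg fun J _ => hB0 I J _) (Finset.mem_univ H.get))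
    refine le_trans ?_ (Finset.single_le_sum (f := fun I => ∑ J, B I J (List.ofFn H.get))
      (fun I _ => Finset.sum_nonneg fun J _ => hB0 I J _) (Finset.mem_univ I))
    exact Finset.single_le_sum (f := fun J => B I J (List.ofFn H.get)) (fun J _ => hB0 I J _) (Finset.mem_univ J)
  · intro u hu hs I x
    refine G.rep_good a xb (fun J => ⟨fun _ => (hg I J).smooth _, fun _ => (hg I J).hom _, fun H => ?_⟩) I
      (hrep I ⟨fun i j => a i j xb, ha_ell xb⟩) (G.good_of_mem hα.1 hu hs) x
    obtain ⟨C, h0, h⟩ := (hg I J).bdd H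
    exact ⟨C, h0, fun _ w hw => h _ w hw⟩

end
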